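/- Fix ℓ_0 ∈ ℤ and an integer d ≥ 2, and let T^{(u)} be as below. There exists a constant C (independent of ℓ_0 and r) such that for all r ∈ (2,3) and all Schwartz functions f on ℝ, ‖V^r{T^{(u)}f : u > 0}‖_{L²(ℝ)} ≤ C (r−2)^{−1} ‖f‖_{L²(ℝ)}. -/

import Mathlib

open MeasureTheory Filter Set Metric
open scoped ENNReal NNReal Topology

noncomputable section

/-- The operator T^{(u)}f(x) = Σ_{ℓ≥ℓ₀} ∫ f(x−t) φ_ℓ(t) e^{iut^d} dt/t,
where φ_ℓ(t) = φ₀(2^{−ℓ}t). -/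
def Tmod (φ₀ : ℝ → ℝ) (ℓ₀ : ℤ) (d : ℕ) (u : ℝ) (f : ℝ → ℂ) (x : ℝ) : ℂ :=
  ∑' ℓ : ℤ,
    if ℓ₀ ≤ ℓ then
      ∫ t : ℝ,
        f (x - t) * ((φ₀ ((2 : ℝ) ^ (-ℓ) * t) : ℝ) : ℂ) *
          Complex.exp (Complex.I * (u : ℂ) * (t : ℂ) ^ d) / (t : ℂ)
    else 0

/-- The Littlewood–Paley projection P_τ onto the frequency interval [−τ,τ], given by
convolution with the Dirichlet kernel sin(τy)/(πy). -/
def Pproj (τ : ℝ) (f : ℝ → ℂ) (x : ℝ) : ℂ :=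
  ∫ y : ℝ, f (x - y) * ((Real.sin (τ * y) / (Real.pi * y) : ℝ) : ℂ)

/-- The `r`-variation norm of a family of complex numbers indexed by `J ⊆ ι`. -/
def vNorm {ι : Type*} [LinearOrder ι] (r : ℝ) (J : Set ι) (a : ι → ℂ) : ℝ≥0∞ :=
  ⨆ (k : ℕ) (u : Fin (k + 1) → ι) (_ : StrictMono u) (_ : ∀ i, u i ∈ J),
    (∑ i : Fin k, (‖a (u i.succ) - a (u i.castSucc)‖₊ : ℝ≥0∞) ^ r) ^ (1 / r)

/-- The character `y ↦ exp (2πiy)`. -/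
def ex (y : ℝ) : ℂ := Complex.exp (((2 * Real.pi * y : ℝ) : ℂ) * Complex.I)

lemma ex_zero : ex 0 = 1 := by simp [ex]

lemma norm_ex (y : ℝ) : ‖ex y‖ = 1 := Complex.norm_exp_ofReal_mul_I _

lemma ex_add (y z : ℝ) : ex (y + z) = ex y * ex z := by
  simp only [ex, ← Complex.exp_add]; congr 1; push_cast; ring

lemma continuous_ex : Continuous ex := by unfold ex; fun_prop

lemma norm_ex_sub_one_le (y : ℝ) : ‖ex y - 1‖ ≤ 2 * Real.pi * |y| := by
  have := Real.norm_exp_I_mul_ofReal_sub_one_le (x := 2 * Real.pi * y)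
  rw [mul_comm] at this
  simpa [ex, abs_mul, abs_of_pos Real.pi_pos] using this

/-- The inverse Fourier integral of `h`. -/
def synth (h : ℝ → ℂ) (x : ℝ) : ℂ := ∫ ξ, ex (ξ * x) * h ξ

/-- Measurable functions in `L¹ ∩ L²`. -/
structure Nice (h : ℝ → ℂ) : Prop where
  meas : StronglyMeasurable h
  int : Integrable h
  sq : MemLp h 2

/-- The squared `L²` norm. -/
def energy (h : ℝ → ℂ) : ℝ≥0∞ := ∫⁻ x, ‖h x‖ₑ ^ 2

lemma energy_eq (h : ℝ → ℂ) : energy h = eLpNorm h 2 volume ^ 2 := by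
  rw [energy, eLpNorm_eq_lintegral_rpow_enorm_toReal (by norm_num) (by norm_num)]
  rw [← ENNReal.rpow_natCast, ← ENNReal.rpow_mul]
  simp

lemma integrable_ex_mul {h : ℝ → ℂ} (hh : Integrable h) (x : ℝ) :
    Integrable fun ξ => ex (ξ * x) * h ξ := by
  refine (hh.bdd_mul (c := 1) (Continuous.aestronglyMeasurable ?_) (ae_of_all _ fun ξ => (norm_ex _).le))
  exact continuous_ex.comp (by fun_prop)

lemma norm_synth_le (h : ℝ → ℂ) (x : ℝ) : ‖synth h x‖ ≤ ∫ ξ, ‖h ξ‖ := by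
  refine (norm_integral_le_integral_norm _).trans (le_of_eq ?_)
  simp [norm_ex]

lemma continuous_synth {h : ℝ → ℂ} (hh : Integrable h) : Continuous (synth h) := by
  refine continuous_of_dominated (bound := fun ξ => ‖h ξ‖) ?_ ?_ hh.norm ?_
  · intro x; exact (integrable_ex_mul hh x).aestronglyMeasurable
  · intro x; exact ae_of_all _ fun ξ => by simp [norm_ex]
  · refine ae_of_all _ fun ξ => ?_
    exact (continuous_ex.comp (by fun_prop)).mul continuous_const

lemma synth_sub {g h : ℝ → ℂ} (hg : Integrable g) (hh : Integrable h) (x : ℝ) :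
    synth (fun ξ => g ξ - h ξ) x = synth g x - synth h x := by
  simp only [synth, mul_sub]
  exact integral_sub (integrable_ex_mul hg x) (integrable_ex_mul hh x)

lemma synth_add {g h : ℝ → ℂ} (hg : Integrable g) (hh : Integrable h) (x : ℝ) :
    synth (fun ξ => g ξ + h ξ) x = synth g x + synth h x := by
  simp only [synth, mul_add]
  exact integral_add (integrable_ex_mul hg x) (integrable_ex_mul hh x)

lemma synth_const_mul (c : ℂ) (h : ℝ → ℂ) (x : ℝ) :
    synth (fun ξ => c * h ξ) x = c * synth h x := by
  simp only [synth, mul_left_comm _ c]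
  exact integral_const_mul _ _

lemma Nice.mul {h : ℝ → ℂ} (hh : Nice h) {m : ℝ → ℂ} (hm : StronglyMeasurable m) {C : ℝ}
    (hC : ∀ ξ, ‖m ξ‖ ≤ C) : Nice fun ξ => m ξ * h ξ := by
  refine ⟨hm.mul hh.meas, hh.int.bdd_mul hm.aestronglyMeasurable (ae_of_all _ hC), ?_⟩
  refine (hh.sq.const_mul (C : ℂ)).of_le (hm.mul hh.meas).aestronglyMeasurable (ae_of_all _ fun ξ => ?_)
  have : 0 ≤ C := (norm_nonneg _).trans (hC ξ)
  simp only [norm_mul, Complex.norm_real, Real.norm_eq_abs, abs_of_nonneg this]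
  gcongr; exact hC ξ

lemma Nice.energy_mul_le (h : ℝ → ℂ) {m : ℝ → ℂ} {C : ℝ}
    (hC : ∀ ξ, ‖m ξ‖ ≤ C) : energy (fun ξ => m ξ * h ξ) ≤ ENNReal.ofReal (C ^ 2) * energy h := by
  unfold energy
  rw [← lintegral_const_mul' _ _ (by simp)]
  refine lintegral_mono fun ξ => ?_
  have : 0 ≤ C := (norm_nonneg _).trans (hC ξ)
  simp only [enorm_mul, mul_pow]
  gcongr
  rw [ENNReal.ofReal_pow this, ← ofReal_norm]
  gcongr; exact hC ξ

open FourierTransform in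
lemma fourierInv_eq_synth (h : ℝ → ℂ) : 𝓕⁻ h = synth h := by
  ext x
  rw [Real.fourierInv_eq', synth]
  simp [ex, mul_comm, mul_left_comm]

lemma integral_synth_mul {g h : ℝ → ℂ} (hg : Integrable g) (hh : Integrable h) :
    ∫ x, synth g x * h x = ∫ x, g x * synth h x := by
  have key : ∀ a b : ℝ → ℂ, ∀ x, synth a x * b x = ∫ ξ, ex (ξ * x) * a ξ * b x := fun a b x => by
    rw [synth, ← integral_mul_const]
  simp_rw [key g h, mul_comm (g _), key h g]
  rw [integral_integral_swap]
  · refine integral_congr_ae (ae_of_all _ fun x => integral_congr_ae (ae_of_all _ fun y => ?_))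
    dsimp only; rw [mul_comm x y]; ring
  · have := (hh.mul_prod hg)
    refine (this.bdd_mul (c := 1) (f := fun z : ℝ × ℝ => ex (z.2 * z.1)) ?_ ?_).congr ?_
    · exact (continuous_ex.comp (by fun_prop)).aestronglyMeasurable
    · exact ae_of_all _ fun z => (norm_ex _).le
    · exact ae_of_all _ fun z => by simp [Function.uncurry]; ring

open FourierTransform ContDiff in
lemma energy_synth {h : ℝ → ℂ} (hh : Nice h) : energy (synth h) = energy h := by
  have hx : (𝓕⁻ (hh.sq.toLp h) : Lp ℂ 2 (volume : Measure ℝ)) =ᵐ[volume] synth h := by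
    apply ae_eq_of_integral_contDiff_smul_eq
    · exact (Lp.memLp _).locallyIntegrable (by norm_num)
    · exact (continuous_synth hh.int).locallyIntegrable
    · intro g hg hgc
      have hgc' : HasCompactSupport (fun x => (g x : ℂ)) :=
        hgc.comp_left (g := fun t : ℝ => (t : ℂ)) (by simp)
      have hg' : ContDiff ℝ ∞ (fun x => (g x : ℂ)) := Complex.ofRealCLM.contDiff.comp hg
      set G := hgc'.toSchwartzMap hg' with hG
      have h1 := congrArg (fun T => T G) (Lp.fourierInv_toTemperedDistribution_eq (hh.sq.toLp h))
      simp only [TemperedDistribution.fourierInv_apply, Lp.toTemperedDistribution_apply] at h1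
      have e1 : ∀ x, G x = (g x : ℂ) := fun x => by simp [hG]
      have e2 : ∫ x, (𝓕⁻ G) x • (hh.sq.toLp h) x = ∫ x, synth G x * h x := by
        apply integral_congr_ae
        filter_upwards [hh.sq.coeFn_toLp] with x hx
        rw [hx, SchwartzMap.fourierInv_coe, fourierInv_eq_synth]; rfl
      rw [e2, integral_synth_mul G.integrable hh.int] at h1
      simp only [e1] at h1
      simpa using h1.symm
  rw [energy_eq h, energy_eq, ← eLpNorm_congr_ae hx, ← eLpNorm_congr_ae hh.sq.coeFn_toLp]
  congr 1
  have := Lp.norm_fourier_eq (𝓕⁻ (hh.sq.toLp h) : Lp ℂ 2 (volume : Measure ℝ))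
  rw [FourierTransform.fourier_fourierInv_eq, eq_comm] at this
  rw [Lp.norm_def, Lp.norm_def] at this
  exact (ENNReal.toReal_eq_toReal_iff' (Lp.memLp _).2.ne (Lp.memLp _).2.ne).1 this

lemma measurable_synth {α : Type*} [MeasurableSpace α] {m : α → ℝ → ℂ}
    (hm : StronglyMeasurable (Function.uncurry m)) :
    Measurable fun z : ℝ × α => synth (m z.2) z.1 := by
  refine StronglyMeasurable.measurable ?_
  have : StronglyMeasurable (Function.uncurry fun (z : ℝ × α) (ξ : ℝ) => ex (ξ * z.1) * m z.2 ξ) := by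
    refine StronglyMeasurable.mul ?_ ?_
    · exact (continuous_ex.measurable.comp (by fun_prop)).stronglyMeasurable
    · exact hm.comp_measurable (g := fun z : (ℝ × α) × ℝ => (z.1.2, z.2)) (by fun_prop)
  exact this.integral_prod_right

/-- The square function estimate for a family of Fourier multipliers. -/
lemma lintegral_square_synth_le {α : Type*} [MeasurableSpace α] (ν : Measure α) [SFinite ν]
    {m : α → ℝ → ℂ} (hm : StronglyMeasurable (Function.uncurry m)) {h : ℝ → ℂ} (hh : Nice h)
    {B : ℝ} (hB : ∀ a ξ, ‖m a ξ‖ ≤ B) {w : ℝ → ℝ≥0∞}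
    (hw : ∀ ξ, ∫⁻ a, ‖m a ξ‖ₑ ^ 2 ∂ν ≤ w ξ) :
    ∫⁻ x, ∫⁻ a, ‖synth (fun ξ => m a ξ * h ξ) x‖ₑ ^ 2 ∂ν ≤ ∫⁻ ξ, w ξ * ‖h ξ‖ₑ ^ 2 := by
  have hmh : StronglyMeasurable (Function.uncurry fun a ξ => m a ξ * h ξ) :=
    hm.mul (hh.meas.comp_measurable measurable_snd)
  rw [lintegral_lintegral_swap (((measurable_synth hmh).enorm.pow_const 2).aemeasurable)]
  have : ∀ a, ∫⁻ x, ‖synth (fun ξ => m a ξ * h ξ) x‖ₑ ^ 2 = ∫⁻ ξ, ‖m a ξ‖ₑ ^ 2 * ‖h ξ‖ₑ ^ 2 := by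
    intro a
    have := energy_synth (hh.mul (hm.comp_measurable (g := fun ξ => (a, ξ))
      (by fun_prop)) (hB a))
    simp only [energy, enorm_mul, mul_pow] at this
    exact this
  simp_rw [this]
  rw [lintegral_lintegral_swap]
  · refine lintegral_mono fun ξ => ?_
    rw [lintegral_mul_const' _ _ (by simp)]
    gcongr; exact hw ξ
  · exact ((hm.measurable.enorm.pow_const 2).mul
      ((hh.meas.measurable.comp measurable_snd).enorm.pow_const 2)).aemeasurable

open FourierTransform in
lemma nice_fourier (f : SchwartzMap ℝ ℂ) : Nice (𝓕 (f : ℝ → ℂ)) := by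
  rw [← SchwartzMap.fourier_coe]
  exact ⟨(𝓕 f).continuous.stronglyMeasurable, (𝓕 f).integrable, (𝓕 f).memLp 2⟩

open FourierTransform in
lemma synth_fourier (f : SchwartzMap ℝ ℂ) : synth (𝓕 (f : ℝ → ℂ)) = f := by
  rw [← fourierInv_eq_synth, ← SchwartzMap.fourier_coe, ← SchwartzMap.fourierInv_coe,
    FourierTransform.fourierInv_fourier_eq]

lemma ennreal_add_sq_le (a b : ℝ≥0∞) : (a + b) ^ 2 ≤ 2 * (a ^ 2 + b ^ 2) := by
  induction a with
  | top => simp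
  | coe a =>
    induction b with
    | top => simp
    | coe b => exact_mod_cast (add_sq_le (a := a) (b := b))

/-- The `ℓʳ` norm of the first `k` terms of a sequence. -/
def lrNorm (r : ℝ) (k : ℕ) (F : ℕ → ℝ≥0∞) : ℝ≥0∞ :=
  (∑ i ∈ Finset.range k, F i ^ r) ^ (1 / r)

lemma lrNorm_mono {r : ℝ} (hr : 0 ≤ r) (k : ℕ) {F G : ℕ → ℝ≥0∞} (h : ∀ i, F i ≤ G i) :
    lrNorm r k F ≤ lrNorm r k G := by
  unfold lrNorm
  gcongr with i _
  exact h i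

lemma lrNorm_add_le {r : ℝ} (hr : 1 ≤ r) (k : ℕ) (F G : ℕ → ℝ≥0∞) :
    lrNorm r k (fun i => F i + G i) ≤ lrNorm r k F + lrNorm r k G :=
  ENNReal.Lp_add_le _ _ _ hr

lemma lrNorm_rpow {r : ℝ} (hr : 0 < r) (k : ℕ) (F : ℕ → ℝ≥0∞) :
    lrNorm r k F ^ r = ∑ i ∈ Finset.range k, F i ^ r := by
  rw [lrNorm, ← ENNReal.rpow_mul, one_div, inv_mul_cancel₀ hr.ne', ENNReal.rpow_one]

lemma lrNorm_two_sq (k : ℕ) (F : ℕ → ℝ≥0∞) :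
    lrNorm 2 k F ^ 2 = ∑ i ∈ Finset.range k, F i ^ 2 := by
  have := lrNorm_rpow (r := 2) (by norm_num) k F
  simpa using this

lemma lrNorm_const_mul {r : ℝ} (hr : 0 < r) (k : ℕ) (c : ℝ≥0∞) (F : ℕ → ℝ≥0∞) :
    lrNorm r k (fun i => c * F i) = c * lrNorm r k F := by
  unfold lrNorm
  simp_rw [ENNReal.mul_rpow_of_nonneg _ _ hr.le, ← Finset.mul_sum]
  rw [ENNReal.mul_rpow_of_nonneg _ _ (by positivity), ← ENNReal.rpow_mul, mul_one_div_cancel hr.ne',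
    ENNReal.rpow_one]

lemma le_lrNorm {r : ℝ} (hr : 0 < r) {k i : ℕ} (hi : i < k) (F : ℕ → ℝ≥0∞) :
    F i ≤ lrNorm r k F := by
  rw [← ENNReal.rpow_le_rpow_iff hr, lrNorm_rpow hr]
  exact Finset.single_le_sum (f := fun i => F i ^ r) (fun _ _ => zero_le) (by simpa)

/-- Interpolation between the `ℓ²` norm and the supremum. -/
lemma lrNorm_sq_le {r : ℝ} (hr : 2 < r) {k : ℕ} {F : ℕ → ℝ≥0∞} {M : ℝ≥0∞}
    (hM : ∀ i < k, F i ≤ M) :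
    lrNorm r k F ^ 2 ≤ (M ^ 2) ^ (1 - 2 / r) * (lrNorm 2 k F ^ 2) ^ (2 / r) := by
  have h0 : ∑ i ∈ Finset.range k, F i ^ r ≤ M ^ (r - 2) * lrNorm 2 k F ^ 2 := by
    rw [lrNorm_two_sq, Finset.mul_sum]
    refine Finset.sum_le_sum fun i hi => ?_
    have : F i ^ r = F i ^ (r - 2) * F i ^ 2 := by
      rw [← ENNReal.rpow_natCast, ← ENNReal.rpow_add_of_nonneg _ _ (by linarith) (by norm_num)]
      simp
    rw [this]
    gcongr
    exact hM i (by simpa using hi)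
  have hr0 : 0 < r := by linarith
  calc lrNorm r k F ^ 2 = (∑ i ∈ Finset.range k, F i ^ r) ^ (2 / r) := by
        rw [lrNorm, ← ENNReal.rpow_natCast, ← ENNReal.rpow_mul]; congr 1; push_cast; ring
    _ ≤ (M ^ (r - 2) * lrNorm 2 k F ^ 2) ^ (2 / r) := by gcongr
    _ = _ := by
        rw [ENNReal.mul_rpow_of_nonneg _ _ (by positivity), ← ENNReal.rpow_mul,
          ← ENNReal.rpow_natCast M 2, ← ENNReal.rpow_mul]
        congr 2; push_cast; field_simp

lemma rpow_mul_rpow_le_add (a b : ℝ≥0∞) {s t : ℝ} (hs : 0 ≤ s) (ht : 0 ≤ t) (hst : s + t = 1) :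
    a ^ s * b ^ t ≤ a + b := by
  calc a ^ s * b ^ t ≤ (a + b) ^ s * (a + b) ^ t := by gcongr <;> simp
    _ = a + b := by rw [← ENNReal.rpow_add_of_nonneg _ _ hs ht, hst, ENNReal.rpow_one]

lemma lrNorm_le_two {r : ℝ} (hr : 2 < r) (k : ℕ) (F : ℕ → ℝ≥0∞) : lrNorm r k F ≤ lrNorm 2 k F := by
  have h := lrNorm_sq_le hr (fun i hi => le_lrNorm (by norm_num) hi F : ∀ i < k, F i ≤ lrNorm 2 k F)
  have hr0 : 2 / r ≤ 1 := by rw [div_le_one (by linarith)]; exact hr.le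
  rw [← ENNReal.rpow_add_of_nonneg _ _ (by linarith) (by positivity), sub_add_cancel,
    ENNReal.rpow_one] at h
  exact (ENNReal.pow_le_pow_left_iff (by norm_num)).1 h

/-- Interpolation between the `ℓ²` norm and the supremum, in additive form. -/
lemma lrNorm_sq_le_add {r : ℝ} (hr : 2 < r) {k : ℕ} {F : ℕ → ℝ≥0∞} {M : ℝ≥0∞}
    (hM : ∀ i < k, F i ≤ M) {ε : ℝ≥0∞} (h0 : ε ≠ 0) (ht : ε ≠ ∞) :
    lrNorm r k F ^ 2 ≤ ε ^ (1 - 2 / r) * (ε⁻¹ * M ^ 2 + lrNorm 2 k F ^ 2) := by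
  have hr0 : 2 / r ≤ 1 := by rw [div_le_one (by linarith)]; exact hr.le
  refine (lrNorm_sq_le hr hM).trans ?_
  have : M ^ 2 = ε * (ε⁻¹ * M ^ 2) := by rw [← mul_assoc, ENNReal.mul_inv_cancel h0 ht, one_mul]
  nth_rw 1 [this]
  rw [ENNReal.mul_rpow_of_nonneg _ _ (by linarith), mul_assoc]
  gcongr
  exact rpow_mul_rpow_le_add _ _ (by linarith) (by positivity) (by ring)

/-- Minkowski's integral inequality for `ℓʳ` norms. -/
lemma lrNorm_lintegral_le {α : Type*} [MeasurableSpace α] (ν : Measure α) {r : ℝ} (hr : 1 < r)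
    (k : ℕ) {F : ℕ → α → ℝ≥0∞} (hF : ∀ i, AEMeasurable (F i) ν) :
    lrNorm r k (fun i => ∫⁻ a, F i a ∂ν) ≤ ∫⁻ a, lrNorm r k (fun i => F i a) ∂ν := by
  have hr0 : 0 < r := by linarith
  set S : ℕ → ℝ≥0∞ := fun i => ∫⁻ a, F i a ∂ν with hS
  by_cases htop : ∃ i < k, S i = ∞
  · obtain ⟨i, hi, hi'⟩ := htop
    have : S i ≤ ∫⁻ a, lrNorm r k (fun i => F i a) ∂ν :=
      lintegral_mono fun a => le_lrNorm hr0 hi (fun i => F i a)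
    rw [hi', top_le_iff] at this
    rw [this]; exact le_top
  push Not at htop
  have hc : (r / (r - 1)).HolderConjugate r := (Real.HolderConjugate.conjExponent hr).symm
  set T := ∑ i ∈ Finset.range k, S i ^ r with hT
  have hTtop : T ≠ ∞ := ENNReal.sum_ne_top.2 fun i hi =>
    ENNReal.rpow_ne_top_of_nonneg hr0.le (htop i (by simpa using hi))
  rcases eq_or_ne T 0 with h0 | h0
  · rw [lrNorm, ← hT, h0, ENNReal.zero_rpow_of_pos (by positivity)]; exact zero_le
  have h1 : T ≤ T ^ (1 - 1 / r) * ∫⁻ a, lrNorm r k (fun i => F i a) ∂ν := by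
    calc T = ∑ i ∈ Finset.range k, ∫⁻ a, S i ^ (r - 1) * F i a ∂ν := by
          refine Finset.sum_congr rfl fun i hi => ?_
          rw [lintegral_const_mul'' _ (hF i)]
          change S i ^ r = S i ^ (r - 1) * S i
          nth_rw 3 [← ENNReal.rpow_one (S i)]
          rw [← ENNReal.rpow_add_of_nonneg _ _ (by linarith) (by norm_num), sub_add_cancel]
      _ = ∫⁻ a, ∑ i ∈ Finset.range k, S i ^ (r - 1) * F i a ∂ν :=
          (lintegral_finsetSum' _ fun i _ => (hF i).const_mul _).symm
      _ ≤ ∫⁻ a, T ^ (1 - 1 / r) * lrNorm r k (fun i => F i a) ∂ν := by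
          refine lintegral_mono fun a => ?_
          refine (ENNReal.inner_le_Lp_mul_Lq _ _ _ hc).trans (le_of_eq ?_)
          simp only [lrNorm, ← ENNReal.rpow_mul]
          have hr1 : r - 1 ≠ 0 := by linarith
          have e1 : (r - 1) * (r / (r - 1)) = r := by field_simp
          have e2 : 1 / (r / (r - 1)) = 1 - 1 / r := by field_simp
          rw [e1, e2]
      _ = _ := lintegral_const_mul' _ _
          (ENNReal.rpow_ne_top_of_nonneg (by rw [sub_nonneg, div_le_one hr0]; exact hr.le) hTtop)
  have h2 : T = T ^ (1 - 1 / r) * T ^ (1 / r) := by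
    rw [← ENNReal.rpow_add _ _ h0 hTtop]; simp
  nth_rw 1 [h2] at h1
  exact (ENNReal.mul_le_mul_iff_right (ENNReal.rpow_pos (pos_iff_ne_zero.2 h0) hTtop).ne'
    (ENNReal.rpow_ne_top_of_ne_zero h0 hTtop)).1 h1

/-- Minkowski's inequality for infinite sums. -/
lemma lrNorm_tsum_le {ι : Type*} {r : ℝ} (hr : 1 < r) (k : ℕ) (F : ℕ → ι → ℝ≥0∞) :
    lrNorm r k (fun i => ∑' a, F i a) ≤ ∑' a, lrNorm r k (fun i => F i a) := by
  let _ : MeasurableSpace ι := ⊤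
  have := lrNorm_lintegral_le (Measure.count (α := ι)) hr k (F := F)
    (fun i => measurable_from_top.aemeasurable)
  simpa [lintegral_count] using this

/-- The increments of `a` along the sequence `u`. -/
def incr {ι : Type*} (a : ι → ℂ) (u : ℕ → ι) (i : ℕ) : ℝ≥0∞ := ‖a (u (i + 1)) - a (u i)‖ₑ

lemma vNorm_le {ι : Type*} [LinearOrder ι] {r : ℝ} {J : Set ι} {a : ι → ℂ} {B : ℝ≥0∞}
    (h : ∀ (k : ℕ) (u : ℕ → ι), Monotone u → (∀ i, u i ∈ J) → lrNorm r k (incr a u) ≤ B) :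
    vNorm r J a ≤ B := by
  refine iSup_le fun k => iSup_le fun u => iSup_le fun hu => iSup_le fun hJ => ?_
  have := h k (fun i => u (Fin.ofNat (k + 1) (min i k))) ?_ (fun i => hJ _)
  · refine le_of_eq_of_le ?_ this
    rw [lrNorm, Finset.sum_range]
    congr 1
    refine Finset.sum_congr rfl fun i _ => ?_
    have e1 : Fin.ofNat (k + 1) (min (i + 1 : ℕ) k) = i.succ := by
      ext; simp [Fin.ofNat, Nat.mod_eq_of_lt, Nat.succ_le_of_lt i.2]
    have e2 : Fin.ofNat (k + 1) (min (i : ℕ) k) = i.castSucc := by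
      ext; simp [Fin.ofNat, Nat.mod_eq_of_lt, i.2.le, Nat.lt_succ_of_lt i.2]
    rw [incr, e1, e2]; rfl
  · intro i j hij
    refine hu.monotone ?_
    rw [Fin.le_def]
    simp only [Fin.ofNat]
    rw [Nat.mod_eq_of_lt (by omega), Nat.mod_eq_of_lt (by omega)]
    omega

lemma sum_fiber_le {κ : Type*} {k : ℕ} {p : ℕ → Prop} [DecidablePred p] {c : ℕ → κ}
    (hinj : ∀ i j, i < j → j < k → p i → p j → c i ≠ c j) (B : κ → ℝ≥0∞) :
    ∑ i ∈ (Finset.range k).filter p, B (c i) ≤ ∑' n, B n := by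
  classical
  have : Set.InjOn c ((Finset.range k).filter p : Finset ℕ) := by
    intro i hi j hj hij
    simp only [Finset.coe_filter, Finset.mem_range, Set.mem_ofPred_eq] at hi hj
    rcases lt_trichotomy i j with h | h | h
    · exact absurd hij (hinj i j h hj.1 hi.2 hj.2)
    · exact h
    · exact absurd hij.symm (hinj j i h hi.1 hj.2 hi.2)
  rw [← Finset.sum_image (f := B) this]
  exact ENNReal.sum_le_tsum _

/-- The `2`-variation of a function controlled on each cell of an ordered partition. -/
lemma lrNorm_two_cells_le {κ : Type*} {F : ℝ → ℂ} {c : ℝ → κ} {u : ℕ → ℝ} (hu : Monotone u)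
    {J : Set ℝ} (hJ : ∀ i, u i ∈ J)
    (hc : ∀ x ∈ J, ∀ y ∈ J, ∀ z ∈ J, x ≤ y → y ≤ z → c x = c z → c x = c y)
    {ν : κ → Measure ℝ} {ρ : κ → ℝ → ℝ} (hρ : ∀ n, Monotone (ρ n))
    (hν : ∀ x ∈ J, ∀ y ∈ J, x ≤ y → c x = c y →
      ‖F y - F x‖ₑ ^ 2 ≤ ν (c x) (Ioc (ρ (c x) x) (ρ (c x) y)))
    {B : κ → ℝ≥0∞} (hB : ∀ x ∈ J, ‖F x‖ₑ ^ 2 ≤ B (c x)) (k : ℕ) :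
    lrNorm 2 k (incr F u) ^ 2 ≤ ∑' n, ν n univ + 4 * ∑' n, B n := by
  classical
  rw [lrNorm_two_sq, ← Finset.sum_filter_add_sum_filter_not _ (fun i => c (u i) = c (u (i + 1)))]
  gcongr
  · set s := (Finset.range k).filter (fun i => c (u i) = c (u (i + 1))) with hs
    calc ∑ i ∈ s, incr F u i ^ 2
        ≤ ∑ i ∈ s, ν (c (u i)) (Ioc (ρ (c (u i)) (u i)) (ρ (c (u i)) (u (i + 1)))) := by
          refine Finset.sum_le_sum fun i hi => hν _ (hJ i) _ (hJ _) (hu (by omega)) ?_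
          simp only [hs, Finset.mem_filter] at hi
          exact hi.2
      _ = ∑ n ∈ s.image (fun i => c (u i)), ∑ i ∈ s.filter (fun i => c (u i) = n),
            ν (c (u i)) (Ioc (ρ (c (u i)) (u i)) (ρ (c (u i)) (u (i + 1)))) :=
          (Finset.sum_fiberwise_of_maps_to (fun i hi => Finset.mem_image_of_mem _ hi) _).symm
      _ ≤ ∑ n ∈ s.image (fun i => c (u i)), ν n univ := by
          refine Finset.sum_le_sum fun n _ => ?_
          have : ∀ i ∈ s.filter (fun i => c (u i) = n),
              ν (c (u i)) (Ioc (ρ (c (u i)) (u i)) (ρ (c (u i)) (u (i + 1)))) =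
              ν n (Ioc (ρ n (u i)) (ρ n (u (i + 1)))) := by
            intro i hi
            rw [(Finset.mem_filter.1 hi).2]
          rw [Finset.sum_congr rfl this, ← measure_biUnion_finset]
          · exact measure_mono (subset_univ _)
          · have hm : Monotone fun i => ρ n (u i) := (hρ n).comp hu
            intro i _ j _ hij
            exact hm.pairwise_disjoint_on_Ioc_succ hij
          · exact fun i _ => measurableSet_Ioc
      _ ≤ _ := ENNReal.sum_le_tsum _
  · set s := (Finset.range k).filter (fun i => ¬ c (u i) = c (u (i + 1))) with hs
    have hle : ∀ i, incr F u i ^ 2 ≤ 2 * B (c (u (i + 1))) + 2 * B (c (u i)) := by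
      intro i
      calc incr F u i ^ 2 ≤ (‖F (u (i + 1))‖ₑ + ‖F (u i)‖ₑ) ^ 2 := by
            gcongr; exact enorm_sub_le
        _ ≤ 2 * ‖F (u (i + 1))‖ₑ ^ 2 + 2 * ‖F (u i)‖ₑ ^ 2 := by
            rw [← mul_add]
            exact ennreal_add_sq_le _ _
        _ ≤ _ := by gcongr <;> exact hB _ (hJ _)
    calc ∑ i ∈ s, incr F u i ^ 2 ≤ ∑ i ∈ s, (2 * B (c (u (i + 1))) + 2 * B (c (u i))) :=
          Finset.sum_le_sum fun i _ => hle i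
      _ = 2 * ∑ i ∈ s, B (c (u (i + 1))) + 2 * ∑ i ∈ s, B (c (u i)) := by
          rw [Finset.sum_add_distrib, Finset.mul_sum, Finset.mul_sum]
      _ ≤ 2 * ∑' n, B n + 2 * ∑' n, B n := by
          gcongr
          · refine sum_fiber_le (c := fun i => c (u (i + 1))) (fun i j hij _ hi hj h => ?_) B
            have := hc (u (i + 1)) (hJ _) (u j) (hJ _) (u (j + 1)) (hJ _) (hu hij) (hu (by omega)) h
            exact hj (this ▸ h)
          · refine sum_fiber_le (c := fun i => c (u i)) (fun i j hij _ hi hj h => ?_) B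
            exact hi (hc (u i) (hJ _) (u (i + 1)) (hJ _) (u j) (hJ _) (hu (by omega)) (hu hij) h)
      _ = _ := by ring

/-- The running maximum of a sequence. -/
def runMax (f : ℕ → ℂ) : ℕ → ℝ
  | 0 => ‖f 0‖
  | k + 1 => max (runMax f k) ‖f (k + 1)‖

/-- The sequence `f` sampled at the successive times at which it has moved by at least the fraction
`ε` of its running maximum. -/
def thr (ε : ℝ) (f : ℕ → ℂ) : ℕ → ℂ
  | 0 => f 0
  | k + 1 => if ε * runMax f (k + 1) ≤ ‖f (k + 1) - thr ε f k‖ then f (k + 1) else thr ε f k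

lemma runMax_mono (f : ℕ → ℂ) : Monotone (runMax f) :=
  monotone_nat_of_le_succ fun _ => le_max_left _ _

lemma norm_le_runMax (f : ℕ → ℂ) (k : ℕ) : ‖f k‖ ≤ runMax f k := by
  cases k with
  | zero => exact le_rfl
  | succ k => exact le_max_right _ _

lemma runMax_nonneg (f : ℕ → ℂ) (k : ℕ) : 0 ≤ runMax f k :=
  (norm_nonneg _).trans (norm_le_runMax f k)

lemma exists_runMax_eq (f : ℕ → ℂ) (k : ℕ) : ∃ p ≤ k, runMax f k = ‖f p‖ := by
  induction k with
  | zero => exact ⟨0, le_rfl, rfl⟩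
  | succ k ih =>
    obtain ⟨p, hp, h⟩ := ih
    rcases le_total (runMax f k) ‖f (k + 1)‖ with h' | h'
    · exact ⟨k + 1, le_rfl, max_eq_right h'⟩
    · exact ⟨p, by omega, (max_eq_left h').trans h⟩

lemma norm_sub_thr_le {ε : ℝ} (hε : 0 ≤ ε) (f : ℕ → ℂ) (k : ℕ) :
    ‖f k - thr ε f k‖ ≤ ε * runMax f k := by
  cases k with
  | zero => simpa [thr] using mul_nonneg hε (runMax_nonneg f 0)
  | succ k =>
    rw [thr]
    split_ifs with h
    · simpa using mul_nonneg hε (runMax_nonneg f _)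
    · exact (not_le.1 h).le

lemma thr_eq_of_forall {ε : ℝ} {f : ℕ → ℂ} {i i' : ℕ} (hi : i ≤ i')
    (h : ∀ k, i ≤ k → k < i' → thr ε f (k + 1) = thr ε f k) : thr ε f i' = thr ε f i := by
  induction i', hi using Nat.le_induction with
  | base => rfl
  | succ k hk ih =>
    rw [h k hk (by omega), ih fun l hl hl' => h l hl (by omega)]

lemma exists_last {p : ℕ → Prop} {i i' : ℕ} (h : ∃ k, i ≤ k ∧ k < i' ∧ p k) :
    ∃ k, i ≤ k ∧ k < i' ∧ p k ∧ ∀ l, k < l → l < i' → ¬ p l := by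
  classical
  obtain ⟨k0, h1, h2, h3⟩ := h
  have hne : ((Finset.Ico i i').filter p).Nonempty := ⟨k0, by simp [h1, h2, h3]⟩
  refine ⟨((Finset.Ico i i').filter p).max' hne, ?_, ?_, ?_, ?_⟩
  · exact (Finset.mem_Ico.1 (Finset.mem_filter.1 (Finset.max'_mem _ hne)).1).1
  · exact (Finset.mem_Ico.1 (Finset.mem_filter.1 (Finset.max'_mem _ hne)).1).2
  · exact (Finset.mem_filter.1 (Finset.max'_mem _ hne)).2
  · intro l hl hl' hp
    have := Finset.le_max' ((Finset.Ico i i').filter p) l (by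
      have := (Finset.mem_Ico.1 (Finset.mem_filter.1 (Finset.max'_mem _ hne)).1).1
      simp only [Finset.mem_filter, Finset.mem_Ico]; exact ⟨⟨by omega, hl'⟩, hp⟩)
    omega

lemma exists_jump {ε : ℝ} (hε : 0 < ε) (hε' : ε ≤ 1 / 2) {f : ℕ → ℂ} {i i' : ℕ} (hi : i ≤ i')
    (h1 : 2 * ε * runMax f i' < ‖f i' - f i‖) :
    ∃ k, i ≤ k ∧ k < i' ∧ ε * runMax f i' / 2 ≤ ‖thr ε f (k + 1) - thr ε f k‖ := by
  have hex : ∃ k, i ≤ k ∧ k < i' ∧ thr ε f (k + 1) ≠ thr ε f k := by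
    by_contra! hcon
    have heq := thr_eq_of_forall hi hcon
    have h2 := norm_sub_thr_le hε.le f i'
    have h3 := norm_sub_thr_le hε.le f i
    have h4 : ‖f i' - f i‖ ≤ ‖f i' - thr ε f i'‖ + ‖f i - thr ε f i‖ := by
      rw [heq]
      calc ‖f i' - f i‖ = ‖(f i' - thr ε f i) - (f i - thr ε f i)‖ := by congr 1; ring
        _ ≤ _ := norm_sub_le _ _
    have h5 := mul_le_mul_of_nonneg_left (runMax_mono f hi) hε.le
    linarith
  obtain ⟨k, hk, hk', hne, hlast⟩ := exists_last hex
  push Not at hlast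
  refine ⟨k, hk, hk', ?_⟩
  have hjump : thr ε f (k + 1) = f (k + 1) ∧ ε * runMax f (k + 1) ≤ ‖f (k + 1) - thr ε f k‖ := by
    rw [thr] at hne ⊢
    split_ifs at hne ⊢ with h
    · exact ⟨rfl, h⟩
    · exact absurd rfl hne
  rw [hjump.1]
  refine le_trans ?_ hjump.2
  by_contra! hcon
  have hM : runMax f (k + 1) < runMax f i' / 2 := by
    by_contra! h'
    have := mul_le_mul_of_nonneg_left h' hε.le
    linarith
  obtain ⟨p, hp, hpM⟩ := exists_runMax_eq f i'
  have hkp : k + 1 < p := by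
    by_contra! h'
    have h2 := (norm_le_runMax f p).trans (runMax_mono f h')
    have := runMax_nonneg f i'
    linarith
  have hg : thr ε f p = f (k + 1) := by
    rw [← hjump.1]
    exact thr_eq_of_forall hkp.le fun l hl hl' => hlast l (by omega) (by omega)
  have h2 := norm_sub_thr_le hε.le f p
  have h3 := norm_le_runMax f (k + 1)
  have h4 : runMax f p ≤ runMax f i' := runMax_mono f hp
  rw [hg] at h2
  have h5 : ‖f p‖ ≤ ‖f p - f (k + 1)‖ + ‖f (k + 1)‖ := by
    simpa using norm_add_le (f p - f (k + 1)) (f (k + 1))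
  have h6 := mul_le_mul hε' h4 (runMax_nonneg f p) (by norm_num)
  linarith

/-- The threshold `2^{-(n+1)}`. -/
def thrEps (n : ℕ) : ℝ := (1 / 2 : ℝ) ^ (n + 1)

lemma thrEps_pos (n : ℕ) : 0 < thrEps n := by unfold thrEps; positivity

lemma thrEps_le (n : ℕ) : thrEps n ≤ 1 / 2 := by
  unfold thrEps
  calc (1 / 2 : ℝ) ^ (n + 1) ≤ (1 / 2) ^ 1 := pow_le_pow_of_le_one (by norm_num) (by norm_num) (by omega)
    _ = _ := by norm_num

lemma norm_sub_rpow_le {r : ℝ} (hr : 2 < r) (hr3 : r < 3) {f : ℕ → ℂ} {i i' : ℕ} (hi : i ≤ i')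
    (hne : f i' ≠ f i) :
    ∃ n k, i ≤ k ∧ k < i' ∧ ‖f i' - f i‖ ^ r ≤
      256 * runMax f i' ^ (r - 2) * thrEps n ^ (r - 2) *
        ‖thr (thrEps n) f (k + 1) - thr (thrEps n) f k‖ ^ 2 := by
  set δ := ‖f i' - f i‖ with hδ
  set M := runMax f i' with hMdef
  have hδ0 : 0 < δ := norm_pos_iff.2 (sub_ne_zero.2 hne)
  have hδM : δ ≤ 2 * M := by
    have h1 := norm_le_runMax f i'
    have h2 := (norm_le_runMax f i).trans (runMax_mono f hi)
    have := norm_sub_le (f i') (f i)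
    linarith
  have hM : 0 < M := by linarith
  obtain ⟨n, hn1, hn2⟩ := exists_nat_pow_near_of_lt_one (x := δ / (2 * M)) (y := 1 / 2)
    (by positivity) (by rw [div_le_one (by positivity)]; exact hδM) (by norm_num) (by norm_num)
  have hn1' : 2 * thrEps n * M < δ := by
    rw [lt_div_iff₀ (by positivity)] at hn1
    unfold thrEps; linarith
  have hn2' : δ ≤ 4 * (thrEps n * M) := by
    rw [div_le_iff₀ (by positivity)] at hn2
    unfold thrEps; rw [pow_succ]; linarith
  obtain ⟨k, hk, hk', hJ⟩ := exists_jump (thrEps_pos n) (thrEps_le n) hi hn1'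
  refine ⟨n, k, hk, hk', ?_⟩
  set J := ‖thr (thrEps n) f (k + 1) - thr (thrEps n) f k‖ with hJd
  have hε := thrEps_pos n
  have e1 : δ ^ r = δ ^ (r - 2) * δ ^ 2 := by
    rw [← Real.rpow_natCast δ 2, ← Real.rpow_add hδ0]; norm_num
  have e2 : δ ^ (r - 2) ≤ 4 * (M ^ (r - 2) * thrEps n ^ (r - 2)) := by
    calc δ ^ (r - 2) ≤ (4 * (thrEps n * M)) ^ (r - 2) := by gcongr
      _ = 4 ^ (r - 2) * (thrEps n ^ (r - 2) * M ^ (r - 2)) := by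
        rw [Real.mul_rpow (by norm_num) (by positivity), Real.mul_rpow hε.le hM.le]
      _ ≤ 4 ^ (1 : ℝ) * (thrEps n ^ (r - 2) * M ^ (r - 2)) := by
        gcongr
        · norm_num
        · linarith
      _ = _ := by rw [Real.rpow_one]; ring
  have e3 : δ ^ 2 ≤ 64 * J ^ 2 := by
    have : δ ≤ 8 * J := by linarith
    calc δ ^ 2 ≤ (8 * J) ^ 2 := by gcongr
      _ = _ := by ring
  rw [e1]
  calc δ ^ (r - 2) * δ ^ 2 ≤ (4 * (M ^ (r - 2) * thrEps n ^ (r - 2))) * (64 * J ^ 2) := by gcongr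
    _ = _ := by ring

/-- The weighted sum over thresholds of the squared jumps in the time interval `[a, b)`. -/
def jumpSum (r : ℝ) (f : ℕ → ℂ) (i i' : ℕ) : ℝ≥0∞ :=
  ∑' n, ENNReal.ofReal (thrEps n ^ (r - 2)) *
    ∑ k ∈ Finset.Ico i i', ‖thr (thrEps n) f (k + 1) - thr (thrEps n) f k‖ₑ ^ 2

lemma enorm_sub_rpow_le {r : ℝ} (hr : 2 < r) (hr3 : r < 3) (f : ℕ → ℂ) {i i' : ℕ} (hi : i ≤ i') :
    ‖f i' - f i‖ₑ ^ r ≤ 256 * ENNReal.ofReal (runMax f i') ^ (r - 2) * jumpSum r f i i' := by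
  by_cases hne : f i' = f i
  · simp [hne, ENNReal.zero_rpow_of_pos (by linarith : 0 < r)]
  obtain ⟨n, k, hk, hk', h⟩ := norm_sub_rpow_le hr hr3 hi hne
  calc ‖f i' - f i‖ₑ ^ r = ENNReal.ofReal (‖f i' - f i‖ ^ r) := by
        rw [← ENNReal.ofReal_rpow_of_nonneg (norm_nonneg _) (by linarith), ofReal_norm]
    _ ≤ _ := ENNReal.ofReal_le_ofReal h
    _ = 256 * ENNReal.ofReal (runMax f i') ^ (r - 2) * (ENNReal.ofReal (thrEps n ^ (r - 2)) *
          ‖thr (thrEps n) f (k + 1) - thr (thrEps n) f k‖ₑ ^ 2) := by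
        have := runMax_nonneg f i'
        have := (thrEps_pos n).le
        rw [ENNReal.ofReal_mul (by positivity), ENNReal.ofReal_mul (by positivity),
          ENNReal.ofReal_mul (by positivity), ENNReal.ofReal_pow (norm_nonneg _), ofReal_norm,
          ENNReal.ofReal_rpow_of_nonneg (by positivity) (by linarith), mul_assoc]
        norm_num
    _ ≤ _ := by
        gcongr
        unfold jumpSum
        refine le_trans ?_ (ENNReal.le_tsum n)
        gcongr
        exact Finset.single_le_sum
          (f := fun k => ‖thr (thrEps n) f (k + 1) - thr (thrEps n) f k‖ₑ ^ 2)
          (fun _ _ => zero_le) (Finset.mem_Ico.2 ⟨hk, hk'⟩)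

lemma sum_jumpSum_le (r : ℝ) (f : ℕ → ℂ) {u : ℕ → ℕ} (hu : Monotone u) {N : ℕ}
    (hN : ∀ i, u i ≤ N) (k : ℕ) :
    ∑ i ∈ Finset.range k, jumpSum r f (u i) (u (i + 1)) ≤ jumpSum r f 0 N := by
  unfold jumpSum
  rw [← Summable.tsum_finsetSum fun _ _ => ENNReal.summable]
  refine ENNReal.tsum_le_tsum fun n => ?_
  rw [← Finset.mul_sum]
  gcongr
  have : ∀ (F : ℕ → ℝ≥0∞), ∑ i ∈ Finset.range k, ∑ l ∈ Finset.Ico (u i) (u (i + 1)), F l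
      = ∑ l ∈ Finset.Ico (u 0) (u k), F l := by
    intro F
    induction k with
    | zero => simp
    | succ k ih =>
      rw [Finset.sum_range_succ, ih, Finset.sum_Ico_consecutive _ (hu (by omega)) (hu (by omega))]
  rw [this]
  exact Finset.sum_le_sum_of_subset (Finset.Ico_subset_Ico (by omega) (hN k))

lemma runMax_sq_le {r : ℝ} (hr : 2 < r) (hr3 : r < 3) (f : ℕ → ℂ) (N : ℕ) :
    ENNReal.ofReal (runMax f N) ^ 2 ≤ 4 * ‖f 0‖ₑ ^ 2 + 2048 * jumpSum r f 0 N := by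
  obtain ⟨p, hp, hM⟩ := exists_runMax_eq f N
  set M := runMax f N
  set δ := ‖f p - f 0‖ with hδ
  have hMδ : M ≤ ‖f 0‖ + δ := by
    rw [hM]; simpa [add_comm] using norm_add_le (f p - f 0) (f 0)
  rcases le_total δ ‖f 0‖ with h | h
  · refine le_add_right ?_
    calc ENNReal.ofReal M ^ 2 ≤ ENNReal.ofReal (2 * ‖f 0‖) ^ 2 := by gcongr; linarith
      _ = _ := by
        rw [ENNReal.ofReal_mul (by norm_num), ofReal_norm, mul_pow]; norm_num
  · refine le_add_left ?_
    rcases eq_or_lt_of_le (norm_nonneg (f p - f 0)) with h0 | h0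
    · have : M ≤ 0 := by linarith
      rw [ENNReal.ofReal_of_nonpos this]; simp
    have hM2 : M ≤ 2 * δ := by linarith
    have h1 := enorm_sub_rpow_le hr hr3 f (Nat.zero_le p)
    have hpM : runMax f p ≤ M := runMax_mono f hp
    have hJ : jumpSum r f 0 p ≤ jumpSum r f 0 N := by
      unfold jumpSum
      gcongr
    rw [← ofReal_norm, ← hδ] at h1
    have hδ0 : ENNReal.ofReal δ ≠ 0 := by simpa [hδ] using h0
    have h2 : ENNReal.ofReal δ ^ (r - 2) * ENNReal.ofReal δ ^ 2 ≤
        ENNReal.ofReal δ ^ (r - 2) * (512 * jumpSum r f 0 N) := by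
      calc ENNReal.ofReal δ ^ (r - 2) * ENNReal.ofReal δ ^ 2 = ENNReal.ofReal δ ^ r := by
            rw [← ENNReal.rpow_natCast, ← ENNReal.rpow_add _ _ hδ0 (by simp)]; norm_num
        _ ≤ _ := h1
        _ ≤ 256 * (ENNReal.ofReal (2 * δ)) ^ (r - 2) * jumpSum r f 0 N := by
            have : 0 ≤ r - 2 := by linarith
            gcongr
            exact hpM.trans hM2
        _ = 256 * (2 ^ (r - 2) * ENNReal.ofReal δ ^ (r - 2)) * jumpSum r f 0 N := by
            rw [ENNReal.ofReal_mul (by norm_num), ENNReal.mul_rpow_of_nonneg _ _ (by linarith)]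
            norm_num
        _ ≤ 256 * (2 ^ (1 : ℝ) * ENNReal.ofReal δ ^ (r - 2)) * jumpSum r f 0 N := by
            gcongr
            · norm_num
            · linarith
        _ = _ := by rw [ENNReal.rpow_one]; ring
    have h3 : ENNReal.ofReal δ ^ 2 ≤ 512 * jumpSum r f 0 N :=
      (ENNReal.mul_le_mul_iff_right (ENNReal.rpow_pos (pos_iff_ne_zero.2 hδ0) (by simp)).ne'
        (ENNReal.rpow_ne_top_of_nonneg (by linarith) (by simp))).1 h2
    calc ENNReal.ofReal M ^ 2 ≤ ENNReal.ofReal (2 * δ) ^ 2 := by gcongr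
      _ = 4 * ENNReal.ofReal δ ^ 2 := by
        rw [ENNReal.ofReal_mul (by norm_num), mul_pow]; norm_num
      _ ≤ 4 * (512 * jumpSum r f 0 N) := by gcongr
      _ = _ := by ring

/-- Pathwise control of the `r`-variation by squared jumps. -/
lemma lrNorm_sq_le_jumpSum {r : ℝ} (hr : 2 < r) (hr3 : r < 3) (f : ℕ → ℂ) {u : ℕ → ℕ}
    (hu : Monotone u) {N : ℕ} (hN : ∀ i, u i ≤ N) (k : ℕ) :
    lrNorm r k (incr f u) ^ 2 ≤ 4 * ‖f 0‖ₑ ^ 2 + 2304 * jumpSum r f 0 N := by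
  have h1 : ∑ i ∈ Finset.range k, incr f u i ^ r ≤
      ENNReal.ofReal (runMax f N) ^ (r - 2) * (256 * jumpSum r f 0 N) := by
    calc ∑ i ∈ Finset.range k, incr f u i ^ r
        ≤ ∑ i ∈ Finset.range k, 256 * ENNReal.ofReal (runMax f N) ^ (r - 2) *
            jumpSum r f (u i) (u (i + 1)) := by
          refine Finset.sum_le_sum fun i _ => ?_
          refine (enorm_sub_rpow_le hr hr3 f (hu (Nat.le_succ i))).trans ?_
          have : 0 ≤ r - 2 := by linarith
          gcongr
          exact runMax_mono f (hN _)
      _ ≤ 256 * ENNReal.ofReal (runMax f N) ^ (r - 2) * jumpSum r f 0 N := by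
          rw [← Finset.mul_sum]
          gcongr
          exact sum_jumpSum_le r f hu hN k
      _ = _ := by ring
  have hr0 : 2 / r ≤ 1 := by rw [div_le_one (by linarith)]; exact hr.le
  calc lrNorm r k (incr f u) ^ 2 = (∑ i ∈ Finset.range k, incr f u i ^ r) ^ (2 / r) := by
        rw [lrNorm, ← ENNReal.rpow_natCast, ← ENNReal.rpow_mul]; congr 1; push_cast; ring
    _ ≤ (ENNReal.ofReal (runMax f N) ^ (r - 2) * (256 * jumpSum r f 0 N)) ^ (2 / r) := by
        gcongr
    _ = (ENNReal.ofReal (runMax f N) ^ 2) ^ (1 - 2 / r) * (256 * jumpSum r f 0 N) ^ (2 / r) := by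
        have : r ≠ 0 := by linarith
        rw [ENNReal.mul_rpow_of_nonneg _ _ (by positivity), ← ENNReal.rpow_mul,
          ← ENNReal.rpow_natCast _ 2, ← ENNReal.rpow_mul]
        congr 2; push_cast; field_simp
    _ ≤ ENNReal.ofReal (runMax f N) ^ 2 + 256 * jumpSum r f 0 N :=
        rpow_mul_rpow_le_add _ _ (by linarith) (by positivity) (by ring)
    _ ≤ (4 * ‖f 0‖ₑ ^ 2 + 2048 * jumpSum r f 0 N) + 256 * jumpSum r f 0 N := by
        gcongr; exact runMax_sq_le hr hr3 f N
    _ = _ := by ring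

lemma tsum_thrEps_le {r : ℝ} (hr : 2 < r) :
    ∑' n, ENNReal.ofReal (thrEps n ^ (r - 2)) ≤ ENNReal.ofReal (2 * (r - 2)⁻¹) := by
  have hs : 0 < r - 2 := by linarith
  set q : ℝ := (1 / 2 : ℝ) ^ (r - 2) with hq
  have hq0 : 0 < q := by positivity
  have hq1 : q < 1 := Real.rpow_lt_one (by norm_num) (by norm_num) hs
  have he : ∀ n, thrEps n ^ (r - 2) = q * q ^ n := by
    intro n
    rw [thrEps, ← Real.rpow_natCast, ← Real.rpow_mul (by norm_num), mul_comm, Real.rpow_mul (by norm_num),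
      ← hq, Real.rpow_natCast, pow_succ, mul_comm]
  simp_rw [he]
  rw [← ENNReal.ofReal_tsum_of_nonneg (fun n => by positivity)
    ((summable_geometric_of_lt_one hq0.le hq1).mul_left q), tsum_mul_left,
    tsum_geometric_of_lt_one hq0.le hq1]
  refine ENNReal.ofReal_le_ofReal ?_
  have hq2 : q = Real.exp (- (Real.log 2 * (r - 2))) := by
    rw [hq, Real.rpow_def_of_pos (by norm_num)]; congr 1
    rw [Real.log_div (by norm_num) (by norm_num)]; simp
  have hx : 1 ≤ q * Real.exp (Real.log 2 * (r - 2)) := by rw [hq2, ← Real.exp_add]; simp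
  have hl := Real.add_one_le_exp (Real.log 2 * (r - 2))
  have hq3 : q * (1 + Real.log 2 * (r - 2)) ≤ 1 := by
    rw [hq2]
    calc _ ≤ Real.exp (- (Real.log 2 * (r - 2))) * Real.exp (Real.log 2 * (r - 2)) := by
          gcongr; linarith
      _ = 1 := by rw [← Real.exp_add]; simp
  have hl2 : 1 / 2 ≤ Real.log 2 := by linarith [Real.log_two_gt_d9]
  rw [← div_eq_mul_inv, ← div_eq_mul_inv, div_le_div_iff₀ (by linarith) hs]
  have := mul_le_mul_of_nonneg_right hl2 (mul_nonneg hq0.le hs.le)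
  nlinarith

/-- The left endpoint of the dyadic interval of length `2^j` containing `x`. -/
def fl (j : ℤ) (x : ℝ) : ℝ := (2 : ℝ) ^ j * ⌊(2 : ℝ) ^ (-j) * x⌋

/-- The average of `F` over the dyadic interval of length `2^j` containing `x`. -/
def avgD (j : ℤ) (F : ℝ → ℂ) (x : ℝ) : ℂ := ∫ σ in (0 : ℝ)..1, F (fl j x + (2 : ℝ) ^ j * σ)

lemma two_zpow_pos (j : ℤ) : (0 : ℝ) < (2 : ℝ) ^ j := by positivity

lemma zpow_mul_zpow_neg (j : ℤ) : (2 : ℝ) ^ j * (2 : ℝ) ^ (-j) = 1 := by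
  rw [← zpow_add₀ (by norm_num)]; simp

lemma fl_eq {j : ℤ} {x : ℝ} {n : ℤ} (h : x ∈ Ico ((2 : ℝ) ^ j * n) ((2 : ℝ) ^ j * (n + 1))) :
    fl j x = (2 : ℝ) ^ j * n := by
  have h0 := two_zpow_pos (-j)
  have h1 := zpow_mul_zpow_neg j
  have : ⌊(2 : ℝ) ^ (-j) * x⌋ = n := by
    rw [Int.floor_eq_iff]
    constructor
    · calc (n : ℝ) = (2 : ℝ) ^ (-j) * ((2 : ℝ) ^ j * n) := by rw [← mul_assoc, mul_comm _ ((2:ℝ) ^ j), h1, one_mul]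
        _ ≤ _ := by gcongr; exact h.1
    · calc (2 : ℝ) ^ (-j) * x < (2 : ℝ) ^ (-j) * ((2 : ℝ) ^ j * (n + 1)) := by gcongr; exact h.2
        _ = n + 1 := by rw [← mul_assoc, mul_comm _ ((2:ℝ) ^ j), h1, one_mul]
  rw [fl, this]

lemma fl_add {j : ℤ} (x : ℝ) {σ : ℝ} (h : σ ∈ Ico (0 : ℝ) 1) :
    fl j (fl j x + (2 : ℝ) ^ j * σ) = fl j x := by
  refine fl_eq (n := ⌊(2 : ℝ) ^ (-j) * x⌋) ⟨?_, ?_⟩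
  · have := mul_nonneg (two_zpow_pos j).le h.1
    unfold fl; linarith
  · have := mul_lt_mul_of_pos_left h.2 (two_zpow_pos j)
    unfold fl; linarith

lemma measurable_fl (j : ℤ) : Measurable (fl j) := by
  unfold fl
  exact measurable_const.mul ((measurable_from_top (f := fun n : ℤ => (n : ℝ))).comp
    (Int.measurable_floor.comp (by fun_prop)))

lemma fl_succ_eq {j : ℤ} {x y : ℝ} (h : fl j x = fl j y) : fl (j + 1) x = fl (j + 1) y := by
  have key : ∀ z, ⌊(2 : ℝ) ^ (-(j + 1)) * z⌋ = ⌊(2 : ℝ) ^ (-j) * z⌋ / 2 := by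
    intro z
    have : (2 : ℝ) ^ (-(j + 1)) * z = ((2 : ℝ) ^ (-j) * z) / (2 : ℕ) := by
      rw [neg_add, zpow_add₀ (by norm_num)]; simp; ring
    rw [this, Int.floor_div_natCast]; simp
  have h' : ⌊(2 : ℝ) ^ (-j) * x⌋ = ⌊(2 : ℝ) ^ (-j) * y⌋ := by
    have := mul_left_cancel₀ (two_zpow_pos j).ne' h
    exact_mod_cast this
  simp only [fl, key, h']

lemma fl_eq_of_le {j j' : ℤ} (hj : j ≤ j') {x y : ℝ} (h : fl j x = fl j y) :
    fl j' x = fl j' y := by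
  induction j', hj using Int.leInduction with
  | base => exact h
  | succ k _ ih => exact fl_succ_eq ih

lemma avgD_eq_of_fl_eq {j : ℤ} {F : ℝ → ℂ} {x y : ℝ} (h : fl j x = fl j y) :
    avgD j F x = avgD j F y := by
  simp only [avgD, h]

lemma measurable_avgD (j : ℤ) (F : ℝ → ℂ) : Measurable (avgD j F) := by
  have : avgD j F = (fun n : ℤ => ∫ σ in (0 : ℝ)..1, F ((2 : ℝ) ^ j * n + (2 : ℝ) ^ j * σ)) ∘
      (fun x => ⌊(2 : ℝ) ^ (-j) * x⌋) := rfl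
  rw [this]
  exact measurable_from_top.comp (Int.measurable_floor.comp (by fun_prop))

lemma norm_avgD_le {j : ℤ} {F : ℝ → ℂ} {B : ℝ} (hB : ∀ x, ‖F x‖ ≤ B) (x : ℝ) :
    ‖avgD j F x‖ ≤ B := by
  unfold avgD
  simpa using intervalIntegral.norm_integral_le_of_norm_le_const
    (a := 0) (b := 1) (f := fun σ : ℝ => F (fl j x + (2 : ℝ) ^ j * σ)) (C := B) (fun σ _ => hB _)

lemma intervalIntegrable_of_bdd {F : ℝ → ℂ} (hF : Measurable F) {B : ℝ} (hB : ∀ x, ‖F x‖ ≤ B)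
    (a b : ℝ) : IntervalIntegrable F volume a b := by
  refine (intervalIntegrable_const (c := B)).mono_fun hF.aestronglyMeasurable (ae_of_all _ fun x => ?_)
  rw [Real.norm_eq_abs]
  exact (hB x).trans (le_abs_self B)

lemma avgD_avgD {j : ℤ} {F : ℝ → ℂ} (hF : Measurable F) {B : ℝ} (hB : ∀ x, ‖F x‖ ≤ B) (x : ℝ) :
    avgD (j + 1) (avgD j F) x = avgD (j + 1) F x := by
  obtain ⟨n, hn⟩ : ∃ n : ℤ, fl (j + 1) x = (2 : ℝ) ^ (j + 1) * n := ⟨_, rfl⟩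
  have hp : (2 : ℝ) ^ (j + 1) = 2 ^ j * 2 := by rw [zpow_add₀ (by norm_num)]; simp
  have h2 := two_zpow_pos j
  set a := (2 : ℝ) ^ j with ha
  have e1 : ∫ σ in (0 : ℝ)..(1 / 2), avgD j F (fl (j + 1) x + (2 : ℝ) ^ (j + 1) * σ)
      = ∫ σ in (0 : ℝ)..(1 / 2), F (fl (j + 1) x + (2 : ℝ) ^ (j + 1) * σ) := by
    have : ∀ σ ∈ Ioo (0 : ℝ) (1 / 2), avgD j F (fl (j + 1) x + (2 : ℝ) ^ (j + 1) * σ) =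
        ∫ τ in (0 : ℝ)..1, F (a * (2 * n) + a * τ) := by
      intro σ hσ
      have : fl j (fl (j + 1) x + (2 : ℝ) ^ (j + 1) * σ) = a * ((2 * n : ℤ) : ℝ) := by
        refine fl_eq ⟨?_, ?_⟩ <;> rw [hn, hp] <;> push_cast
        · nlinarith [hσ.1]
        · nlinarith [hσ.2]
      rw [avgD, this]; push_cast; rfl
    rw [intervalIntegral.integral_congr_uIoo (fun σ hσ => this σ (by
      rwa [uIoo_of_le (by norm_num)] at hσ)),
      intervalIntegral.integral_const]
    have h3 := intervalIntegral.integral_comp_mul_left (a := 0) (b := 1 / 2)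
      (fun τ => F (a * (2 * n) + a * τ)) (two_ne_zero)
    rw [hn, hp]
    simp only [mul_zero, sub_zero] at h3 ⊢
    rw [mul_one_div_cancel two_ne_zero, ← one_div] at h3
    rw [← h3]
    refine intervalIntegral.integral_congr fun σ _ => ?_
    congr 1; ring
  have e2 : ∫ σ in (1 / 2 : ℝ)..1, avgD j F (fl (j + 1) x + (2 : ℝ) ^ (j + 1) * σ)
      = ∫ σ in (1 / 2 : ℝ)..1, F (fl (j + 1) x + (2 : ℝ) ^ (j + 1) * σ) := by
    have : ∀ σ ∈ Ioo (1 / 2 : ℝ) 1, avgD j F (fl (j + 1) x + (2 : ℝ) ^ (j + 1) * σ) =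
        ∫ τ in (0 : ℝ)..1, F (a * (2 * n + 1) + a * τ) := by
      intro σ hσ
      have : fl j (fl (j + 1) x + (2 : ℝ) ^ (j + 1) * σ) = a * ((2 * n + 1 : ℤ) : ℝ) := by
        refine fl_eq ⟨?_, ?_⟩ <;> rw [hn, hp] <;> push_cast
        · nlinarith [hσ.1]
        · nlinarith [hσ.2]
      rw [avgD, this]; push_cast; rfl
    rw [intervalIntegral.integral_congr_uIoo (fun σ hσ => this σ (by
      rwa [uIoo_of_le (by norm_num)] at hσ)),
      intervalIntegral.integral_const]
    have h3 := intervalIntegral.integral_comp_mul_sub (a := 1 / 2) (b := 1)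
      (fun τ => F (a * (2 * n + 1) + a * τ)) (two_ne_zero) 1
    norm_num at h3
    rw [hn, hp]
    norm_num
    rw [← h3]
    refine intervalIntegral.integral_congr fun σ _ => ?_
    congr 1; ring
  have hi : ∀ (G : ℝ → ℂ), Measurable G → (∀ x, ‖G x‖ ≤ B) → ∀ c d : ℝ,
      IntervalIntegrable (fun σ => G (fl (j + 1) x + (2 : ℝ) ^ (j + 1) * σ)) volume c d :=
    fun G hG hGB c d => intervalIntegrable_of_bdd (hG.comp (by fun_prop)) (fun _ => hGB _) c d
  rw [avgD, avgD, ← intervalIntegral.integral_add_adjacent_intervals (b := 1 / 2)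
    (hi _ (measurable_avgD j F) (norm_avgD_le hB) _ _) (hi _ (measurable_avgD j F) (norm_avgD_le hB) _ _),
    e1, e2, intervalIntegral.integral_add_adjacent_intervals (hi F hF hB _ _) (hi F hF hB _ _)]

lemma lintegral_lavg (j : ℤ) {Φ : ℝ → ℝ≥0∞} :
    ∫⁻ x, ∫⁻ σ in Ico (0 : ℝ) 1, Φ (fl j x + (2 : ℝ) ^ j * σ) = ∫⁻ x, Φ x := by
  have h2 := two_zpow_pos j
  set a := (2 : ℝ) ^ j with ha
  have key : ∀ Ψ : ℝ → ℝ≥0∞, ∫⁻ x, Ψ x = ∑' n : ℤ, ∫⁻ x in Ico (n • a) ((n + 1) • a), Ψ x := by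
    intro Ψ
    rw [← lintegral_iUnion (fun _ => measurableSet_Ico) (pairwise_disjoint_Ico_zsmul a),
      iUnion_Ico_zsmul h2, Measure.restrict_univ]
  rw [key, key Φ]
  refine tsum_congr fun n => ?_
  have e1 : ∀ x ∈ Ico (n • a) ((n + 1) • a), fl j x = a * n := by
    intro x hx
    refine fl_eq ⟨?_, ?_⟩
    · simpa [mul_comm] using hx.1
    · simpa [mul_comm] using hx.2
  rw [setLIntegral_congr_fun (g := fun _ => ∫⁻ σ in Ico (0 : ℝ) 1, Φ (a * n + a * σ)) measurableSet_Ico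
    (fun x hx => by simp only [e1 x hx])]
  have himg : (fun σ => a * n + a * σ) '' Ico (0 : ℝ) 1 = Ico (n • a) ((n + 1) • a) := by
    rw [show (fun σ => a * n + a * σ) = (fun y => a * n + y) ∘ (fun σ => a * σ) from rfl, image_comp,
      image_mul_left_Ico h2, image_const_add_Ico]
    congr 1 <;> simp <;> ring
  have h3 := lintegral_image_eq_lintegral_abs_deriv_mul (s := Ico (0 : ℝ) 1)
    (f := fun σ => a * n + a * σ) (f' := fun _ => a) measurableSet_Ico
    (fun σ _ => by
      have := ((hasDerivAt_id σ).const_mul a).const_add (a * n)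
      simpa using this.hasDerivWithinAt)
    (fun σ _ τ _ h => by simpa [h2.ne'] using h) Φ
  rw [himg] at h3
  rw [h3, lintegral_const_mul' _ _ (by simp), setLIntegral_const, Real.volume_Ico, abs_of_pos h2, mul_comm]
  congr 2
  simp [add_smul]

lemma lintegral_sq_sub_mean {α : Type*} [MeasurableSpace α] (P : Measure α)
    [IsProbabilityMeasure P] {φ : α → ℂ} (hφ : Measurable φ) {B : ℝ} (hB : ∀ x, ‖φ x‖ ≤ B) (c : ℂ) :
    ∫⁻ x, ‖φ x - c‖ₑ ^ 2 ∂P = ∫⁻ x, ‖φ x - ∫ y, φ y ∂P‖ₑ ^ 2 ∂P + ‖(∫ y, φ y ∂P) - c‖ₑ ^ 2 := by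
  set m := ∫ y, φ y ∂P with hm
  have hi : Integrable φ P := Integrable.of_bound hφ.aestronglyMeasurable B (ae_of_all _ hB)
  have hsq : ∀ c : ℂ, Integrable (fun x => ‖φ x - c‖ ^ 2) P := fun c => by
    refine Integrable.of_bound ((hφ.sub_const c).norm.pow_const 2).aestronglyMeasurable
      ((B + ‖c‖) ^ 2) (ae_of_all _ fun x => ?_)
    rw [Real.norm_of_nonneg (by positivity)]
    gcongr
    exact (norm_sub_le _ _).trans (by linarith [hB x])
  have conv : ∀ c : ℂ, ∫⁻ x, ‖φ x - c‖ₑ ^ 2 ∂P = ENNReal.ofReal (∫ x, ‖φ x - c‖ ^ 2 ∂P) := by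
    intro c
    rw [ofReal_integral_eq_lintegral_ofReal (hsq c) (ae_of_all _ fun x => by positivity)]
    refine lintegral_congr fun x => ?_
    rw [ENNReal.ofReal_pow (norm_nonneg _), ofReal_norm]
  rw [conv, conv, ← ofReal_norm (m - c), ← ENNReal.ofReal_pow (norm_nonneg _),
    ← ENNReal.ofReal_add (integral_nonneg fun x => by positivity) (by positivity)]
  congr 1
  have pt : ∀ x, ‖φ x - c‖ ^ 2 = ‖φ x - m‖ ^ 2 + 2 * ((φ x - m) * (starRingEnd ℂ) (m - c)).re
      + ‖m - c‖ ^ 2 := by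
    intro x
    simp only [← Complex.normSq_eq_norm_sq, Complex.normSq_apply, Complex.mul_re, Complex.sub_re,
      Complex.sub_im, Complex.conj_re, Complex.conj_im]
    ring
  have hi2 : Integrable (fun x => (φ x - m) * (starRingEnd ℂ) (m - c)) P :=
    (hi.sub (integrable_const _)).mul_const _
  have hi3 : Integrable (fun x => 2 * ((φ x - m) * (starRingEnd ℂ) (m - c)).re) P :=
    hi2.re.const_mul 2
  have hz : ∫ x, 2 * ((φ x - m) * (starRingEnd ℂ) (m - c)).re ∂P = 0 := by
    rw [integral_const_mul]
    have := integral_re hi2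
    simp only [RCLike.re_to_complex] at this
    rw [this, integral_mul_const, integral_sub hi (integrable_const _), ← hm]
    simp
  simp_rw [pt]
  have hi4 : Integrable (fun x => ‖φ x - m‖ ^ 2 + 2 * ((φ x - m) * (starRingEnd ℂ) (m - c)).re) P :=
    (hsq m).add hi3
  rw [integral_add hi4 (integrable_const _), integral_add (hsq m) hi3, hz]
  simp

lemma lintegral_sq_sub_level (j : ℤ) {F G : ℝ → ℂ} (hF : Measurable F) {B : ℝ}
    (hB : ∀ x, ‖F x‖ ≤ B) (hG : Measurable G) (hlev : ∀ x y, fl j x = fl j y → G x = G y) :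
    ∫⁻ x, ‖F x - G x‖ₑ ^ 2 =
      (∫⁻ x, ‖F x - avgD j F x‖ₑ ^ 2) + ∫⁻ x, ‖avgD j F x - G x‖ₑ ^ 2 := by
  have hP : IsProbabilityMeasure ((volume : Measure ℝ).restrict (Ico 0 1)) :=
    ⟨by simp⟩
  have hfl : ∀ {K : ℝ → ℂ}, (∀ x y, fl j x = fl j y → K x = K y) → ∀ x,
      ∫⁻ σ in Ico (0 : ℝ) 1, ‖F (fl j x + (2 : ℝ) ^ j * σ) - K (fl j x + (2 : ℝ) ^ j * σ)‖ₑ ^ 2 =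
      ∫⁻ σ in Ico (0 : ℝ) 1, ‖F (fl j x + (2 : ℝ) ^ j * σ) - K x‖ₑ ^ 2 := by
    intro K hK x
    refine setLIntegral_congr_fun measurableSet_Ico fun σ hσ => ?_
    rw [hK _ x (fl_add x hσ)]
  have h1 : ∫⁻ x, ‖F x - avgD j F x‖ₑ ^ 2 = ∫⁻ x, ∫⁻ σ in Ico (0 : ℝ) 1,
      ‖F (fl j x + (2 : ℝ) ^ j * σ) - avgD j F (fl j x + (2 : ℝ) ^ j * σ)‖ₑ ^ 2 :=
    (lintegral_lavg j).symm
  have h2 : Measurable fun x => ‖avgD j F x - G x‖ₑ ^ 2 :=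
    ((measurable_avgD j F).sub hG).enorm.pow_const 2
  rw [← lintegral_lavg j, h1, ← lintegral_add_right _ h2]
  refine lintegral_congr fun x => ?_
  rw [hfl hlev, hfl (fun x y => avgD_eq_of_fl_eq)]
  have := lintegral_sq_sub_mean ((volume : Measure ℝ).restrict (Ico 0 1))
    (φ := fun σ => F (fl j x + (2 : ℝ) ^ j * σ)) (hF.comp (by fun_prop)) (fun _ => hB _) (G x)
  rw [this]
  have hm : ∫ σ in Ico (0 : ℝ) 1, F (fl j x + (2 : ℝ) ^ j * σ) = avgD j F x := by
    rw [avgD, intervalIntegral.integral_of_le (by norm_num), integral_Ico_eq_integral_Ioo,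
      integral_Ioc_eq_integral_Ioo]
  rw [hm]

lemma measurable_runMax {α : Type*} [MeasurableSpace α] {f : ℕ → α → ℂ} (hf : ∀ k, Measurable (f k))
    (k : ℕ) : Measurable fun a => runMax (fun k => f k a) k := by
  induction k with
  | zero => exact (hf 0).norm
  | succ k ih => exact ih.max (hf _).norm

lemma measurable_thr {α : Type*} [MeasurableSpace α] (ε : ℝ) {f : ℕ → α → ℂ}
    (hf : ∀ k, Measurable (f k)) (k : ℕ) : Measurable fun a => thr ε (fun k => f k a) k := by
  induction k with
  | zero => exact hf 0
  | succ k ih =>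
    refine Measurable.ite (measurableSet_le ?_ ?_) (hf _) ih
    · exact measurable_const.mul (measurable_runMax hf _)
    · exact ((hf _).sub ih).norm

lemma measurable_jumpSum {α : Type*} [MeasurableSpace α] (r : ℝ) {f : ℕ → α → ℂ}
    (hf : ∀ k, Measurable (f k)) (i i' : ℕ) : Measurable fun a => jumpSum r (fun k => f k a) i i' := by
  unfold jumpSum
  refine Measurable.tsum fun n => measurable_const.mul (Finset.measurable_sum _ fun k _ => ?_)
  exact ((measurable_thr _ hf _).sub (measurable_thr _ hf _)).enorm.pow_const 2

lemma runMax_congr {f g : ℕ → ℂ} {k : ℕ} (h : ∀ i ≤ k, f i = g i) : runMax f k = runMax g k := by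
  induction k with
  | zero => simp [runMax, h 0 le_rfl]
  | succ k ih => rw [runMax, runMax, ih fun i hi => h i (by omega), h _ le_rfl]

lemma thr_congr {ε : ℝ} {f g : ℕ → ℂ} {k : ℕ} (h : ∀ i ≤ k, f i = g i) : thr ε f k = thr ε g k := by
  induction k with
  | zero => simp [thr, h 0 le_rfl]
  | succ k ih => rw [thr, thr, ih fun i hi => h i (by omega), h _ le_rfl, runMax_congr h]

/-- The dyadic martingale of `F`, starting at scale `2^N`. -/
def dyMart (N : ℤ) (F : ℝ → ℂ) (k : ℕ) (x : ℝ) : ℂ := avgD (N - k) F x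

lemma sum_jumps_eq (N : ℤ) (ε : ℝ) {F : ℝ → ℂ} (hF : Measurable F) {B : ℝ} (hB : ∀ x, ‖F x‖ ≤ B)
    (n : ℕ) :
    (∑ k ∈ Finset.range n, ∫⁻ x, ‖thr ε (fun i => dyMart N F i x) (k + 1) -
      thr ε (fun i => dyMart N F i x) k‖ₑ ^ 2) +
      (∫⁻ x, ‖dyMart N F n x - thr ε (fun i => dyMart N F i x) n‖ₑ ^ 2) +
      (∫⁻ x, ‖dyMart N F 0 x‖ₑ ^ 2) = ∫⁻ x, ‖dyMart N F n x‖ₑ ^ 2 := by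
  have hm : ∀ k, Measurable (dyMart N F k) := fun k => measurable_avgD _ _
  have hg : ∀ k, Measurable fun x => thr ε (fun i => dyMart N F i x) k := measurable_thr ε hm
  induction n with
  | zero => simp [thr]
  | succ n ih =>
    have hj : (N - (n + 1 : ℕ) : ℤ) + 1 = N - n := by push_cast; ring
    have hav : avgD (N - n) (dyMart N F (n + 1)) = dyMart N F n := by
      ext x
      have := avgD_avgD (j := N - (n + 1 : ℕ)) hF hB x
      rw [hj] at this
      exact this
    have orth : ∀ {G : ℝ → ℂ}, Measurable G → (∀ x y, fl (N - n) x = fl (N - n) y → G x = G y) →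
        ∫⁻ x, ‖dyMart N F (n + 1) x - G x‖ₑ ^ 2 =
        (∫⁻ x, ‖dyMart N F (n + 1) x - dyMart N F n x‖ₑ ^ 2) +
          ∫⁻ x, ‖dyMart N F n x - G x‖ₑ ^ 2 := by
      intro G hG hlev
      have := lintegral_sq_sub_level (N - n) (hm (n + 1)) (B := B) (norm_avgD_le hB) hG hlev
      rwa [hav] at this
    have o1 := orth (hg n) (fun x y hxy => thr_congr fun i hi =>
      avgD_eq_of_fl_eq (fl_eq_of_le (by omega) hxy))
    have o2 := orth (G := fun _ => 0) measurable_const (fun _ _ _ => rfl)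
    simp only [sub_zero] at o2
    have hstep : (∫⁻ x, ‖thr ε (fun i => dyMart N F i x) (n + 1) -
        thr ε (fun i => dyMart N F i x) n‖ₑ ^ 2) +
        (∫⁻ x, ‖dyMart N F (n + 1) x - thr ε (fun i => dyMart N F i x) (n + 1)‖ₑ ^ 2) =
        ∫⁻ x, ‖dyMart N F (n + 1) x - thr ε (fun i => dyMart N F i x) n‖ₑ ^ 2 := by
      have hmm : Measurable fun x => ‖thr ε (fun i => dyMart N F i x) (n + 1) -
        thr ε (fun i => dyMart N F i x) n‖ₑ ^ 2 := ((hg _).sub (hg _)).enorm.pow_const 2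
      rw [← lintegral_add_left hmm]
      refine lintegral_congr fun x => ?_
      rw [thr]
      split_ifs <;> simp
    rw [Finset.sum_range_succ, o2, ← ih]
    calc _ = (∑ k ∈ Finset.range n, ∫⁻ x, ‖thr ε (fun i => dyMart N F i x) (k + 1) -
        thr ε (fun i => dyMart N F i x) k‖ₑ ^ 2) + ((∫⁻ x, ‖thr ε (fun i => dyMart N F i x) (n + 1) -
        thr ε (fun i => dyMart N F i x) n‖ₑ ^ 2) +
        (∫⁻ x, ‖dyMart N F (n + 1) x - thr ε (fun i => dyMart N F i x) (n + 1)‖ₑ ^ 2))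
        + (∫⁻ x, ‖dyMart N F 0 x‖ₑ ^ 2) := by ring
      _ = _ := by rw [hstep, o1]; ring

lemma energy_avgD_le (j : ℤ) {F : ℝ → ℂ} (hF : Measurable F) {B : ℝ} (hB : ∀ x, ‖F x‖ ≤ B) :
    energy (avgD j F) ≤ energy F := by
  have := lintegral_sq_sub_level j hF hB (G := fun _ => 0) measurable_const (fun _ _ _ => rfl)
  simp only [sub_zero] at this
  unfold energy
  rw [this]
  exact le_add_left le_rfl

/-- The pathwise majorant of the squared `r`-variation of the dyadic martingale. -/
def martMaj (r : ℝ) (N : ℤ) (n : ℕ) (F : ℝ → ℂ) (x : ℝ) : ℝ≥0∞ :=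
  4 * ‖dyMart N F 0 x‖ₑ ^ 2 + 2304 * jumpSum r (fun k => dyMart N F k x) 0 n

lemma lintegral_martMaj_le {r : ℝ} (hr : 2 < r) (hr3 : r < 3) (N : ℤ) (n : ℕ) {F : ℝ → ℂ}
    (hF : Measurable F) {B : ℝ} (hB : ∀ x, ‖F x‖ ≤ B) :
    ∫⁻ x, martMaj r N n F x ≤ 5000 * ENNReal.ofReal ((r - 2)⁻¹) * energy F := by
  have hm : ∀ k, Measurable (dyMart N F k) := fun k => measurable_avgD _ _
  have hE : ∀ k, energy (dyMart N F k) ≤ energy F := fun k => energy_avgD_le _ hF hB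
  have hJ : ∫⁻ x, jumpSum r (fun k => dyMart N F k x) 0 n ≤
      ENNReal.ofReal (2 * (r - 2)⁻¹) * energy F := by
    unfold jumpSum
    have hg : ∀ ε k, Measurable fun x => thr ε (fun i => dyMart N F i x) k :=
      fun ε => measurable_thr ε hm
    have hmm : ∀ ε k, Measurable fun x => ‖thr ε (fun i => dyMart N F i x) (k + 1) -
        thr ε (fun i => dyMart N F i x) k‖ₑ ^ 2 := fun ε k => ((hg ε _).sub (hg ε _)).enorm.pow_const 2
    rw [lintegral_tsum]
    swap
    · intro m
      exact ((Finset.measurable_sum _ fun k _ => hmm (thrEps m) k).const_mul _).aemeasurable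
    calc _ ≤ ∑' m, ENNReal.ofReal (thrEps m ^ (r - 2)) * energy F := by
          refine ENNReal.tsum_le_tsum fun m => ?_
          rw [lintegral_const_mul' _ _ (by simp), lintegral_finsetSum _ fun k _ => hmm _ k]
          gcongr
          rw [← Finset.range_eq_Ico]
          refine le_trans ?_ (hE n)
          rw [energy, ← sum_jumps_eq N (thrEps m) hF hB n, add_assoc]
          exact le_add_right le_rfl
      _ ≤ _ := by
          rw [ENNReal.tsum_mul_right]
          gcongr
          exact tsum_thrEps_le hr
  unfold martMaj
  have hmm : Measurable fun x => 4 * ‖dyMart N F 0 x‖ₑ ^ 2 :=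
    ((hm 0).enorm.pow_const 2).const_mul 4
  rw [lintegral_add_left hmm,
    lintegral_const_mul' _ _ (by simp), lintegral_const_mul' _ _ (by simp)]
  have h1 : (1 : ℝ≥0∞) ≤ ENNReal.ofReal ((r - 2)⁻¹) := by
    rw [← ENNReal.ofReal_one]
    refine ENNReal.ofReal_le_ofReal ?_
    rw [one_le_inv₀ (by linarith)]; linarith
  rw [ENNReal.ofReal_mul (by norm_num)] at hJ
  calc _ ≤ 4 * (ENNReal.ofReal ((r - 2)⁻¹) * energy F) +
        2304 * (ENNReal.ofReal 2 * ENNReal.ofReal ((r - 2)⁻¹) * energy F) := by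
        gcongr
        calc _ ≤ 1 * energy F := by rw [one_mul]; exact hE 0
          _ ≤ _ := by gcongr
    _ = 4612 * (ENNReal.ofReal ((r - 2)⁻¹) * energy F) := by
        rw [show ENNReal.ofReal 2 = 2 by norm_num]; ring
    _ ≤ 5000 * (ENNReal.ofReal ((r - 2)⁻¹) * energy F) := by gcongr; norm_num
    _ = _ := by ring

lemma lintegral_mul_sq_le {α : Type*} [MeasurableSpace α] (ν : Measure α) {f g : α → ℝ≥0∞}
    (hf : AEMeasurable f ν) (hg : AEMeasurable g ν) :
    (∫⁻ a, f a * g a ∂ν) ^ 2 ≤ (∫⁻ a, f a ^ 2 ∂ν) * ∫⁻ a, g a ^ 2 ∂ν := by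
  have h := ENNReal.lintegral_mul_le_Lp_mul_Lq ν (p := 2) (q := 2) Real.HolderConjugate.two_two hf hg
  simp only [Pi.mul_apply, ENNReal.rpow_two] at h
  calc _ ≤ ((∫⁻ a, f a ^ 2 ∂ν) ^ (1 / 2 : ℝ) * (∫⁻ a, g a ^ 2 ∂ν) ^ (1 / 2 : ℝ)) ^ 2 := by gcongr
    _ = _ := by
      rw [mul_pow, ← ENNReal.rpow_natCast, ← ENNReal.rpow_natCast, ← ENNReal.rpow_mul,
        ← ENNReal.rpow_mul]
      norm_num

lemma lintegral_sq_le {α : Type*} [MeasurableSpace α] (ν : Measure α) {f : α → ℝ≥0∞}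
    (hf : AEMeasurable f ν) : (∫⁻ a, f a ∂ν) ^ 2 ≤ ν univ * ∫⁻ a, f a ^ 2 ∂ν := by
  have := lintegral_mul_sq_le ν (f := fun _ => 1) aemeasurable_const hf
  simpa using this

/-- The Fourier transform of the indicator function of the unit interval. -/
def sig (ξ : ℝ) : ℂ := ∫ σ in (0 : ℝ)..1, ex (ξ * σ)

/-- The multiplier of the averaged dyadic conditional expectations. -/
def Lh (ξ : ℝ) : ℂ := sig ξ * sig (-ξ)

lemma continuous_sig : Continuous sig := by
  unfold sig
  exact intervalIntegral.continuous_parametric_intervalIntegral_of_continuous'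
    (f := fun ξ σ => ex (ξ * σ)) (continuous_ex.comp (by fun_prop)) 0 1

lemma continuous_Lh : Continuous Lh := continuous_sig.mul (continuous_sig.comp continuous_neg)

lemma norm_sig_le_one (ξ : ℝ) : ‖sig ξ‖ ≤ 1 := by
  unfold sig
  simpa using intervalIntegral.norm_integral_le_of_norm_le_const
    (a := 0) (b := 1) (f := fun σ : ℝ => ex (ξ * σ)) (C := 1) (fun σ _ => (norm_ex _).le)

lemma norm_Lh_le_one (ξ : ℝ) : ‖Lh ξ‖ ≤ 1 := by
  rw [Lh, norm_mul]
  exact mul_le_one₀ (norm_sig_le_one _) (norm_nonneg _) (norm_sig_le_one _)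

lemma norm_sig_sub_one_le (ξ : ℝ) : ‖sig ξ - 1‖ ≤ 2 * Real.pi * |ξ| := by
  have : sig ξ - 1 = ∫ σ in (0 : ℝ)..1, (ex (ξ * σ) - 1) := by
    rw [intervalIntegral.integral_sub, sig]
    · simp
    · exact (continuous_ex.comp (by fun_prop)).intervalIntegrable _ _
    · simp
  rw [this]
  have h := intervalIntegral.norm_integral_le_of_norm_le_const
    (a := 0) (b := 1) (f := fun σ : ℝ => ex (ξ * σ) - 1) (C := 2 * Real.pi * |ξ|) (fun σ hσ => ?_)
  · simpa using h
  · rw [uIoc_of_le zero_le_one] at hσ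
    refine (norm_ex_sub_one_le _).trans ?_
    rw [abs_mul, abs_of_pos hσ.1]
    have := mul_le_mul_of_nonneg_left hσ.2 (abs_nonneg ξ)
    have := Real.pi_pos
    gcongr
    linarith

lemma norm_sig_le_inv {ξ : ℝ} (hξ : ξ ≠ 0) : ‖sig ξ‖ ≤ 1 / |ξ| := by
  have hc : (2 * Real.pi * ξ : ℂ) * Complex.I ≠ 0 := by
    simp [hξ, Real.pi_ne_zero]
  have : sig ξ = (ex ξ - 1) / ((2 * Real.pi * ξ : ℂ) * Complex.I) := by
    have h := integral_exp_mul_complex (a := 0) (b := 1) hc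
    simp only [Complex.ofReal_zero, mul_zero, Complex.exp_zero, Complex.ofReal_one, mul_one] at h
    unfold sig ex
    rw [show (((2 * Real.pi * ξ : ℝ) : ℂ)) = 2 * Real.pi * ξ by push_cast; ring, ← h]
    refine intervalIntegral.integral_congr fun σ _ => ?_
    congr 1; push_cast; ring
  rw [this, norm_div]
  have h1 : ‖ex ξ - 1‖ ≤ 2 := by
    calc _ ≤ ‖ex ξ‖ + ‖(1 : ℂ)‖ := norm_sub_le _ _
      _ = 2 := by rw [norm_ex]; norm_num
  have h2 : ‖(2 * Real.pi * ξ : ℂ) * Complex.I‖ = 2 * Real.pi * |ξ| := by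
    simp [abs_of_pos Real.pi_pos]
  rw [h2]
  have hξ' : 0 < |ξ| := abs_pos.2 hξ
  have hpi := Real.pi_gt_three
  rw [div_le_div_iff₀ (by positivity) hξ']
  nlinarith

lemma norm_Lh_le_inv {ξ : ℝ} (hξ : ξ ≠ 0) : ‖Lh ξ‖ ≤ 1 / |ξ| := by
  rw [Lh, norm_mul]
  calc _ ≤ 1 / |ξ| * 1 := by
        gcongr
        · exact norm_sig_le_inv hξ
        · exact norm_sig_le_one _
    _ = _ := mul_one _

lemma norm_Lh_sub_one_le (ξ : ℝ) : ‖Lh ξ - 1‖ ≤ 4 * Real.pi * |ξ| := by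
  have : Lh ξ - 1 = (sig ξ - 1) * sig (-ξ) + (sig (-ξ) - 1) := by rw [Lh]; ring
  rw [this]
  calc _ ≤ ‖sig ξ - 1‖ * ‖sig (-ξ)‖ + ‖sig (-ξ) - 1‖ := (norm_add_le _ _).trans (by rw [norm_mul])
    _ ≤ 2 * Real.pi * |ξ| * 1 + 2 * Real.pi * |-ξ| := by
        have := Real.pi_pos
        gcongr
        · exact norm_sig_sub_one_le _
        · exact norm_sig_le_one _
        · exact norm_sig_sub_one_le _
    _ = _ := by rw [abs_neg]; ring

lemma integral_synth_line {h : ℝ → ℂ} (hh : Integrable h) (y c : ℝ) :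
    ∫ σ in (0 : ℝ)..1, synth h (y + c * σ) = synth (fun ξ => sig (c * ξ) * h ξ) y := by
  rw [intervalIntegral.integral_of_le zero_le_one]
  simp only [synth]
  rw [integral_integral_swap]
  · refine integral_congr_ae (ae_of_all _ fun ξ => ?_)
    simp only [sig]
    rw [← mul_assoc, ← intervalIntegral.integral_const_mul, ← intervalIntegral.integral_mul_const,
      intervalIntegral.integral_of_le zero_le_one]
    refine integral_congr_ae (ae_of_all _ fun σ => ?_)
    simp only
    rw [← ex_add]; congr 2; ring
  · have h1 : Integrable (fun z : ℝ × ℝ => (1 : ℂ) * h z.2) ((volume.restrict (Ioc 0 1)).prod volume) :=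
      (integrable_const (1 : ℂ)).mul_prod hh
    refine (h1.bdd_mul (c := 1) (f := fun z : ℝ × ℝ => ex (z.2 * (y + c * z.1))) ?_ ?_).congr ?_
    · exact (continuous_ex.comp (by fun_prop)).aestronglyMeasurable
    · exact ae_of_all _ fun z => (norm_ex _).le
    · exact ae_of_all _ fun z => by simp [Function.uncurry]

/-- The smooth averages of `synth h` at scale `2^j`. -/
def aS (h : ℝ → ℂ) (j : ℤ) (x : ℝ) : ℂ := synth (fun ξ => Lh ((2 : ℝ) ^ j * ξ) * h ξ) x

lemma integrable_sig_mul {h : ℝ → ℂ} (hh : Integrable h) (c : ℝ) :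
    Integrable fun ξ => sig (c * ξ) * h ξ :=
  hh.bdd_mul (c := 1) (continuous_sig.comp (by fun_prop)).aestronglyMeasurable
    (ae_of_all _ fun ξ => norm_sig_le_one _)

lemma aS_eq {h : ℝ → ℂ} (hh : Integrable h) (j : ℤ) (x : ℝ) :
    aS h j x = ∫ τ in (0 : ℝ)..1, ∫ σ in (0 : ℝ)..1, synth h (x - (2 : ℝ) ^ j * τ + (2 : ℝ) ^ j * σ) := by
  simp_rw [integral_synth_line hh, sub_eq_add_neg, ← neg_mul]
  rw [integral_synth_line (integrable_sig_mul hh _), aS]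
  congr 1; ext ξ
  rw [Lh, neg_mul]; ring

lemma integral_avgD_translate {F : ℝ → ℂ} (hF : Continuous F) {B : ℝ} (hB : ∀ x, ‖F x‖ ≤ B) {j N : ℤ} (hj : j ≤ N) (x : ℝ) :
    ∫ ρ in (0 : ℝ)..1, avgD j (fun y => F (y + (2 : ℝ) ^ N * ρ)) (x - (2 : ℝ) ^ N * ρ) =
      ∫ τ in (0 : ℝ)..1, ∫ σ in (0 : ℝ)..1, F (x - (2 : ℝ) ^ j * τ + (2 : ℝ) ^ j * σ) := by
  set H : ℝ → ℂ := fun τ => ∫ σ in (0 : ℝ)..1, F (x - (2 : ℝ) ^ j * τ + (2 : ℝ) ^ j * σ) with hH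
  obtain ⟨m, hm⟩ : ∃ m : ℕ, N = j + m := ⟨(N - j).toNat, by omega⟩
  have h1 : ∀ ρ, avgD j (fun y => F (y + (2 : ℝ) ^ N * ρ)) (x - (2 : ℝ) ^ N * ρ) =
      H (Int.fract ((2 : ℝ) ^ (-j) * x - (2 : ℝ) ^ m * ρ)) := by
    intro ρ
    have e : (2 : ℝ) ^ (-j) * (x - (2 : ℝ) ^ N * ρ) = (2 : ℝ) ^ (-j) * x - (2 : ℝ) ^ m * ρ := by
      rw [hm, zpow_add₀ (by norm_num), mul_sub, ← mul_assoc, ← mul_assoc, mul_comm _ ((2:ℝ) ^ j),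
        zpow_mul_zpow_neg, one_mul, zpow_natCast]
    simp only [avgD, hH]
    refine intervalIntegral.integral_congr fun σ _ => ?_
    congr 1
    rw [← e, Int.fract, fl]
    linear_combination (x - (2 : ℝ) ^ N * ρ) * zpow_mul_zpow_neg j
  simp_rw [h1]
  have hper : Function.Periodic (fun y => H (Int.fract y)) 1 := fun y => by
    simp only [Int.fract_add_one]
  have h2 := intervalIntegral.integral_comp_sub_mul (a := 0) (b := 1) (fun y => H (Int.fract y))
    (c := (2 : ℝ) ^ m) (by positivity) ((2 : ℝ) ^ (-j) * x)
  rw [h2]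
  have h3 := hper.intervalIntegral_add_zsmul_eq ((2 : ℤ) ^ m) ((2 : ℝ) ^ (-j) * x - 2 ^ m)
    (fun t₁ t₂ => ?_)
  · simp only [mul_one, mul_zero, sub_zero]
    rw [show (2 : ℝ) ^ (-j) * x = (2 : ℝ) ^ (-j) * x - 2 ^ m + (2 : ℤ) ^ m • (1 : ℝ) by simp]
    simp only [zsmul_eq_mul, mul_one] at h3 ⊢
    push_cast at h3 ⊢
    rw [sub_add_cancel] at h3
    simp only [sub_add_cancel]
    rw [h3]
    simp only [Complex.real_smul]
    have h4 := hper.intervalIntegral_add_eq ((2 : ℝ) ^ (-j) * x - 2 ^ m) 0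
    rw [h4, zero_add]
    push_cast
    rw [← mul_assoc, inv_mul_cancel₀ (pow_ne_zero _ two_ne_zero), one_mul]
    rw [intervalIntegral.integral_congr_uIoo]
    intro y hy
    rw [uIoo_of_le zero_le_one] at hy
    simp only [Int.fract_eq_self.2 ⟨hy.1.le, hy.2⟩]
    rfl
  · have hc : Continuous H :=
      intervalIntegral.continuous_parametric_intervalIntegral_of_continuous'
        (f := fun τ σ => F (x - (2 : ℝ) ^ j * τ + (2 : ℝ) ^ j * σ)) (hF.comp (by fun_prop)) 0 1
    refine intervalIntegrable_of_bdd (hc.measurable.comp measurable_fract) (B := B) (fun y => ?_) _ _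
    have := intervalIntegral.norm_integral_le_of_norm_le_const (a := 0) (b := 1) (C := B)
      (f := fun σ : ℝ => F (x - (2 : ℝ) ^ j * Int.fract y + (2 : ℝ) ^ j * σ)) (fun σ _ => hB _)
    simpa using this

/-- The dyadic martingale of the function translated by `2^N ρ`, read off at the point `x`. -/
def shiftMart (N : ℤ) (F : ℝ → ℂ) (k : ℕ) (z : ℝ × ℝ) : ℂ :=
  dyMart N (fun y => F (y + (2 : ℝ) ^ N * z.2)) k (z.1 - (2 : ℝ) ^ N * z.2)

lemma measurable_shiftMart (N : ℤ) {F : ℝ → ℂ} (hF : Continuous F) (k : ℕ) :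
    Measurable (shiftMart N F k) := by
  unfold shiftMart dyMart avgD
  simp_rw [intervalIntegral.integral_of_le zero_le_one]
  have h1 : Measurable fun p : (ℝ × ℝ) × ℝ => fl (N - k) (p.1.1 - (2 : ℝ) ^ N * p.1.2) :=
    (measurable_fl _).comp (by fun_prop)
  have h2 : Measurable fun p : (ℝ × ℝ) × ℝ => F (fl (N - k) (p.1.1 - (2 : ℝ) ^ N * p.1.2) +
      (2 : ℝ) ^ (N - (k : ℤ)) * p.2 + (2 : ℝ) ^ N * p.1.2) :=
    hF.measurable.comp ((h1.add (by fun_prop)).add (by fun_prop))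
  exact (h2.stronglyMeasurable.integral_prod_right' (ν := volume.restrict (Ioc (0 : ℝ) 1))).measurable

lemma norm_shiftMart_le (N : ℤ) {F : ℝ → ℂ} {B : ℝ} (hB : ∀ x, ‖F x‖ ≤ B) (k : ℕ) (z : ℝ × ℝ) :
    ‖shiftMart N F k z‖ ≤ B := by
  unfold shiftMart dyMart
  exact norm_avgD_le (fun y => hB _) _

lemma lrNorm_congr {r : ℝ} {k : ℕ} {F G : ℕ → ℝ≥0∞} (h : ∀ i < k, F i = G i) :
    lrNorm r k F = lrNorm r k G := by
  unfold lrNorm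
  rw [Finset.sum_congr rfl fun i hi => by rw [h i (Finset.mem_range.1 hi)]]

lemma measurable_lrNorm {α : Type*} [MeasurableSpace α] (r : ℝ) (k : ℕ) {F : ℕ → α → ℝ≥0∞}
    (hF : ∀ i, Measurable (F i)) : Measurable fun a => lrNorm r k fun i => F i a :=
  (Finset.measurable_sum _ fun i _ => (hF i).pow_const r).pow_const _

/-- The averaged majorant for the window `[-N, N]` of scales. -/
def windowMaj (r : ℝ) (N : ℕ) (F : ℝ → ℂ) (x : ℝ) : ℝ≥0∞ :=
  ∫⁻ ρ in Ioc (0 : ℝ) 1, (4 * ‖shiftMart N F 0 (x, ρ)‖ₑ ^ 2 +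
    2304 * jumpSum r (fun k => shiftMart N F k (x, ρ)) 0 (2 * N))

lemma measurable_windowMaj_aux (r : ℝ) (N : ℕ) {F : ℝ → ℂ} (hF : Continuous F) :
    Measurable fun z : ℝ × ℝ => 4 * ‖shiftMart N F 0 z‖ₑ ^ 2 +
      2304 * jumpSum r (fun k => shiftMart N F k z) 0 (2 * N) :=
  (measurable_const.mul ((measurable_shiftMart N hF 0).enorm.pow_const 2)).add
    (measurable_const.mul (measurable_jumpSum r (measurable_shiftMart N hF) _ _))

lemma measurable_windowMaj (r : ℝ) (N : ℕ) {F : ℝ → ℂ} (hF : Continuous F) :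
    Measurable (windowMaj r N F) :=
  Measurable.lintegral_prod_right (measurable_windowMaj_aux r N hF)

lemma lintegral_windowMaj_le {r : ℝ} (hr : 2 < r) (hr3 : r < 3) (N : ℕ) {F : ℝ → ℂ}
    (hF : Continuous F) {B : ℝ} (hB : ∀ x, ‖F x‖ ≤ B) :
    ∫⁻ x, windowMaj r N F x ≤ 5000 * ENNReal.ofReal ((r - 2)⁻¹) * energy F := by
  unfold windowMaj
  rw [lintegral_lintegral_swap (measurable_windowMaj_aux r N hF).aemeasurable]
  have h1 : ∀ ρ : ℝ, ∫⁻ x, (4 * ‖shiftMart N F 0 (x, ρ)‖ₑ ^ 2 +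
      2304 * jumpSum r (fun k => shiftMart N F k (x, ρ)) 0 (2 * N)) ≤
      5000 * ENNReal.ofReal ((r - 2)⁻¹) * energy F := by
    intro ρ
    have h2 := lintegral_martMaj_le hr hr3 N (2 * N) (F := fun y => F (y + (2 : ℝ) ^ (N : ℤ) * ρ))
      (by fun_prop) (fun x => hB _)
    have h3 : energy (fun y => F (y + (2 : ℝ) ^ (N : ℤ) * ρ)) = energy F :=
      lintegral_add_right_eq_self (fun y => ‖F y‖ₑ ^ 2) _
    rw [h3] at h2
    refine le_trans (le_of_eq ?_) h2
    exact lintegral_sub_right_eq_self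
      (martMaj r N (2 * N) (fun y => F (y + (2 : ℝ) ^ (N : ℤ) * ρ))) ((2 : ℝ) ^ (N : ℤ) * ρ)
  calc _ ≤ ∫⁻ _ in Ioc (0 : ℝ) 1, 5000 * ENNReal.ofReal ((r - 2)⁻¹) * energy F :=
        lintegral_mono fun ρ => h1 ρ
    _ = _ := by simp

lemma lrNorm_aS_le_windowMaj {r : ℝ} (hr : 2 < r) (hr3 : r < 3) {h : ℝ → ℂ} (hh : Integrable h)
    {v : ℕ → ℤ} (hv : Antitone v) {N : ℕ} (hN : ∀ i, |v i| ≤ N) (k : ℕ) (x : ℝ) :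
    lrNorm r k (incr (fun j => aS h j x) v) ^ 2 ≤ windowMaj r N (synth h) x := by
  have hc := continuous_synth hh
  have hB : ∀ y, ‖synth h y‖ ≤ ∫ ξ, ‖h ξ‖ := norm_synth_le h
  obtain ⟨u, hu⟩ : ∃ u : ℕ → ℕ, ∀ i, u i = ((N : ℤ) - v i).toNat := ⟨_, fun _ => rfl⟩
  have hN' : ∀ i, (N : ℤ) - u i = v i := fun i => by
    have := abs_le.1 (hN i); rw [hu]; omega
  have hmono : Monotone u := fun i i' hi => by
    have := hv hi
    rw [hu, hu]
    omega
  have hle : ∀ i, u i ≤ 2 * N := fun i => by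
    have := abs_le.1 (hN i); rw [hu]; omega
  have hms : ∀ k, Measurable fun ρ => shiftMart N (synth h) k (x, ρ) := fun k =>
    (measurable_shiftMart N hc k).comp (by fun_prop)
  have hbd : ∀ k ρ, ‖shiftMart N (synth h) k (x, ρ)‖ ≤ ∫ ξ, ‖h ξ‖ := fun k ρ =>
    norm_shiftMart_le N hB k _
  have ha : ∀ i, aS h (v i) x = ∫ ρ in (0 : ℝ)..1, shiftMart N (synth h) (u i) (x, ρ) := by
    intro i
    rw [aS_eq hh, ← integral_avgD_translate hc hB (N := N) ((le_abs_self _).trans (hN i))]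
    simp only [shiftMart, dyMart, hN']
  have hmi : ∀ i, Measurable fun ρ => incr (fun k => shiftMart N (synth h) k (x, ρ)) u i := fun i =>
    ((hms _).sub (hms _)).enorm
  have hi : ∀ i, incr (fun j => aS h j x) v i ≤
      ∫⁻ ρ in Ioc (0 : ℝ) 1, incr (fun k => shiftMart N (synth h) k (x, ρ)) u i := by
    intro i
    simp only [incr]
    rw [ha, ha, ← intervalIntegral.integral_sub (intervalIntegrable_of_bdd (hms _) (hbd _) _ _)
      (intervalIntegrable_of_bdd (hms _) (hbd _) _ _), intervalIntegral.integral_of_le zero_le_one]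
    exact enorm_integral_le_lintegral_enorm _
  calc _ ≤ (∫⁻ ρ in Ioc (0 : ℝ) 1,
        lrNorm r k (fun i => incr (fun k => shiftMart N (synth h) k (x, ρ)) u i)) ^ 2 := by
        gcongr
        refine (lrNorm_mono (by linarith) k hi).trans ?_
        exact lrNorm_lintegral_le _ (by linarith) k fun i => (hmi i).aemeasurable
    _ ≤ (volume.restrict (Ioc (0 : ℝ) 1)) univ * ∫⁻ ρ in Ioc (0 : ℝ) 1,
        lrNorm r k (fun i => incr (fun k => shiftMart N (synth h) k (x, ρ)) u i) ^ 2 :=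
        lintegral_sq_le _ (measurable_lrNorm r k hmi).aemeasurable
    _ = ∫⁻ ρ in Ioc (0 : ℝ) 1,
        lrNorm r k (fun i => incr (fun k => shiftMart N (synth h) k (x, ρ)) u i) ^ 2 := by simp
    _ ≤ _ := lintegral_mono fun ρ => lrNorm_sq_le_jumpSum hr hr3 _ hmono hle k

/-- A square-integrable majorant for the `r`-variation of the smooth averages. -/
def avgMaj (r : ℝ) (h : ℝ → ℂ) (x : ℝ) : ℝ≥0∞ :=
  liminf (fun N : ℕ => windowMaj r N (synth h) x) atTop

lemma measurable_avgMaj (r : ℝ) {h : ℝ → ℂ} (hh : Integrable h) : Measurable (avgMaj r h) :=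
  Measurable.liminf fun N => measurable_windowMaj r N (continuous_synth hh)

lemma lintegral_avgMaj_le {r : ℝ} (hr : 2 < r) (hr3 : r < 3) {h : ℝ → ℂ} (hh : Nice h) :
    ∫⁻ x, avgMaj r h x ≤ 5000 * ENNReal.ofReal ((r - 2)⁻¹) * energy h := by
  refine (lintegral_liminf_le fun N => measurable_windowMaj r N (continuous_synth hh.int)).trans ?_
  rw [← energy_synth hh]
  refine liminf_le_of_le (by isBoundedDefault) fun b hb => ?_
  obtain ⟨N, hN⟩ := hb.exists
  exact hN.trans (lintegral_windowMaj_le hr hr3 N (continuous_synth hh.int) (norm_synth_le h))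

/-- Lépingle's inequality for the smooth averages. -/
lemma lrNorm_aS_le {r : ℝ} (hr : 2 < r) (hr3 : r < 3) {h : ℝ → ℂ} (hh : Integrable h)
    {v : ℕ → ℤ} (hv : Antitone v) (k : ℕ) (x : ℝ) :
    lrNorm r k (incr (fun j => aS h j x) v) ^ 2 ≤ avgMaj r h x := by
  have h1 : lrNorm r k (incr (fun j => aS h j x) v) =
      lrNorm r k (incr (fun j => aS h j x) fun i => v (min i k)) :=
    lrNorm_congr fun i hi => by
      simp only [incr]
      rw [min_eq_left hi.le, min_eq_left (Nat.succ_le_of_lt hi)]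
  have hv' : Antitone fun i => v (min i k) := fun i i' hi => hv (min_le_min_right k hi)
  rw [h1]
  refine le_liminf_of_le (by isBoundedDefault) ?_
  filter_upwards [eventually_ge_atTop (max (v 0).natAbs (v k).natAbs)] with N hN
  refine lrNorm_aS_le_windowMaj hr hr3 hh hv' (fun i => ?_) k x
  have h2 := hv (min_le_right i k)
  have h3 := hv (Nat.zero_le (min i k))
  have := max_le_iff.1 hN
  rw [abs_le]
  omega

/-- The unimodular function `e^{iy}`. -/
def cis (y : ℝ) : ℂ := Complex.exp ((y : ℂ) * Complex.I)

lemma norm_cis (y : ℝ) : ‖cis y‖ = 1 := Complex.norm_exp_ofReal_mul_I _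

lemma cis_zero : cis 0 = 1 := by simp [cis]

lemma cis_add (y z : ℝ) : cis (y + z) = cis y * cis z := by
  simp only [cis]; rw [← Complex.exp_add]; congr 1; push_cast; ring

lemma continuous_cis : Continuous cis := by unfold cis; fun_prop

lemma ex_eq_cis (y : ℝ) : ex y = cis (2 * Real.pi * y) := rfl

lemma conj_cis (y : ℝ) : (starRingEnd ℂ) (cis y) = cis (-y) := by
  simp only [cis]; rw [← Complex.exp_conj]; congr 1; simp

lemma hasDerivAt_cis (y : ℝ) : HasDerivAt cis (cis y * Complex.I) y := by
  unfold cis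
  have h1 : HasDerivAt (fun y : ℝ => (y : ℂ) * Complex.I) (1 * Complex.I) y :=
    (Complex.ofRealCLM.hasDerivAt (x := y)).mul_const Complex.I
  simpa using h1.cexp

lemma abs_div_sq_add_le {p M B : ℝ} (hB : 0 < B) (h : B ^ 2 ≤ p ^ 2 + M) (hM : 0 ≤ M) :
    |p / (p ^ 2 + M)| ≤ 1 / B := by
  have h0 : 0 < p ^ 2 + M := lt_of_lt_of_le (by positivity) h
  rw [abs_div, abs_of_pos h0, div_le_div_iff₀ h0 hB, one_mul]
  nlinarith [sq_nonneg (|p| - B), sq_abs p, abs_nonneg p]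

/-- A first derivative test in which the phase derivative is damped near its zeros. -/
lemma norm_integral_cis_le {P P1 P2 : ℝ → ℝ} {η η1 : ℝ → ℂ} {α β M B H D : ℝ} (hαβ : α ≤ β)
    (hP : ∀ t, HasDerivAt P (P1 t) t) (hP1 : ∀ t, HasDerivAt P1 (P2 t) t)
    (hP2 : Continuous P2) (hη : ∀ t, HasDerivAt η (η1 t) t) (hη1 : Continuous η1)
    (hM : 0 ≤ M) (hB : 0 < B) (hPB : ∀ t ∈ Icc α β, B ^ 2 ≤ P1 t ^ 2 + M)
    (hH : ∀ t, ‖η t‖ ≤ H) (hH1 : ∀ t, ‖η1 t‖ ≤ H) (hD : ∀ t ∈ Icc α β, |P2 t| ≤ D) :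
    ‖∫ t in α..β, cis (P t) * (η t * ((P1 t ^ 2 / (P1 t ^ 2 + M) : ℝ) : ℂ))‖ ≤
      2 * H / B + (β - α) * (H / B + H * D / B ^ 2) := by
  have hpos : ∀ t ∈ Icc α β, 0 < P1 t ^ 2 + M := fun t ht => lt_of_lt_of_le (by positivity) (hPB t ht)
  set g : ℝ → ℝ := fun t => P1 t / (P1 t ^ 2 + M) with hg
  set g1 : ℝ → ℝ := fun t => P2 t * (M - P1 t ^ 2) / (P1 t ^ 2 + M) ^ 2 with hg1
  have hcP : Continuous P := continuous_iff_continuousAt.2 fun t => (hP t).continuousAt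
  have hcP1 : Continuous P1 := continuous_iff_continuousAt.2 fun t => (hP1 t).continuousAt
  have hcη : Continuous η := continuous_iff_continuousAt.2 fun t => (hη t).continuousAt
  have hgd : ∀ t ∈ Icc α β, HasDerivAt g (g1 t) t := fun t ht => by
    have h := (hP1 t).div (((hP1 t).pow 2).add_const M) (hpos t ht).ne'
    refine h.congr_deriv ?_
    simp only [hg1]
    congr 1
    norm_num
    ring
  have hgc : ContinuousOn g (Icc α β) := fun t ht => (hgd t ht).continuousAt.continuousWithinAt
  have hg1c : ContinuousOn g1 (Icc α β) :=
    ContinuousOn.div (by fun_prop) (by fun_prop) fun t ht => (pow_pos (hpos t ht) 2).ne'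
  have hgB : ∀ t ∈ Icc α β, |g t| ≤ 1 / B := fun t ht => abs_div_sq_add_le hB (hPB t ht) hM
  have hg1B : ∀ t ∈ Icc α β, |g1 t| ≤ D / B ^ 2 := fun t ht => by
    have h0 := hpos t ht
    have h1 : |M - P1 t ^ 2| ≤ P1 t ^ 2 + M := by
      rw [abs_le]; constructor <;> nlinarith [sq_nonneg (P1 t)]
    simp only [hg1]
    rw [abs_div, abs_mul, abs_of_pos (pow_pos h0 2)]
    calc _ ≤ D * (P1 t ^ 2 + M) / (P1 t ^ 2 + M) ^ 2 := by
          gcongr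
          · exact (abs_nonneg _).trans (hD t ht)
          · exact hD t ht
      _ = D / (P1 t ^ 2 + M) := by field_simp
      _ ≤ _ := by
          gcongr
          · exact (abs_nonneg _).trans (hD t ht)
          · exact hPB t ht
  set U : ℝ → ℂ := fun t => η t * (g t : ℂ) with hU
  set U1 : ℝ → ℂ := fun t => η1 t * (g t : ℂ) + η t * (g1 t : ℂ) with hU1
  have hUd : ∀ t ∈ uIcc α β, HasDerivAt U (U1 t) t := fun t ht => by
    rw [uIcc_of_le hαβ] at ht
    exact (hη t).mul (hgd t ht).ofReal_comp
  have hVd : ∀ t ∈ uIcc α β, HasDerivAt (fun t => cis (P t) * (-Complex.I)) (cis (P t) * (P1 t : ℂ)) t := by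
    intro t _
    have h := ((hasDerivAt_cis (P t)).scomp t (hP t)).mul_const (-Complex.I)
    refine h.congr_deriv ?_
    simp only [Complex.real_smul]
    linear_combination (-(P1 t : ℂ) * cis (P t)) * Complex.I_sq
  have hU1c : ContinuousOn U1 (uIcc α β) := by
    rw [uIcc_of_le hαβ]
    exact (hη1.continuousOn.mul (Complex.continuous_ofReal.comp_continuousOn hgc)).add
      (hcη.continuousOn.mul (Complex.continuous_ofReal.comp_continuousOn hg1c))
  have hparts := intervalIntegral.integral_mul_deriv_eq_deriv_mul hUd hVd
    hU1c.intervalIntegrable ((continuous_cis.comp hcP).mul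
      (Complex.continuous_ofReal.comp hcP1)).continuousOn.intervalIntegrable
  have hlhs : ∫ t in α..β, cis (P t) * (η t * ((P1 t ^ 2 / (P1 t ^ 2 + M) : ℝ) : ℂ)) =
      ∫ t in α..β, U t * (cis (P t) * (P1 t : ℂ)) := by
    refine intervalIntegral.integral_congr fun t _ => ?_
    simp only [hU, hg]
    push_cast
    ring
  have hH0 : 0 ≤ H := (norm_nonneg _).trans (hH 0)
  have hUB : ∀ t ∈ Icc α β, ‖U t * (cis (P t) * (-Complex.I))‖ ≤ H / B := fun t ht => by
    simp only [hU, norm_mul, norm_cis, norm_neg, Complex.norm_I, Complex.norm_real, Real.norm_eq_abs]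
    calc _ ≤ H * (1 / B) * (1 * 1) := by
          gcongr
          · exact hH t
          · exact hgB t ht
      _ = _ := by ring
  have hbdInt : ‖∫ t in α..β, U1 t * (cis (P t) * (-Complex.I))‖ ≤ (H / B + H * D / B ^ 2) * |β - α| := by
    refine intervalIntegral.norm_integral_le_of_norm_le_const fun t ht => ?_
    rw [uIoc_of_le hαβ] at ht
    have ht' : t ∈ Icc α β := ⟨ht.1.le, ht.2⟩
    simp only [hU1, norm_mul, norm_cis, norm_neg, Complex.norm_I, mul_one]
    refine (norm_add_le _ _).trans ?_
    simp only [norm_mul, Complex.norm_real, Real.norm_eq_abs]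
    calc _ ≤ H * (1 / B) + H * (D / B ^ 2) := by
          gcongr
          · exact hH1 t
          · exact hgB t ht'
          · exact hH t
          · exact hg1B t ht'
      _ = _ := by ring
  rw [hlhs, hparts]
  rw [abs_of_nonneg (sub_nonneg.2 hαβ)] at hbdInt
  refine (norm_sub_le _ _).trans ?_
  refine (add_le_add (norm_sub_le _ _) hbdInt).trans ?_
  have h1 := hUB β (right_mem_Icc.2 hαβ)
  have h2 := hUB α (left_mem_Icc.2 hαβ)
  have : 2 * H / B = H / B + H / B := by ring
  rw [this]
  linarith

/-- Amplitudes supported in `1/2 ≤ |t| ≤ 2`. -/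
structure Bump (ψ : ℝ → ℂ) : Prop where
  smooth : ContDiff ℝ 1 ψ
  vanish : ∀ t, ¬(1 / 2 ≤ |t| ∧ |t| ≤ 2) → ψ t = 0

/-- The oscillatory multiplier with amplitude `ψ` and phase `lam t^d - 2πξt`. -/
def osc (ψ : ℝ → ℂ) (d : ℕ) (lam ξ : ℝ) : ℂ := ∫ t, ψ t * (cis (lam * t ^ d) * ex (-(ξ * t)))

namespace Bump

variable {ψ : ℝ → ℂ}

lemma continuous (hψ : Bump ψ) : Continuous ψ := hψ.smooth.continuous

lemma continuous_deriv (hψ : Bump ψ) : Continuous (deriv ψ) :=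
  hψ.smooth.continuous_deriv le_rfl

lemma hasDerivAt (hψ : Bump ψ) (t : ℝ) : HasDerivAt ψ (deriv ψ t) t :=
  (hψ.smooth.differentiable one_ne_zero t).hasDerivAt

lemma hasCompactSupport (hψ : Bump ψ) : HasCompactSupport ψ := by
  refine HasCompactSupport.of_support_subset_isCompact (isCompact_Icc (a := (-2 : ℝ)) (b := 2)) ?_
  intro t ht
  by_contra h
  refine ht (hψ.vanish t fun h2 => h ?_)
  exact abs_le.1 h2.2

lemma exists_bound (hψ : Bump ψ) : ∃ H : ℝ, 0 < H ∧ (∀ t, ‖ψ t‖ ≤ H) ∧ ∀ t, ‖deriv ψ t‖ ≤ H := by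
  obtain ⟨C1, h1⟩ := hψ.hasCompactSupport.exists_bound_of_continuous hψ.continuous
  obtain ⟨C2, h2⟩ := hψ.hasCompactSupport.deriv.exists_bound_of_continuous hψ.continuous_deriv
  refine ⟨max (max C1 C2) 1, by positivity, fun t => ?_, fun t => ?_⟩
  · exact (h1 t).trans ((le_max_left _ _).trans (le_max_left _ _))
  · exact (h2 t).trans ((le_max_right _ _).trans (le_max_left _ _))

lemma integrable_mul (hψ : Bump ψ) {g : ℝ → ℂ} (hg : Continuous g) : Integrable fun t => ψ t * g t :=
  (hψ.continuous.mul hg).integrable_of_hasCompactSupport hψ.hasCompactSupport.mul_right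

lemma integrable (hψ : Bump ψ) : Integrable ψ :=
  hψ.continuous.integrable_of_hasCompactSupport hψ.hasCompactSupport

lemma integral_mul_eq (hψ : Bump ψ) {g : ℝ → ℂ} (hg : Continuous g) :
    ∫ t, ψ t * g t = (∫ t in (1 / 2 : ℝ)..2, ψ t * g t) + ∫ t in (-2 : ℝ)..(-(1 / 2)), ψ t * g t := by
  have hi := hψ.integrable_mul hg
  rw [intervalIntegral.integral_of_le (by norm_num), intervalIntegral.integral_of_le (by norm_num),
    ← integral_Icc_eq_integral_Ioc, ← integral_Icc_eq_integral_Ioc,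
    ← setIntegral_union _ measurableSet_Icc hi.integrableOn hi.integrableOn]
  · symm
    refine setIntegral_eq_integral_of_forall_compl_eq_zero fun t ht => ?_
    rw [hψ.vanish t, zero_mul]
    rintro ⟨h1, h2⟩
    refine ht ?_
    rcases le_abs.1 h1 with h3 | h3
    · exact Or.inl ⟨h3, (abs_le.1 h2).2⟩
    · exact Or.inr ⟨(abs_le.1 h2).1, by linarith⟩
  · rw [Set.disjoint_left]
    rintro t ⟨h1, _⟩ ⟨_, h2⟩
    linarith

lemma norm_integral_mul_le (hψ : Bump ψ) {g : ℝ → ℂ} {A : ℝ}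
    (hA : ∀ t, |t| ≤ 2 → ‖g t‖ ≤ A) : ‖∫ t, ψ t * g t‖ ≤ A * ∫ t, ‖ψ t‖ := by
  rw [← integral_const_mul]
  refine norm_integral_le_of_norm_le (hψ.integrable.norm.const_mul A) (ae_of_all _ fun t => ?_)
  rw [norm_mul, mul_comm]
  by_cases h : 1 / 2 ≤ |t| ∧ |t| ≤ 2
  · gcongr; exact hA t h.2
  · simp [hψ.vanish t h]

lemma norm_osc_le (hψ : Bump ψ) (d : ℕ) (lam ξ : ℝ) : ‖osc ψ d lam ξ‖ ≤ ∫ t, ‖ψ t‖ := by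
  have := hψ.norm_integral_mul_le (g := fun t => cis (lam * t ^ d) * ex (-(ξ * t))) (A := 1)
    (fun t _ => by simp [norm_cis, norm_ex])
  simpa [osc] using this

lemma norm_osc_sub_le (hψ : Bump ψ) (d : ℕ) (lam ξ : ℝ) :
    ‖osc ψ d lam ξ - osc ψ d lam 0‖ ≤ 4 * Real.pi * |ξ| * ∫ t, ‖ψ t‖ := by
  have hc : ∀ ξ : ℝ, Continuous fun t : ℝ => cis (lam * t ^ d) * ex (-(ξ * t)) := fun ξ =>
    (continuous_cis.comp (by fun_prop)).mul (continuous_ex.comp (by fun_prop))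
  have h := hψ.norm_integral_mul_le
    (g := fun t => cis (lam * t ^ d) * ex (-(ξ * t)) - cis (lam * t ^ d) * ex (-(0 * t)))
    (A := 4 * Real.pi * |ξ|) (fun t ht => by
      rw [← mul_sub, norm_mul, norm_cis, one_mul, zero_mul, neg_zero, ex_zero]
      refine (norm_ex_sub_one_le _).trans ?_
      rw [abs_neg, abs_mul]
      have := mul_le_mul_of_nonneg_left ht (abs_nonneg ξ)
      nlinarith [Real.pi_pos])
  rw [osc, osc, ← integral_sub (hψ.integrable_mul (hc ξ)) (hψ.integrable_mul (hc 0))]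
  simpa only [mul_sub] using h

lemma continuous_osc (hψ : Bump ψ) (d : ℕ) : Continuous (Function.uncurry (osc ψ d)) := by
  refine continuous_of_dominated (bound := fun t => ‖ψ t‖)
    (F := fun (z : ℝ × ℝ) t => ψ t * (cis (z.1 * t ^ d) * ex (-(z.2 * t)))) ?_ ?_ ?_ ?_
  · intro z
    exact (hψ.continuous.mul ((continuous_cis.comp (by fun_prop)).mul
      (continuous_ex.comp (by fun_prop)))).aestronglyMeasurable
  · intro z
    exact ae_of_all _ fun t => by simp [norm_cis, norm_ex]
  · exact hψ.integrable.norm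
  · exact ae_of_all _ fun t => continuous_const.mul ((continuous_cis.comp (by fun_prop)).mul
      (continuous_ex.comp (by fun_prop)))

lemma mul_smooth (hψ : Bump ψ) {g : ℝ → ℂ} (hg : ContDiff ℝ 1 g) : Bump fun t => g t * ψ t :=
  ⟨hg.mul hψ.smooth, fun t ht => by simp [hψ.vanish t ht]⟩

lemma deriv_amp (hψ : Bump ψ) (d : ℕ) : Bump fun t => (Complex.I * (t : ℂ) ^ d) * ψ t :=
  hψ.mul_smooth (contDiff_const.mul ((Complex.ofRealCLM.contDiff).pow d))

/-- The dependence on `lam` through the fundamental theorem of calculus. -/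
lemma osc_sub_osc (hψ : Bump ψ) (d : ℕ) (a b ξ : ℝ) :
    osc ψ d b ξ - osc ψ d a ξ =
      ∫ τ in a..b, osc (fun t => (Complex.I * (t : ℂ) ^ d) * ψ t) d τ ξ := by
  have hd : ∀ τ ∈ uIcc a b, HasDerivAt (fun lam => osc ψ d lam ξ)
      (osc (fun t => (Complex.I * (t : ℂ) ^ d) * ψ t) d τ ξ) τ := by
    intro τ _
    have hB := hψ.deriv_amp d
    refine (hasDerivAt_integral_of_dominated_loc_of_deriv_le (s := univ)
      (F := fun (lam t : ℝ) => ψ t * (cis (lam * t ^ d) * ex (-(ξ * t))))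
      (F' := fun (lam t : ℝ) => Complex.I * (t : ℂ) ^ d * ψ t * (cis (lam * t ^ d) * ex (-(ξ * t))))
      (bound := fun t : ℝ => ‖Complex.I * (t : ℂ) ^ d * ψ t‖) univ_mem ?_ ?_ ?_ ?_ ?_ ?_).2
    · exact Eventually.of_forall fun lam => (hψ.continuous.mul ((continuous_cis.comp (by fun_prop)).mul
        (continuous_ex.comp (by fun_prop)))).aestronglyMeasurable
    · exact hψ.integrable_mul ((continuous_cis.comp (by fun_prop)).mul
        (continuous_ex.comp (by fun_prop)))
    · exact (hB.continuous.mul ((continuous_cis.comp (by fun_prop)).mul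
        (continuous_ex.comp (by fun_prop)))).aestronglyMeasurable
    · refine ae_of_all _ fun t lam _ => ?_
      rw [norm_mul, norm_mul (cis _), norm_cis, norm_ex, one_mul, mul_one]
    · exact hB.integrable.norm
    · refine ae_of_all _ fun t lam _ => ?_
      have h := (hasDerivAt_cis (lam * t ^ d)).scomp lam ((hasDerivAt_id lam).mul_const (t ^ d))
      refine ((h.mul_const (ex (-(ξ * t)))).const_mul (ψ t)).congr_deriv ?_
      simp only [one_mul, Complex.real_smul]
      push_cast
      ring
  symm
  refine intervalIntegral.integral_eq_sub_of_hasDerivAt hd ?_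
  exact (((hψ.deriv_amp d).continuous_osc d).comp
    (f := fun τ : ℝ => (τ, ξ)) (by fun_prop)).intervalIntegrable _ _

end Bump

/-- The oscillatory multipliers as convolutions on the physical side. -/
lemma synth_osc {ψ : ℝ → ℂ} (hψ : Bump ψ) (d : ℕ) (lam c : ℝ) {h : ℝ → ℂ} (hh : Integrable h) (x : ℝ) :
    synth (fun ξ => osc ψ d lam (c * ξ) * h ξ) x =
      ∫ t, ψ t * (cis (lam * t ^ d) * synth h (x - c * t)) := by
  simp only [synth, osc]
  have hi : Integrable (Function.uncurry fun ξ t : ℝ =>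
      (ex (ξ * (x - c * t)) * cis (lam * t ^ d)) * (h ξ * ψ t)) (volume.prod volume) := by
    have h1 : Integrable (fun z : ℝ × ℝ => h z.1 * ψ z.2) (volume.prod volume) :=
      hh.mul_prod hψ.integrable
    refine (h1.bdd_mul (c := 1)
      (f := fun z : ℝ × ℝ => ex (z.1 * (x - c * z.2)) * cis (lam * z.2 ^ d)) ?_ ?_)
    · exact ((continuous_ex.comp (by fun_prop)).mul
        (continuous_cis.comp (by fun_prop))).aestronglyMeasurable
    · exact ae_of_all _ fun z => by simp [norm_ex, norm_cis]
  have hs := integral_integral_swap hi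
  calc _ = ∫ ξ, ∫ t, (ex (ξ * (x - c * t)) * cis (lam * t ^ d)) * (h ξ * ψ t) := by
        refine integral_congr_ae (ae_of_all _ fun ξ => ?_)
        simp only
        rw [← integral_mul_const, ← integral_const_mul]
        refine integral_congr_ae (ae_of_all _ fun t => ?_)
        simp only
        rw [mul_sub, sub_eq_add_neg, ex_add, show -(ξ * (c * t)) = -(c * ξ * t) by ring]
        ring
    _ = _ := hs
    _ = _ := by
        refine integral_congr_ae (ae_of_all _ fun t => ?_)
        simp only
        rw [← integral_const_mul, ← integral_const_mul]
        refine integral_congr_ae (ae_of_all _ fun ξ => ?_)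
        simp only
        ring

namespace Bump

variable {ψ : ℝ → ℂ}

lemma norm_osc_le_of_phase (hψ : Bump ψ) (d : ℕ) : ∃ C : ℝ, 0 < C ∧ ∀ K B lam ξ : ℝ, 0 ≤ K → 0 < B →
    (∀ t : ℝ, 1 / 2 ≤ |t| → |t| ≤ 2 → B ≤ |lam * (d * t ^ (d - 1)) - 2 * Real.pi * ξ|) →
    |lam| ≤ K * B → ‖osc ψ d lam ξ‖ * B ≤ C * (1 + K) := by
  obtain ⟨H, hH0, hH, hH1⟩ := hψ.exists_bound
  set D₀ : ℝ := d * ((d - 1 : ℕ) * 2 ^ (d - 1 - 1)) with hD₀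
  have hD0 : 0 ≤ D₀ := by positivity
  refine ⟨2 * (2 * H + 2 * H + 2 * H * D₀), by positivity, fun K B lam ξ hK hB hP hlam => ?_⟩
  set P : ℝ → ℝ := fun t => lam * t ^ d - 2 * Real.pi * ξ * t with hPdef
  set P1 : ℝ → ℝ := fun t => lam * (d * t ^ (d - 1)) - 2 * Real.pi * ξ with hP1def
  set P2 : ℝ → ℝ := fun t => lam * (d * ((d - 1 : ℕ) * t ^ (d - 1 - 1))) with hP2def
  have hPd : ∀ t, HasDerivAt P (P1 t) t := fun t => by
    have := ((hasDerivAt_pow d t).const_mul lam).sub ((hasDerivAt_id t).const_mul (2 * Real.pi * ξ))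
    refine this.congr_deriv ?_
    simp [hP1def]
  have hP1d : ∀ t, HasDerivAt P1 (P2 t) t := fun t => by
    have := (((hasDerivAt_pow (d - 1) t).const_mul (d : ℝ)).const_mul lam).sub_const (2 * Real.pi * ξ)
    simpa [hP1def, hP2def] using this
  have hcis : ∀ t, cis (lam * t ^ d) * ex (-(ξ * t)) = cis (P t) := fun t => by
    rw [ex_eq_cis, ← cis_add]; congr 1; simp only [hPdef]; ring
  have key : ∀ α β : ℝ, α ≤ β → β - α ≤ 2 → (∀ t ∈ Icc α β, 1 / 2 ≤ |t| ∧ |t| ≤ 2) →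
      ‖∫ t in α..β, ψ t * (cis (lam * t ^ d) * ex (-(ξ * t)))‖ * B ≤
        (2 * H + 2 * H + 2 * H * D₀) * (1 + K) := by
    intro α β hαβ hβα ht
    have hP1B : ∀ t ∈ Icc α β, B ≤ |P1 t| := fun t h => hP t (ht t h).1 (ht t h).2
    have h := norm_integral_cis_le (M := 0) (B := B) (H := H) (D := D₀ * |lam|) hαβ hPd hP1d
      (by simp only [hP2def]; fun_prop) hψ.hasDerivAt hψ.continuous_deriv le_rfl hB
      (fun t h => by
        rw [add_zero, ← sq_abs (P1 t)]
        exact pow_le_pow_left₀ hB.le (hP1B t h) 2) hH hH1 (fun t h => by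
        simp only [hP2def, hD₀]
        rw [abs_mul, abs_mul, abs_mul, Nat.abs_cast, Nat.abs_cast, abs_pow, mul_comm]
        gcongr
        exact (ht t h).2)
    have he : ∫ t in α..β, ψ t * (cis (lam * t ^ d) * ex (-(ξ * t))) =
        ∫ t in α..β, cis (P t) * (ψ t * ((P1 t ^ 2 / (P1 t ^ 2 + 0) : ℝ) : ℂ)) := by
      refine intervalIntegral.integral_congr fun t h => ?_
      rw [uIcc_of_le hαβ] at h
      have : P1 t ≠ 0 := fun h0 => by
        have := hP1B t h
        rw [h0, abs_zero] at this
        linarith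
      rw [hcis, add_zero, div_self (pow_ne_zero 2 this)]
      push_cast; ring
    rw [he]
    calc _ ≤ (2 * H / B + (β - α) * (H / B + H * (D₀ * |lam|) / B ^ 2)) * B := by gcongr
      _ ≤ (2 * H / B + 2 * (H / B + H * (D₀ * (K * B)) / B ^ 2)) * B := by gcongr
      _ = 2 * H + 2 * H + 2 * H * D₀ * K := by field_simp; ring
      _ ≤ _ := by
        have h1 : 0 ≤ H * K := by positivity
        have h2 : 0 ≤ H * D₀ := by positivity
        nlinarith
  have e := hψ.integral_mul_eq (g := fun t => cis (lam * t ^ d) * ex (-(ξ * t)))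
    ((continuous_cis.comp (by fun_prop)).mul (continuous_ex.comp (by fun_prop)))
  have k1 := key (1 / 2) 2 (by norm_num) (by norm_num) (fun t h => by
    have : 0 < t := by linarith [h.1]
    rw [abs_of_pos this]; exact h)
  have k2 := key (-2) (-(1 / 2)) (by norm_num) (by norm_num) (fun t h => by
    have : t < 0 := by linarith [h.2]
    rw [abs_of_neg this]; constructor <;> linarith [h.1, h.2])
  rw [osc, e]
  calc _ ≤ _ := mul_le_mul_of_nonneg_right (norm_add_le _ _) hB.le
    _ ≤ _ := by rw [add_mul]; linarith

/-- Pointwise bounds for the oscillatory multipliers. -/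
lemma exists_osc_bound (hψ : Bump ψ) {d : ℕ} (hd : 1 ≤ d) : ∃ C : ℝ, 0 < C ∧
    (∀ lam ξ : ℝ, ‖osc ψ d lam ξ‖ ≤ C) ∧
    (∀ lam ξ : ℝ, ‖osc ψ d lam ξ - osc ψ d lam 0‖ ≤ C * |ξ|) ∧
    (∀ lam ξ : ℝ, d * 2 ^ d * |lam| ≤ |ξ| → ‖osc ψ d lam ξ‖ * |ξ| ≤ C) ∧
    (∀ lam ξ : ℝ, 8 * 2 ^ d * |ξ| ≤ |lam| → ‖osc ψ d lam ξ‖ * |lam| ≤ C) := by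
  obtain ⟨C, hC, hb⟩ := hψ.norm_osc_le_of_phase d
  have hI : 0 ≤ ∫ t, ‖ψ t‖ := by positivity
  have hd' : (1 : ℝ) ≤ d := by exact_mod_cast hd
  have h2d : (1 : ℝ) ≤ 2 ^ d := one_le_pow₀ (by norm_num)
  have hpi := Real.pi_gt_three
  have hpi4 := Real.pi_le_four
  have hdd : (2 : ℝ) ^ d = 2 * 2 ^ (d - 1) := by
    rw [← pow_succ', Nat.sub_add_cancel hd]
  have hJ : 0 ≤ 4 * Real.pi * ∫ t, ‖ψ t‖ := by positivity
  refine ⟨(∫ t, ‖ψ t‖) + 4 * Real.pi * (∫ t, ‖ψ t‖) + 2 * C + C * (1 + 2 ^ d) * 2 ^ d, by positivity,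
    fun lam ξ => ?_, fun lam ξ => ?_, fun lam ξ h => ?_, fun lam ξ h => ?_⟩
  · have := hψ.norm_osc_le d lam ξ
    have : 0 ≤ C * (1 + 2 ^ d) * 2 ^ d := by positivity
    linarith
  · refine (hψ.norm_osc_sub_le d lam ξ).trans ?_
    rw [show 4 * Real.pi * |ξ| * ∫ t, ‖ψ t‖ = (4 * Real.pi * ∫ t, ‖ψ t‖) * |ξ| by ring]
    gcongr
    have : 0 ≤ C * (1 + 2 ^ d) * 2 ^ d := by positivity
    linarith
  · rcases eq_or_ne ξ 0 with rfl | hξ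
    · simp only [abs_zero, mul_zero]; positivity
    · have hξ' : 0 < |ξ| := abs_pos.2 hξ
      have := hb 1 |ξ| lam ξ zero_le_one hξ' (fun t _ ht => ?_) ?_
      · have h1 : 0 ≤ C * (1 + 2 ^ d) * 2 ^ d := by positivity
        linarith
      · have h1 : |lam * (d * t ^ (d - 1))| ≤ |ξ| := by
          rw [abs_mul, abs_mul, Nat.abs_cast, abs_pow]
          calc |lam| * (d * |t| ^ (d - 1)) ≤ |lam| * (d * 2 ^ (d - 1)) := by gcongr
            _ ≤ d * 2 ^ d * |lam| := by
                rw [hdd]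
                have : 0 ≤ |lam| * (d * 2 ^ (d - 1)) := by positivity
                linarith
            _ ≤ _ := h
        have h2 : |2 * Real.pi * ξ| = 2 * Real.pi * |ξ| := by
          rw [abs_mul, abs_of_pos (by positivity)]
        have h3 := abs_sub_abs_le_abs_sub (2 * Real.pi * ξ) (lam * (d * t ^ (d - 1)))
        rw [abs_sub_comm] at h3
        nlinarith
      · rw [one_mul]
        refine le_trans ?_ h
        have : (1 : ℝ) ≤ d * 2 ^ d := by nlinarith
        nlinarith [abs_nonneg lam]
  · rcases eq_or_ne lam 0 with rfl | hlam
    · simp only [abs_zero, mul_zero]; positivity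
    · have hl : 0 < |lam| := abs_pos.2 hlam
      have := hb (2 ^ d) (|lam| / 2 ^ d) lam ξ (by positivity) (by positivity) (fun t ht _ => ?_) ?_
      · have h1 : ‖osc ψ d lam ξ‖ * |lam| ≤ C * (1 + 2 ^ d) * 2 ^ d := by
          rw [← mul_div_assoc, div_le_iff₀ (by positivity)] at this
          exact this
        linarith
      · have h1 : 2 * (|lam| / 2 ^ d) ≤ |lam * (d * t ^ (d - 1))| := by
          rw [abs_mul, abs_mul, Nat.abs_cast, abs_pow]
          calc 2 * (|lam| / 2 ^ d) = |lam| * (1 * (1 / 2) ^ (d - 1)) := by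
                rw [hdd, one_div, inv_pow]; field_simp
            _ ≤ _ := by gcongr
        have h2 : |2 * Real.pi * ξ| = 2 * Real.pi * |ξ| := by
          rw [abs_mul, abs_of_pos (by positivity)]
        have h3 := abs_sub_abs_le_abs_sub (lam * (d * t ^ (d - 1))) (2 * Real.pi * ξ)
        have h4 : 8 * |ξ| ≤ |lam| / 2 ^ d := by
          rw [le_div_iff₀ (by positivity)]; linarith
        have h5 : 2 * Real.pi * |ξ| ≤ 8 * |ξ| := by gcongr; linarith
        linarith
      · rw [mul_div_cancel₀ _ (by positivity)]

end Bump

lemma lintegral_scale {c : ℝ} (hc : 0 < c) (f : ℝ → ℝ≥0∞) :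
    ∫⁻ x, f (c * x) = ENNReal.ofReal c⁻¹ * ∫⁻ x, f x := by
  have h := lintegral_map_equiv (μ := volume) f (Homeomorph.mulLeft₀ c hc.ne').toMeasurableEquiv
  have h2 : (Homeomorph.mulLeft₀ c hc.ne').toMeasurableEquiv = fun x => c * x := rfl
  rw [h2, Real.map_volume_mul_left hc.ne', lintegral_smul_measure, abs_of_pos (inv_pos.2 hc)] at h
  exact h.symm

lemma nice_of_bdd_support {G : ℝ → ℂ} (hm : Measurable G) {H a b : ℝ} (hH : ∀ x, ‖G x‖ ≤ H)
    (hs : ∀ x, x ∉ Icc a b → G x = 0) :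
    Nice G ∧ energy G ≤ ENNReal.ofReal (H ^ 2 * (b - a)) := by
  have hind : G = (Icc a b).indicator G := by
    ext x
    by_cases hx : x ∈ Icc a b
    · rw [indicator_of_mem hx]
    · rw [indicator_of_notMem hx, hs x hx]
  have hL : ∀ p : ℝ≥0∞, MemLp G p := fun p => by
    rw [hind, memLp_indicator_iff_restrict measurableSet_Icc]
    exact MemLp.of_bound hm.aestronglyMeasurable H (ae_of_all _ hH)
  refine ⟨⟨hm.stronglyMeasurable, memLp_one_iff_integrable.1 (hL 1), hL 2⟩, ?_⟩
  have hH0 : 0 ≤ H := (norm_nonneg _).trans (hH 0)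
  unfold energy
  calc ∫⁻ x, ‖G x‖ₑ ^ 2 = ∫⁻ x in Icc a b, ‖G x‖ₑ ^ 2 := by
        rw [← lintegral_indicator measurableSet_Icc]
        refine lintegral_congr fun x => ?_
        by_cases hx : x ∈ Icc a b
        · rw [indicator_of_mem hx]
        · rw [indicator_of_notMem hx, hs x hx]; simp
    _ ≤ ∫⁻ _ in Icc a b, ENNReal.ofReal (H ^ 2) := by
        refine lintegral_mono fun x => ?_
        rw [ENNReal.ofReal_pow hH0, ← ofReal_norm]
        gcongr
        exact hH x
    _ = _ := by
        rw [setLIntegral_const, Real.volume_Icc, ENNReal.ofReal_mul (by positivity)]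

namespace Bump

variable {ψ : ℝ → ℂ}

lemma exists_square_bound_half (hψ : Bump ψ) {d : ℕ} (hd : 1 ≤ d) : ∃ C : ℝ≥0, ∀ ξ : ℝ,
    ∫⁻ lam, ‖∫ t in Ioi (0 : ℝ), ψ t * (cis (lam * t ^ d) * ex (-(ξ * t)))‖ₑ ^ 2 ≤ C := by
  obtain ⟨H, hH0, hH, -⟩ := hψ.exists_bound
  have hd0 : (0 : ℝ) < d := by exact_mod_cast hd
  have hd1 : (1 : ℝ) ≤ d := by exact_mod_cast hd
  set p : ℝ := (d : ℝ)⁻¹ with hp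
  have hp0 : 0 < p := by positivity
  have hp1 : p ≤ 1 := inv_le_one_of_one_le₀ hd1
  set a : ℝ := (1 / 2 : ℝ) ^ d with ha
  set b : ℝ := (2 : ℝ) ^ d with hb
  have ha0 : 0 < a := by positivity
  have hab : a ≤ b := (pow_le_pow_left₀ (by norm_num) (by norm_num) d)
  set A : ℝ := a ^ (p - 1) with hA
  have hA0 : 0 < A := by positivity
  refine ⟨(2 * Real.pi * ((A * H) ^ 2 * (b - a))).toNNReal, fun ξ => ?_⟩
  set G : ℝ → ℂ := (Icc a b).indicator fun x =>
    (p * x ^ (p - 1) : ℝ) • (ψ (x ^ p) * ex (-(ξ * x ^ p))) with hG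
  have hGm : Measurable G := by
    refine Measurable.indicator ?_ measurableSet_Icc
    have h1 : Measurable fun x : ℝ => p * x ^ (p - 1) := by fun_prop
    have h2 : Measurable fun x : ℝ => x ^ p := by fun_prop
    exact h1.smul ((hψ.continuous.measurable.comp h2).mul
      (continuous_ex.measurable.comp (h2.const_mul ξ).neg))
  have hGH : ∀ x, ‖G x‖ ≤ A * H := fun x => by
    by_cases hx : x ∈ Icc a b
    · have hx0 : 0 < x := ha0.trans_le hx.1
      simp only [hG, indicator_of_mem hx, norm_smul, norm_mul, norm_ex, mul_one, Real.norm_eq_abs,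
        abs_of_pos hp0, abs_of_pos (Real.rpow_pos_of_pos hx0 _)]
      have h1 : x ^ (p - 1) ≤ A := Real.rpow_le_rpow_of_nonpos ha0 hx.1 (by linarith)
      calc p * x ^ (p - 1) * ‖ψ (x ^ p)‖ ≤ 1 * A * H := by
            gcongr
            exact hH _
        _ = _ := by ring
    · rw [hG, indicator_of_notMem hx, norm_zero]; positivity
  obtain ⟨hN, hE⟩ := nice_of_bdd_support hGm hGH (fun x hx => by rw [hG, indicator_of_notMem hx])
  have key : ∀ lam : ℝ, ∫ t in Ioi (0 : ℝ), ψ t * (cis (lam * t ^ d) * ex (-(ξ * t))) =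
      synth G ((2 * Real.pi)⁻¹ * lam) := by
    intro lam
    rw [← integral_comp_rpow_Ioi (fun t => ψ t * (cis (lam * t ^ d) * ex (-(ξ * t)))) hp0.ne', synth,
      ← integral_indicator measurableSet_Ioi]
    refine integral_congr_ae (ae_of_all _ fun x => ?_)
    simp only
    by_cases hx0 : x ∈ Ioi (0 : ℝ)
    · have hx0' : 0 < x := hx0
      rw [indicator_of_mem hx0]
      have hxd : (x ^ p) ^ d = x := by
        rw [← Real.rpow_natCast, ← Real.rpow_mul hx0'.le, hp, inv_mul_cancel₀ hd0.ne', Real.rpow_one]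
      have hc : ex (x * ((2 * Real.pi)⁻¹ * lam)) = cis (lam * x) := by
        rw [ex_eq_cis]; congr 1; field_simp
      rw [hc, hxd, abs_of_pos hp0]
      by_cases hx : x ∈ Icc a b
      · simp only [hG, indicator_of_mem hx, Complex.real_smul]; ring
      · rw [hG, indicator_of_notMem hx, hψ.vanish (x ^ p), zero_mul, smul_zero, mul_zero]
        rintro ⟨h1, h2⟩
        rw [abs_of_pos (Real.rpow_pos_of_pos hx0' _)] at h1 h2
        refine hx ⟨?_, ?_⟩
        · rw [← hxd]; exact pow_le_pow_left₀ (by norm_num) h1 d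
        · rw [← hxd]; exact pow_le_pow_left₀ (by positivity) h2 d
    · rw [indicator_of_notMem hx0, hG, indicator_of_notMem, mul_zero]
      exact fun h => hx0 (ha0.trans_le h.1)
  simp_rw [key]
  rw [lintegral_scale (by positivity) (fun y => ‖synth G y‖ₑ ^ 2), inv_inv]
  have := energy_synth hN
  unfold energy at this hE
  rw [this]
  calc _ ≤ ENNReal.ofReal (2 * Real.pi) * ENNReal.ofReal ((A * H) ^ 2 * (b - a)) := by gcongr
    _ = _ := by rw [← ENNReal.ofReal_mul (by positivity)]; rfl

lemma comp_neg (hψ : Bump ψ) : Bump fun t => ψ (-t) :=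
  ⟨hψ.smooth.comp contDiff_neg, fun t ht => hψ.vanish _ (by rwa [abs_neg])⟩

/-- The square integral in `lam` of the oscillatory multipliers is bounded uniformly in `ξ`. -/
lemma exists_square_bound (hψ : Bump ψ) {d : ℕ} (hd : 1 ≤ d) : ∃ C : ℝ≥0, ∀ ξ : ℝ,
    ∫⁻ lam, ‖osc ψ d lam ξ‖ₑ ^ 2 ≤ C := by
  obtain ⟨C₁, h₁⟩ := hψ.exists_square_bound_half hd
  obtain ⟨C₂, h₂⟩ := hψ.comp_neg.exists_square_bound_half hd
  refine ⟨2 * (C₁ + C₂), fun ξ => ?_⟩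
  set I₁ : ℝ → ℂ := fun lam => ∫ t in Ioi (0 : ℝ), ψ t * (cis (lam * t ^ d) * ex (-(ξ * t))) with hI₁
  set I₂ : ℝ → ℂ := fun lam => ∫ t in Ioi (0 : ℝ), ψ (-t) * (cis (lam * t ^ d) * ex (-(-ξ * t))) with hI₂
  have hsplit : ∀ lam, osc ψ d lam ξ = I₁ lam + I₂ ((-1) ^ d * lam) := by
    intro lam
    have hi := hψ.integrable_mul (g := fun t => cis (lam * t ^ d) * ex (-(ξ * t)))
      ((continuous_cis.comp (by fun_prop)).mul (continuous_ex.comp (by fun_prop)))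
    have h := integral_add_compl (measurableSet_Ioi (a := (0 : ℝ))) hi
    rw [osc, ← h, compl_Ioi]
    congr 1
    have h3 := integral_comp_neg_Ioi (0 : ℝ) fun t => ψ t * (cis (lam * t ^ d) * ex (-(ξ * t)))
    rw [neg_zero] at h3
    rw [← h3]
    refine setIntegral_congr_fun measurableSet_Ioi fun t _ => ?_
    rw [neg_pow t d]
    congr 3
    · ring
    · ring
  have hmeas : Measurable I₁ := by
    refine StronglyMeasurable.measurable ?_
    refine StronglyMeasurable.integral_prod_right' (ν := volume.restrict (Ioi (0 : ℝ)))
      (f := fun z : ℝ × ℝ => ψ z.2 * (cis (z.1 * z.2 ^ d) * ex (-(ξ * z.2)))) ?_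
    refine Continuous.stronglyMeasurable ?_
    exact (hψ.continuous.comp continuous_snd).mul ((continuous_cis.comp (by fun_prop)).mul
      (continuous_ex.comp (by fun_prop)))
  have hneg : ∫⁻ lam, ‖I₂ ((-1) ^ d * lam)‖ₑ ^ 2 ≤ C₂ := by
    rcases neg_one_pow_eq_or ℝ d with h | h
    · simp only [h, one_mul]; exact h₂ (-ξ)
    · simp only [h, neg_mul, one_mul]
      rw [lintegral_neg_eq_self (fun lam => ‖I₂ lam‖ₑ ^ 2)]
      exact h₂ (-ξ)
  calc _ ≤ ∫⁻ lam, (2 * ‖I₁ lam‖ₑ ^ 2 + 2 * ‖I₂ ((-1) ^ d * lam)‖ₑ ^ 2) := by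
        refine lintegral_mono fun lam => ?_
        rw [hsplit, ← mul_add]
        calc _ ≤ (‖I₁ lam‖ₑ + ‖I₂ ((-1) ^ d * lam)‖ₑ) ^ 2 := by gcongr; exact enorm_add_le _ _
          _ ≤ _ := ennreal_add_sq_le _ _
    _ = 2 * (∫⁻ lam, ‖I₁ lam‖ₑ ^ 2) + 2 * ∫⁻ lam, ‖I₂ ((-1) ^ d * lam)‖ₑ ^ 2 := by
        rw [lintegral_add_left ((hmeas.enorm.pow_const 2).const_mul 2),
          lintegral_const_mul' _ _ (by norm_num), lintegral_const_mul' _ _ (by norm_num)]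
    _ ≤ 2 * C₁ + 2 * C₂ := by gcongr; exact h₁ ξ
    _ = _ := by push_cast; ring

end Bump

lemma integral_sq_div_le {P1 P2 P3 : ℝ → ℝ} {α β N D E : ℝ} (hαβ : α ≤ β)
    (hP1 : ∀ t, HasDerivAt P1 (P2 t) t) (hP2 : ∀ t, HasDerivAt P2 (P3 t) t) (hP3 : Continuous P3)
    (hN : 0 < N) (hD : ∀ t ∈ Icc α β, |P2 t| ≤ D) (hE : ∀ t ∈ Icc α β, |P3 t| ≤ E) :
    ∫ t in α..β, P2 t ^ 2 * (N ^ 2 / (P1 t ^ 2 + N ^ 2)) ≤ 2 * N * (2 * D + (β - α) * E) := by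
  have hc1 : Continuous P1 := continuous_iff_continuousAt.2 fun t => (hP1 t).continuousAt
  have hc2 : Continuous P2 := continuous_iff_continuousAt.2 fun t => (hP2 t).continuousAt
  have hpos : ∀ t, 0 < P1 t ^ 2 + N ^ 2 := fun t => by positivity
  set v : ℝ → ℝ := fun t => Real.arctan (P1 t / N) with hv
  have hvd : ∀ t, HasDerivAt v (P2 t * N / (P1 t ^ 2 + N ^ 2)) t := fun t => by
    have h := ((hP1 t).div_const N).arctan
    refine h.congr_deriv ?_
    have := (hpos t).ne'
    have : 1 + (P1 t / N) ^ 2 ≠ 0 := by positivity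
    field_simp
    ring
  have hv2 : ∀ t, |v t| ≤ 2 := fun t => by
    have h1 := Real.arctan_lt_pi_div_two (P1 t / N)
    have h2 := Real.neg_pi_div_two_lt_arctan (P1 t / N)
    have := Real.pi_le_four
    rw [abs_le]; constructor <;> simp only [hv] <;> linarith
  have hcv' : Continuous fun t => P2 t * N / (P1 t ^ 2 + N ^ 2) :=
    Continuous.div (by fun_prop) (by fun_prop) fun t => (hpos t).ne'
  have hparts := intervalIntegral.integral_mul_deriv_eq_deriv_mul (a := α) (b := β)
    (u := fun t => N * P2 t) (u' := fun t => N * P3 t) (v := v)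
    (fun t _ => (hP2 t).const_mul N) (fun t _ => hvd t)
    ((hP3.const_mul N).intervalIntegrable _ _) (hcv'.intervalIntegrable _ _)
  have he : ∫ t in α..β, P2 t ^ 2 * (N ^ 2 / (P1 t ^ 2 + N ^ 2)) =
      ∫ t in α..β, N * P2 t * (P2 t * N / (P1 t ^ 2 + N ^ 2)) := by
    congr 1; ext t; ring
  have hbd : ‖∫ t in α..β, N * P3 t * v t‖ ≤ N * E * 2 * |β - α| := by
    refine intervalIntegral.norm_integral_le_of_norm_le_const fun t ht => ?_
    rw [uIoc_of_le hαβ] at ht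
    have h1 := hE t (Ioc_subset_Icc_self ht)
    rw [Real.norm_eq_abs, abs_mul, abs_mul, abs_of_pos hN]
    have h0 : 0 ≤ E := (abs_nonneg _).trans h1
    gcongr
    exact hv2 t
  rw [abs_of_nonneg (sub_nonneg.2 hαβ), Real.norm_eq_abs] at hbd
  have hend : ∀ t ∈ Icc α β, |N * P2 t * v t| ≤ N * D * 2 := fun t ht => by
    have h1 := hD t ht
    rw [abs_mul, abs_mul, abs_of_pos hN]
    have h0 : 0 ≤ D := (abs_nonneg _).trans h1
    gcongr
    exact hv2 t
  have ha := abs_le.1 (hend α (left_mem_Icc.2 hαβ))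
  have hb := abs_le.1 (hend β (right_mem_Icc.2 hαβ))
  rw [he, hparts]
  have := abs_le.1 hbd
  nlinarith [ha.1, hb.2, this.1]

namespace Bump

variable {ψ : ℝ → ℂ}

set_option maxHeartbeats 1600000 in
/-- Decay of the kernels of the composition of two oscillatory averages with different
coefficients. -/
lemma exists_kernel_bound (hψ : Bump ψ) {d : ℕ} (hd : 2 ≤ d) : ∃ C : ℝ, 0 < C ∧
    ∀ q a b s : ℝ, 1 ≤ q → q ^ 3 ≤ a → a ≤ 2 ^ d * q ^ 3 → q ^ 3 ≤ b → b ≤ 2 ^ d * q ^ 3 →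
      |s| ≤ 4 → s ≠ 0 →
      ‖∫ t, ψ t * (cis (a * t ^ d) * (starRingEnd ℂ) (ψ (t - s) * cis (b * (t - s) ^ d)))‖ ≤
        C * (q⁻¹ * (1 + (s ^ 2)⁻¹)) := by
  obtain ⟨n, rfl⟩ := Nat.exists_eq_add_of_le' hd
  obtain ⟨H₀, hH0, hHψ, hHψ'⟩ := hψ.exists_bound
  set H : ℝ := 2 * H₀ ^ 2 with hH
  set A : ℝ := (n + 2) * (n + 1) with hA
  have hA2 : 2 ≤ A := by
    have : (0 : ℝ) ≤ n := Nat.cast_nonneg n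
    nlinarith
  set D₀ : ℝ := A * (2 ^ (n + 2) * 2 * 6 ^ n) with hD₀
  have hD0 : 0 ≤ D₀ := by positivity
  set C₁ : ℝ := 288 * (D₀ + n * D₀) + 4 * (n + 1) ^ 2 with hC₁
  have hC1 : 0 ≤ C₁ := by positivity
  refine ⟨2 * (H * (4 + 2 * D₀) + H * (4 ^ n * C₁)), by positivity,
    fun q a b s hq ha ha' hb hb' hs hs0 => ?_⟩
  have hq0 : 0 < q := by linarith
  have hs2 : 0 < s ^ 2 := by positivity
  set P : ℝ → ℝ := fun t => a * t ^ (n + 2) - b * (t - s) ^ (n + 2) with hP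
  set P1 : ℝ → ℝ := fun t => (n + 2) * (a * t ^ (n + 1) - b * (t - s) ^ (n + 1)) with hP1
  set P2 : ℝ → ℝ := fun t => A * (a * t ^ n - b * (t - s) ^ n) with hP2
  set P3 : ℝ → ℝ := fun t => A * (a * (n * t ^ (n - 1)) - b * (n * (t - s) ^ (n - 1))) with hP3
  have hpow : ∀ (k : ℕ) (t : ℝ), HasDerivAt (fun t : ℝ => (t - s) ^ k) (k * (t - s) ^ (k - 1)) t :=
    fun k t => by
      have := ((hasDerivAt_id t).sub_const s).pow k
      refine this.congr_deriv ?_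
      simp
  have hPd : ∀ t, HasDerivAt P (P1 t) t := fun t => by
    refine (((hasDerivAt_pow (n + 2) t).const_mul a).sub ((hpow (n + 2) t).const_mul b)).congr_deriv ?_
    simp only [hP1, Nat.add_succ_sub_one]
    push_cast; ring
  have hP1d : ∀ t, HasDerivAt P1 (P2 t) t := fun t => by
    refine ((((hasDerivAt_pow (n + 1) t).const_mul a).sub
      ((hpow (n + 1) t).const_mul b)).const_mul ((n : ℝ) + 2)).congr_deriv ?_
    simp only [hP2, Nat.add_succ_sub_one, hA]
    push_cast; ring
  have hP2d : ∀ t, HasDerivAt P2 (P3 t) t := fun t =>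
    (((hasDerivAt_pow n t).const_mul a).sub ((hpow n t).const_mul b)).const_mul A
  have hcP1 : Continuous P1 := by simp only [hP1]; fun_prop
  have hcP : Continuous P := by simp only [hP]; fun_prop
  have hcP2 : Continuous P2 := by simp only [hP2]; fun_prop
  have hcP3 : Continuous P3 := by simp only [hP3]; fun_prop
  have ha0 : 0 ≤ a := le_trans (by positivity) ha
  have hb0 : 0 ≤ b := le_trans (by positivity) hb
  have hts : ∀ t : ℝ, |t| ≤ 2 → |t - s| ≤ 6 := fun t ht => by
    have := abs_sub t s
    linarith
  have hgen : ∀ (k : ℕ) (t : ℝ), k ≤ n → |t| ≤ 2 →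
      |a * t ^ k - b * (t - s) ^ k| ≤ 2 ^ (n + 2) * 2 * 6 ^ n * q ^ 3 := by
    intro k t hk ht
    have h6 : (6 : ℝ) ^ k ≤ 6 ^ n := pow_le_pow_right₀ (by norm_num) hk
    have h1 : |a * t ^ k| ≤ 2 ^ (n + 2) * q ^ 3 * 6 ^ n := by
      rw [abs_mul, abs_pow, abs_of_nonneg ha0]
      have : |t| ^ k ≤ 6 ^ k := pow_le_pow_left₀ (abs_nonneg t) (by linarith) k
      gcongr; linarith
    have h2 : |b * (t - s) ^ k| ≤ 2 ^ (n + 2) * q ^ 3 * 6 ^ n := by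
      rw [abs_mul, abs_pow, abs_of_nonneg hb0]
      have : |t - s| ^ k ≤ 6 ^ k := pow_le_pow_left₀ (abs_nonneg _) (hts t ht) k
      gcongr; linarith
    calc _ ≤ |a * t ^ k| + |b * (t - s) ^ k| := abs_sub _ _
      _ ≤ _ := by linarith
  have hA0 : 0 ≤ A := by linarith
  have hDb : ∀ t : ℝ, |t| ≤ 2 → |P2 t| ≤ D₀ * q ^ 3 := fun t ht => by
    simp only [hP2, hD₀]
    rw [abs_mul, abs_of_nonneg hA0]
    calc _ ≤ A * (2 ^ (n + 2) * 2 * 6 ^ n * q ^ 3) :=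
          mul_le_mul_of_nonneg_left (hgen n t le_rfl ht) hA0
      _ = _ := by ring
  have hEb : ∀ t : ℝ, |t| ≤ 2 → |P3 t| ≤ n * D₀ * q ^ 3 := fun t ht => by
    have : P3 t = A * n * (a * t ^ (n - 1) - b * (t - s) ^ (n - 1)) := by simp only [hP3]; ring
    rw [this, abs_mul, abs_of_nonneg (by positivity)]
    calc _ ≤ A * n * (2 ^ (n + 2) * 2 * 6 ^ n * q ^ 3) := by
          gcongr; exact hgen (n - 1) t (Nat.sub_le _ _) ht
      _ = _ := by simp only [hD₀]; ring
  have hlow : ∀ t : ℝ, 1 / 2 ≤ |t| → |t| ≤ 2 →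
      (q ^ 3 * |s| * (1 / 2) ^ n) ^ 2 ≤ 72 * P2 t ^ 2 + 2 * (n + 1) ^ 2 * P1 t ^ 2 := by
    intro t ht ht'
    have hid : (t - s) * P2 t - (n + 1) * P1 t = -(A * a * s * t ^ n) := by
      simp only [hP1, hP2, hA]; ring
    have h1 : q ^ 3 * |s| * (1 / 2) ^ n ≤ |A * a * s * t ^ n| := by
      rw [abs_mul, abs_mul, abs_mul, abs_pow, abs_of_nonneg hA0, abs_of_nonneg ha0]
      have : q ^ 3 ≤ A * a := by nlinarith
      gcongr
    have h2 : (q ^ 3 * |s| * (1 / 2) ^ n) ^ 2 ≤ ((t - s) * P2 t - (n + 1) * P1 t) ^ 2 := by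
      rw [hid, neg_sq, ← sq_abs (A * a * s * t ^ n)]
      exact pow_le_pow_left₀ (by positivity) h1 2
    have h3 : (t - s) ^ 2 ≤ 36 := by
      rw [← sq_abs]
      exact (pow_le_pow_left₀ (abs_nonneg _) (hts t ht') 2).trans (by norm_num)
    have h4 : (t - s) ^ 2 * P2 t ^ 2 ≤ 36 * P2 t ^ 2 := by gcongr
    have h5 := sq_nonneg ((t - s) * P2 t + (n + 1) * P1 t)
    calc _ ≤ _ := h2
      _ ≤ ((t - s) * P2 t - (n + 1) * P1 t) ^ 2 + ((t - s) * P2 t + (n + 1) * P1 t) ^ 2 := by linarith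
      _ = 2 * ((t - s) ^ 2 * P2 t ^ 2) + 2 * (n + 1) ^ 2 * P1 t ^ 2 := by ring
      _ ≤ _ := by linarith
  set η : ℝ → ℂ := fun t => ψ t * (starRingEnd ℂ) (ψ (t - s)) with hη
  set η1 : ℝ → ℂ := fun t => deriv ψ t * (starRingEnd ℂ) (ψ (t - s)) +
    ψ t * (starRingEnd ℂ) (deriv ψ (t - s)) with hη1
  have hηd : ∀ t, HasDerivAt η (η1 t) t := fun t => by
    have h1 : HasDerivAt (fun t : ℝ => ψ (t - s)) (deriv ψ (t - s)) t :=
      (hψ.hasDerivAt (t - s)).comp_sub_const t s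
    exact (hψ.hasDerivAt t).mul h1.star
  have hcη : Continuous η := continuous_iff_continuousAt.2 fun t => (hηd t).continuousAt
  have hcη1 : Continuous η1 := by
    have h1 := hψ.continuous
    have h2 := hψ.continuous_deriv
    have h3 : Continuous fun t => ψ (t - s) := h1.comp (by fun_prop)
    have h4 : Continuous fun t => deriv ψ (t - s) := h2.comp (by fun_prop)
    exact (h2.mul (Complex.continuous_conj.comp h3)).add (h1.mul (Complex.continuous_conj.comp h4))
  have hηH : ∀ t, ‖η t‖ ≤ H := fun t => by
    simp only [hη, norm_mul, RCLike.norm_conj]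
    have := mul_le_mul (hHψ t) (hHψ (t - s)) (norm_nonneg _) hH0.le
    nlinarith
  have hηderH : ∀ t, ‖η1 t‖ ≤ H := fun t => by
    refine (norm_add_le _ _).trans ?_
    simp only [norm_mul, RCLike.norm_conj]
    have h1 := mul_le_mul (hHψ' t) (hHψ (t - s)) (norm_nonneg _) hH0.le
    have h2 := mul_le_mul (hHψ t) (hHψ' (t - s)) (norm_nonneg _) hH0.le
    nlinarith
  have hpos : ∀ t, 0 < P1 t ^ 2 + (q ^ 2) ^ 2 := fun t => by positivity
  have hH' : 0 ≤ H := by positivity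
  have key : ∀ α β : ℝ, α ≤ β → β - α ≤ 2 → (∀ t ∈ Icc α β, 1 / 2 ≤ |t| ∧ |t| ≤ 2) →
      ‖∫ t in α..β, η t * cis (P t)‖ ≤
        (H * (4 + 2 * D₀) + H * (4 ^ n * C₁)) * (q⁻¹ * (1 + (s ^ 2)⁻¹)) := by
    intro α β hαβ hβα ht
    have hcw : Continuous fun t => P1 t ^ 2 / (P1 t ^ 2 + (q ^ 2) ^ 2) :=
      Continuous.div (by fun_prop) (by fun_prop) fun t => (hpos t).ne'
    have hcw' : Continuous fun t => (q ^ 2) ^ 2 / (P1 t ^ 2 + (q ^ 2) ^ 2) :=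
      Continuous.div (by fun_prop) (by fun_prop) fun t => (hpos t).ne'
    have hcc := continuous_cis.comp hcP
    have hfirst := norm_integral_cis_le (M := (q ^ 2) ^ 2) (B := q ^ 2) (H := H)
      (D := D₀ * q ^ 3) hαβ hPd hP1d hcP2 hηd hcη1 (by positivity) (by positivity)
      (fun t _ => by nlinarith [sq_nonneg (P1 t)]) hηH hηderH (fun t h => hDb t (ht t h).2)
    have hsq := integral_sq_div_le (N := q ^ 2) (D := D₀ * q ^ 3) (E := n * D₀ * q ^ 3) hαβ hP1d hP2d
      hcP3 (by positivity) (fun t h => hDb t (ht t h).2) (fun t h => hEb t (ht t h).2)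
    have hsplit : ∫ t in α..β, η t * cis (P t) =
        (∫ t in α..β, cis (P t) * (η t * ((P1 t ^ 2 / (P1 t ^ 2 + (q ^ 2) ^ 2) : ℝ) : ℂ))) +
        ∫ t in α..β, cis (P t) * (η t * (((q ^ 2) ^ 2 / (P1 t ^ 2 + (q ^ 2) ^ 2) : ℝ) : ℂ)) := by
      rw [← intervalIntegral.integral_add]
      · congr 1; ext t
        rw [← mul_add, ← mul_add, ← Complex.ofReal_add, ← add_div, div_self (hpos t).ne']
        push_cast; ring
      · exact (hcc.mul (hcη.mul (Complex.continuous_ofReal.comp hcw))).intervalIntegrable _ _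
      · exact (hcc.mul (hcη.mul (Complex.continuous_ofReal.comp hcw'))).intervalIntegrable _ _
    set J : ℝ := ∫ t in α..β, (q ^ 2) ^ 2 / (P1 t ^ 2 + (q ^ 2) ^ 2) with hJ
    have hsecond : ‖∫ t in α..β,
        cis (P t) * (η t * (((q ^ 2) ^ 2 / (P1 t ^ 2 + (q ^ 2) ^ 2) : ℝ) : ℂ))‖ ≤ H * J := by
      rw [hJ, ← intervalIntegral.integral_const_mul]
      refine intervalIntegral.norm_integral_le_of_norm_le hαβ (ae_of_all _ fun t _ => ?_)
        ((hcw'.const_mul H).intervalIntegrable _ _)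
      rw [norm_mul, norm_mul, norm_cis, one_mul, Complex.norm_real, Real.norm_eq_abs,
        abs_of_nonneg (by positivity)]
      gcongr
      exact hηH t
    have hJle : (q ^ 3 * |s| * (1 / 2) ^ n) ^ 2 * J ≤ C₁ * q ^ 5 := by
      have h1 : (q ^ 3 * |s| * (1 / 2) ^ n) ^ 2 * J ≤ ∫ t in α..β,
          (72 * (P2 t ^ 2 * ((q ^ 2) ^ 2 / (P1 t ^ 2 + (q ^ 2) ^ 2))) + 2 * (n + 1) ^ 2 * q ^ 4) := by
        rw [hJ, ← intervalIntegral.integral_const_mul]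
        refine intervalIntegral.integral_mono_on hαβ ((hcw'.const_mul _).intervalIntegrable _ _)
          (((((hcP2.pow 2).mul hcw').const_mul _).add continuous_const).intervalIntegrable _ _)
          fun t h => ?_
        have hl := hlow t (ht t h).1 (ht t h).2
        set w := (q ^ 2) ^ 2 / (P1 t ^ 2 + (q ^ 2) ^ 2) with hw
        have hw0 : 0 ≤ w := by positivity
        have hw1 : P1 t ^ 2 * w ≤ q ^ 4 := by
          rw [hw, mul_div_assoc', div_le_iff₀ (hpos t)]
          nlinarith [sq_nonneg (q ^ 4)]
        calc _ ≤ (72 * P2 t ^ 2 + 2 * (n + 1) ^ 2 * P1 t ^ 2) * w := by gcongr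
          _ = 72 * (P2 t ^ 2 * w) + 2 * (n + 1) ^ 2 * (P1 t ^ 2 * w) := by ring
          _ ≤ _ := by gcongr
      have hcm : Continuous fun t => 72 * (P2 t ^ 2 * ((q ^ 2) ^ 2 / (P1 t ^ 2 + (q ^ 2) ^ 2))) :=
        ((hcP2.pow 2).mul hcw').const_mul _
      rw [intervalIntegral.integral_add (hcm.intervalIntegrable _ _)
        (continuous_const.intervalIntegrable _ _), intervalIntegral.integral_const_mul,
        intervalIntegral.integral_const, smul_eq_mul] at h1
      have h2 : (β - α) * (2 * (n + 1) ^ 2 * q ^ 4) ≤ 4 * (n + 1) ^ 2 * q ^ 5 := by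
        have : q ^ 4 ≤ q ^ 5 := pow_le_pow_right₀ hq (by norm_num)
        calc _ ≤ 2 * (2 * ((n : ℝ) + 1) ^ 2 * q ^ 5) := by gcongr
          _ = _ := by ring
      have h3 : 2 * q ^ 2 * (2 * (D₀ * q ^ 3) + (β - α) * (n * D₀ * q ^ 3)) ≤
          4 * (D₀ + n * D₀) * q ^ 5 := by
        calc _ ≤ 2 * q ^ 2 * (2 * (D₀ * q ^ 3) + 2 * (n * D₀ * q ^ 3)) := by gcongr
          _ = _ := by ring
      calc _ ≤ _ := h1
        _ ≤ 72 * (4 * (D₀ + n * D₀) * q ^ 5) + 4 * (n + 1) ^ 2 * q ^ 5 := by gcongr; linarith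
        _ = _ := by rw [hC₁]; ring
    have hJ2 : J ≤ 4 ^ n * C₁ * (q⁻¹ * (s ^ 2)⁻¹) := by
      have h4 : (q ^ 3 * |s| * (1 / 2) ^ n) ^ 2 = q ^ 6 * s ^ 2 * (4 ^ n)⁻¹ := by
        rw [mul_pow, mul_pow, sq_abs, ← pow_mul, ← pow_mul, mul_comm n 2, pow_mul (1 / 2 : ℝ)]
        rw [show ((1 / 2 : ℝ) ^ 2) = 4⁻¹ by norm_num, inv_pow]
      rw [h4] at hJle
      have : J = (q ^ 6 * s ^ 2 * (4 ^ n)⁻¹ * J) * (4 ^ n * ((q ^ 6)⁻¹ * (s ^ 2)⁻¹)) := by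
        field_simp
      rw [this]
      calc _ ≤ (C₁ * q ^ 5) * (4 ^ n * ((q ^ 6)⁻¹ * (s ^ 2)⁻¹)) := by gcongr
        _ = _ := by field_simp
    have hf2 : 2 * H / q ^ 2 + (β - α) * (H / q ^ 2 + H * (D₀ * q ^ 3) / (q ^ 2) ^ 2) ≤
        H * (4 + 2 * D₀) * q⁻¹ := by
      calc _ ≤ 2 * H / q ^ 2 + 2 * (H / q ^ 2 + H * (D₀ * q ^ 3) / (q ^ 2) ^ 2) := by gcongr
        _ = 4 * H * (q ^ 2)⁻¹ + 2 * H * D₀ * q⁻¹ := by field_simp; ring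
        _ ≤ 4 * H * q⁻¹ + 2 * H * D₀ * q⁻¹ := by
            gcongr; nlinarith
        _ = _ := by ring
    rw [hsplit]
    have hx : 0 ≤ H * (4 + 2 * D₀) * (q⁻¹ * (s ^ 2)⁻¹) := by positivity
    have hy : 0 ≤ H * (4 ^ n * C₁) * q⁻¹ := by positivity
    calc _ ≤ _ := norm_add_le _ _
      _ ≤ H * (4 + 2 * D₀) * q⁻¹ + H * (4 ^ n * C₁ * (q⁻¹ * (s ^ 2)⁻¹)) := by
          refine add_le_add (hfirst.trans hf2) (hsecond.trans ?_)
          gcongr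
      _ ≤ _ := by linarith
  have hcs : Continuous fun t => ψ (t - s) := hψ.continuous.comp (by fun_prop)
  have e := hψ.integral_mul_eq (g := fun t => cis (a * t ^ (n + 2)) *
    (starRingEnd ℂ) (ψ (t - s) * cis (b * (t - s) ^ (n + 2))))
    ((continuous_cis.comp (by fun_prop)).mul (Complex.continuous_conj.comp
      (hcs.mul (continuous_cis.comp (by fun_prop)))))
  have hrw : ∀ t, ψ t * (cis (a * t ^ (n + 2)) *
      (starRingEnd ℂ) (ψ (t - s) * cis (b * (t - s) ^ (n + 2)))) = η t * cis (P t) := fun t => by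
    simp only [hη, hP, map_mul, conj_cis, sub_eq_add_neg, cis_add]
    ring
  rw [e]
  simp only [hrw]
  have k1 := key (1 / 2) 2 (by norm_num) (by norm_num) (fun t h => by
    have : 0 < t := by linarith [h.1]
    rw [abs_of_pos this]; exact h)
  have k2 := key (-2) (-(1 / 2)) (by norm_num) (by norm_num) (fun t h => by
    have : t < 0 := by linarith [h.2]
    rw [abs_of_neg this]; constructor <;> linarith [h.1, h.2])
  calc _ ≤ _ := norm_add_le _ _
    _ ≤ _ := by linarith

end Bump

lemma ennreal_two_mul_le_add_sq (a b : ℝ≥0∞) : 2 * a * b ≤ a ^ 2 + b ^ 2 := by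
  rcases le_total a b with h | h
  · obtain ⟨c, rfl⟩ := exists_add_of_le h
    calc 2 * a * (a + c) ≤ 2 * a * (a + c) + c ^ 2 := le_self_add
      _ = _ := by ring
  · obtain ⟨c, rfl⟩ := exists_add_of_le h
    calc 2 * (b + c) * b ≤ 2 * (b + c) * b + c ^ 2 := le_self_add
      _ = _ := by ring

lemma lintegral_lintegral_conv_le {μ : Measure ℝ} [SFinite μ] (hμ : μ ≤ volume) {a w : ℝ → ℝ≥0∞}
    (ha : Measurable a) (hw : Measurable w) (hweven : ∀ s, w (-s) = w s) :
    ∫⁻ x, a x * ∫⁻ x', a x' * w (x - x') ∂μ ∂μ ≤ (∫⁻ s, w s) * ∫⁻ x, a x ^ 2 ∂μ := by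
  have hsub : ∀ x : ℝ, ∫⁻ x', w (x - x') ∂μ ≤ ∫⁻ s, w s := fun x => by
    calc _ ≤ ∫⁻ x', w (x - x') := lintegral_mono' hμ le_rfl
      _ = _ := lintegral_sub_left_eq_self w x
  have hone : ∫⁻ x, ∫⁻ x', a x ^ 2 * w (x - x') ∂μ ∂μ ≤ (∫⁻ s, w s) * ∫⁻ x, a x ^ 2 ∂μ := by
    rw [← lintegral_const_mul _ (ha.pow_const 2)]
    refine lintegral_mono fun x => ?_
    have hwx : Measurable fun x' => w (x - x') := hw.comp (measurable_const.sub measurable_id)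
    rw [lintegral_const_mul _ hwx, mul_comm]
    exact mul_le_mul' (hsub x) le_rfl
  have htwo : ∫⁻ x, ∫⁻ x', a x' ^ 2 * w (x - x') ∂μ ∂μ ≤ (∫⁻ s, w s) * ∫⁻ x, a x ^ 2 ∂μ := by
    rw [lintegral_lintegral_swap]
    · refine le_trans (lintegral_mono fun x => lintegral_mono fun x' => ?_) hone
      rw [← hweven, neg_sub]
    · exact (((ha.comp measurable_snd).pow_const 2).mul
        (hw.comp (measurable_fst.sub measurable_snd))).aemeasurable
  have hm1 : Measurable fun z : ℝ × ℝ => a z.1 ^ 2 * w (z.1 - z.2) :=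
    ((ha.comp measurable_fst).pow_const 2).mul (hw.comp (measurable_fst.sub measurable_snd))
  have hm2 : Measurable fun z : ℝ × ℝ => a z.1 * (a z.2 * w (z.1 - z.2)) :=
    (ha.comp measurable_fst).mul ((ha.comp measurable_snd).mul
      (hw.comp (measurable_fst.sub measurable_snd)))
  have hdouble : 2 * ∫⁻ x, a x * ∫⁻ x', a x' * w (x - x') ∂μ ∂μ ≤
      2 * ((∫⁻ s, w s) * ∫⁻ x, a x ^ 2 ∂μ) := by
    calc _ = ∫⁻ x, ∫⁻ x', 2 * (a x * (a x' * w (x - x'))) ∂μ ∂μ := by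
          rw [← lintegral_const_mul']
          · refine lintegral_congr fun x => ?_
            rw [lintegral_const_mul' _ _ (by norm_num), lintegral_const_mul]
            exact ha.mul (hw.comp (by fun_prop))
          · norm_num
      _ ≤ ∫⁻ x, ∫⁻ x', (a x ^ 2 * w (x - x') + a x' ^ 2 * w (x - x')) ∂μ ∂μ := by
          refine lintegral_mono fun x => lintegral_mono fun x' => ?_
          rw [← add_mul, ← mul_assoc, ← mul_assoc]
          gcongr
          exact ennreal_two_mul_le_add_sq _ _
      _ = (∫⁻ x, ∫⁻ x', a x ^ 2 * w (x - x') ∂μ ∂μ) + ∫⁻ x, ∫⁻ x', a x' ^ 2 * w (x - x') ∂μ ∂μ := by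
          rw [← lintegral_add_left hm1.lintegral_prod_right']
          refine lintegral_congr fun x => ?_
          rw [lintegral_add_left]
          exact (hw.comp (by fun_prop)).const_mul _
      _ ≤ _ := by rw [two_mul]; exact add_le_add hone htwo
  exact (ENNReal.mul_le_mul_iff_right (by norm_num) (by norm_num)).1 hdouble

/-- A `T T*` argument: an integral operator is bounded on `L²` by the `L¹` norm of a convolution
majorant of the kernel of `T T*`. -/
lemma lintegral_kernel_sq_le {μ ρ : Measure ℝ} [IsFiniteMeasure μ] [IsFiniteMeasure ρ]
    (hμ : μ ≤ volume) {k : ℝ → ℝ → ℂ} (hk : StronglyMeasurable (Function.uncurry k)) {H : ℝ}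
    (hH : ∀ x y, ‖k x y‖ ≤ H) {F : ℝ → ℂ} (hF : StronglyMeasurable F) {B : ℝ}
    (hB : ∀ y, ‖F y‖ ≤ B) {w : ℝ → ℝ≥0∞} (hw : Measurable w) (hweven : ∀ s, w (-s) = w s)
    (hkw : ∀ᵐ x ∂μ, ∀ᵐ x' ∂μ, ‖∫ y, k x y * (starRingEnd ℂ) (k x' y) ∂ρ‖ₑ ≤ w (x - x')) :
    ∫⁻ x, ‖∫ y, k x y * F y ∂ρ‖ₑ ^ 2 ∂μ ≤ (∫⁻ s, w s) * ∫⁻ y, ‖F y‖ₑ ^ 2 ∂ρ := by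
  have hH0 : 0 ≤ H := (norm_nonneg _).trans (hH 0 0)
  have hB0 : 0 ≤ B := (norm_nonneg _).trans (hB 0)
  set A : ℝ → ℂ := fun x => ∫ y, k x y * F y ∂ρ with hA
  have hAm : StronglyMeasurable A :=
    (hk.mul (hF.comp_measurable measurable_snd)).integral_prod_right'
  have hcm : Measurable (starRingEnd ℂ : ℂ → ℂ) := Complex.continuous_conj.measurable
  have hAb : ∀ x, ‖A x‖ ≤ H * B * ρ.real univ := fun x => by
    refine norm_integral_le_of_norm_le_const (ae_of_all _ fun y => ?_)
    rw [norm_mul]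
    exact mul_le_mul (hH x y) (hB y) (norm_nonneg _) hH0
  set BA : ℝ := H * B * ρ.real univ with hBA
  have hBA0 : 0 ≤ BA := by positivity
  set Q : ℝ → ℂ := fun y => ∫ x, (starRingEnd ℂ) (A x) * k x y ∂μ with hQ
  have hkm : Measurable (Function.uncurry k) := hk.measurable
  have hk' : Measurable fun z : ℝ × ℝ => k z.2 z.1 := hkm.comp measurable_swap
  have hQm : StronglyMeasurable Q := by
    refine StronglyMeasurable.integral_prod_right'
      (f := fun z : ℝ × ℝ => (starRingEnd ℂ) (A z.2) * k z.2 z.1) ?_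
    exact ((hcm.comp (hAm.measurable.comp measurable_snd)).mul hk').stronglyMeasurable
  have hQb : ∀ y, ‖Q y‖ ≤ BA * H * μ.real univ := fun y => by
    refine norm_integral_le_of_norm_le_const (ae_of_all _ fun x => ?_)
    rw [norm_mul, RCLike.norm_conj]
    exact mul_le_mul (hAb x) (hH x y) (norm_nonneg _) hBA0
  set X : ℝ≥0∞ := ∫⁻ x, ‖A x‖ₑ ^ 2 ∂μ with hX
  set Y : ℝ≥0∞ := ∫⁻ y, ‖Q y‖ₑ ^ 2 ∂ρ with hY
  set E : ℝ≥0∞ := ∫⁻ y, ‖F y‖ₑ ^ 2 ∂ρ with hE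
  have normsq : ∀ (m : Measure ℝ) [IsFiniteMeasure m] (G : ℝ → ℂ) (b : ℝ), StronglyMeasurable G →
      (∀ x, ‖G x‖ ≤ b) → ∫⁻ x, ‖G x‖ₑ ^ 2 ∂m = ‖∫ x, G x * (starRingEnd ℂ) (G x) ∂m‖ₑ := by
    intro m _ G b hG hb
    have hi : Integrable (fun x => ‖G x‖ ^ 2) m := by
      refine Integrable.of_bound (hG.norm.pow 2).aestronglyMeasurable (b ^ 2) (ae_of_all _ fun x => ?_)
      rw [Real.norm_eq_abs, abs_of_nonneg (by positivity)]
      exact pow_le_pow_left₀ (norm_nonneg _) (hb x) 2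
    have h1 : ∫ x, G x * (starRingEnd ℂ) (G x) ∂m = ((∫ x, ‖G x‖ ^ 2 ∂m : ℝ) : ℂ) := by
      rw [← integral_complex_ofReal]
      refine integral_congr_ae (ae_of_all _ fun x => ?_)
      simp only [Complex.mul_conj, Complex.normSq_eq_norm_sq]
    have h0 : 0 ≤ ∫ x, ‖G x‖ ^ 2 ∂m := integral_nonneg fun x => by positivity
    rw [h1, ← ofReal_norm, Complex.norm_real, Real.norm_eq_abs, abs_of_nonneg h0,
      ofReal_integral_eq_lintegral_ofReal hi (ae_of_all _ fun x => by positivity)]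
    refine lintegral_congr fun x => ?_
    rw [ENNReal.ofReal_pow (norm_nonneg _), ofReal_norm]
  have hXle : X ≤ ∫⁻ y, ‖Q y‖ₑ * ‖F y‖ₑ ∂ρ := by
    rw [hX, normsq μ A BA hAm hAb]
    have : ∫ x, A x * (starRingEnd ℂ) (A x) ∂μ = ∫ y, Q y * F y ∂ρ := by
      calc _ = ∫ x, ∫ y, (starRingEnd ℂ) (A x) * k x y * F y ∂ρ ∂μ := by
            refine integral_congr_ae (ae_of_all _ fun x => ?_)
            simp only [mul_assoc]
            rw [integral_const_mul, mul_comm]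
        _ = ∫ y, ∫ x, (starRingEnd ℂ) (A x) * k x y * F y ∂μ ∂ρ := by
            refine integral_integral_swap ?_
            refine Integrable.of_bound (Measurable.aestronglyMeasurable ?_) (BA * H * B)
              (ae_of_all _ fun z => ?_)
            · exact ((hcm.comp (hAm.measurable.comp measurable_fst)).mul hkm).mul
                (hF.measurable.comp measurable_snd)
            · simp only [Function.uncurry, norm_mul, RCLike.norm_conj]
              exact mul_le_mul (mul_le_mul (hAb _) (hH _ _) (norm_nonneg _) hBA0) (hB _)
                (norm_nonneg _) (by positivity)
        _ = _ := by
            refine integral_congr_ae (ae_of_all _ fun y => ?_)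
            simp only
            rw [integral_mul_const]
    rw [this]
    refine (enorm_integral_le_lintegral_enorm _).trans (le_of_eq ?_)
    simp only [enorm_mul]
  have hYle : Y ≤ (∫⁻ s, w s) * X := by
    rw [hY, normsq ρ Q _ hQm hQb]
    set QB := BA * H * μ.real univ
    have hQB0 : 0 ≤ QB := by positivity
    have hconjQ : ∀ y, (starRingEnd ℂ) (Q y) = ∫ x', A x' * (starRingEnd ℂ) (k x' y) ∂μ := fun y => by
      rw [hQ]
      simp only
      rw [← integral_conj]
      simp only [map_mul, Complex.conj_conj]
    have h1 : ∫ y, Q y * (starRingEnd ℂ) (Q y) ∂ρ =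
        ∫ x, (starRingEnd ℂ) (A x) * ∫ y, k x y * (starRingEnd ℂ) (Q y) ∂ρ ∂μ := by
      calc _ = ∫ y, ∫ x, (starRingEnd ℂ) (A x) * k x y * (starRingEnd ℂ) (Q y) ∂μ ∂ρ := by
            refine integral_congr_ae (ae_of_all _ fun y => ?_)
            simp only
            rw [integral_mul_const]
        _ = ∫ x, ∫ y, (starRingEnd ℂ) (A x) * k x y * (starRingEnd ℂ) (Q y) ∂ρ ∂μ := by
            refine integral_integral_swap ?_
            refine Integrable.of_bound (Measurable.aestronglyMeasurable ?_) (BA * H * QB)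
              (ae_of_all _ fun z => ?_)
            · exact ((hcm.comp (hAm.measurable.comp measurable_snd)).mul hk').mul
                (hcm.comp (hQm.measurable.comp measurable_fst))
            · simp only [Function.uncurry, norm_mul, RCLike.norm_conj]
              exact mul_le_mul (mul_le_mul (hAb _) (hH _ _) (norm_nonneg _) hBA0) (hQb _)
                (norm_nonneg _) (by positivity)
        _ = _ := by
            refine integral_congr_ae (ae_of_all _ fun x => ?_)
            simp only [mul_assoc]
            rw [integral_const_mul]
    have h2 : ∀ x, ∫ y, k x y * (starRingEnd ℂ) (Q y) ∂ρ =
        ∫ x', A x' * ∫ y, k x y * (starRingEnd ℂ) (k x' y) ∂ρ ∂μ := by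
      intro x
      simp only [hconjQ]
      calc _ = ∫ y, ∫ x', A x' * (k x y * (starRingEnd ℂ) (k x' y)) ∂μ ∂ρ := by
            refine integral_congr_ae (ae_of_all _ fun y => ?_)
            simp only
            rw [← integral_const_mul]
            refine integral_congr_ae (ae_of_all _ fun x' => ?_)
            simp only
            ring
        _ = ∫ x', ∫ y, A x' * (k x y * (starRingEnd ℂ) (k x' y)) ∂ρ ∂μ := by
            refine integral_integral_swap ?_
            refine Integrable.of_bound (Measurable.aestronglyMeasurable ?_) (BA * (H * H))
              (ae_of_all _ fun z => ?_)
            · exact (hAm.measurable.comp measurable_snd).mul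
                ((hkm.comp (measurable_const.prodMk measurable_fst)).mul (hcm.comp hk'))
            · simp only [Function.uncurry, norm_mul, RCLike.norm_conj]
              exact mul_le_mul (hAb _) (mul_le_mul (hH _ _) (hH _ _) (norm_nonneg _) hH0)
                (by positivity) hBA0
        _ = _ := by
            refine integral_congr_ae (ae_of_all _ fun x' => ?_)
            simp only
            rw [integral_const_mul]
    rw [h1]
    calc _ ≤ ∫⁻ x, ‖A x‖ₑ * ∫⁻ x', ‖A x'‖ₑ * w (x - x') ∂μ ∂μ := by
          refine (enorm_integral_le_lintegral_enorm _).trans (lintegral_mono_ae ?_)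
          filter_upwards [hkw] with x hx
          rw [enorm_mul, RCLike.enorm_conj, h2]
          gcongr
          refine (enorm_integral_le_lintegral_enorm _).trans (lintegral_mono_ae ?_)
          filter_upwards [hx] with x' hx'
          rw [enorm_mul]
          gcongr
      _ ≤ _ := lintegral_lintegral_conv_le hμ hAm.measurable.enorm hw hweven
  have hXtop : X ≠ ∞ := by
    have : X ≤ ∫⁻ _, ENNReal.ofReal (BA ^ 2) ∂μ := by
      refine lintegral_mono fun x => ?_
      rw [ENNReal.ofReal_pow hBA0, ← ofReal_norm]
      gcongr
      exact hAb x
    refine (this.trans_lt ?_).ne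
    rw [lintegral_const]
    exact ENNReal.mul_lt_top ENNReal.ofReal_lt_top (measure_lt_top _ _)
  have hsq : X ^ 2 ≤ ((∫⁻ s, w s) * X) * E := by
    calc X ^ 2 ≤ (∫⁻ y, ‖Q y‖ₑ * ‖F y‖ₑ ∂ρ) ^ 2 := by gcongr
      _ ≤ Y * E := lintegral_mul_sq_le ρ hQm.measurable.enorm.aemeasurable hF.measurable.enorm.aemeasurable
      _ ≤ _ := by gcongr
  rcases eq_or_ne X 0 with h0 | h0
  · rw [h0]; exact zero_le
  · refine (ENNReal.mul_le_mul_iff_right h0 hXtop).1 ?_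
    calc X * X = X ^ 2 := (sq X).symm
      _ ≤ _ := hsq
      _ = _ := by ring

lemma lintegral_le_of_forall_Icc {f : ℝ → ℝ≥0∞} {b : ℝ≥0∞}
    (h : ∀ R : ℝ, ∫⁻ x in Icc (-R) R, f x ≤ b) : ∫⁻ x, f x ≤ b := by
  have hU : (⋃ n : ℕ, Icc (-(n : ℝ)) n) = univ := by
    refine eq_univ_of_forall fun x => mem_iUnion.2 ?_
    obtain ⟨n, hn⟩ := exists_nat_ge |x|
    exact ⟨n, abs_le.1 hn⟩
  have hd : Directed (· ⊆ ·) fun n : ℕ => Icc (-(n : ℝ)) n :=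
    directed_of_isDirected_le fun m n hmn => Icc_subset_Icc (by simpa using hmn) (by simpa using hmn)
  rw [← setLIntegral_univ, ← hU, setLIntegral_iUnion_of_directed _ hd]
  exact iSup_le fun n => h n

namespace Bump

variable {ψ : ℝ → ℂ}

lemma continuous_average (hψ : Bump ψ) (d : ℕ) {F : ℝ → ℂ} (hF : Continuous F) {B : ℝ}
    (hB : ∀ y, ‖F y‖ ≤ B) :
    Continuous fun z : ℝ × ℝ => ∫ t, ψ t * (cis (z.1 * t ^ d) * F (z.2 - t)) := by
  refine continuous_of_dominated (bound := fun t => ‖ψ t‖ * B) ?_ ?_ ?_ ?_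
  · intro z
    exact (hψ.continuous.mul ((continuous_cis.comp (by fun_prop)).mul
      (hF.comp (by fun_prop)))).aestronglyMeasurable
  · intro z
    refine ae_of_all _ fun t => ?_
    rw [norm_mul, norm_mul, norm_cis, one_mul]
    gcongr
    exact hB _
  · exact hψ.integrable.norm.mul_const B
  · refine ae_of_all _ fun t => ?_
    exact continuous_const.mul ((continuous_cis.comp (by fun_prop)).mul (hF.comp (by fun_prop)))

lemma exists_linearized_bound (hψ : Bump ψ) {d : ℕ} (hd : 2 ≤ d) : ∃ C : ℝ≥0, ∀ (p B : ℝ)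
    (lam : ℝ → ℝ) (F : ℝ → ℂ), 1 ≤ p → Measurable lam → (∀ x, p ^ 6 ≤ lam x) →
    (∀ x, lam x ≤ 2 ^ d * p ^ 6) → Continuous F → (∀ y, ‖F y‖ ≤ B) →
    ∫⁻ x, ‖∫ t, ψ t * (cis (lam x * t ^ d) * F (x - t))‖ₑ ^ 2 ≤
      C * ENNReal.ofReal p⁻¹ * energy F := by
  obtain ⟨C₀, hC0, hker⟩ := hψ.exists_kernel_bound hd
  obtain ⟨H, hH0, hH, -⟩ := hψ.exists_bound
  have hI : 0 ≤ ∫ t, ‖ψ t‖ := by positivity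
  set C : ℝ := C₀ + H * ∫ t, ‖ψ t‖ with hC
  have hCpos : 0 < C := by positivity
  refine ⟨(C * 8 + 2 * C * Real.pi).toNNReal, fun p B lam F hp hlm hlam hlam' hF hB => ?_⟩
  have hp0 : 0 < p := by linarith
  set k : ℝ → ℝ → ℂ := fun x y => ψ (x - y) * cis (lam x * (x - y) ^ d) with hk
  have hkm : StronglyMeasurable (Function.uncurry k) := by
    refine Measurable.stronglyMeasurable ?_
    have h1 : Measurable fun z : ℝ × ℝ => z.1 - z.2 := measurable_fst.sub measurable_snd
    exact (hψ.continuous.measurable.comp h1).mul (continuous_cis.measurable.comp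
      ((hlm.comp measurable_fst).mul (h1.pow_const d)))
  have hkH : ∀ x y, ‖k x y‖ ≤ H := fun x y => by
    simp only [hk, norm_mul, norm_cis, mul_one]; exact hH _
  have hkv : ∀ x y : ℝ, 2 < |x - y| → k x y = 0 := fun x y h => by
    simp only [hk]
    rw [hψ.vanish _ (fun h' => absurd h'.2 (not_le.2 h)), zero_mul]
  set w : ℝ → ℝ≥0∞ := fun s => (Icc (-4 : ℝ) 4).indicator (fun _ => ENNReal.ofReal (C * (p ^ 2)⁻¹)) s +
    ENNReal.ofReal (2 * C) * ENNReal.ofReal ((1 + (p * s) ^ 2)⁻¹) with hw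
  have hwm2 : Measurable fun s : ℝ => ENNReal.ofReal ((1 + s ^ 2)⁻¹) := by fun_prop
  have hwm : Measurable w := by
    refine (measurable_const.indicator measurableSet_Icc).add ?_
    fun_prop
  have hweven : ∀ s, w (-s) = w s := fun s => by
    simp only [hw, mul_neg, neg_sq]
    congr 1
    simp only [indicator, mem_Icc]
    congr 1
    rw [neg_le_neg_iff, neg_le, and_comm]
  have hwint : ∫⁻ s, w s ≤ ENNReal.ofReal (C * 8 + 2 * C * Real.pi) * ENNReal.ofReal p⁻¹ := by
    rw [hw, lintegral_add_left (measurable_const.indicator measurableSet_Icc),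
      lintegral_indicator_const measurableSet_Icc, Real.volume_Icc,
      lintegral_const_mul' _ _ ENNReal.ofReal_ne_top,
      lintegral_scale hp0 (fun s => ENNReal.ofReal ((1 + s ^ 2)⁻¹)),
      ← ofReal_integral_eq_lintegral_ofReal integrable_inv_one_add_sq
        (ae_of_all _ fun s => by positivity), integral_univ_inv_one_add_sq,
      ← ENNReal.ofReal_mul (by positivity), ← ENNReal.ofReal_mul (by positivity),
      ← ENNReal.ofReal_mul (by positivity), ← ENNReal.ofReal_mul (by positivity),
      ← ENNReal.ofReal_add (by positivity) (by positivity)]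
    refine ENNReal.ofReal_le_ofReal ?_
    have h1 : (p ^ 2)⁻¹ ≤ p⁻¹ := inv_anti₀ hp0 (by nlinarith)
    calc _ = C * 8 * (p ^ 2)⁻¹ + 2 * C * Real.pi * p⁻¹ := by ring
      _ ≤ C * 8 * p⁻¹ + 2 * C * Real.pi * p⁻¹ := by gcongr
      _ = _ := by ring
  have hkk : ∀ x x' : ℝ, ‖∫ y, k x y * (starRingEnd ℂ) (k x' y)‖ₑ ≤ w (x - x') := by
    intro x x'
    set s := x - x' with hs
    have h1 : ∫ y, k x y * (starRingEnd ℂ) (k x' y) = ∫ t, ψ t * (cis (lam x * t ^ d) *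
        (starRingEnd ℂ) (ψ (t - s) * cis (lam x' * (t - s) ^ d))) := by
      rw [← integral_sub_left_eq_self (fun y => k x y * (starRingEnd ℂ) (k x' y)) volume x]
      refine integral_congr_ae (ae_of_all _ fun t => ?_)
      simp only [hk, hs]
      rw [show x - (x - t) = t by ring, show x' - (x - t) = t - (x - x') by ring, mul_assoc]
    rw [h1]
    set K := ∫ t, ψ t * (cis (lam x * t ^ d) *
        (starRingEnd ℂ) (ψ (t - s) * cis (lam x' * (t - s) ^ d))) with hK
    have htriv : ‖K‖ ≤ C := by
      have := hψ.norm_integral_mul_le (A := H) (g := fun t => cis (lam x * t ^ d) *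
        (starRingEnd ℂ) (ψ (t - s) * cis (lam x' * (t - s) ^ d))) (fun t _ => by
          rw [norm_mul, RCLike.norm_conj, norm_mul, norm_cis, norm_cis, one_mul, mul_one]
          exact hH _)
      exact this.trans (by rw [hC]; linarith)
    by_cases h4 : |s| ≤ 4
    · have hmem : s ∈ Icc (-4 : ℝ) 4 := abs_le.1 h4
      simp only [hw, indicator_of_mem hmem]
      rw [← ENNReal.ofReal_mul (by positivity), ← ENNReal.ofReal_add (by positivity) (by positivity),
        ← ofReal_norm]
      refine ENNReal.ofReal_le_ofReal ?_
      rcases le_or_gt 1 ((p * s) ^ 2) with h5 | h5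
      · have hs0 : s ≠ 0 := by rintro h; rw [h] at h5; norm_num at h5
        have hb := hker (p ^ 2) (lam x) (lam x') s (by nlinarith)
          (by rw [← pow_mul]; exact hlam x) (by rw [← pow_mul]; exact hlam' x)
          (by rw [← pow_mul]; exact hlam x') (by rw [← pow_mul]; exact hlam' x') h4 hs0
        have h6 : ((p * s) ^ 2)⁻¹ ≤ 2 * (1 + (p * s) ^ 2)⁻¹ := by
          rw [← div_eq_mul_inv, inv_eq_one_div, div_le_div_iff₀ (by linarith) (by linarith)]
          linarith
        have hC0C : C₀ ≤ C := by rw [hC]; nlinarith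
        calc ‖K‖ ≤ C₀ * ((p ^ 2)⁻¹ * (1 + (s ^ 2)⁻¹)) := hb
          _ ≤ C * ((p ^ 2)⁻¹ * (1 + (s ^ 2)⁻¹)) := by gcongr
          _ = C * (p ^ 2)⁻¹ + C * ((p * s) ^ 2)⁻¹ := by rw [mul_pow, mul_inv]; ring
          _ ≤ C * (p ^ 2)⁻¹ + C * (2 * (1 + (p * s) ^ 2)⁻¹) := by gcongr
          _ = _ := by ring
      · have h6 : 1 ≤ 2 * (1 + (p * s) ^ 2)⁻¹ := by
          rw [← div_eq_mul_inv, le_div_iff₀ (by positivity)]; linarith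
        have h7 : 0 ≤ C * (p ^ 2)⁻¹ := by positivity
        calc ‖K‖ ≤ C * 1 := by rw [mul_one]; exact htriv
          _ ≤ C * (2 * (1 + (p * s) ^ 2)⁻¹) := by gcongr
          _ ≤ _ := by linarith
    · have hK0 : K = 0 := by
        rw [hK]
        refine integral_eq_zero_of_ae (ae_of_all _ fun t => ?_)
        simp only [Pi.zero_apply]
        by_cases h : |t| ≤ 2
        · have h' : 2 < |t - s| := by
            have := abs_sub_abs_le_abs_sub s t
            rw [abs_sub_comm s t] at this
            push Not at h4
            linarith
          rw [hψ.vanish (t - s) (fun h'' => absurd h''.2 (not_le.2 h'))]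
          simp
        · rw [hψ.vanish t (fun h'' => h h''.2)]; simp
      rw [hK0, enorm_zero]; exact zero_le
  refine lintegral_le_of_forall_Icc fun R => ?_
  set μ : Measure ℝ := volume.restrict (Icc (-R) R) with hμ
  set ρ : Measure ℝ := volume.restrict (Icc (-R - 2) (R + 2)) with hρ
  have hloc : ∀ x ∈ Icc (-R) R, ∀ G : ℝ → ℂ, ∫ y, k x y * G y ∂ρ = ∫ y, k x y * G y := by
    intro x hx G
    refine setIntegral_eq_integral_of_forall_compl_eq_zero fun y hy => ?_
    rw [hkv x y, zero_mul]
    by_contra h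
    refine hy ?_
    have := abs_le.1 (not_lt.1 h)
    constructor <;> linarith [this.1, this.2, hx.1, hx.2]
  have hmain := lintegral_kernel_sq_le (μ := μ) (ρ := ρ) Measure.restrict_le_self hkm hkH
    hF.stronglyMeasurable hB hwm hweven (by
      filter_upwards [ae_restrict_mem measurableSet_Icc] with x hx
      refine ae_of_all _ fun x' => ?_
      rw [hloc x hx]
      exact hkk x x')
  calc _ = ∫⁻ x, ‖∫ y, k x y * F y ∂ρ‖ₑ ^ 2 ∂μ := by
        refine setLIntegral_congr_fun measurableSet_Icc fun x hx => ?_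
        rw [hloc x hx, ← integral_sub_left_eq_self (fun y => k x y * F y) volume x]
        congr 3
        ext t
        simp only [hk]
        rw [show x - (x - t) = t by ring, mul_assoc]
    _ ≤ _ := hmain
    _ ≤ _ := by
      refine mul_le_mul' hwint ?_
      exact setLIntegral_le_lintegral _ _

lemma exists_maximal_bound_unit (hψ : Bump ψ) {d : ℕ} (hd : 2 ≤ d) : ∃ C : ℝ≥0, ∀ (p B : ℝ)
    (F : ℝ → ℂ), 1 ≤ p → Continuous F → (∀ y, ‖F y‖ ≤ B) → ∃ G : ℝ → ℝ≥0∞, Measurable G ∧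
      (∀ lam ∈ Icc (p ^ 6) (2 ^ d * p ^ 6), ∀ x : ℝ,
        ‖∫ t, ψ t * (cis (lam * t ^ d) * F (x - t))‖ₑ ^ 2 ≤ G x) ∧
      ∫⁻ x, G x ≤ C * ENNReal.ofReal p⁻¹ * energy F := by
  obtain ⟨C, hC⟩ := hψ.exists_linearized_bound hd
  refine ⟨C, fun p B F hp hF hB => ?_⟩
  have hp0 : 0 < p := by linarith
  have hle : p ^ 6 ≤ 2 ^ d * p ^ 6 := le_mul_of_one_le_left (by positivity) (one_le_pow₀ (by norm_num))
  have : Nonempty (Icc (p ^ 6) (2 ^ d * p ^ 6)) := ⟨⟨p ^ 6, left_mem_Icc.2 hle⟩⟩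
  set q : ℕ → Icc (p ^ 6) (2 ^ d * p ^ 6) := TopologicalSpace.denseSeq _ with hq
  set A : ℝ → ℝ → ℂ := fun lam x => ∫ t, ψ t * (cis (lam * t ^ d) * F (x - t)) with hA
  have hcA : Continuous fun z : ℝ × ℝ => A z.1 z.2 := hψ.continuous_average d hF hB
  set sel : ℕ → ℝ → ℝ := fun n => Nat.rec (fun _ => (q 0 : ℝ))
    (fun n s x => if ‖A (s x) x‖ₑ < ‖A (q (n + 1)) x‖ₑ then (q (n + 1) : ℝ) else s x) n with hsel
  have hsucc : ∀ n x, sel (n + 1) x =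
      if ‖A (sel n x) x‖ₑ < ‖A (q (n + 1)) x‖ₑ then (q (n + 1) : ℝ) else sel n x := fun n x => rfl
  have hselm : ∀ n, Measurable (sel n) ∧ ∀ x, sel n x ∈ Icc (p ^ 6) (2 ^ d * p ^ 6) := by
    intro n
    induction n with
    | zero => exact ⟨measurable_const, fun x => (q 0).2⟩
    | succ n ih =>
      refine ⟨?_, fun x => ?_⟩
      · have h1 : Measurable fun x => ‖A (sel n x) x‖ₑ :=
          (hcA.measurable.comp (ih.1.prodMk measurable_id)).enorm
        have h2 : Measurable fun x => ‖A (q (n + 1)) x‖ₑ :=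
          (hcA.measurable.comp (measurable_const.prodMk measurable_id)).enorm
        exact Measurable.ite (measurableSet_lt h1 h2) measurable_const ih.1
      · rw [hsucc]
        split_ifs
        · exact (q (n + 1)).2
        · exact ih.2 x
  set g : ℕ → ℝ → ℝ≥0∞ := fun n x => ‖A (sel n x) x‖ₑ ^ 2 with hg
  have hgm : ∀ n, Measurable (g n) := fun n =>
    (hcA.measurable.comp ((hselm n).1.prodMk measurable_id)).enorm.pow_const 2
  have hstep : ∀ n x, ‖A (sel n x) x‖ₑ ≤ ‖A (sel (n + 1) x) x‖ₑ ∧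
      ‖A (q (n + 1)) x‖ₑ ≤ ‖A (sel (n + 1) x) x‖ₑ := fun n x => by
    rw [hsucc]
    split_ifs with h
    · exact ⟨h.le, le_rfl⟩
    · exact ⟨le_rfl, not_lt.1 h⟩
  have hgmono : Monotone g := monotone_nat_of_le_succ fun n x => by
    simp only [hg]
    gcongr
    exact (hstep n x).1
  have hgq : ∀ n x, ‖A (q n) x‖ₑ ^ 2 ≤ g n x := fun n x => by
    cases n with
    | zero => exact le_rfl
    | succ n =>
      simp only [hg]
      gcongr
      exact (hstep n x).2
  refine ⟨fun x => ⨆ n, g n x, .iSup hgm, fun lam hlam x => ?_, ?_⟩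
  · have hdense : DenseRange q := TopologicalSpace.denseRange_denseSeq _
    refine hdense.induction_on (p := fun l : Icc (p ^ 6) (2 ^ d * p ^ 6) =>
      ‖A l x‖ₑ ^ 2 ≤ ⨆ n, g n x) ⟨lam, hlam⟩ ?_ fun n => (hgq n x).trans (le_iSup (fun n => g n x) n)
    have hcx : Continuous fun l : Icc (p ^ 6) (2 ^ d * p ^ 6) => A l x :=
      hcA.comp (f := fun l : Icc (p ^ 6) (2 ^ d * p ^ 6) => ((l : ℝ), x))
        (continuous_subtype_val.prodMk continuous_const)
    exact isClosed_le ((ENNReal.continuous_pow 2).comp hcx.enorm) continuous_const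
  · rw [lintegral_iSup hgm hgmono]
    refine iSup_le fun n => ?_
    exact hC p B (sel n) F hp (hselm n).1 (fun x => ((hselm n).2 x).1) (fun x => ((hselm n).2 x).2) hF hB

/-- The maximal function over one scale of coefficients decays on `L²`. -/
lemma exists_maximal_bound (hψ : Bump ψ) {d : ℕ} (hd : 2 ≤ d) : ∃ C : ℝ≥0, ∀ (p c B : ℝ)
    (F : ℝ → ℂ), 1 ≤ p → 0 < c → Continuous F → (∀ y, ‖F y‖ ≤ B) → ∃ G : ℝ → ℝ≥0∞, Measurable G ∧
      (∀ lam ∈ Icc (p ^ 6) (2 ^ d * p ^ 6), ∀ x : ℝ,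
        ‖∫ t, ψ t * (cis (lam * t ^ d) * F (x - c * t))‖ₑ ^ 2 ≤ G x) ∧
      ∫⁻ x, G x ≤ C * ENNReal.ofReal p⁻¹ * energy F := by
  obtain ⟨C, hC⟩ := hψ.exists_maximal_bound_unit hd
  refine ⟨C, fun p c B F hp hc hF hB => ?_⟩
  obtain ⟨G, hGm, hG, hGi⟩ := hC p B (fun y => F (c * y)) hp (hF.comp (by fun_prop)) (fun y => hB _)
  refine ⟨fun x => G (c⁻¹ * x), hGm.comp (measurable_id.const_mul _), fun lam hlam x => ?_, ?_⟩
  · convert hG lam hlam (c⁻¹ * x) using 8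
    field_simp
  · rw [lintegral_scale (inv_pos.2 hc) G, inv_inv]
    have he : energy (fun y => F (c * y)) = ENNReal.ofReal c⁻¹ * energy F :=
      lintegral_scale hc fun y => ‖F y‖ₑ ^ 2
    rw [he] at hGi
    calc _ ≤ ENNReal.ofReal c * (C * ENNReal.ofReal p⁻¹ * (ENNReal.ofReal c⁻¹ * energy F)) := by gcongr
      _ = (ENNReal.ofReal c * ENNReal.ofReal c⁻¹) * (C * ENNReal.ofReal p⁻¹ * energy F) := by ring
      _ = _ := by
        rw [← ENNReal.ofReal_mul hc.le, mul_inv_cancel₀ hc.ne', ENNReal.ofReal_one, one_mul]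

end Bump

lemma hasSum_int_geometric {ρ : ℝ} (h0 : 0 ≤ ρ) (h1 : ρ < 1) :
    HasSum (fun k : ℤ => ρ ^ k.natAbs) ((1 - ρ)⁻¹ + ρ * (1 - ρ)⁻¹) := by
  refine HasSum.of_nat_of_neg_add_one ?_ ?_
  · simpa using hasSum_geometric_of_lt_one h0 h1
  · have : (fun n : ℕ => ρ ^ (-((n : ℤ) + 1)).natAbs) = fun n : ℕ => ρ * ρ ^ n := by
      ext n
      have : (-((n : ℤ) + 1)).natAbs = n + 1 := by omega
      rw [this, pow_succ, mul_comm]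
    rw [this]
    exact (hasSum_geometric_of_lt_one h0 h1).mul_left ρ

lemma tsum_int_geometric_le {ρ : ℝ} (h0 : 0 ≤ ρ) (h1 : ρ < 1) :
    ∑' k : ℤ, ENNReal.ofReal (ρ ^ k.natAbs) ≤ ENNReal.ofReal (2 / (1 - ρ)) := by
  have h := hasSum_int_geometric h0 h1
  rw [← ENNReal.ofReal_tsum_of_nonneg (fun k => by positivity) h.summable, h.tsum_eq]
  refine ENNReal.ofReal_le_ofReal ?_
  have : 0 < (1 - ρ)⁻¹ := inv_pos.2 (by linarith)
  rw [div_eq_mul_inv]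
  nlinarith

/-- The weight `min(|ξ|, |ξ|⁻¹)^{1/2}`. -/
def wt (ξ : ℝ) : ℝ≥0∞ := ENNReal.ofReal (Real.sqrt (min |ξ| |ξ|⁻¹))

lemma measurable_wt : Measurable wt := by
  unfold wt
  fun_prop

lemma ofReal_le_wt {a c ξ : ℝ} (hc : 0 ≤ c) (h1 : a ^ 2 ≤ c ^ 2 * |ξ|) (h2 : a ^ 2 * |ξ| ≤ c ^ 2) :
    ENNReal.ofReal a ≤ ENNReal.ofReal c * wt ξ := by
  rw [wt, ← ENNReal.ofReal_mul hc]
  refine ENNReal.ofReal_le_ofReal ?_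
  rcases eq_or_ne ξ 0 with rfl | hξ
  · have : a = 0 := by simpa using le_antisymm (by simpa using h1) (sq_nonneg a)
    simp [this]
  · have hp : 0 < |ξ| := abs_pos.2 hξ
    refine (abs_le_of_sq_le_sq' ?_ (by positivity)).2
    rw [mul_pow, Real.sq_sqrt (le_min hp.le (inv_nonneg.2 hp.le))]
    rcases min_choice |ξ| |ξ|⁻¹ with h | h <;> rw [h]
    · exact h1
    · rwa [← div_eq_mul_inv, le_div_iff₀ hp]

lemma wt_le_of_bounds {y : ℝ} {k : ℤ} (h1 : (2 : ℝ) ^ k ≤ |y|) (h2 : |y| < (2 : ℝ) ^ (k + 1)) :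
    wt y ≤ ENNReal.ofReal (2 * (3 / 4 : ℝ) ^ k.natAbs) := by
  refine ENNReal.ofReal_le_ofReal ?_
  have hy : 0 < |y| := lt_of_lt_of_le (by positivity) h1
  rw [Real.sqrt_le_left (by positivity)]
  have hmin : min |y| |y|⁻¹ ≤ 2 * (1 / 2 : ℝ) ^ k.natAbs := by
    rcases le_total 0 k with hk | hk
    · obtain ⟨n, rfl⟩ := Int.eq_ofNat_of_zero_le hk
      refine (min_le_right _ _).trans ?_
      have : |y|⁻¹ ≤ ((2 : ℝ) ^ n)⁻¹ := inv_anti₀ (by positivity) (by simpa using h1)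
      have h3 : ((2 : ℝ) ^ n)⁻¹ = (1 / 2 : ℝ) ^ n := by simp
      rw [h3] at this
      have : (0 : ℝ) < (1 / 2 : ℝ) ^ n := by positivity
      simp only [Int.natAbs_natCast]
      linarith
    · obtain ⟨n, rfl⟩ : ∃ n : ℕ, k = -n := ⟨k.natAbs, by omega⟩
      refine (min_le_left _ _).trans (h2.le.trans (le_of_eq ?_))
      rw [zpow_add₀ (by norm_num), zpow_neg]
      simp [mul_comm]
  refine hmin.trans ?_
  have : (1 / 2 : ℝ) ^ k.natAbs ≤ ((3 / 4 : ℝ) ^ k.natAbs) ^ 2 := by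
    rw [← pow_mul, mul_comm, pow_mul]
    exact pow_le_pow_left₀ (by norm_num) (by norm_num) _
  have : (0 : ℝ) < (1 / 2 : ℝ) ^ k.natAbs := by positivity
  nlinarith

lemma tsum_wt_le (ξ : ℝ) : ∑' j : ℤ, wt ((2 : ℝ) ^ j * ξ) ≤ 16 := by
  rcases eq_or_ne ξ 0 with rfl | hξ
  · simp [wt]
  have hp : 0 < |ξ| := abs_pos.2 hξ
  set n := Int.log 2 |ξ| with hn
  have h1 : (2 : ℝ) ^ n ≤ |ξ| := by exact_mod_cast Int.zpow_log_le_self (b := 2) (by norm_num) hp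
  have h2 : |ξ| < (2 : ℝ) ^ (n + 1) := by
    exact_mod_cast Int.lt_zpow_succ_log_self (b := 2) (by norm_num) |ξ|
  have key : ∀ j : ℤ, wt ((2 : ℝ) ^ j * ξ) ≤
      2 * ENNReal.ofReal ((3 / 4 : ℝ) ^ (Equiv.addRight n j).natAbs) := fun j => by
    have h2j : (0 : ℝ) < 2 ^ j := by positivity
    have := wt_le_of_bounds (y := (2 : ℝ) ^ j * ξ) (k := j + n)
      (by rw [abs_mul, abs_of_pos h2j, zpow_add₀ (by norm_num)]; gcongr)
      (by rw [abs_mul, abs_of_pos h2j, add_assoc, zpow_add₀ (by norm_num)]; gcongr)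
    rwa [ENNReal.ofReal_mul (by norm_num), ENNReal.ofReal_ofNat] at this
  refine (ENNReal.tsum_le_tsum key).trans ?_
  rw [ENNReal.tsum_mul_left,
    (Equiv.addRight n).tsum_eq fun k : ℤ => ENNReal.ofReal ((3 / 4 : ℝ) ^ k.natAbs)]
  calc _ ≤ 2 * ENNReal.ofReal (2 / (1 - 3 / 4)) := by
        gcongr; exact tsum_int_geometric_le (by norm_num) (by norm_num)
    _ = 16 := by
        rw [show (2 / (1 - 3 / 4) : ℝ) = 8 by norm_num]
        norm_num

/-- A bounded measurable family of multipliers `m` with parameter derivative `m'`. -/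
structure MultFam (m m' : ℝ → ℝ → ℂ) : Prop where
  meas : StronglyMeasurable (Function.uncurry m)
  meas' : StronglyMeasurable (Function.uncurry m')
  bdd : ∃ B : ℝ, ∀ a ξ, ‖m a ξ‖ ≤ B
  bdd' : ∃ B : ℝ, ∀ a ξ, ‖m' a ξ‖ ≤ B
  ftc : ∀ a b ξ : ℝ, m b ξ - m a ξ = ∫ τ in a..b, m' τ ξ

namespace MultFam

variable {m m' n n' : ℝ → ℝ → ℂ}

lemma intervalIntegrable (hm : MultFam m m') (a b ξ : ℝ) :
    IntervalIntegrable (fun τ => m' τ ξ) volume a b := by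
  obtain ⟨B, hB⟩ := hm.bdd'
  have h1 : StronglyMeasurable fun τ => m' τ ξ :=
    hm.meas'.comp_measurable (g := fun τ : ℝ => (τ, ξ)) (by fun_prop)
  exact (intervalIntegrable_const (c := B)).mono_fun h1.aestronglyMeasurable
    (ae_of_all _ fun τ => (hB τ ξ).trans (le_abs_self B))

lemma sub (hm : MultFam m m') (hn : MultFam n n') :
    MultFam (fun a ξ => m a ξ - n a ξ) (fun a ξ => m' a ξ - n' a ξ) where
  meas := hm.meas.sub hn.meas
  meas' := hm.meas'.sub hn.meas'
  bdd := by
    obtain ⟨B, hB⟩ := hm.bdd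
    obtain ⟨D, hD⟩ := hn.bdd
    exact ⟨B + D, fun a ξ => (norm_sub_le _ _).trans (add_le_add (hB a ξ) (hD a ξ))⟩
  bdd' := by
    obtain ⟨B, hB⟩ := hm.bdd'
    obtain ⟨D, hD⟩ := hn.bdd'
    exact ⟨B + D, fun a ξ => (norm_sub_le _ _).trans (add_le_add (hB a ξ) (hD a ξ))⟩
  ftc a b ξ := by
    rw [intervalIntegral.integral_sub (hm.intervalIntegrable a b ξ) (hn.intervalIntegrable a b ξ),
      ← hm.ftc, ← hn.ftc]
    ring

lemma mul_left (hm : MultFam m m') {g : ℝ → ℂ} (hg : StronglyMeasurable g) {D : ℝ}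
    (hD : ∀ ξ, ‖g ξ‖ ≤ D) :
    MultFam (fun a ξ => g ξ * m a ξ) (fun a ξ => g ξ * m' a ξ) where
  meas := (hg.comp_measurable measurable_snd).mul hm.meas
  meas' := (hg.comp_measurable measurable_snd).mul hm.meas'
  bdd := by
    obtain ⟨B, hB⟩ := hm.bdd
    refine ⟨D * B, fun a ξ => ?_⟩
    rw [norm_mul]
    exact mul_le_mul (hD ξ) (hB a ξ) (norm_nonneg _) ((norm_nonneg _).trans (hD ξ))
  bdd' := by
    obtain ⟨B, hB⟩ := hm.bdd'
    refine ⟨D * B, fun a ξ => ?_⟩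
    rw [norm_mul]
    exact mul_le_mul (hD ξ) (hB a ξ) (norm_nonneg _) ((norm_nonneg _).trans (hD ξ))
  ftc a b ξ := by
    rw [intervalIntegral.integral_const_mul, ← hm.ftc, mul_sub]

lemma comp (hm : MultFam m m') {g : ℝ → ℝ} (hg : Measurable g) :
    MultFam (fun a ξ => m a (g ξ)) (fun a ξ => m' a (g ξ)) where
  meas := hm.meas.comp_measurable (g := fun z : ℝ × ℝ => (z.1, g z.2)) (by fun_prop)
  meas' := hm.meas'.comp_measurable (g := fun z : ℝ × ℝ => (z.1, g z.2)) (by fun_prop)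
  bdd := hm.bdd.imp fun B hB a ξ => hB a _
  bdd' := hm.bdd'.imp fun B hB a ξ => hB a _
  ftc a b ξ := hm.ftc a b _

lemma sub_initial (hm : MultFam m m') : MultFam (fun a ξ => m a ξ - m 0 ξ) m' where
  meas := by
    refine hm.meas.sub ?_
    exact hm.meas.comp_measurable (g := fun z : ℝ × ℝ => ((0 : ℝ), z.2)) (by fun_prop)
  meas' := hm.meas'
  bdd := by
    obtain ⟨B, hB⟩ := hm.bdd
    exact ⟨B + B, fun a ξ => (norm_sub_le _ _).trans (add_le_add (hB a ξ) (hB 0 ξ))⟩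
  bdd' := hm.bdd'
  ftc a b ξ := by
    rw [← hm.ftc]
    ring

lemma synth_ftc (hm : MultFam m m') {h : ℝ → ℂ} (hh : Nice h) (a b x : ℝ) :
    synth (fun ξ => m b ξ * h ξ) x - synth (fun ξ => m a ξ * h ξ) x =
      ∫ τ in a..b, synth (fun ξ => m' τ ξ * h ξ) x := by
  obtain ⟨B, hB⟩ := hm.bdd
  obtain ⟨D, hD⟩ := hm.bdd'
  have hN : ∀ c, Nice fun ξ => m c ξ * h ξ := fun c => hh.mul
    (hm.meas.comp_measurable (g := fun ξ : ℝ => (c, ξ)) (by fun_prop)) (hB c)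
  have e1 : synth (fun ξ => m b ξ * h ξ) x - synth (fun ξ => m a ξ * h ξ) x =
      ∫ ξ, ∫ τ in a..b, ex (ξ * x) * (m' τ ξ * h ξ) := by
    unfold synth
    rw [← integral_sub (integrable_ex_mul (hN b).int x) (integrable_ex_mul (hN a).int x)]
    refine integral_congr_ae (ae_of_all _ fun ξ => ?_)
    simp only
    rw [intervalIntegral.integral_const_mul, intervalIntegral.integral_mul_const, ← hm.ftc]
    ring
  rw [e1]
  unfold synth
  refine (intervalIntegral_integral_swap ?_).symm
  have hmeas : AEStronglyMeasurable (Function.uncurry fun τ ξ => ex (ξ * x) * (m' τ ξ * h ξ))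
      ((volume.restrict (uIoc a b)).prod volume) := by
    refine StronglyMeasurable.aestronglyMeasurable ?_
    refine StronglyMeasurable.mul (Continuous.stronglyMeasurable ?_) (hm.meas'.mul
      (hh.meas.comp_measurable measurable_snd))
    exact continuous_ex.comp (by fun_prop)
  have hdom : Integrable (fun z : ℝ × ℝ => (1 : ℝ) * (D * ‖h z.2‖))
      ((volume.restrict (uIoc a b)).prod volume) := by
    have : IsFiniteMeasure (volume.restrict (uIoc a b)) := by
      rw [uIoc]; infer_instance
    exact (integrable_const (1 : ℝ)).mul_prod (hh.int.norm.const_mul D)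
  refine hdom.mono' hmeas (ae_of_all _ fun z => ?_)
  simp only [Function.uncurry, norm_mul, norm_ex, one_mul]
  exact mul_le_mul_of_nonneg_right (hD _ _) (norm_nonneg _)

end MultFam

lemma enorm_sub_sq_le_of_ftc {F F' : ℝ → ℂ} (hF' : Measurable F')
    (hftc : ∀ a b, F b - F a = ∫ τ in a..b, F' τ) {L x y : ℝ} (hxy : x ≤ y) (hL : y - x ≤ L) :
    ‖F y - F x‖ₑ ^ 2 ≤ ∫⁻ τ in Ioc x y, ENNReal.ofReal L * ‖F' τ‖ₑ ^ 2 := by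
  rw [hftc, intervalIntegral.integral_of_le hxy, lintegral_const_mul _ (by fun_prop)]
  calc _ ≤ (∫⁻ τ in Ioc x y, ‖F' τ‖ₑ) ^ 2 := by
        gcongr; exact enorm_integral_le_lintegral_enorm _
    _ ≤ _ := lintegral_sq_le _ (by fun_prop)
    _ ≤ _ := by
        rw [Measure.restrict_apply_univ, Real.volume_Ioc]
        gcongr

lemma enorm_sq_le_of_ftc {F F' : ℝ → ℂ} (hF : Measurable F) (hF' : Measurable F')
    (hftc : ∀ a b, F b - F a = ∫ τ in a..b, F' τ) {L a b x : ℝ} (hL : 0 < L) (hb : b = a + L)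
    (hx : x ∈ Ico a b) :
    ‖F x‖ₑ ^ 2 ≤ 2 * ∫⁻ τ in Ico a b,
      (ENNReal.ofReal L⁻¹ * ‖F τ‖ₑ ^ 2 + ENNReal.ofReal L * ‖F' τ‖ₑ ^ 2) := by
  set E : ℝ≥0∞ := ∫⁻ τ in Ico a b, ENNReal.ofReal L * ‖F' τ‖ₑ ^ 2 with hE
  have hpt : ∀ s ∈ Ico a b, ‖F x‖ₑ ^ 2 ≤ 2 * (‖F s‖ₑ ^ 2 + E) := fun s hs => by
    have h1 : ‖F x - F s‖ₑ ^ 2 ≤ E := by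
      rcases le_total s x with h | h
      · refine (enorm_sub_sq_le_of_ftc hF' hftc h (L := L) (by linarith [hs.1, hx.2])).trans ?_
        exact lintegral_mono_set fun t ht => ⟨hs.1.trans ht.1.le, ht.2.trans_lt hx.2⟩
      · rw [enorm_sub_rev]
        refine (enorm_sub_sq_le_of_ftc hF' hftc h (L := L) (by linarith [hx.1, hs.2])).trans ?_
        exact lintegral_mono_set fun t ht => ⟨hx.1.trans ht.1.le, ht.2.trans_lt hs.2⟩
    calc ‖F x‖ₑ ^ 2 = ‖F s + (F x - F s)‖ₑ ^ 2 := by congr 2; ring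
      _ ≤ (‖F s‖ₑ + ‖F x - F s‖ₑ) ^ 2 := by gcongr; exact enorm_add_le _ _
      _ ≤ _ := ennreal_add_sq_le _ _
      _ ≤ _ := by gcongr
  have hvol : ENNReal.ofReal L⁻¹ * volume (Ico a b) = 1 := by
    rw [Real.volume_Ico, ← ENNReal.ofReal_mul (by positivity), hb, add_sub_cancel_left,
      inv_mul_cancel₀ hL.ne', ENNReal.ofReal_one]
  calc ‖F x‖ₑ ^ 2 = ∫⁻ _ in Ico a b, ENNReal.ofReal L⁻¹ * ‖F x‖ₑ ^ 2 := by
        rw [setLIntegral_const, mul_right_comm, hvol, one_mul]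
    _ ≤ ∫⁻ s in Ico a b, (2 * (ENNReal.ofReal L⁻¹ * ‖F s‖ₑ ^ 2) + 2 * (ENNReal.ofReal L⁻¹ * E)) := by
        refine setLIntegral_mono (by fun_prop) fun s hs => ?_
        refine (mul_le_mul_right (hpt s hs) _).trans (le_of_eq ?_)
        ring
    _ = 2 * (∫⁻ s in Ico a b, ENNReal.ofReal L⁻¹ * ‖F s‖ₑ ^ 2) + 2 * E := by
        rw [lintegral_add_left (by fun_prop), lintegral_const_mul _ (by fun_prop),
          setLIntegral_const]
        congr 1
        rw [mul_assoc, mul_right_comm, hvol, one_mul]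
    _ = _ := by
        rw [lintegral_add_left (by fun_prop), mul_add]

/-- The integer `j` with `2^{-dj} ≤ u < 2^{-d(j-1)}`. -/
def scaleIdx (d : ℕ) (u : ℝ) : ℤ := -Int.log (2 ^ d) u

section scaleIdx

variable {d : ℕ}

lemma zpow_neg_scaleIdx_le (hd : 1 ≤ d) {u : ℝ} (hu : 0 < u) :
    ((2 : ℝ) ^ d) ^ (-scaleIdx d u) ≤ u := by
  rw [scaleIdx, neg_neg]
  exact_mod_cast Int.zpow_log_le_self (b := 2 ^ d) (Nat.one_lt_two_pow (by omega)) hu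

lemma lt_zpow_neg_scaleIdx (hd : 1 ≤ d) (u : ℝ) :
    u < ((2 : ℝ) ^ d) ^ (-scaleIdx d u + 1) := by
  rw [scaleIdx, neg_neg]
  exact_mod_cast Int.lt_zpow_succ_log_self (b := 2 ^ d) (Nat.one_lt_two_pow (by omega)) u

lemma scaleIdx_anti {u v : ℝ} (hu : 0 < u) (huv : u ≤ v) : scaleIdx d v ≤ scaleIdx d u :=
  neg_le_neg (Int.log_mono_right hu huv)

lemma mul_zpow_scaleIdx_mem (hd : 1 ≤ d) {u : ℝ} (hu : 0 < u) (m : ℤ) :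
    u * ((2 : ℝ) ^ d) ^ (scaleIdx d u + m) ∈
      Ico (((2 : ℝ) ^ d) ^ m) (((2 : ℝ) ^ d) ^ (m + 1)) := by
  have hp : (0 : ℝ) < ((2 : ℝ) ^ d) ^ (scaleIdx d u + m) := by positivity
  have h0 : ((2 : ℝ) ^ d) ≠ 0 := by positivity
  constructor
  · have := mul_le_mul_of_nonneg_right (zpow_neg_scaleIdx_le hd hu) hp.le
    rwa [← zpow_add₀ h0, neg_add_cancel_left] at this
  · have := mul_lt_mul_of_pos_right (lt_zpow_neg_scaleIdx hd u) hp
    rwa [← zpow_add₀ h0, show -scaleIdx d u + 1 + (scaleIdx d u + m) = m + 1 by ring] at this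

end scaleIdx

lemma tsum_setLIntegral_Ico_le {L : ℝ} (hL : 0 < L) (μ : Measure ℝ) (g : ℝ → ℝ≥0∞) :
    ∑' n : ℤ, ∫⁻ τ in Ico (n * L) ((n + 1) * L), g τ ∂μ = ∫⁻ τ, g τ ∂μ := by
  have h1 := iUnion_Ico_zsmul hL
  have h2 := pairwise_disjoint_Ico_zsmul L
  simp only [zsmul_eq_mul, Int.cast_add, Int.cast_one] at h1 h2
  rw [← lintegral_iUnion (fun n => measurableSet_Ico) h2, h1, Measure.restrict_univ]

lemma lrNorm_two_shift_le {d : ℕ} (hd : 1 ≤ d) {F F' : ℤ → ℝ → ℂ} (hF : ∀ ℓ, Measurable (F ℓ))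
    (hF' : ∀ ℓ, Measurable (F' ℓ)) (hftc : ∀ ℓ a b, F ℓ b - F ℓ a = ∫ τ in a..b, F' ℓ τ)
    {m p q : ℤ} {L : ℝ} (hL : 0 < L) (hp : p * L = ((2 : ℝ) ^ d) ^ m)
    (hq : q * L = ((2 : ℝ) ^ d) ^ (m + 1)) {u : ℕ → ℝ} (hu : Monotone u) (hJ : ∀ i, u i ∈ Ioi 0)
    (k : ℕ) :
    lrNorm 2 k (incr (fun v => F (scaleIdx d v + m) (v * ((2 : ℝ) ^ d) ^ (scaleIdx d v + m))) u) ^ 2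
      ≤ 9 * ∑' ℓ, ∫⁻ τ in Ico (((2 : ℝ) ^ d) ^ m) (((2 : ℝ) ^ d) ^ (m + 1)),
        (ENNReal.ofReal L⁻¹ * ‖F ℓ τ‖ₑ ^ 2 + ENNReal.ofReal L * ‖F' ℓ τ‖ₑ ^ 2) := by
  set D : ℝ := (2 : ℝ) ^ d with hD
  have hD0 : 0 < D := by positivity
  set I : Set ℝ := Ico (D ^ m) (D ^ (m + 1)) with hI
  set pos : ℝ → ℝ := fun v => v * D ^ (scaleIdx d v + m) with hpos
  set c : ℝ → ℤ × ℤ := fun v => (scaleIdx d v + m, ⌊pos v / L⌋) with hcdef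
  set J : ℤ → Set ℝ := fun n => Ico (n * L) ((n + 1) * L) with hJdef
  have hmem : ∀ v ∈ Ioi (0 : ℝ), pos v ∈ I := fun v hv => mul_zpow_scaleIdx_mem hd hv m
  have hmemJ : ∀ v, pos v ∈ J (c v).2 := fun v => by
    constructor
    · have := Int.floor_le (pos v / L)
      rwa [le_div_iff₀ hL] at this
    · have := Int.lt_floor_add_one (pos v / L)
      rwa [div_lt_iff₀ hL] at this
  have hsub : ∀ v ∈ Ioi (0 : ℝ), J (c v).2 ⊆ I := fun v hv => by
    obtain ⟨h1, h2⟩ := hmem v hv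
    rw [← hp] at h1
    rw [← hq] at h2
    have h3 : p ≤ (c v).2 := Int.le_floor.2 ((le_div_iff₀ hL).2 h1)
    have h4 : (c v).2 + 1 ≤ q := Int.floor_lt.2 ((div_lt_iff₀ hL).2 h2)
    have h3' : (p : ℝ) ≤ (c v).2 := by exact_mod_cast h3
    have h4' : ((c v).2 : ℝ) + 1 ≤ q := by exact_mod_cast h4
    rw [hI, ← hp, ← hq]
    exact Ico_subset_Ico (mul_le_mul_of_nonneg_right h3' hL.le)
      (mul_le_mul_of_nonneg_right h4' hL.le)
  have hres : ∀ v ∈ Ioi (0 : ℝ), (volume.restrict I).restrict (J (c v).2) =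
      volume.restrict (J (c v).2) := fun v hv => by
    rw [Measure.restrict_restrict measurableSet_Ico, inter_eq_left.2 (hsub v hv)]
  set g : ℤ → ℝ → ℝ≥0∞ := fun ℓ τ =>
    ENNReal.ofReal L⁻¹ * ‖F ℓ τ‖ₑ ^ 2 + ENNReal.ofReal L * ‖F' ℓ τ‖ₑ ^ 2 with hg
  have key := lrNorm_two_cells_le (F := fun v => F (scaleIdx d v + m) (pos v)) (c := c) hu hJ ?_
    (ν := fun n => ((volume.restrict I).restrict (J n.2)).withDensity
      fun τ => ENNReal.ofReal L * ‖F' n.1 τ‖ₑ ^ 2)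
    (ρ := fun n v => v * D ^ n.1) ?_ ?_
    (B := fun n => 2 * ∫⁻ τ in J n.2, g n.1 τ ∂(volume.restrict I)) ?_ k
  · refine key.trans ?_
    have e1 : ∑' n : ℤ × ℤ, ((volume.restrict I).restrict (J n.2)).withDensity
        (fun τ => ENNReal.ofReal L * ‖F' n.1 τ‖ₑ ^ 2) univ ≤ ∑' ℓ, ∫⁻ τ in I, g ℓ τ := by
      rw [ENNReal.tsum_prod']
      refine ENNReal.tsum_le_tsum fun ℓ => ?_
      rw [← tsum_setLIntegral_Ico_le hL (volume.restrict I) (g ℓ)]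
      refine ENNReal.tsum_le_tsum fun n => ?_
      rw [withDensity_apply _ MeasurableSet.univ, Measure.restrict_univ]
      exact lintegral_mono fun τ => le_add_self
    have e2 : ∑' n : ℤ × ℤ, 2 * ∫⁻ τ in J n.2, g n.1 τ ∂(volume.restrict I) =
        2 * ∑' ℓ, ∫⁻ τ in I, g ℓ τ := by
      rw [ENNReal.tsum_mul_left, ENNReal.tsum_prod']
      congr 2
      ext ℓ
      exact tsum_setLIntegral_Ico_le hL (volume.restrict I) (g ℓ)
    rw [e2]
    refine (add_le_add_left e1 _).trans (le_of_eq ?_)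
    ring
  · intro x hx y hy z hz hxy hyz h
    rw [hcdef] at h ⊢
    simp only [Prod.mk.injEq, add_left_inj] at h ⊢
    have h1 : scaleIdx d x = scaleIdx d y :=
      le_antisymm (h.1.trans_le (scaleIdx_anti hy hyz)) (scaleIdx_anti hx hxy)
    have h2 : scaleIdx d y = scaleIdx d z := h1.symm.trans h.1
    refine ⟨h1, le_antisymm ?_ (?_ : _ ≤ _)⟩
    · refine Int.floor_le_floor ?_
      simp only [hpos, h1]
      gcongr
    · rw [h.2]
      refine Int.floor_le_floor ?_
      simp only [hpos, h2]
      gcongr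
  · intro n x y hxy
    exact mul_le_mul_of_nonneg_right hxy (by positivity)
  · intro x hx y hy hxy hc
    have hc1 : scaleIdx d y + m = (c x).1 := (congrArg Prod.fst hc).symm
    have hle : x * D ^ (c x).1 ≤ y * D ^ (c x).1 :=
      mul_le_mul_of_nonneg_right hxy (by positivity)
    have hy' : y * D ^ (c x).1 = pos y := by simp only [hpos, hc1]
    have hx' : x * D ^ (c x).1 = pos x := rfl
    have h1 := hmemJ x
    have h2 := hmemJ y
    rw [← hc] at h2
    have hsubset : Ioc (x * D ^ (c x).1) (y * D ^ (c x).1) ⊆ J (c x).2 := by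
      rw [hx', hy']
      exact fun t ht => ⟨h1.1.trans ht.1.le, ht.2.trans_lt h2.2⟩
    rw [withDensity_apply _ measurableSet_Ioc, hres x hx,
      Measure.restrict_restrict measurableSet_Ioc, inter_eq_left.2 hsubset]
    have := enorm_sub_sq_le_of_ftc (hF' (c x).1) (hftc (c x).1) (L := L) hle (by
      rw [hx', hy']
      linarith [h1.1, h2.2])
    refine le_of_eq_of_le ?_ this
    rw [hy', hx', hc1]
  · intro x hx
    simp only [hres x hx]
    exact enorm_sq_le_of_ftc (hF (c x).1) (hF' (c x).1) (hftc (c x).1) hL (by ring) (hmemJ x)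

section square

variable {α : Type*} [MeasurableSpace α]

lemma stronglyMeasurable_dilate_mul {m : α → ℝ → ℂ} (hm : StronglyMeasurable (Function.uncurry m))
    {h : ℝ → ℂ} (hh : StronglyMeasurable h) (c : ℝ) :
    StronglyMeasurable (Function.uncurry fun a ξ => m a (c * ξ) * h ξ) :=
  (hm.comp_measurable (g := fun z : α × ℝ => (z.1, c * z.2)) (by fun_prop)).mul
    (hh.comp_measurable measurable_snd)

lemma measurable_synth_dilate {m : α → ℝ → ℂ} (hm : StronglyMeasurable (Function.uncurry m))
    {h : ℝ → ℂ} (hh : StronglyMeasurable h) (c : ℝ) :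
    Measurable fun z : ℝ × α => synth (fun ξ => m z.2 (c * ξ) * h ξ) z.1 :=
  measurable_synth (m := fun a ξ => m a (c * ξ) * h ξ) (stronglyMeasurable_dilate_mul hm hh c)

lemma measurable_synth_dilate_left {m : α → ℝ → ℂ}
    (hm : StronglyMeasurable (Function.uncurry m)) {h : ℝ → ℂ} (hh : StronglyMeasurable h)
    (c x : ℝ) : Measurable fun a : α => synth (fun ξ => m a (c * ξ) * h ξ) x := by
  have := (measurable_synth_dilate hm hh c).comp (measurable_prodMk_left (x := x))
  exact this

lemma measurable_square_dilate (ν : Measure α) [SFinite ν] {m : α → ℝ → ℂ}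
    (hm : StronglyMeasurable (Function.uncurry m)) {h : ℝ → ℂ} (hh : StronglyMeasurable h) (c : ℝ) :
    Measurable fun x => ∫⁻ a, ‖synth (fun ξ => m a (c * ξ) * h ξ) x‖ₑ ^ 2 ∂ν :=
  Measurable.lintegral_prod_right' (f := fun z : ℝ × α =>
    ‖synth (fun ξ => m z.2 (c * ξ) * h ξ) z.1‖ₑ ^ 2)
    ((measurable_synth_dilate hm hh c).enorm.pow_const 2)

lemma lintegral_tsum_square_le (ν : Measure α) [SFinite ν] {m : α → ℝ → ℂ}
    (hm : StronglyMeasurable (Function.uncurry m)) {B : ℝ} (hB : ∀ a ξ, ‖m a ξ‖ ≤ B) {K : ℝ≥0∞}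
    {s : ℝ} (hK : ∀ ξ, ∫⁻ a, ‖m a ξ‖ₑ ^ 2 ∂ν ≤ K * wt (s * ξ)) {h : ℝ → ℂ} (hh : Nice h) :
    ∫⁻ x, ∑' ℓ : ℤ, ∫⁻ a, ‖synth (fun ξ => m a ((2 : ℝ) ^ ℓ * ξ) * h ξ) x‖ₑ ^ 2 ∂ν ≤
      16 * K * energy h := by
  rw [lintegral_tsum fun ℓ => (measurable_square_dilate ν hm hh.meas _).aemeasurable]
  have hmeas : Measurable fun ξ => ‖h ξ‖ₑ ^ 2 := hh.meas.measurable.enorm.pow_const 2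
  have hw : ∀ ℓ : ℤ, Measurable fun ξ : ℝ => K * wt ((2 : ℝ) ^ ℓ * (s * ξ)) * ‖h ξ‖ₑ ^ 2 := by
    intro ℓ
    have : Measurable fun ξ : ℝ => wt ((2 : ℝ) ^ ℓ * (s * ξ)) := measurable_wt.comp (by fun_prop)
    exact (this.const_mul K).mul hmeas
  calc ∑' ℓ : ℤ, ∫⁻ x, ∫⁻ a, ‖synth (fun ξ => m a ((2 : ℝ) ^ ℓ * ξ) * h ξ) x‖ₑ ^ 2 ∂ν
      ≤ ∑' ℓ : ℤ, ∫⁻ ξ, K * wt ((2 : ℝ) ^ ℓ * (s * ξ)) * ‖h ξ‖ₑ ^ 2 := by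
        refine ENNReal.tsum_le_tsum fun ℓ => ?_
        refine lintegral_square_synth_le ν (m := fun a ξ => m a ((2 : ℝ) ^ ℓ * ξ)) ?_ hh
          (fun a ξ => hB a _) fun ξ => ?_
        · exact hm.comp_measurable (g := fun z : α × ℝ => (z.1, (2 : ℝ) ^ ℓ * z.2)) (by fun_prop)
        · refine (hK _).trans (le_of_eq ?_)
          congr 2
          ring
    _ = ∫⁻ ξ, ∑' ℓ : ℤ, K * wt ((2 : ℝ) ^ ℓ * (s * ξ)) * ‖h ξ‖ₑ ^ 2 :=
        (lintegral_tsum fun ℓ => (hw ℓ).aemeasurable).symm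
    _ ≤ ∫⁻ ξ, 16 * K * ‖h ξ‖ₑ ^ 2 := by
        refine lintegral_mono fun ξ => ?_
        simp only
        rw [ENNReal.tsum_mul_right, ENNReal.tsum_mul_left, mul_comm 16 K]
        gcongr
        exact tsum_wt_le _
    _ = _ := lintegral_const_mul _ hmeas

end square

/-- The part of the truncated sum over scales at distance `M` from the critical scale of `u`. -/
def shiftPiece (m : ℝ → ℝ → ℂ) (ℓ₀ : ℤ) (d : ℕ) (M : ℤ) (h : ℝ → ℂ) (u x : ℝ) : ℂ :=
  if ℓ₀ ≤ scaleIdx d u + M then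
    synth (fun ξ => m (u * ((2 : ℝ) ^ d) ^ (scaleIdx d u + M)) ((2 : ℝ) ^ (scaleIdx d u + M) * ξ) *
      h ξ) x
  else 0

lemma MultFam.exists_shift_bound {m m' : ℝ → ℝ → ℂ} (hm : MultFam m m') {d : ℕ} (hd : 1 ≤ d)
    {M p q : ℤ} {L : ℝ} (hL : 0 < L) (hp : p * L = ((2 : ℝ) ^ d) ^ M)
    (hq : q * L = ((2 : ℝ) ^ d) ^ (M + 1)) {K K' : ℝ≥0∞} {s : ℝ}
    (hK : ∀ ξ, ∫⁻ τ in Ico (((2 : ℝ) ^ d) ^ M) (((2 : ℝ) ^ d) ^ (M + 1)), ‖m τ ξ‖ₑ ^ 2 ≤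
      K * wt (s * ξ))
    (hK' : ∀ ξ, ∫⁻ τ in Ico (((2 : ℝ) ^ d) ^ M) (((2 : ℝ) ^ d) ^ (M + 1)), ‖m' τ ξ‖ₑ ^ 2 ≤
      K' * wt (s * ξ)) {h : ℝ → ℂ} (hh : Nice h) (ℓ₀ : ℤ) :
    ∃ G : ℝ → ℝ≥0∞, Measurable G ∧
      (∀ (x : ℝ) (u : ℕ → ℝ), Monotone u → (∀ i, u i ∈ Ioi 0) → ∀ k,
        lrNorm 2 k (incr (fun v => shiftPiece m ℓ₀ d M h v x) u) ^ 2 ≤ G x) ∧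
      ∫⁻ x, G x ≤ 144 * (ENNReal.ofReal L⁻¹ * K + ENNReal.ofReal L * K') * energy h := by
  set I : Set ℝ := Ico (((2 : ℝ) ^ d) ^ M) (((2 : ℝ) ^ d) ^ (M + 1)) with hI
  set S : (ℝ → ℝ → ℂ) → ℝ → ℝ≥0∞ := fun n x =>
    ∑' ℓ : ℤ, ∫⁻ τ in I, ‖synth (fun ξ => n τ ((2 : ℝ) ^ ℓ * ξ) * h ξ) x‖ₑ ^ 2 with hS
  have hSm : Measurable (S m) :=
    Measurable.tsum fun ℓ => measurable_square_dilate _ hm.meas hh.meas _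
  have hSm' : Measurable (S m') :=
    Measurable.tsum fun ℓ => measurable_square_dilate _ hm.meas' hh.meas _
  refine ⟨fun x => 9 * (ENNReal.ofReal L⁻¹ * S m x + ENNReal.ofReal L * S m' x), by fun_prop, ?_, ?_⟩
  · intro x u hu hJ k
    set F : ℤ → ℝ → ℂ := fun ℓ τ =>
      if ℓ₀ ≤ ℓ then synth (fun ξ => m τ ((2 : ℝ) ^ ℓ * ξ) * h ξ) x else 0 with hF
    set F' : ℤ → ℝ → ℂ := fun ℓ τ =>
      if ℓ₀ ≤ ℓ then synth (fun ξ => m' τ ((2 : ℝ) ^ ℓ * ξ) * h ξ) x else 0 with hF'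
    have hFm : ∀ ℓ : ℤ, Measurable fun τ => synth (fun ξ => m τ ((2 : ℝ) ^ ℓ * ξ) * h ξ) x :=
      fun ℓ => measurable_synth_dilate_left hm.meas hh.meas _ x
    have hFm' : ∀ ℓ : ℤ, Measurable fun τ => synth (fun ξ => m' τ ((2 : ℝ) ^ ℓ * ξ) * h ξ) x :=
      fun ℓ => measurable_synth_dilate_left hm.meas' hh.meas _ x
    have h1 : ∀ ℓ, Measurable (F ℓ) := by
      intro ℓ
      simp only [hF]
      split_ifs
      · exact hFm ℓ
      · exact measurable_const
    have h2 : ∀ ℓ, Measurable (F' ℓ) := by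
      intro ℓ
      simp only [hF']
      split_ifs
      · exact hFm' ℓ
      · exact measurable_const
    have h3 : ∀ (ℓ : ℤ) (a b : ℝ), F ℓ b - F ℓ a = ∫ τ in a..b, F' ℓ τ := by
      intro ℓ a b
      simp only [hF, hF']
      split_ifs
      · exact (hm.comp (g := fun ξ => (2 : ℝ) ^ ℓ * ξ) (by fun_prop)).synth_ftc hh a b x
      · simp
    refine le_trans (lrNorm_two_shift_le hd h1 h2 h3 hL hp hq hu hJ k) ?_
    refine mul_le_mul' le_rfl ?_
    simp only [hS]
    rw [← ENNReal.tsum_mul_left, ← ENNReal.tsum_mul_left, ← ENNReal.tsum_add]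
    refine ENNReal.tsum_le_tsum fun ℓ => ?_
    rw [← lintegral_const_mul _ ((hFm ℓ).enorm.pow_const 2),
      ← lintegral_const_mul _ ((hFm' ℓ).enorm.pow_const 2),
      ← lintegral_add_left (((hFm ℓ).enorm.pow_const 2).const_mul _)]
    refine lintegral_mono fun τ => ?_
    simp only [hF, hF']
    split_ifs
    · exact le_rfl
    · simp
  · obtain ⟨B, hB⟩ := hm.bdd
    obtain ⟨B', hB'⟩ := hm.bdd'
    rw [lintegral_const_mul _ (by fun_prop), lintegral_add_left (by fun_prop),
      lintegral_const_mul _ hSm, lintegral_const_mul _ hSm']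
    calc _ ≤ 9 * (ENNReal.ofReal L⁻¹ * (16 * K * energy h) +
          ENNReal.ofReal L * (16 * K' * energy h)) := by
          have h1 := lintegral_tsum_square_le (volume.restrict I) hm.meas hB hK hh
          have h2 := lintegral_tsum_square_le (volume.restrict I) hm.meas' hB' hK' hh
          exact mul_le_mul' le_rfl (add_le_add (mul_le_mul' le_rfl h1) (mul_le_mul' le_rfl h2))
      _ = _ := by ring

lemma enorm_sq_le_mul_wt {z : ℂ} {A B ξ : ℝ} (hB : 0 ≤ B) (h0 : ‖z‖ ≤ B)
    (h1 : ‖z‖ ≤ A * |ξ|) (h2 : ‖z‖ * |ξ| ≤ A) {c : ℝ} (hc : 0 ≤ c) (hcc : A * B ^ 3 ≤ c ^ 2) :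
    ‖z‖ₑ ^ 2 ≤ ENNReal.ofReal c * wt ξ := by
  rw [← ofReal_norm, ← ENNReal.ofReal_pow (norm_nonneg _)]
  have hz := norm_nonneg z
  have h3 : ‖z‖ ^ 3 ≤ B ^ 3 := pow_le_pow_left₀ hz h0 3
  have h4 : (0 : ℝ) ≤ ‖z‖ ^ 3 := by positivity
  refine ofReal_le_wt hc ?_ ?_
  · calc (‖z‖ ^ 2) ^ 2 = ‖z‖ ^ 3 * ‖z‖ := by ring
      _ ≤ B ^ 3 * (A * |ξ|) := mul_le_mul h3 h1 hz (by positivity)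
      _ = A * B ^ 3 * |ξ| := by ring
      _ ≤ _ := by gcongr
  · calc (‖z‖ ^ 2) ^ 2 * |ξ| = ‖z‖ ^ 3 * (‖z‖ * |ξ|) := by ring
      _ ≤ B ^ 3 * A := mul_le_mul h3 h2 (by positivity) (by positivity)
      _ = A * B ^ 3 := by ring
      _ ≤ _ := hcc

/-- The multiplier `osc` with its low frequency part removed. -/
def oscHigh (ψ : ℝ → ℂ) (d : ℕ) (lam ξ : ℝ) : ℂ := osc ψ d lam ξ - Lh ξ * osc ψ d lam 0

namespace Bump

variable {ψ : ℝ → ℂ} {d : ℕ}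

lemma multFam_osc (hψ : Bump ψ) (d : ℕ) :
    MultFam (osc ψ d) (osc (fun t => (Complex.I * (t : ℂ) ^ d) * ψ t) d) where
  meas := (hψ.continuous_osc d).stronglyMeasurable
  meas' := ((hψ.deriv_amp d).continuous_osc d).stronglyMeasurable
  bdd := ⟨_, fun a ξ => hψ.norm_osc_le d a ξ⟩
  bdd' := ⟨_, fun a ξ => (hψ.deriv_amp d).norm_osc_le d a ξ⟩
  ftc a b ξ := hψ.osc_sub_osc d a b ξ

lemma multFam_oscHigh (hψ : Bump ψ) (d : ℕ) :
    MultFam (oscHigh ψ d) (oscHigh (fun t => (Complex.I * (t : ℂ) ^ d) * ψ t) d) :=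
  (hψ.multFam_osc d).sub (((hψ.multFam_osc d).comp (g := fun _ => 0) measurable_const).mul_left
    continuous_Lh.stronglyMeasurable norm_Lh_le_one)

lemma norm_Lh_mul_abs_le (ξ : ℝ) : ‖Lh ξ‖ * |ξ| ≤ 1 := by
  rcases eq_or_ne ξ 0 with rfl | hξ
  · simp
  · have := norm_Lh_le_inv hξ
    rwa [le_div_iff₀ (abs_pos.2 hξ)] at this

lemma exists_oscHigh_bound (hψ : Bump ψ) (hd : 1 ≤ d) : ∃ A : ℝ, 0 < A ∧
    (∀ lam ξ : ℝ, ‖oscHigh ψ d lam ξ‖ ≤ A ∧ ‖oscHigh ψ d lam ξ‖ ≤ A * |ξ|) ∧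
    ∀ lam ξ : ℝ, |lam| ≤ 1 → ‖oscHigh ψ d lam ξ‖ * |ξ| ≤ A := by
  obtain ⟨C, hC0, hC1, hC2, hC3, -⟩ := hψ.exists_osc_bound hd
  set R : ℝ := d * 2 ^ d with hR
  have hd1 : (1 : ℝ) ≤ d := by exact_mod_cast hd
  have h2d : (1 : ℝ) ≤ 2 ^ d := one_le_pow₀ (by norm_num)
  have hR1 : 1 ≤ R := by nlinarith
  have hb : ∀ lam ξ : ℝ, ‖oscHigh ψ d lam ξ‖ ≤ 2 * C := fun lam ξ => by
    calc ‖oscHigh ψ d lam ξ‖ ≤ ‖osc ψ d lam ξ‖ + ‖Lh ξ‖ * ‖osc ψ d lam 0‖ := by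
          rw [← norm_mul]; exact norm_sub_le _ _
      _ ≤ C + 1 * C := add_le_add (hC1 _ _)
          (mul_le_mul (norm_Lh_le_one _) (hC1 _ _) (norm_nonneg _) zero_le_one)
      _ = _ := by ring
  have hpi := Real.pi_pos
  refine ⟨C * (2 + 4 * Real.pi + 2 * R), by positivity, fun lam ξ => ⟨?_, ?_⟩, fun lam ξ hlam => ?_⟩
  · exact (hb lam ξ).trans (by nlinarith [mul_pos hC0 hpi])
  · calc ‖oscHigh ψ d lam ξ‖ = ‖(osc ψ d lam ξ - osc ψ d lam 0) - (Lh ξ - 1) * osc ψ d lam 0‖ := by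
          rw [oscHigh]; congr 1; ring
      _ ≤ ‖osc ψ d lam ξ - osc ψ d lam 0‖ + ‖Lh ξ - 1‖ * ‖osc ψ d lam 0‖ := by
          rw [← norm_mul]; exact norm_sub_le _ _
      _ ≤ C * |ξ| + (4 * Real.pi * |ξ|) * C := add_le_add (hC2 _ _)
          (mul_le_mul (norm_Lh_sub_one_le _) (hC1 _ _) (norm_nonneg _) (by positivity))
      _ = C * (1 + 4 * Real.pi) * |ξ| := by ring
      _ ≤ _ := by
          refine mul_le_mul_of_nonneg_right (mul_le_mul_of_nonneg_left ?_ hC0.le) (abs_nonneg _)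
          linarith
  · rcases le_total R |ξ| with h | h
    · have h1 := hC3 lam ξ (by
        calc (d : ℝ) * 2 ^ d * |lam| ≤ d * 2 ^ d * 1 := by gcongr
          _ ≤ _ := by rwa [mul_one])
      calc ‖oscHigh ψ d lam ξ‖ * |ξ| ≤ (‖osc ψ d lam ξ‖ + ‖Lh ξ‖ * ‖osc ψ d lam 0‖) * |ξ| := by
            rw [← norm_mul]; gcongr; exact norm_sub_le _ _
        _ = ‖osc ψ d lam ξ‖ * |ξ| + (‖Lh ξ‖ * |ξ|) * ‖osc ψ d lam 0‖ := by ring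
        _ ≤ C + 1 * C := add_le_add h1
            (mul_le_mul (norm_Lh_mul_abs_le ξ) (hC1 _ _) (norm_nonneg _) zero_le_one)
        _ ≤ _ := by nlinarith [mul_pos hC0 hpi]
    · calc ‖oscHigh ψ d lam ξ‖ * |ξ| ≤ (2 * C) * R := by
            gcongr; exact hb lam ξ
        _ ≤ _ := by nlinarith [mul_pos hC0 hpi]

/-- The pieces at scales below the critical one. -/
lemma exists_neg_piece_bound (hψ : Bump ψ) (hd : 1 ≤ d) : ∃ C : ℝ≥0, ∀ M : ℤ, M < 0 →
    ∀ (h : ℝ → ℂ) (ℓ₀ : ℤ), Nice h → ∃ G : ℝ → ℝ≥0∞, Measurable G ∧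
      (∀ (x : ℝ) (u : ℕ → ℝ), Monotone u → (∀ i, u i ∈ Ioi 0) → ∀ k,
        lrNorm 2 k (incr (fun v =>
          shiftPiece (fun lam ξ => oscHigh ψ d lam ξ - oscHigh ψ d 0 ξ) ℓ₀ d M h v x) u) ^ 2 ≤ G x) ∧
      ∫⁻ x, G x ≤ C * ENNReal.ofReal ((1 / 2) ^ M.natAbs) * energy h := by
  obtain ⟨A, hA0, hA1, hA2⟩ := (hψ.deriv_amp d).exists_oscHigh_bound hd
  set D : ℝ := (2 : ℝ) ^ d with hD
  have hD2 : 2 ≤ D := by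
    calc (2 : ℝ) = 2 ^ 1 := by norm_num
      _ ≤ 2 ^ d := pow_le_pow_right₀ (by norm_num) hd
  have hm := (hψ.multFam_oscHigh d).sub_initial
  refine ⟨(144 * (D ^ 3 * A ^ 2 + D * A ^ 2)).toNNReal, fun M hM h ℓ₀ hh => ?_⟩
  have hDM : 0 < D ^ M := by positivity
  have hDM1 : D * D ^ M ≤ 1 := by
    rw [← zpow_one_add₀ (by positivity)]
    exact zpow_le_one_of_nonpos₀ (by linarith) (by omega)
  have hI : ∀ τ ∈ Ico (D ^ M) (D ^ (M + 1)), 0 ≤ τ ∧ τ ≤ D * D ^ M := fun τ hτ =>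
    ⟨hDM.le.trans hτ.1, hτ.2.le.trans (by rw [zpow_add_one₀ (by positivity), mul_comm])⟩
  have hvol : volume (Ico (D ^ M) (D ^ (M + 1))) ≤ ENNReal.ofReal (D * D ^ M) := by
    rw [Real.volume_Ico, zpow_add_one₀ (by positivity)]
    exact ENNReal.ofReal_le_ofReal (by nlinarith)
  have hb' : ∀ τ ∈ Ico (D ^ M) (D ^ (M + 1)), ∀ ξ,
      ‖oscHigh (fun t => (Complex.I * (t : ℂ) ^ d) * ψ t) d τ ξ‖ₑ ^ 2 ≤
        ENNReal.ofReal (A ^ 2) * wt ξ := fun τ hτ ξ => by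
    refine enorm_sq_le_mul_wt hA0.le (hA1 τ ξ).1 (hA1 τ ξ).2 (hA2 τ ξ ?_) (by positivity)
      (le_of_eq (by ring))
    rw [abs_of_nonneg (hI τ hτ).1]
    exact (hI τ hτ).2.trans hDM1
  have hbdInt : ∀ τ ∈ Ico (D ^ M) (D ^ (M + 1)), ∀ (ξ B : ℝ),
      (∀ s : ℝ, |s| ≤ 1 → ‖oscHigh (fun t => (Complex.I * (t : ℂ) ^ d) * ψ t) d s ξ‖ ≤ B) →
      ‖oscHigh ψ d τ ξ - oscHigh ψ d 0 ξ‖ ≤ B * (D * D ^ M) := fun τ hτ ξ B hB => by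
    have hB0 : 0 ≤ B := (norm_nonneg _).trans (hB 0 (by simp))
    rw [(hψ.multFam_oscHigh d).ftc]
    refine (intervalIntegral.norm_integral_le_of_norm_le_const (C := B) fun s hs => hB s ?_).trans ?_
    · rw [uIoc_of_le (hI τ hτ).1] at hs
      rw [abs_of_pos hs.1]
      exact hs.2.trans ((hI τ hτ).2.trans hDM1)
    · rw [sub_zero, abs_of_nonneg (hI τ hτ).1]
      exact mul_le_mul_of_nonneg_left (hI τ hτ).2 hB0
  have hb : ∀ τ ∈ Ico (D ^ M) (D ^ (M + 1)), ∀ ξ, ‖oscHigh ψ d τ ξ - oscHigh ψ d 0 ξ‖ₑ ^ 2 ≤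
        ENNReal.ofReal ((A * (D * D ^ M)) ^ 2) * wt ξ := fun τ hτ ξ => by
    have hA' : 0 ≤ A * (D * D ^ M) := by positivity
    refine enorm_sq_le_mul_wt (A := A * (D * D ^ M)) hA'
      (hbdInt τ hτ ξ A fun s _ => (hA1 s ξ).1) ?_ ?_ (by positivity)
      (le_of_eq (by ring))
    · refine (hbdInt τ hτ ξ (A * |ξ|) fun s _ => (hA1 s ξ).2).trans (le_of_eq (by ring))
    · rcases eq_or_ne ξ 0 with rfl | hξ
      · simpa using hA'
      · have hp : 0 < |ξ| := abs_pos.2 hξ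
        have := hbdInt τ hτ ξ (A / |ξ|) fun s hs => (le_div_iff₀ hp).2 (hA2 s ξ hs)
        calc _ ≤ A / |ξ| * (D * D ^ M) * |ξ| := by gcongr
          _ = _ := by field_simp
  have hset : ∀ {g : ℝ → ℝ → ℂ} {B : ℝ}, 0 ≤ B → (∀ τ ∈ Ico (D ^ M) (D ^ (M + 1)), ∀ ξ,
      ‖g τ ξ‖ₑ ^ 2 ≤ ENNReal.ofReal B * wt ξ) → ∀ ξ,
      ∫⁻ τ in Ico (D ^ M) (D ^ (M + 1)), ‖g τ ξ‖ₑ ^ 2 ≤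
        ENNReal.ofReal (D * D ^ M * B) * wt (1 * ξ) := fun {g B} hB0 hg ξ => by
    refine (setLIntegral_mono measurable_const fun τ hτ => hg τ hτ ξ).trans ?_
    rw [setLIntegral_const, one_mul, ENNReal.ofReal_mul (by positivity)]
    calc _ ≤ ENNReal.ofReal B * wt ξ * ENNReal.ofReal (D * D ^ M) := by gcongr
      _ = _ := by ring
  obtain ⟨G, hG1, hG2, hG3⟩ := hm.exists_shift_bound hd hDM (p := 1) (q := 2 ^ d) (M := M)
    (by simp [hD]) (by rw [zpow_add_one₀ (by positivity)]; push_cast; ring)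
    (hset (by positivity) hb) (hset (by positivity) hb') hh ℓ₀
  refine ⟨G, hG1, hG2, hG3.trans ?_⟩
  refine mul_le_mul' ?_ le_rfl
  change _ ≤ ENNReal.ofReal _ * _
  rw [← ENNReal.ofReal_mul (by positivity), ← ENNReal.ofReal_mul (by positivity),
    ← ENNReal.ofReal_add (by positivity) (by positivity),
    ← ENNReal.ofReal_ofNat, ← ENNReal.ofReal_mul (by positivity),
    ← ENNReal.ofReal_mul (by positivity)]
  refine ENNReal.ofReal_le_ofReal ?_
  have hDhalf : D ^ M ≤ (1 / 2) ^ M.natAbs := by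
    obtain ⟨n, rfl⟩ : ∃ n : ℕ, M = -n := ⟨M.natAbs, by omega⟩
    rw [zpow_neg, zpow_natCast, Int.natAbs_neg, Int.natAbs_natCast, one_div, inv_pow]
    exact inv_anti₀ (by positivity) (pow_le_pow_left₀ (by norm_num) hD2 n)
  have hD1 : D ^ M ≤ 1 := by nlinarith
  have hsq : D ^ M * D ^ M ≤ (1 / 2) ^ M.natAbs := by nlinarith
  calc _ = 144 * (D ^ 3 * A ^ 2 + D * A ^ 2) * (D ^ M * D ^ M) := by
        field_simp
    _ ≤ _ := by gcongr

end Bump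

/-- The frequencies at which the phase `lam * t ^ d - 2 * π * ξ * t` may be stationary
for `lam ∈ [Λ, 2 ^ d * Λ]`. -/
def midSet (d : ℕ) (Λ : ℝ) : Set ℝ :=
  {ξ | Λ < 8 * 2 ^ d * |ξ| ∧ |ξ| < d * 2 ^ d * (2 ^ d * Λ)}

/-- The indicator function of `midSet`. -/
def mid (d : ℕ) (Λ : ℝ) : ℝ → ℂ := (midSet d Λ).indicator fun _ => 1

lemma measurableSet_midSet (d : ℕ) (Λ : ℝ) : MeasurableSet (midSet d Λ) := by
  have h1 : Measurable fun ξ : ℝ => 8 * (2 : ℝ) ^ d * |ξ| := by fun_prop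
  have h2 : Measurable fun ξ : ℝ => |ξ| := by fun_prop
  exact (measurableSet_lt measurable_const h1).inter (measurableSet_lt h2 measurable_const)

lemma stronglyMeasurable_mid (d : ℕ) (Λ : ℝ) : StronglyMeasurable (mid d Λ) :=
  stronglyMeasurable_const.indicator (measurableSet_midSet d Λ)

lemma norm_mid_le_one (d : ℕ) (Λ ξ : ℝ) : ‖mid d Λ ξ‖ ≤ 1 := by
  unfold mid
  refine (norm_indicator_le_norm_self _ _).trans (by simp)

lemma mid_of_mem {d : ℕ} {Λ ξ : ℝ} (h : ξ ∈ midSet d Λ) : mid d Λ ξ = 1 := indicator_of_mem h _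

lemma mid_of_notMem {d : ℕ} {Λ ξ : ℝ} (h : ξ ∉ midSet d Λ) : mid d Λ ξ = 0 :=
  indicator_of_notMem h _

lemma enorm_mid_sq_le {d : ℕ} (hd : 1 ≤ d) {Λ : ℝ} (hΛ : 0 < Λ) (ξ : ℝ) :
    ‖mid d Λ ξ‖ₑ ^ 2 ≤ ENNReal.ofReal (8 * d * (2 ^ d) ^ 2) * wt (Λ⁻¹ * ξ) := by
  by_cases h : ξ ∈ midSet d Λ
  · rw [mid_of_mem h, enorm_one, one_pow, ← ENNReal.ofReal_one]
    obtain ⟨h1, h2⟩ := h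
    have hd1 : (1 : ℝ) ≤ d := by exact_mod_cast hd
    set D : ℝ := 2 ^ d with hD
    have hD1 : (1 : ℝ) ≤ D := one_le_pow₀ (by norm_num)
    have hdD : 1 ≤ (d : ℝ) * D := by nlinarith
    have e : |Λ⁻¹ * ξ| = |ξ| / Λ := by
      rw [abs_mul, abs_of_pos (inv_pos.2 hΛ)]; ring
    set c : ℝ := 8 * d * D ^ 2 with hc
    have hc8 : 8 * D ≤ c := by nlinarith
    have hc1 : 1 ≤ c := by linarith
    have hcd : d * D * D ≤ c := by nlinarith
    have hcc : c ≤ c ^ 2 := by nlinarith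
    refine ofReal_le_wt (by positivity) ?_ ?_
    · rw [e, one_pow, ← mul_div_assoc, le_div_iff₀ hΛ, one_mul]
      refine h1.le.trans ?_
      gcongr
      exact hc8.trans hcc
    · rw [e, one_pow, one_mul, div_le_iff₀ hΛ]
      refine h2.le.trans ?_
      calc d * D * (D * Λ) = d * D * D * Λ := by ring
        _ ≤ _ := by gcongr; exact hcd.trans hcc
  · simp [mid_of_notMem h]

namespace Bump

variable {ψ : ℝ → ℂ} {d : ℕ}

lemma multFam_mid (hψ : Bump ψ) (d : ℕ) (Λ : ℝ) :
    MultFam (fun lam ξ => mid d Λ ξ * osc ψ d lam ξ)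
      (fun lam ξ => mid d Λ ξ * osc (fun t => (Complex.I * (t : ℂ) ^ d) * ψ t) d lam ξ) :=
  (hψ.multFam_osc d).mul_left (stronglyMeasurable_mid d Λ) (norm_mid_le_one d Λ)

lemma multFam_rem (hψ : Bump ψ) (d : ℕ) (Λ : ℝ) :
    MultFam (fun lam ξ => oscHigh ψ d lam ξ - mid d Λ ξ * osc ψ d lam ξ)
      (fun lam ξ => oscHigh (fun t => (Complex.I * (t : ℂ) ^ d) * ψ t) d lam ξ -
        mid d Λ ξ * osc (fun t => (Complex.I * (t : ℂ) ^ d) * ψ t) d lam ξ) :=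
  (hψ.multFam_oscHigh d).sub (hψ.multFam_mid d Λ)

lemma exists_rem_bound (hψ : Bump ψ) (hd : 1 ≤ d) : ∃ A : ℝ, 0 < A ∧ ∀ Λ lam ξ : ℝ, 1 ≤ Λ →
    Λ ≤ lam → lam ≤ 2 ^ d * Λ →
    ‖oscHigh ψ d lam ξ - mid d Λ ξ * osc ψ d lam ξ‖ ≤ A * |ξ| ∧
    ‖oscHigh ψ d lam ξ - mid d Λ ξ * osc ψ d lam ξ‖ * Λ ≤ A ∧
    ‖oscHigh ψ d lam ξ - mid d Λ ξ * osc ψ d lam ξ‖ * |ξ| ≤ A := by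
  obtain ⟨C, hC0, hC1, -, hC3, hC4⟩ := hψ.exists_osc_bound hd
  obtain ⟨A₁, hA0, hA1, -⟩ := hψ.exists_oscHigh_bound hd
  have hd1 : (1 : ℝ) ≤ d := by exact_mod_cast hd
  have hD1 : (1 : ℝ) ≤ 2 ^ d := one_le_pow₀ (by norm_num)
  refine ⟨A₁ + 2 * C + 8 * 2 ^ d * C, by positivity, fun Λ lam ξ hΛ h1 h2 => ?_⟩
  set D : ℝ := 2 ^ d with hD
  have hlam : |lam| = lam := abs_of_nonneg (by linarith)
  have hDC : C ≤ D * C := by nlinarith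
  have hk : ‖osc ψ d lam 0‖ * lam ≤ C := by
    have := hC4 lam 0 (by simp)
    rwa [hlam] at this
  have hkΛ : ‖osc ψ d lam 0‖ * Λ ≤ C := (mul_le_mul_of_nonneg_left h1 (norm_nonneg _)).trans hk
  have hL : ‖Lh ξ * osc ψ d lam 0‖ * Λ ≤ C := by
    rw [norm_mul]
    have := mul_le_mul_of_nonneg_right (norm_Lh_le_one ξ)
      (by positivity : 0 ≤ ‖osc ψ d lam 0‖ * Λ)
    linarith
  have hLx : ‖Lh ξ * osc ψ d lam 0‖ * |ξ| ≤ C := by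
    rw [norm_mul]
    have := mul_le_mul (norm_Lh_mul_abs_le ξ) (hC1 lam 0) (norm_nonneg _) zero_le_one
    linarith
  have hLC : ‖Lh ξ * osc ψ d lam 0‖ ≤ C := by
    rw [norm_mul]
    have := mul_le_mul (norm_Lh_le_one ξ) (hC1 lam 0) (norm_nonneg _) zero_le_one
    linarith
  by_cases hmid : ξ ∈ midSet d Λ
  · have e : oscHigh ψ d lam ξ - mid d Λ ξ * osc ψ d lam ξ = -(Lh ξ * osc ψ d lam 0) := by
      rw [mid_of_mem hmid, oscHigh]; ring
    rw [e, norm_neg]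
    refine ⟨?_, by linarith, by linarith⟩
    have h3 : 1 ≤ 8 * D * |ξ| := hΛ.trans hmid.1.le
    have : C ≤ 8 * D * C * |ξ| := by nlinarith
    have : 0 ≤ (A₁ + 2 * C) * |ξ| := by positivity
    nlinarith
  · rw [mid_of_notMem hmid, zero_mul, sub_zero]
    have htri : ‖oscHigh ψ d lam ξ‖ ≤ ‖osc ψ d lam ξ‖ + ‖Lh ξ * osc ψ d lam 0‖ := norm_sub_le _ _
    refine ⟨(hA1 lam ξ).2.trans ?_, ?_⟩
    · gcongr
      nlinarith
    · have hcase : 8 * D * |ξ| ≤ Λ ∨ d * D * (D * Λ) ≤ |ξ| := by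
        by_contra hcon
        push Not at hcon
        exact hmid hcon
      rcases hcase with h | h
      · have h5 := hC4 lam ξ (by rw [hlam]; exact h.trans h1)
        rw [hlam] at h5
        have h6 : ‖osc ψ d lam ξ‖ * Λ ≤ C :=
          (mul_le_mul_of_nonneg_left h1 (norm_nonneg _)).trans h5
        have h7 : ‖oscHigh ψ d lam ξ‖ * Λ ≤ 2 * C := by
          have := mul_le_mul_of_nonneg_right htri (by linarith : 0 ≤ Λ)
          linarith
        have h8 : |ξ| ≤ Λ := by nlinarith [abs_nonneg ξ]
        have h9 := mul_le_mul_of_nonneg_left h8 (norm_nonneg (oscHigh ψ d lam ξ))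
        constructor <;> linarith
      · have h5 := hC3 lam ξ (by
          rw [hlam]
          exact (mul_le_mul_of_nonneg_left h2 (by positivity)).trans h)
        have h7 : ‖oscHigh ψ d lam ξ‖ * |ξ| ≤ 2 * C := by
          have := mul_le_mul_of_nonneg_right htri (abs_nonneg ξ)
          linarith
        have h8 : Λ ≤ |ξ| := by
          refine le_trans ?_ h
          have hdD : 1 ≤ (d : ℝ) * D := by nlinarith
          have : Λ ≤ D * Λ := by nlinarith
          nlinarith
        have h9 := mul_le_mul_of_nonneg_left h8 (norm_nonneg (oscHigh ψ d lam ξ))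
        constructor <;> linarith

lemma exists_rem_piece_bound (hψ : Bump ψ) (hd : 2 ≤ d) : ∃ C : ℝ≥0, ∀ (n : ℕ) (h : ℝ → ℂ)
    (ℓ₀ : ℤ), Nice h → ∃ G : ℝ → ℝ≥0∞, Measurable G ∧
      (∀ (x : ℝ) (u : ℕ → ℝ), Monotone u → (∀ i, u i ∈ Ioi 0) → ∀ k,
        lrNorm 2 k (incr (fun v => shiftPiece (fun lam ξ => oscHigh ψ d lam ξ -
          mid d ((2 ^ d) ^ n) ξ * osc ψ d lam ξ) ℓ₀ d n h v x) u) ^ 2 ≤ G x) ∧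
      ∫⁻ x, G x ≤ C * ENNReal.ofReal ((1 / 2) ^ n) * energy h := by
  have hd1 : 1 ≤ d := by omega
  obtain ⟨A₁, hA₁, hb₁⟩ := hψ.exists_rem_bound hd1
  obtain ⟨A₂, hA₂, hb₂⟩ := (hψ.deriv_amp d).exists_rem_bound hd1
  have hD4 : (4 : ℝ) ≤ 2 ^ d := by
    calc (4 : ℝ) = 2 ^ 2 := by norm_num
      _ ≤ 2 ^ d := pow_le_pow_right₀ (by norm_num) hd
  refine ⟨(144 * 2 ^ d * (A₁ ^ 2 + A₂ ^ 2)).toNNReal, fun n h ℓ₀ hh => ?_⟩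
  set D : ℝ := 2 ^ d with hD
  set Λ : ℝ := D ^ n with hΛ
  have hΛ0 : 0 < Λ := by positivity
  have hΛ1 : 1 ≤ Λ := one_le_pow₀ (by linarith)
  have hΛ4 : (2 ^ n) ^ 2 ≤ Λ := by
    rw [← pow_mul, mul_comm, pow_mul]
    exact pow_le_pow_left₀ (by norm_num) (by linarith) n
  have e1 : D ^ (n : ℤ) = Λ := zpow_natCast _ _
  have e2 : D ^ ((n : ℤ) + 1) = D * Λ := by rw [zpow_add_one₀ (by positivity), e1, mul_comm]
  have hbdInt : ∀ {g : ℝ → ℝ → ℂ} {A : ℝ}, 0 < A → (∀ lam ξ : ℝ, Λ ≤ lam → lam ≤ D * Λ →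
      ‖g lam ξ‖ ≤ A * |ξ| ∧ ‖g lam ξ‖ * Λ ≤ A ∧ ‖g lam ξ‖ * |ξ| ≤ A) → ∀ ξ,
      ∫⁻ τ in Ico (D ^ (n : ℤ)) (D ^ ((n : ℤ) + 1)), ‖g τ ξ‖ₑ ^ 2 ≤
        ENNReal.ofReal (D * A ^ 2 * (1 / 2) ^ n) * wt (1 * ξ) := fun {g A} hA hg ξ => by
    have hc : 0 ≤ A ^ 2 / (Λ * 2 ^ n) := by positivity
    have hcc : A * (A / Λ) ^ 3 ≤ (A ^ 2 / (Λ * 2 ^ n)) ^ 2 := by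
      have e3 : A * (A / Λ) ^ 3 = A ^ 4 / (Λ ^ 2 * Λ) := by field_simp
      have e4 : (A ^ 2 / (Λ * 2 ^ n)) ^ 2 = A ^ 4 / (Λ ^ 2 * (2 ^ n) ^ 2) := by field_simp
      rw [e3, e4]
      gcongr
    rw [e1, e2]
    refine (setLIntegral_mono (measurable_const (a := ENNReal.ofReal (A ^ 2 / (Λ * 2 ^ n)) * wt ξ))
      fun τ hτ => ?_).trans ?_
    · obtain ⟨g1, g2, g3⟩ := hg τ ξ hτ.1 hτ.2.le
      exact enorm_sq_le_mul_wt (by positivity) ((le_div_iff₀ hΛ0).2 g2) g1 g3 hc hcc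
    · rw [setLIntegral_const, Real.volume_Ico, one_mul]
      calc _ ≤ ENNReal.ofReal (A ^ 2 / (Λ * 2 ^ n)) * wt ξ * ENNReal.ofReal (D * Λ) := by
            gcongr; linarith
        _ = ENNReal.ofReal (A ^ 2 / (Λ * 2 ^ n)) * ENNReal.ofReal (D * Λ) * wt ξ := by ring
        _ = _ := by
            rw [← ENNReal.ofReal_mul hc]
            congr 2
            rw [one_div, inv_pow]
            field_simp
  obtain ⟨G, hG1, hG2, hG3⟩ := (hψ.multFam_rem d Λ).exists_shift_bound hd1 one_pos
    (p := (2 ^ d) ^ n) (q := 2 ^ d * (2 ^ d) ^ n) (M := n)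
    (by push_cast; rw [mul_one, ← hD, e1]) (by push_cast; rw [mul_one, ← hD, e2])
    (hbdInt hA₁ fun lam ξ => hb₁ Λ lam ξ hΛ1) (hbdInt hA₂ fun lam ξ => hb₂ Λ lam ξ hΛ1) hh ℓ₀
  refine ⟨G, hG1, hG2, hG3.trans ?_⟩
  refine mul_le_mul' ?_ le_rfl
  change _ ≤ ENNReal.ofReal _ * _
  rw [← ENNReal.ofReal_mul (by positivity), ← ENNReal.ofReal_mul (by positivity),
    ← ENNReal.ofReal_add (by positivity) (by positivity),
    ← ENNReal.ofReal_ofNat, ← ENNReal.ofReal_mul (by positivity),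
    ← ENNReal.ofReal_mul (by positivity)]
  refine ENNReal.ofReal_le_ofReal (le_of_eq ?_)
  rw [inv_one]
  ring

end Bump

lemma exists_tsum_majorant {ρ : ℝ} (h0 : 0 < ρ) (h1 : ρ < 1) {G : ℤ → ℝ → ℝ≥0∞}
    (hG : ∀ M, Measurable (G M)) {A : ℝ≥0∞}
    (hA : ∀ M, ∫⁻ x, G M x ≤ A * ENNReal.ofReal ((ρ ^ 2) ^ M.natAbs)) :
    ∃ H : ℝ → ℝ≥0∞, Measurable H ∧ (∀ x, (∑' M, G M x ^ (1 / 2 : ℝ)) ^ 2 ≤ H x) ∧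
      ∫⁻ x, H x ≤ ENNReal.ofReal (2 / (1 - ρ)) ^ 2 * A := by
  have hm : ∀ M : ℤ, Measurable fun x => G M x * ENNReal.ofReal ((ρ ^ M.natAbs)⁻¹) :=
    fun M => (hG M).mul_const _
  refine ⟨fun x => ENNReal.ofReal (2 / (1 - ρ)) *
    ∑' M : ℤ, G M x * ENNReal.ofReal ((ρ ^ M.natAbs)⁻¹), (Measurable.tsum hm).const_mul _,
    fun x => ?_, ?_⟩
  · have hs : ∀ M : ℤ, 0 < Real.sqrt (ρ ^ M.natAbs) := fun M => Real.sqrt_pos.2 (by positivity)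
    have key := lintegral_mul_sq_le (Measure.count (α := ℤ))
      (f := fun M => ENNReal.ofReal (Real.sqrt (ρ ^ M.natAbs)))
      (g := fun M => G M x ^ (1 / 2 : ℝ) * ENNReal.ofReal ((Real.sqrt (ρ ^ M.natAbs))⁻¹))
      Measurable.of_discrete.aemeasurable Measurable.of_discrete.aemeasurable
    simp only [lintegral_count] at key
    calc (∑' M, G M x ^ (1 / 2 : ℝ)) ^ 2 = (∑' M : ℤ, ENNReal.ofReal (Real.sqrt (ρ ^ M.natAbs)) *
          (G M x ^ (1 / 2 : ℝ) * ENNReal.ofReal ((Real.sqrt (ρ ^ M.natAbs))⁻¹))) ^ 2 := by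
          congr 2
          ext M
          rw [mul_left_comm, ← ENNReal.ofReal_mul (hs M).le, mul_inv_cancel₀ (hs M).ne',
            ENNReal.ofReal_one, mul_one]
      _ ≤ _ := key
      _ = (∑' M : ℤ, ENNReal.ofReal (ρ ^ M.natAbs)) *
          ∑' M : ℤ, G M x * ENNReal.ofReal ((ρ ^ M.natAbs)⁻¹) := by
          congr 1
          · congr 1
            ext M
            rw [← ENNReal.ofReal_pow (hs M).le, Real.sq_sqrt (by positivity)]
          · congr 1
            ext M
            rw [mul_pow, ← ENNReal.ofReal_pow (by positivity), inv_pow,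
              Real.sq_sqrt (by positivity), ← ENNReal.rpow_two, ← ENNReal.rpow_mul]
            norm_num
      _ ≤ _ := mul_le_mul' (tsum_int_geometric_le h0.le h1) le_rfl
  · rw [lintegral_const_mul _ (Measurable.tsum hm), lintegral_tsum fun M => (hm M).aemeasurable,
      pow_two, mul_assoc]
    refine mul_le_mul' le_rfl ?_
    calc ∑' M : ℤ, ∫⁻ x, G M x * ENNReal.ofReal ((ρ ^ M.natAbs)⁻¹)
        ≤ ∑' M : ℤ, ENNReal.ofReal (ρ ^ M.natAbs) * A := by
          refine ENNReal.tsum_le_tsum fun M => ?_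
          rw [lintegral_mul_const _ (hG M)]
          refine (mul_le_mul' (hA M) le_rfl).trans (le_of_eq ?_)
          rw [mul_assoc, ← ENNReal.ofReal_mul (by positivity), mul_comm]
          congr 2
          rw [← pow_mul, mul_comm 2, pow_mul]
          field_simp
      _ ≤ _ := by
          rw [ENNReal.tsum_mul_right]
          gcongr
          exact tsum_int_geometric_le h0.le h1

lemma ennreal_le_rpow_half {a b : ℝ≥0∞} (h : a ^ 2 ≤ b) : a ≤ b ^ (1 / 2 : ℝ) := by
  refine le_trans (le_of_eq ?_) (ENNReal.rpow_le_rpow h (by norm_num))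
  rw [← ENNReal.rpow_two, ← ENNReal.rpow_mul]
  norm_num

lemma ennreal_rpow_half_sq (a : ℝ≥0∞) : (a ^ (1 / 2 : ℝ)) ^ 2 = a := by
  rw [← ENNReal.rpow_two, ← ENNReal.rpow_mul]
  norm_num

namespace Bump

variable {ψ : ℝ → ℂ} {d : ℕ}

lemma nice_mid_dilate {h : ℝ → ℂ} (hh : Nice h) (d : ℕ) (Λ c : ℝ) :
    Nice fun ξ => mid d Λ (c * ξ) * h ξ :=
  hh.mul ((stronglyMeasurable_mid d Λ).comp_measurable (g := fun ξ => c * ξ) (by fun_prop))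
    fun ξ => norm_mid_le_one _ _ _

lemma tsum_energy_mid_le {h : ℝ → ℂ} (hh : Nice h) (hd : 1 ≤ d) {Λ : ℝ} (hΛ : 0 < Λ) :
    ∑' ℓ : ℤ, energy (fun ξ => mid d Λ ((2 : ℝ) ^ ℓ * ξ) * h ξ) ≤
      16 * ENNReal.ofReal (8 * d * (2 ^ d) ^ 2) * energy h := by
  have hm : ∀ ℓ : ℤ, Measurable fun ξ => ‖mid d Λ ((2 : ℝ) ^ ℓ * ξ) * h ξ‖ₑ ^ 2 :=
    fun ℓ => (nice_mid_dilate hh d Λ _).meas.measurable.enorm.pow_const 2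
  unfold energy
  rw [← lintegral_tsum fun ℓ => (hm ℓ).aemeasurable,
    ← lintegral_const_mul _ (hh.meas.measurable.enorm.pow_const 2)]
  refine lintegral_mono fun ξ => ?_
  simp only [enorm_mul, mul_pow]
  rw [ENNReal.tsum_mul_right]
  gcongr
  calc ∑' ℓ : ℤ, ‖mid d Λ ((2 : ℝ) ^ ℓ * ξ)‖ₑ ^ 2
      ≤ ∑' ℓ : ℤ, ENNReal.ofReal (8 * d * (2 ^ d) ^ 2) * wt ((2 : ℝ) ^ ℓ * (Λ⁻¹ * ξ)) := by
        refine ENNReal.tsum_le_tsum fun ℓ => (enorm_mid_sq_le hd hΛ _).trans (le_of_eq ?_)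
        congr 2
        ring
    _ ≤ _ := by
        rw [ENNReal.tsum_mul_left, mul_comm 16]
        gcongr
        exact tsum_wt_le _

lemma exists_mid_sup_bound (hψ : Bump ψ) (hd : 2 ≤ d) : ∃ C : ℝ≥0, ∀ (n : ℕ) (h : ℝ → ℂ)
    (ℓ₀ : ℤ), Nice h → ∃ G : ℝ → ℝ≥0∞, Measurable G ∧
      (∀ x v : ℝ, 0 < v → ‖shiftPiece (fun lam ξ => mid d ((2 ^ d) ^ n) ξ * osc ψ d lam ξ)
        ℓ₀ d n h v x‖ₑ ^ 2 ≤ G x) ∧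
      ∫⁻ x, G x ≤ C * ENNReal.ofReal ((2 : ℝ) ^ (d * n / 6 : ℝ))⁻¹ * energy h := by
  obtain ⟨C, hC⟩ := hψ.exists_maximal_bound hd
  have hd1 : 1 ≤ d := by omega
  refine ⟨C * (16 * (8 * d * (2 ^ d) ^ 2)), fun n h ℓ₀ hh => ?_⟩
  set p : ℝ := (2 : ℝ) ^ (d * n / 6 : ℝ) with hp
  have hp1 : 1 ≤ p := Real.one_le_rpow (by norm_num) (by positivity)
  have hp6 : p ^ 6 = (2 ^ d) ^ n := by
    rw [hp, ← Real.rpow_natCast, ← Real.rpow_mul (by norm_num), ← pow_mul, ← Real.rpow_natCast]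
    congr 1
    push_cast
    ring
  set Λ : ℝ := (2 ^ d) ^ n with hΛ
  have hΛ0 : 0 < Λ := by positivity
  have hN := fun ℓ : ℤ => nice_mid_dilate hh d Λ ((2 : ℝ) ^ ℓ)
  choose G hG1 hG2 hG3 using fun ℓ : ℤ => hC p ((2 : ℝ) ^ ℓ) _
    (synth fun ξ => mid d Λ ((2 : ℝ) ^ ℓ * ξ) * h ξ) hp1 (by positivity)
    (continuous_synth (hN ℓ).int) (norm_synth_le _)
  refine ⟨fun x => ∑' ℓ, G ℓ x, Measurable.tsum hG1, fun x v hv => ?_, ?_⟩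
  · unfold shiftPiece
    split_ifs
    · set ℓ := scaleIdx d v + n with hℓ
      have hmem := mul_zpow_scaleIdx_mem hd1 hv n
      rw [zpow_add_one₀ (by positivity), zpow_natCast, ← hΛ, ← hp6] at hmem
      refine le_trans (le_of_eq ?_) ((hG2 ℓ _ ⟨hmem.1, by linarith [hmem.2]⟩ x).trans
        (ENNReal.le_tsum ℓ))
      rw [← synth_osc hψ d _ _ (hN ℓ).int]
      congr 3
      ext ξ
      ring
    · simp
  · rw [lintegral_tsum fun ℓ => (hG1 ℓ).aemeasurable]
    calc ∑' ℓ, ∫⁻ x, G ℓ x ≤ ∑' ℓ : ℤ, C * ENNReal.ofReal p⁻¹ *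
          energy (fun ξ => mid d Λ ((2 : ℝ) ^ ℓ * ξ) * h ξ) := by
          refine ENNReal.tsum_le_tsum fun ℓ => ?_
          rw [← energy_synth (hN ℓ)]
          exact hG3 ℓ
      _ ≤ C * ENNReal.ofReal p⁻¹ * (16 * ENNReal.ofReal (8 * d * (2 ^ d) ^ 2) * energy h) := by
          rw [ENNReal.tsum_mul_left]
          gcongr
          exact tsum_energy_mid_le hh hd1 hΛ0
      _ = _ := by
          have : ENNReal.ofReal (8 * d * (2 ^ d) ^ 2) = 8 * d * (2 ^ d) ^ 2 := by
            rw [ENNReal.ofReal_mul (by positivity), ENNReal.ofReal_mul (by positivity),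
              ENNReal.ofReal_pow (by positivity), ENNReal.ofReal_pow (by positivity)]
            simp
          rw [this]
          push_cast
          ring

lemma exists_mid_square_bound (hψ : Bump ψ) (hd : 1 ≤ d) : ∃ C : ℝ≥0, ∀ (n : ℕ) (h : ℝ → ℂ)
    (ℓ₀ : ℤ), Nice h → ∃ G : ℝ → ℝ≥0∞, Measurable G ∧
      (∀ (x : ℝ) (u : ℕ → ℝ), Monotone u → (∀ i, u i ∈ Ioi 0) → ∀ k,
        lrNorm 2 k (incr (fun v => shiftPiece (fun lam ξ =>
          mid d ((2 ^ d) ^ n) ξ * osc ψ d lam ξ) ℓ₀ d n h v x) u) ^ 2 ≤ G x) ∧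
      ∫⁻ x, G x ≤ C * energy h := by
  obtain ⟨C₁, hC₁⟩ := hψ.exists_square_bound hd
  obtain ⟨C₂, hC₂⟩ := (hψ.deriv_amp d).exists_square_bound hd
  refine ⟨144 * (C₁ * (8 * d * (2 ^ d) ^ 2 : ℝ).toNNReal + C₂ * (8 * d * (2 ^ d) ^ 2 : ℝ).toNNReal),
    fun n h ℓ₀ hh => ?_⟩
  set Λ : ℝ := (2 ^ d) ^ n with hΛ
  have hΛ0 : 0 < Λ := by positivity
  have hbdInt : ∀ {g : ℝ → ℝ → ℂ} {C : ℝ≥0}, (∀ ξ, ∫⁻ lam, ‖g lam ξ‖ₑ ^ 2 ≤ C) → ∀ ξ,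
      ∫⁻ τ in Ico (((2 : ℝ) ^ d) ^ (n : ℤ)) (((2 : ℝ) ^ d) ^ ((n : ℤ) + 1)),
        ‖mid d Λ ξ * g τ ξ‖ₑ ^ 2 ≤
        C * ENNReal.ofReal (8 * d * (2 ^ d) ^ 2) * wt (Λ⁻¹ * ξ) := fun {g C} hC ξ => by
    calc _ ≤ ∫⁻ τ, ‖mid d Λ ξ * g τ ξ‖ₑ ^ 2 := setLIntegral_le_lintegral _ _
      _ = ∫⁻ τ, ‖mid d Λ ξ‖ₑ ^ 2 * ‖g τ ξ‖ₑ ^ 2 := by simp only [enorm_mul, mul_pow]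
      _ = ‖mid d Λ ξ‖ₑ ^ 2 * ∫⁻ τ, ‖g τ ξ‖ₑ ^ 2 := lintegral_const_mul' _ _ (by simp)
      _ ≤ (ENNReal.ofReal (8 * d * (2 ^ d) ^ 2) * wt (Λ⁻¹ * ξ)) * C :=
          mul_le_mul' (enorm_mid_sq_le hd hΛ0 ξ) (hC ξ)
      _ = _ := by ring
  obtain ⟨G, hG1, hG2, hG3⟩ := (hψ.multFam_mid d Λ).exists_shift_bound hd one_pos
    (p := (2 ^ d) ^ n) (q := 2 ^ d * (2 ^ d) ^ n) (M := n)
    (by push_cast; rw [mul_one, zpow_natCast])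
    (by push_cast; rw [mul_one, zpow_add_one₀ (by positivity), zpow_natCast, mul_comm])
    (hbdInt hC₁) (hbdInt hC₂) hh ℓ₀
  refine ⟨G, hG1, hG2, hG3.trans (le_of_eq ?_)⟩
  rw [inv_one, ENNReal.ofReal_one, one_mul, one_mul]
  push_cast
  rfl

/-- The main piece at and above the critical scale. -/
lemma exists_mid_piece_bound (hψ : Bump ψ) (hd : 2 ≤ d) : ∃ C : ℝ≥0, ∀ (n : ℕ) (h : ℝ → ℂ)
    (ℓ₀ : ℤ) (r : ℝ), Nice h → 2 < r → r < 3 → ∃ G : ℝ → ℝ≥0∞, Measurable G ∧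
      (∀ (x : ℝ) (u : ℕ → ℝ), Monotone u → (∀ i, u i ∈ Ioi 0) → ∀ k,
        lrNorm r k (incr (fun v => shiftPiece (fun lam ξ =>
          mid d ((2 ^ d) ^ n) ξ * osc ψ d lam ξ) ℓ₀ d n h v x) u) ^ 2 ≤ G x) ∧
      ∫⁻ x, G x ≤ C * ENNReal.ofReal (((2 : ℝ) ^ (-((r - 2) / 9))) ^ n) * energy h := by
  obtain ⟨C₁, hC₁⟩ := hψ.exists_mid_sup_bound hd
  obtain ⟨C₂, hC₂⟩ := hψ.exists_mid_square_bound (d := d) (by omega)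
  refine ⟨4 * C₁ + C₂, fun n h ℓ₀ r hh hr hr3 => ?_⟩
  obtain ⟨S, hS1, hS2, hS3⟩ := hC₁ n h ℓ₀ hh
  obtain ⟨Q, hQ1, hQ2, hQ3⟩ := hC₂ n h ℓ₀ hh
  set p : ℝ := (2 : ℝ) ^ (d * n / 6 : ℝ) with hp
  have hp0 : 0 < p := by positivity
  set ε : ℝ≥0∞ := ENNReal.ofReal p⁻¹ with hε
  have hε0 : ε ≠ 0 := by rw [hε, Ne, ENNReal.ofReal_eq_zero, not_le]; positivity
  have hεt : ε ≠ ∞ := ENNReal.ofReal_ne_top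
  refine ⟨fun x => ε ^ (1 - 2 / r) * (ε⁻¹ * (4 * S x) + Q x), by fun_prop, ?_, ?_⟩
  · intro x u hu hJ k
    refine (lrNorm_sq_le_add hr (M := (4 * S x) ^ (1 / 2 : ℝ)) (fun i _ => ?_) hε0 hεt).trans ?_
    · refine ennreal_le_rpow_half ?_
      calc _ ≤ (‖_‖ₑ + ‖_‖ₑ) ^ 2 := by
            refine pow_le_pow_left₀ zero_le ?_ 2
            exact enorm_sub_le
        _ ≤ _ := ennreal_add_sq_le _ _
        _ ≤ 2 * (S x + S x) := by
            gcongr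
            · exact hS2 x _ (hJ _)
            · exact hS2 x _ (hJ _)
        _ = _ := by ring
    · rw [ennreal_rpow_half_sq]
      exact mul_le_mul' le_rfl (add_le_add le_rfl (hQ2 x u hu hJ k))
  · rw [lintegral_const_mul _ (by fun_prop), lintegral_add_left (by fun_prop),
      lintegral_const_mul _ (by fun_prop), lintegral_const_mul _ hS1]
    have hεle : ε ^ (1 - 2 / r) ≤ ENNReal.ofReal (((2 : ℝ) ^ (-((r - 2) / 9))) ^ n) := by
      rw [hε, ENNReal.ofReal_rpow_of_pos (by positivity)]
      refine ENNReal.ofReal_le_ofReal ?_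
      rw [hp, ← Real.rpow_neg (by norm_num), ← Real.rpow_mul (by norm_num), ← Real.rpow_natCast,
        ← Real.rpow_mul (by norm_num)]
      refine Real.rpow_le_rpow_of_exponent_le (by norm_num) ?_
      have hr0 : 0 < r := by linarith
      have h1 : (r - 2) / 3 ≤ 1 - 2 / r := by
        rw [one_sub_div hr0.ne']
        exact div_le_div_of_nonneg_left (by linarith) hr0 hr3.le
      have h2 : (2 : ℝ) ≤ d := by exact_mod_cast hd
      have h3 : (2 : ℝ) * n ≤ d * n := by gcongr
      have h4 : (0 : ℝ) ≤ n := by positivity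
      have h5 : 2 * n / 6 * ((r - 2) / 3) ≤ d * n / 6 * (1 - 2 / r) := by
        refine mul_le_mul (by linarith) h1 (by linarith) (by positivity)
      linarith
    calc _ ≤ ENNReal.ofReal (((2 : ℝ) ^ (-((r - 2) / 9))) ^ n) *
          (ε⁻¹ * (4 * (C₁ * ε * energy h)) + C₂ * energy h) :=
          mul_le_mul' hεle (add_le_add (mul_le_mul' le_rfl (mul_le_mul' le_rfl hS3)) hQ3)
      _ = ENNReal.ofReal (((2 : ℝ) ^ (-((r - 2) / 9))) ^ n) *
          ((ε⁻¹ * ε) * (4 * C₁ * energy h) + C₂ * energy h) := by ring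
      _ = _ := by
          rw [ENNReal.inv_mul_cancel hε0 hεt, one_mul]
          push_cast
          ring

end Bump

lemma lrNorm_incr_add_le {ι : Type*} {r : ℝ} (hr : 1 ≤ r) (k : ℕ) {a b c : ι → ℂ} {u : ℕ → ι}
    (h : ∀ i, a (u i) = b (u i) + c (u i)) :
    lrNorm r k (incr a u) ≤ lrNorm r k (incr b u) + lrNorm r k (incr c u) := by
  refine (lrNorm_mono (by linarith) k fun i => ?_).trans (lrNorm_add_le hr k _ _)
  simp only [incr, h]
  rw [add_sub_add_comm]
  exact enorm_add_le _ _

lemma sq_lrNorm_incr_add_le {ι : Type*} {r : ℝ} (hr : 1 ≤ r) (k : ℕ) {a b c : ι → ℂ} {u : ℕ → ι}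
    (h : ∀ i, a (u i) = b (u i) + c (u i)) {B C : ℝ≥0∞} (hB : lrNorm r k (incr b u) ^ 2 ≤ B)
    (hC : lrNorm r k (incr c u) ^ 2 ≤ C) : lrNorm r k (incr a u) ^ 2 ≤ 2 * (B + C) :=
  (pow_le_pow_left₀ zero_le (lrNorm_incr_add_le hr k h) 2).trans
    ((ennreal_add_sq_le _ _).trans (mul_le_mul' le_rfl (add_le_add hB hC)))

lemma lrNorm_incr_hasSum_le {ι κ : Type*} {r : ℝ} (hr : 1 < r) (k : ℕ) {a : ι → ℂ}
    {b : κ → ι → ℂ} {u : ℕ → ι} (h : ∀ i, HasSum (fun m => b m (u i)) (a (u i))) :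
    lrNorm r k (incr a u) ≤ ∑' m, lrNorm r k (incr (b m) u) := by
  refine (lrNorm_mono (by linarith) k fun i => ?_).trans (lrNorm_tsum_le hr k _)
  simp only [incr]
  rw [← ((h (i + 1)).sub (h i)).tsum_eq]
  exact enorm_tsum_le_tsum_enorm

namespace MultFam

variable {m m' n n' : ℝ → ℝ → ℂ}

lemma nice_dilate (hm : MultFam m m') {h : ℝ → ℂ} (hh : Nice h) (a c : ℝ) :
    Nice fun ξ => m a (c * ξ) * h ξ := by
  obtain ⟨B, hB⟩ := hm.bdd
  exact hh.mul (hm.meas.comp_measurable (g := fun ξ : ℝ => (a, c * ξ)) (by fun_prop))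
    fun ξ => hB a _

lemma shiftPiece_add (hm : MultFam m m') (hn : MultFam n n') {h : ℝ → ℂ} (hh : Nice h)
    (ℓ₀ : ℤ) (d : ℕ) (M : ℤ) (u x : ℝ) :
    shiftPiece (fun a ξ => m a ξ + n a ξ) ℓ₀ d M h u x =
      shiftPiece m ℓ₀ d M h u x + shiftPiece n ℓ₀ d M h u x := by
  unfold shiftPiece
  split_ifs
  · rw [← synth_add (hm.nice_dilate hh _ _).int (hn.nice_dilate hh _ _).int]
    simp only [add_mul]
  · simp

end MultFam

/-- The multiplier at distance `M` from the critical scale, with its low frequency part removed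
and, below the critical scale, its value at `0` subtracted. -/
def highMult (ψ : ℝ → ℂ) (d : ℕ) (M : ℤ) (lam ξ : ℝ) : ℂ :=
  oscHigh ψ d lam ξ - if M < 0 then oscHigh ψ d 0 ξ else 0

namespace Bump

variable {ψ : ℝ → ℂ} {d : ℕ}

lemma exists_high_piece_bound (hψ : Bump ψ) (hd : 2 ≤ d) : ∃ C : ℝ≥0, ∀ (M : ℤ) (h : ℝ → ℂ)
    (ℓ₀ : ℤ) (r : ℝ), Nice h → 2 < r → r < 3 → ∃ G : ℝ → ℝ≥0∞, Measurable G ∧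
      (∀ (x : ℝ) (u : ℕ → ℝ), Monotone u → (∀ i, u i ∈ Ioi 0) → ∀ k,
        lrNorm r k (incr (fun v => shiftPiece (highMult ψ d M) ℓ₀ d M h v x) u) ^ 2 ≤ G x) ∧
      ∫⁻ x, G x ≤ C * ENNReal.ofReal (((2 : ℝ) ^ (-((r - 2) / 9))) ^ M.natAbs) * energy h := by
  obtain ⟨C₁, hC₁⟩ := hψ.exists_neg_piece_bound (d := d) (by omega)
  obtain ⟨C₂, hC₂⟩ := hψ.exists_rem_piece_bound hd
  obtain ⟨C₃, hC₃⟩ := hψ.exists_mid_piece_bound hd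
  refine ⟨C₁ + 2 * (C₂ + C₃), fun M h ℓ₀ r hh hr hr3 => ?_⟩
  have hle : ∀ n : ℕ, ENNReal.ofReal ((1 / 2) ^ n) ≤
      ENNReal.ofReal (((2 : ℝ) ^ (-((r - 2) / 9))) ^ n) := fun n => by
    refine ENNReal.ofReal_le_ofReal (pow_le_pow_left₀ (by norm_num) ?_ n)
    rw [one_div, ← Real.rpow_neg_one]
    exact Real.rpow_le_rpow_of_exponent_le (by norm_num) (by linarith)
  rcases lt_or_ge M 0 with hM | hM
  · obtain ⟨G, hG1, hG2, hG3⟩ := hC₁ M hM h ℓ₀ hh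
    refine ⟨G, hG1, fun x u hu hJ k => ?_, hG3.trans ?_⟩
    · refine (pow_le_pow_left₀ zero_le (lrNorm_le_two hr k _) 2).trans ?_
      have : highMult ψ d M = fun lam ξ => oscHigh ψ d lam ξ - oscHigh ψ d 0 ξ := by
        ext lam ξ
        simp [highMult, hM]
      rw [this]
      exact hG2 x u hu hJ k
    · refine mul_le_mul' (mul_le_mul' ?_ (hle _)) le_rfl
      push_cast
      exact le_self_add
  · obtain ⟨n, rfl⟩ := Int.eq_ofNat_of_zero_le hM
    obtain ⟨G, hG1, hG2, hG3⟩ := hC₂ n h ℓ₀ hh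
    obtain ⟨K, hK1, hK2, hK3⟩ := hC₃ n h ℓ₀ r hh hr hr3
    refine ⟨fun x => 2 * (G x + K x), by fun_prop, fun x u hu hJ k => ?_, ?_⟩
    · refine sq_lrNorm_incr_add_le (by linarith) k (fun i => ?_)
        ((pow_le_pow_left₀ zero_le (lrNorm_le_two hr k _) 2).trans (hG2 x u hu hJ k))
        (hK2 x u hu hJ k)
      rw [← (hψ.multFam_rem d _).shiftPiece_add (hψ.multFam_mid d _) hh]
      congr 1
      ext lam ξ
      simp [highMult]
    · rw [lintegral_const_mul _ (by fun_prop), lintegral_add_left hG1, Int.natAbs_natCast]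
      calc _ ≤ 2 * (C₂ * ENNReal.ofReal (((2 : ℝ) ^ (-((r - 2) / 9))) ^ n) * energy h +
            C₃ * ENNReal.ofReal (((2 : ℝ) ^ (-((r - 2) / 9))) ^ n) * energy h) := by
            refine mul_le_mul' le_rfl (add_le_add (hG3.trans ?_) hK3)
            exact mul_le_mul' (mul_le_mul' le_rfl (hle n)) le_rfl
        _ = ((2 * (C₂ + C₃) : ℝ≥0) : ℝ≥0∞) *
            ENNReal.ofReal (((2 : ℝ) ^ (-((r - 2) / 9))) ^ n) * energy h := by
            push_cast
            ring
        _ ≤ _ := by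
            refine mul_le_mul' (mul_le_mul' ?_ le_rfl) le_rfl
            exact_mod_cast le_add_self

/-- The `r`-variation of the sum of all the pieces with low frequencies removed. -/
lemma exists_high_bound (hψ : Bump ψ) (hd : 2 ≤ d) : ∃ C : ℝ≥0, ∀ (h : ℝ → ℂ)
    (ℓ₀ : ℤ) (r : ℝ), Nice h → 2 < r → r < 3 → ∃ G : ℝ → ℝ≥0∞, Measurable G ∧
      (∀ (x : ℝ) (F : ℝ → ℂ), (∀ v, 0 < v →
          HasSum (fun M => shiftPiece (highMult ψ d M) ℓ₀ d M h v x) (F v)) →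
        ∀ u : ℕ → ℝ, Monotone u → (∀ i, u i ∈ Ioi 0) → ∀ k, lrNorm r k (incr F u) ^ 2 ≤ G x) ∧
      ∫⁻ x, G x ≤ C * ENNReal.ofReal (r - 2)⁻¹ ^ 2 * energy h := by
  obtain ⟨C, hC⟩ := hψ.exists_high_piece_bound hd
  refine ⟨144 ^ 2 * C, fun h ℓ₀ r hh hr hr3 => ?_⟩
  choose G hG1 hG2 hG3 using fun M => hC M h ℓ₀ r hh hr hr3
  set ρ : ℝ := (2 : ℝ) ^ (-((r - 2) / 18)) with hρ
  have h2 : (2 : ℝ) ^ (-((r - 2) / 9)) = ρ ^ 2 := by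
    rw [hρ, ← Real.rpow_natCast, ← Real.rpow_mul (by norm_num)]
    congr 1
    push_cast
    ring
  have hρ0 : 0 < ρ := by positivity
  have hρ1 : ρ ≤ 1 - (r - 2) / 72 := by
    have hlog : 1 / 2 ≤ Real.log 2 := by linarith [Real.log_two_gt_d9]
    set y := (r - 2) / 18 * Real.log 2 with hy
    have hy1 : (r - 2) / 36 ≤ y := by nlinarith
    have hexp : ρ = (Real.exp y)⁻¹ := by
      rw [hρ, Real.rpow_def_of_pos (by norm_num), ← Real.exp_neg]
      congr 1
      rw [hy]
      ring
    have h3 : 1 + (r - 2) / 36 ≤ Real.exp y := by linarith [Real.add_one_le_exp y]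
    rw [hexp]
    refine (inv_anti₀ (by linarith) h3).trans ?_
    rw [inv_le_comm₀ (by linarith) (by linarith), inv_le_iff_one_le_mul₀ (by linarith)]
    nlinarith
  obtain ⟨H, hH1, hH2, hH3⟩ := exists_tsum_majorant hρ0 (by linarith) hG1
    (A := C * energy h) (fun M => (hG3 M).trans (le_of_eq (by rw [h2, mul_right_comm])))
  refine ⟨H, hH1, fun x F hF u hu hJ k => ?_, hH3.trans ?_⟩
  · refine le_trans (pow_le_pow_left₀ zero_le ?_ 2) (hH2 x)
    refine (lrNorm_incr_hasSum_le (by linarith) k (a := F) (u := u)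
      (b := fun M v => shiftPiece (highMult ψ d M) ℓ₀ d M h v x) fun i => hF (u i) (hJ i)).trans ?_
    exact ENNReal.tsum_le_tsum fun M => ennreal_le_rpow_half (hG2 M x u hu hJ k)
  · have h3 : ENNReal.ofReal (2 / (1 - ρ)) ≤ 144 * ENNReal.ofReal (r - 2)⁻¹ := by
      rw [← ENNReal.ofReal_ofNat 144, ← ENNReal.ofReal_mul (by norm_num)]
      refine ENNReal.ofReal_le_ofReal ?_
      rw [← div_eq_mul_inv, div_le_div_iff₀ (by linarith) (by linarith)]
      linarith
    calc _ ≤ (144 * ENNReal.ofReal (r - 2)⁻¹) ^ 2 * (C * energy h) :=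
          mul_le_mul' (pow_le_pow_left₀ zero_le h3 2) le_rfl
      _ = _ := by
          push_cast
          ring

end Bump

/-- A smooth even dyadic partition of unity generated by `φ`. -/
structure Cutoff (φ : ℝ → ℝ) : Prop where
  smooth : ContDiff ℝ (⊤ : ℕ∞) φ
  even : ∀ t, φ (-t) = φ t
  vanish : ∀ t : ℝ, ¬(1 / 2 ≤ |t| ∧ |t| ≤ 2) → φ t = 0
  part : ∀ t : ℝ, t ≠ 0 → HasSum (fun ℓ : ℤ => φ ((2 : ℝ) ^ (-ℓ) * t)) 1

/-- The derivative of the smooth cutoff to `|t| ≤ 2` obtained by summing the partition of unity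
over small scales. -/
def edge (φ : ℝ → ℝ) (t : ℝ) : ℝ := if |t| ≤ 3 / 4 then 0 else deriv φ t + 2 * deriv φ (2 * t)

namespace Cutoff

variable {φ : ℝ → ℝ}

lemma hasDerivAt (hφ : Cutoff φ) (t : ℝ) : HasDerivAt φ (deriv φ t) t :=
  (hφ.smooth.differentiable (by simp) t).hasDerivAt

lemma continuous_deriv (hφ : Cutoff φ) : Continuous (deriv φ) :=
  hφ.smooth.continuous_deriv (by simp)

lemma contDiff_deriv (hφ : Cutoff φ) : ContDiff ℝ 1 (deriv φ) := by
  have h : ContDiff ℝ (1 + 1) φ := by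
    rw [one_add_one_eq_two]
    exact hφ.smooth.of_le (WithTop.coe_le_coe.2 (le_top : (2 : ℕ∞) ≤ ⊤))
  exact (contDiff_succ_iff_deriv.1 h).2.2

lemma deriv_neg (hφ : Cutoff φ) (t : ℝ) : deriv φ (-t) = -deriv φ t := by
  have h := deriv_comp_neg φ t
  simp only [hφ.even] at h
  linarith

lemma deriv_eq_zero_of_lt (hφ : Cutoff φ) {t : ℝ} (ht : |t| < 1 / 2) : deriv φ t = 0 := by
  have : φ =ᶠ[𝓝 t] fun _ => 0 := by
    filter_upwards [(isOpen_lt continuous_abs continuous_const).mem_nhds ht] with s hs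
    exact hφ.vanish s fun h => absurd h.1 (not_le.2 hs)
  rw [this.deriv_eq, deriv_const]

lemma deriv_eq_zero_of_gt (hφ : Cutoff φ) {t : ℝ} (ht : 2 < |t|) : deriv φ t = 0 := by
  have : φ =ᶠ[𝓝 t] fun _ => 0 := by
    filter_upwards [(isOpen_lt continuous_const continuous_abs).mem_nhds ht] with s hs
    exact hφ.vanish s fun h => absurd h.2 (not_le.2 hs)
  rw [this.deriv_eq, deriv_const]

lemma add_dilate_eq_one (hφ : Cutoff φ) {t : ℝ} (h1 : 1 / 2 < |t|) (h2 : |t| < 1) :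
    φ t + φ (2 * t) = 1 := by
  have ht : t ≠ 0 := by
    rintro rfl
    norm_num at h1
  have hs : HasSum (fun ℓ : ℤ => φ ((2 : ℝ) ^ (-ℓ) * t))
      (∑ ℓ ∈ ({0, -1} : Finset ℤ), φ ((2 : ℝ) ^ (-ℓ) * t)) := by
    refine hasSum_sum_of_ne_finset_zero fun ℓ hℓ => hφ.vanish _ ?_
    simp only [Finset.mem_insert, Finset.mem_singleton, not_or] at hℓ
    rw [abs_mul, abs_of_pos (by positivity : (0 : ℝ) < 2 ^ (-ℓ))]
    rintro ⟨h3, h4⟩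
    rcases lt_or_ge 0 ℓ with hpos | hneg
    · have : (2 : ℝ) ^ (-ℓ) ≤ 2 ^ (-1 : ℤ) := zpow_le_zpow_right₀ (by norm_num) (by omega)
      have h5 : (2 : ℝ) ^ (-ℓ) * |t| ≤ 2 ^ (-1 : ℤ) * |t| := by gcongr
      rw [show (2 : ℝ) ^ (-1 : ℤ) = 1 / 2 by norm_num] at h5
      linarith
    · have : (2 : ℝ) ^ (2 : ℤ) ≤ 2 ^ (-ℓ) := zpow_le_zpow_right₀ (by norm_num) (by omega)
      have h5 : (2 : ℝ) ^ (2 : ℤ) * |t| ≤ 2 ^ (-ℓ) * |t| := by gcongr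
      rw [show (2 : ℝ) ^ (2 : ℤ) = 4 by norm_num] at h5
      linarith
  have := hs.unique (hφ.part t ht)
  simpa using this

lemma deriv_add_dilate (hφ : Cutoff φ) {t : ℝ} (h1 : 1 / 2 < |t|) (h2 : |t| < 1) :
    deriv φ t + 2 * deriv φ (2 * t) = 0 := by
  have hd : HasDerivAt (fun s => φ s + φ (2 * s)) (deriv φ t + deriv φ (2 * t) * (2 * 1)) t :=
    (hφ.hasDerivAt t).add ((hφ.hasDerivAt (2 * t)).comp t ((hasDerivAt_id t).const_mul 2))
  have he : (fun s => φ s + φ (2 * s)) =ᶠ[𝓝 t] fun _ => 1 := by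
    filter_upwards [(isOpen_lt continuous_const continuous_abs).mem_nhds h1,
      (isOpen_lt continuous_abs continuous_const).mem_nhds h2] with s hs1 hs2
    exact hφ.add_dilate_eq_one hs1 hs2
  have := hd.unique ((hasDerivAt_const t (1 : ℝ)).congr_of_eventuallyEq he)
  linarith

lemma edge_eq_zero (hφ : Cutoff φ) {t : ℝ} (ht : |t| < 1) : edge φ t = 0 := by
  unfold edge
  split_ifs with h
  · rfl
  · exact hφ.deriv_add_dilate (by linarith) ht

lemma edge_of_one_lt (hφ : Cutoff φ) {t : ℝ} (ht : 1 < |t|) : edge φ t = deriv φ t := by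
  unfold edge
  rw [if_neg (by linarith), hφ.deriv_eq_zero_of_gt (t := 2 * t) (by rw [abs_mul]; norm_num; linarith)]
  ring

lemma contDiff_edge (hφ : Cutoff φ) : ContDiff ℝ 1 (edge φ) := by
  refine contDiff_iff_contDiffAt.2 fun t => ?_
  rcases lt_or_ge (|t|) 1 with h | h
  · refine (contDiffAt_const (c := (0 : ℝ))).congr_of_eventuallyEq ?_
    filter_upwards [(isOpen_lt continuous_abs continuous_const).mem_nhds h] with s hs
    exact hφ.edge_eq_zero hs
  · have hc : ContDiff ℝ 1 fun t => deriv φ t + 2 * deriv φ (2 * t) :=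
      hφ.contDiff_deriv.add (contDiff_const.mul
        (hφ.contDiff_deriv.comp (contDiff_const.mul contDiff_id)))
    refine hc.contDiffAt.congr_of_eventuallyEq ?_
    filter_upwards [(isOpen_lt continuous_const continuous_abs).mem_nhds
      (lt_of_lt_of_le (by norm_num : (3 / 4 : ℝ) < 1) h)] with s hs
    exact if_neg (not_le.2 hs)

lemma bump_edge (hφ : Cutoff φ) : Bump fun t => (edge φ t : ℂ) where
  smooth := Complex.ofRealCLM.contDiff.comp hφ.contDiff_edge
  vanish t ht := by
    rw [Complex.ofReal_eq_zero]
    rcases lt_or_ge (|t|) 1 with h | h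
    · exact hφ.edge_eq_zero h
    · have h2 : 2 < |t| := by
        by_contra h3
        exact ht ⟨by linarith, by linarith⟩
      rw [hφ.edge_of_one_lt (by linarith), hφ.deriv_eq_zero_of_gt h2]

lemma bump_div (hφ : Cutoff φ) : Bump fun t => (φ t : ℂ) / (t : ℂ) where
  smooth := by
    refine contDiff_iff_contDiffAt.2 fun t => ?_
    have h1 : ContDiff ℝ 1 fun t => (φ t : ℂ) :=
      Complex.ofRealCLM.contDiff.comp (hφ.smooth.of_le (by exact_mod_cast le_top))
    rcases eq_or_ne t 0 with rfl | h
    · refine (contDiffAt_const (c := (0 : ℂ))).congr_of_eventuallyEq ?_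
      filter_upwards [(isOpen_lt continuous_abs continuous_const).mem_nhds
        (show |(0 : ℝ)| < 1 / 2 by norm_num)] with s hs
      rw [hφ.vanish s fun h => absurd h.1 (not_le.2 hs)]
      simp
    · simp only [div_eq_mul_inv]
      refine h1.contDiffAt.mul (ContDiffAt.inv ?_ (by exact_mod_cast h))
      exact Complex.ofRealCLM.contDiff.contDiffAt
  vanish t ht := by simp [hφ.vanish t ht]

lemma integral_eq_zero_of_odd {g : ℝ → ℂ} (hg : ∀ t, g (-t) = -g t) : ∫ t, g t = 0 := by
  have h := integral_neg_eq_self g volume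
  simp only [hg, integral_neg] at h
  exact self_eq_neg.1 h.symm

lemma osc_div_zero (hφ : Cutoff φ) (d : ℕ) : osc (fun t => (φ t : ℂ) / (t : ℂ)) d 0 0 = 0 := by
  simp only [osc, zero_mul, neg_zero, cis_zero, ex_zero, mul_one]
  refine integral_eq_zero_of_odd fun t => ?_
  rw [hφ.even]
  push_cast
  rw [div_neg]

lemma osc_edge_zero (hφ : Cutoff φ) (d : ℕ) : osc (fun t => (edge φ t : ℂ)) d 0 0 = 0 := by
  simp only [osc, zero_mul, neg_zero, cis_zero, ex_zero, mul_one]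
  refine integral_eq_zero_of_odd fun t => ?_
  unfold edge
  rw [abs_neg, mul_neg, hφ.deriv_neg, hφ.deriv_neg]
  split_ifs
  · simp
  · push_cast
    ring

lemma deriv_ae_eq (hφ : Cutoff φ) : ∀ᵐ t : ℝ, deriv φ t = edge φ t - 2 * edge φ (2 * t) := by
  have hfin : ({1 / 2, -(1 / 2), 1, -1} : Set ℝ).Finite := by simp
  filter_upwards [hfin.countable.ae_notMem volume] with t ht
  simp only [mem_insert_iff, mem_singleton_iff, not_or] at ht
  have h2 : |2 * t| = 2 * |t| := by rw [abs_mul]; norm_num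
  have h4 : |2 * (2 * t)| = 4 * |t| := by rw [abs_mul, h2]; norm_num; ring
  rcases lt_trichotomy (|t|) 1 with h | h | h
  · rw [hφ.edge_eq_zero h]
    rcases lt_trichotomy (|t|) (1 / 2) with h' | h' | h'
    · rw [hφ.deriv_eq_zero_of_lt h', hφ.edge_eq_zero (by rw [h2]; linarith)]
      ring
    · rcases (abs_eq (by norm_num)).1 h' with h' | h'
      · exact absurd h' ht.1
      · exact absurd h' ht.2.1
    · rw [hφ.edge_of_one_lt (by rw [h2]; linarith)]
      linarith [hφ.deriv_add_dilate h' h]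
  · rcases (abs_eq (by norm_num)).1 h with h' | h'
    · exact absurd h' ht.2.2.1
    · exact absurd h' ht.2.2.2
  · rw [hφ.edge_of_one_lt h, hφ.edge_of_one_lt (by rw [h2]; linarith),
      hφ.deriv_eq_zero_of_gt (t := 2 * t) (by rw [h2]; linarith)]
    ring

lemma integral_deriv_mul_cis (hφ : Cutoff φ) (d : ℕ) (lam : ℝ) :
    ∫ t, ((deriv φ t : ℝ) : ℂ) * cis (lam * t ^ d) =
      osc (fun t => (edge φ t : ℂ)) d lam 0 - osc (fun t => (edge φ t : ℂ)) d (lam / 2 ^ d) 0 := by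
  have hc : ∀ a : ℝ, Continuous fun t : ℝ => cis (a * t ^ d) := fun a =>
    continuous_cis.comp (by fun_prop)
  have hi := fun a => hφ.bump_edge.integrable_mul (hc a)
  have h1 : ∫ t : ℝ, 2 * ((edge φ (2 * t) : ℂ) * cis (lam / 2 ^ d * (2 * t) ^ d)) =
      osc (fun t => (edge φ t : ℂ)) d (lam / 2 ^ d) 0 := by
    rw [integral_const_mul, Measure.integral_comp_mul_left
      (fun t => (edge φ t : ℂ) * cis (lam / 2 ^ d * t ^ d))]
    simp only [osc, zero_mul, neg_zero, ex_zero, mul_one]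
    rw [abs_of_pos (by norm_num), Complex.real_smul]
    push_cast
    ring
  rw [← h1]
  have h2 : osc (fun t => (edge φ t : ℂ)) d lam 0 = ∫ t : ℝ, (edge φ t : ℂ) * cis (lam * t ^ d) := by
    simp [osc, ex_zero]
  rw [h2, ← integral_sub (hi lam)
    (((hi (lam / 2 ^ d)).comp_mul_left' (two_ne_zero)).const_mul 2)]
  refine integral_congr_ae ?_
  filter_upwards [hφ.deriv_ae_eq] with t ht
  rw [ht, show lam / 2 ^ d * (2 * t) ^ d = lam * t ^ d by field_simp; rw [mul_pow]; ring]
  push_cast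
  ring

lemma mul_osc_deriv_amp (hφ : Cutoff φ) {d : ℕ} (hd : 1 ≤ d) (lam : ℝ) :
    d * lam * osc (fun t => (Complex.I * (t : ℂ) ^ d) * ((φ t : ℂ) / (t : ℂ))) d lam 0 =
      osc (fun t => (edge φ t : ℂ)) d (lam / 2 ^ d) 0 - osc (fun t => (edge φ t : ℂ)) d lam 0 := by
  have hc : Continuous fun t : ℝ => cis (lam * t ^ d) := continuous_cis.comp (by fun_prop)
  have hφc : HasCompactSupport fun t => (φ t : ℂ) := by
    refine HasCompactSupport.of_support_subset_isCompact (isCompact_Icc (a := (-2 : ℝ)) (b := 2)) ?_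
    intro t ht
    by_contra h
    refine ht ?_
    simp only [Complex.ofReal_eq_zero]
    exact hφ.vanish t fun h2 => h (abs_le.1 h2.2)
  have hφd : ∀ t, HasDerivAt (fun t => (φ t : ℂ)) ((deriv φ t : ℝ) : ℂ) t :=
    fun t => (hφ.hasDerivAt t).ofReal_comp
  have hφd' : deriv (fun t => (φ t : ℂ)) = fun t => ((deriv φ t : ℝ) : ℂ) :=
    funext fun t => (hφd t).deriv
  have hv : ∀ t, HasDerivAt (fun t : ℝ => cis (lam * t ^ d))
      (((lam * (d * t ^ (d - 1)) : ℝ) : ℂ) * (cis (lam * t ^ d) * Complex.I)) t := fun t => by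
    have := (hasDerivAt_cis (lam * t ^ d)).scomp t (((hasDerivAt_pow d t)).const_mul lam)
    simp only [Complex.real_smul] at this
    exact this
  have hφcont : Continuous fun t => (φ t : ℂ) := Complex.continuous_ofReal.comp hφ.smooth.continuous
  have hparts := integral_mul_deriv_eq_deriv_mul_of_integrable (u := fun t => (φ t : ℂ))
    (fun t _ => hφd t) (fun t _ => hv t)
    ((hφcont.mul ((Complex.continuous_ofReal.comp (by fun_prop)).mul
      (hc.mul continuous_const))).integrable_of_hasCompactSupport hφc.mul_right)
    (((Complex.continuous_ofReal.comp hφ.continuous_deriv).mul hc).integrable_of_hasCompactSupport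
      (hφd' ▸ hφc.deriv).mul_right)
    ((hφcont.mul hc).integrable_of_hasCompactSupport hφc.mul_right)
  have hL : d * lam * osc (fun t => (Complex.I * (t : ℂ) ^ d) * ((φ t : ℂ) / (t : ℂ))) d lam 0 =
      ∫ t, (φ t : ℂ) * (((lam * (d * t ^ (d - 1)) : ℝ) : ℂ) * (cis (lam * t ^ d) * Complex.I)) := by
    rw [osc, ← integral_const_mul]
    congr 1
    ext t
    rw [zero_mul, neg_zero, ex_zero]
    obtain ⟨e, rfl⟩ : ∃ e, d = e + 1 := ⟨d - 1, by omega⟩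
    rcases eq_or_ne t 0 with rfl | ht
    · rw [hφ.vanish 0 (by norm_num)]
      simp
    · have : (t : ℂ) ≠ 0 := by exact_mod_cast ht
      push_cast
      field_simp
      ring
  rw [hL, hparts, ← neg_sub, ← hφ.integral_deriv_mul_cis]

end Cutoff

lemma Bump.exists_osc_zero_bound {ψ : ℝ → ℂ} (hψ : Bump ψ) {d : ℕ} (hd : 1 ≤ d)
    (h0 : osc ψ d 0 0 = 0) :
    ∃ C : ℝ, 0 < C ∧ ∀ lam, ‖osc ψ d lam 0‖ ≤ C * |lam| ∧ ‖osc ψ d lam 0‖ * |lam| ≤ C := by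
  obtain ⟨C, hC, -, -, -, h⟩ := hψ.exists_osc_bound hd
  set A := ∫ t : ℝ, ‖(Complex.I * (t : ℂ) ^ d) * ψ t‖ with hA
  have hA0 : 0 ≤ A := integral_nonneg fun _ => norm_nonneg _
  refine ⟨C + A, by positivity, fun lam => ⟨?_, ?_⟩⟩
  · have h1 := hψ.osc_sub_osc d 0 lam 0
    rw [h0, sub_zero] at h1
    rw [h1]
    have := intervalIntegral.norm_integral_le_of_norm_le_const (a := (0 : ℝ)) (b := lam) (C := A)
      (f := fun τ => osc (fun t : ℝ => (Complex.I * (t : ℂ) ^ d) * ψ t) d τ 0)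
      fun τ _ => (hψ.deriv_amp d).norm_osc_le d τ 0
    rw [sub_zero] at this
    exact this.trans (mul_le_mul_of_nonneg_right (by linarith) (abs_nonneg _))
  · exact (h lam 0 (by simp)).trans (by linarith)

/-- The density whose integral over one scale gives the zero-frequency value of a piece. -/
def edgeSlope (φ : ℝ → ℝ) (d : ℕ) (v : ℝ) : ℂ := osc (fun t => (edge φ t : ℂ)) d v 0 / (v : ℂ)

namespace Cutoff

variable {φ : ℝ → ℝ} {d : ℕ}

lemma measurable_edgeSlope (hφ : Cutoff φ) (d : ℕ) : Measurable (edgeSlope φ d) := by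
  have h := hφ.bump_edge.continuous_osc d
  have h1 : Continuous fun v : ℝ => osc (fun t => (edge φ t : ℂ)) d v 0 :=
    h.comp (continuous_id.prodMk continuous_const)
  exact h1.measurable.div Complex.measurable_ofReal

lemma integrable_edgeSlope (hφ : Cutoff φ) (hd : 1 ≤ d) : Integrable (edgeSlope φ d) := by
  obtain ⟨C, hC, h⟩ := hφ.bump_edge.exists_osc_zero_bound hd (hφ.osc_edge_zero d)
  refine ((integrable_inv_one_add_sq).const_mul (2 * C)).mono'
    (hφ.measurable_edgeSlope d).aestronglyMeasurable (Eventually.of_forall fun v => ?_)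
  obtain ⟨h1, h2⟩ := h v
  unfold edgeSlope
  rw [norm_div, Complex.norm_real, Real.norm_eq_abs]
  set z := ‖osc (fun t => (edge φ t : ℂ)) d v 0‖ with hz
  rcases eq_or_ne v 0 with rfl | hv
  · simp only [abs_zero, div_zero]
    positivity
  have hv' := abs_pos.2 hv
  rw [← div_eq_mul_inv, div_le_div_iff₀ hv' (by positivity), ← sq_abs v]
  nlinarith

lemma osc_div_eq (hφ : Cutoff φ) (hd : 1 ≤ d) (lam : ℝ) :
    osc (fun t => (φ t : ℂ) / (t : ℂ)) d lam 0 =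
      -(1 / (d : ℂ)) * ∫ v in lam / 2 ^ d..lam, edgeSlope φ d v := by
  have hd0 : (d : ℂ) ≠ 0 := by exact_mod_cast (show d ≠ 0 by omega)
  have hi := hφ.integrable_edgeSlope hd
  have h1 := hφ.bump_div.osc_sub_osc d 0 lam 0
  rw [hφ.osc_div_zero, sub_zero] at h1
  rw [h1]
  have h2 : ∀ᵐ τ : ℝ, osc (fun t : ℝ => (Complex.I * (t : ℂ) ^ d) * ((φ t : ℂ) / (t : ℂ))) d τ 0 =
      (1 / (d : ℂ)) * (((2 : ℂ) ^ d)⁻¹ * edgeSlope φ d (τ / 2 ^ d) - edgeSlope φ d τ) := by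
    filter_upwards [(Set.finite_singleton (0 : ℝ)).countable.ae_notMem volume] with τ hτ
    have hτ0 : (τ : ℂ) ≠ 0 := by exact_mod_cast hτ
    have := hφ.mul_osc_deriv_amp hd τ
    unfold edgeSlope
    generalize osc (fun t : ℝ => (Complex.I * (t : ℂ) ^ d) * ((φ t : ℂ) / (t : ℂ))) d τ 0 = z
      at this ⊢
    push_cast
    field_simp
    linear_combination this
  rw [intervalIntegral.integral_congr_ae (h2.mono fun τ h _ => h)]
  have hi2 : Integrable fun τ => edgeSlope φ d (τ / 2 ^ d) := hi.comp_div (by positivity)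
  rw [intervalIntegral.integral_const_mul, intervalIntegral.integral_sub
    (hi2.const_mul _).intervalIntegrable hi.intervalIntegrable,
    intervalIntegral.integral_const_mul, intervalIntegral.integral_comp_div _ (by positivity),
    zero_div, Complex.real_smul]
  have h3 := intervalIntegral.integral_interval_sub_left (a := 0) (b := lam) (c := lam / 2 ^ d)
    (hi.intervalIntegrable (μ := volume)) hi.intervalIntegrable
  rw [← h3]
  push_cast
  field_simp
  ring

end Cutoff

lemma mem_Ico_scale_iff {d : ℕ} (hd : 1 ≤ d) {u v : ℝ} (hu : 0 < u) (hv : 0 < v) (ℓ : ℤ) :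
    v ∈ Ico (u * ((2 : ℝ) ^ d) ^ ℓ / 2 ^ d) (u * ((2 : ℝ) ^ d) ^ ℓ) ↔
      1 - scaleIdx d (v / u) = ℓ := by
  have h1 : 1 < 2 ^ d := Nat.one_lt_two_pow (by omega)
  have hp := div_pos hv hu
  have hD : (0 : ℝ) < 2 ^ d := by positivity
  have e1 : u * ((2 : ℝ) ^ d) ^ ℓ / 2 ^ d ≤ v ↔ ℓ - 1 ≤ Int.log (2 ^ d) (v / u) := by
    rw [← Int.zpow_le_iff_le_log h1 hp, le_div_iff₀ hu, zpow_sub_one₀ (by positivity)]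
    push_cast
    rw [div_eq_mul_inv]
    constructor <;> intro h <;> linarith
  have e2 : v < u * ((2 : ℝ) ^ d) ^ ℓ ↔ Int.log (2 ^ d) (v / u) < ℓ := by
    rw [← Int.lt_zpow_iff_log_lt h1 hp, div_lt_iff₀ hu, mul_comm]
    push_cast
    rfl
  rw [mem_Ico, e1, e2, scaleIdx]
  omega

lemma aemeasurable_scaleIdx_div (d : ℕ) {u : ℝ} (hu : 0 < u) :
    AEMeasurable (fun v => 1 - scaleIdx d (v / u)) (volume.restrict (Ioi (0 : ℝ))) := by
  refine aemeasurable_restrict_of_monotoneOn measurableSet_Ioi fun v hv w _ hvw => ?_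
  exact sub_le_sub_left (scaleIdx_anti (div_pos hv hu) (by gcongr)) _

namespace Cutoff

variable {φ : ℝ → ℝ} {d : ℕ} {c : ℤ → ℂ} {B : ℝ}

lemma integrableOn_edgeSlope_mul (hφ : Cutoff φ) (hd : 1 ≤ d) (hc : ∀ ℓ, ‖c ℓ‖ ≤ B) {u : ℝ}
    (hu : 0 < u) :
    IntegrableOn (fun v => edgeSlope φ d v * c (1 - scaleIdx d (v / u))) (Ioi 0) := by
  refine (hφ.integrable_edgeSlope hd).integrableOn.mul_bdd (c := B) ?_
    (Eventually.of_forall fun v => hc _)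
  exact ((Measurable.of_discrete (f := c)).comp_aemeasurable
    (aemeasurable_scaleIdx_div d hu)).aestronglyMeasurable

lemma hasSum_low (hφ : Cutoff φ) (hd : 1 ≤ d) (hc : ∀ ℓ, ‖c ℓ‖ ≤ B) {u : ℝ} (hu : 0 < u) :
    HasSum (fun ℓ : ℤ =>
      osc (fun t => (φ t : ℂ) / (t : ℂ)) d (u * ((2 : ℝ) ^ d) ^ ℓ) 0 * c ℓ)
      (-(1 / (d : ℂ)) * ∫ v in Ioi 0, edgeSlope φ d v * c (1 - scaleIdx d (v / u))) := by
  set s : ℤ → Set ℝ := fun ℓ => Ico (u * ((2 : ℝ) ^ d) ^ ℓ / 2 ^ d) (u * ((2 : ℝ) ^ d) ^ ℓ) with hs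
  have hpos : ∀ ℓ, s ℓ ⊆ Ioi 0 := fun ℓ v hv => lt_of_lt_of_le (by positivity) hv.1
  have hU : ⋃ ℓ, s ℓ = Ioi 0 := by
    refine Subset.antisymm (iUnion_subset hpos) fun v hv => ?_
    exact mem_iUnion.2 ⟨_, (mem_Ico_scale_iff hd hu hv _).2 rfl⟩
  have hdisj : Pairwise (Function.onFun Disjoint s) := fun ℓ m hℓm => by
    refine Set.disjoint_left.2 fun v h1 h2 => hℓm ?_
    rw [← (mem_Ico_scale_iff hd hu (hpos _ h1) ℓ).1 h1,
      ← (mem_Ico_scale_iff hd hu (hpos _ h2) m).1 h2]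
  have key := hasSum_integral_iUnion (μ := volume) (s := s) (fun ℓ => measurableSet_Ico) hdisj
    (f := fun v => edgeSlope φ d v * c (1 - scaleIdx d (v / u)))
    (by rw [hU]; exact hφ.integrableOn_edgeSlope_mul hd hc hu)
  rw [hU] at key
  refine Eq.mpr (congrArg (HasSum · _) (funext fun ℓ => ?_)) (key.mul_left (-(1 / (d : ℂ))))
  have hle : u * ((2 : ℝ) ^ d) ^ ℓ / 2 ^ d ≤ u * ((2 : ℝ) ^ d) ^ ℓ :=
    div_le_self (by positivity) (one_le_pow₀ one_le_two)
  rw [hφ.osc_div_eq hd, intervalIntegral.integral_of_le hle, ← integral_Ico_eq_integral_Ioc,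
    mul_assoc, ← integral_mul_const]
  congr 1
  refine setIntegral_congr_fun measurableSet_Ico fun v hv => ?_
  rw [(mem_Ico_scale_iff hd hu (hpos ℓ hv) ℓ).1 hv]

lemma lrNorm_low_le (hφ : Cutoff φ) (hd : 1 ≤ d) (hc : ∀ ℓ, ‖c ℓ‖ ≤ B) {r : ℝ} (hr : 1 < r)
    {S : ℝ≥0∞} (hS : ∀ w : ℕ → ℤ, Antitone w → ∀ k, lrNorm r k (incr c w) ≤ S) {F : ℝ → ℂ}
    (hF : ∀ v, 0 < v → HasSum (fun ℓ : ℤ =>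
      osc (fun t => (φ t : ℂ) / (t : ℂ)) d (v * ((2 : ℝ) ^ d) ^ ℓ) 0 * c ℓ) (F v))
    {u : ℕ → ℝ} (hu : Monotone u) (hu0 : ∀ i, u i ∈ Ioi (0 : ℝ)) (k : ℕ) :
    lrNorm r k (incr F u) ≤ (∫⁻ v, ‖edgeSlope φ d v‖ₑ) * S := by
  have hFe : ∀ i, F (u i) =
      -(1 / (d : ℂ)) * ∫ v in Ioi 0, edgeSlope φ d v * c (1 - scaleIdx d (v / u i)) := fun i =>
    (hF _ (hu0 i)).unique (hφ.hasSum_low hd hc (hu0 i))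
  have hd1 : ‖-(1 / (d : ℂ))‖ₑ ≤ 1 := by
    rw [enorm_neg, ← ofReal_norm, norm_div, norm_one, Complex.norm_natCast]
    refine ENNReal.ofReal_le_one.2 (div_le_one_of_le₀ (by exact_mod_cast hd) (by positivity))
  have hω := (hφ.measurable_edgeSlope d).enorm
  have h1 : ∀ i, incr F u i ≤ ∫⁻ v in Ioi 0,
      ‖edgeSlope φ d v‖ₑ * incr c (fun j => 1 - scaleIdx d (v / u j)) i := fun i => by
    unfold incr
    rw [hFe, hFe, ← mul_sub, ← integral_sub (hφ.integrableOn_edgeSlope_mul hd hc (hu0 _))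
      (hφ.integrableOn_edgeSlope_mul hd hc (hu0 _)), enorm_mul]
    refine (mul_le_of_le_one_left zero_le hd1).trans
      ((enorm_integral_le_lintegral_enorm _).trans (le_of_eq ?_))
    refine lintegral_congr fun v => ?_
    rw [← mul_sub, enorm_mul]
  refine (lrNorm_mono (by linarith) k h1).trans ((lrNorm_lintegral_le _ hr k fun i => ?_).trans ?_)
  · have hm : ∀ j, AEMeasurable (fun v => c (1 - scaleIdx d (v / u j)))
        (volume.restrict (Ioi (0 : ℝ))) := fun j =>
      (Measurable.of_discrete (f := c)).comp_aemeasurable (aemeasurable_scaleIdx_div d (hu0 j))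
    exact hω.aemeasurable.mul ((hm (i + 1)).sub (hm i)).enorm
  · rw [← lintegral_mul_const _ hω]
    refine (setLIntegral_mono' measurableSet_Ioi fun v hv => ?_).trans
      (setLIntegral_le_lintegral (Ioi 0) _)
    rw [lrNorm_const_mul (by linarith)]
    refine mul_le_mul' le_rfl (hS _ (fun i j hij => ?_) k)
    exact sub_le_sub_left (scaleIdx_anti (div_pos hv (hu0 j))
      (div_le_div_of_nonneg_left (le_of_lt hv) (hu0 i) (hu hij))) _

end Cutoff

lemma sq_lrNorm_jump_le {r : ℝ} (hr : 2 < r) (ℓ₀ : ℤ) (z : ℂ) {w : ℕ → ℤ} (hw : Antitone w) (k : ℕ) :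
    lrNorm r k (incr (fun ℓ => if ℓ < ℓ₀ then z else 0) w) ^ 2 ≤ ‖z‖ₑ ^ 2 := by
  have h : ∀ n, ∑ i ∈ Finset.range n, incr (fun ℓ => if ℓ < ℓ₀ then z else 0) w i ^ 2 ≤
      if w n < ℓ₀ then ‖z‖ₑ ^ 2 else 0 := fun n => by
    induction n with
    | zero => simp
    | succ n ih =>
      rw [Finset.sum_range_succ]
      have hn := hw (Nat.le_succ n)
      by_cases h1 : w n < ℓ₀
      · have h2 : w (n + 1) < ℓ₀ := hn.trans_lt h1
        simp only [h1, h2, if_true, incr, sub_self, enorm_zero] at ih ⊢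
        simpa using ih
      · rw [if_neg h1] at ih
        rw [nonpos_iff_eq_zero.1 ih, zero_add]
        by_cases h2 : w (n + 1) < ℓ₀ <;> simp [incr, h1, h2]
  refine (pow_le_pow_left₀ zero_le (lrNorm_le_two hr k _) 2).trans ?_
  rw [lrNorm_two_sq]
  refine (h k).trans ?_
  split_ifs <;> simp

lemma sq_lrNorm_truncate_le {r : ℝ} (hr : 2 < r) {a : ℤ → ℂ} {S : ℝ≥0∞}
    (hS : ∀ w : ℕ → ℤ, Antitone w → ∀ k, lrNorm r k (incr a w) ^ 2 ≤ S) (ℓ₀ : ℤ) {w : ℕ → ℤ}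
    (hw : Antitone w) (k : ℕ) :
    lrNorm r k (incr (fun ℓ => if ℓ₀ ≤ ℓ then a ℓ else 0) w) ^ 2 ≤ 2 * (S + ‖a ℓ₀‖ₑ ^ 2) := by
  have h := sq_lrNorm_jump_le hr ℓ₀ (-a ℓ₀) hw k
  rw [enorm_neg] at h
  refine sq_lrNorm_incr_add_le (by linarith) k (b := fun ℓ => a (max ℓ ℓ₀)) (fun i => ?_)
    (hS (fun i => max (w i) ℓ₀) (fun i j hij => max_le_max_right _ (hw hij)) k) h
  rcases le_or_gt ℓ₀ (w i) with h1 | h1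
  · simp [h1, not_lt.2 h1]
  · simp [h1, not_le.2 h1, h1.le]

lemma norm_aS_le {h : ℝ → ℂ} (hh : Integrable h) (j : ℤ) (x : ℝ) : ‖aS h j x‖ ≤ ∫ ξ, ‖h ξ‖ := by
  refine (norm_synth_le _ x).trans (integral_mono_of_nonneg
    (Eventually.of_forall fun _ => norm_nonneg _) hh.norm (Eventually.of_forall fun ξ => ?_))
  simp only [norm_mul]
  exact mul_le_of_le_one_left (norm_nonneg _) (norm_Lh_le_one _)

lemma nice_aS {h : ℝ → ℂ} (hh : Nice h) (j : ℤ) : Nice fun ξ => Lh ((2 : ℝ) ^ j * ξ) * h ξ :=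
  hh.mul (m := fun ξ => Lh ((2 : ℝ) ^ j * ξ))
    (continuous_Lh.comp (continuous_const.mul continuous_id)).stronglyMeasurable
    fun _ => norm_Lh_le_one _

lemma lintegral_aS_le {h : ℝ → ℂ} (hh : Nice h) (j : ℤ) :
    ∫⁻ x, ‖aS h j x‖ₑ ^ 2 ≤ energy h := by
  refine (energy_synth (nice_aS hh j)).le.trans ?_
  refine (Nice.energy_mul_le h (m := fun ξ => Lh ((2 : ℝ) ^ j * ξ))
    (fun ξ => norm_Lh_le_one _)).trans ?_
  simp

/-- The low frequency parts of the pieces have bounded variation. -/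
lemma Cutoff.exists_low_bound {φ : ℝ → ℝ} (hφ : Cutoff φ) {d : ℕ} (hd : 1 ≤ d) :
    ∃ C : ℝ≥0, ∀ (h : ℝ → ℂ) (ℓ₀ : ℤ) (r : ℝ), Nice h → 2 < r → r < 3 →
      ∃ G : ℝ → ℝ≥0∞, Measurable G ∧
        (∀ (x : ℝ) (F : ℝ → ℂ), (∀ v, 0 < v → HasSum (fun ℓ : ℤ =>
          osc (fun t => (φ t : ℂ) / (t : ℂ)) d (v * ((2 : ℝ) ^ d) ^ ℓ) 0 *
            (if ℓ₀ ≤ ℓ then aS h ℓ x else 0)) (F v)) →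
          ∀ u : ℕ → ℝ, Monotone u → (∀ i, u i ∈ Ioi (0 : ℝ)) → ∀ k,
            lrNorm r k (incr F u) ^ 2 ≤ G x) ∧
        ∫⁻ x, G x ≤ C * ENNReal.ofReal (r - 2)⁻¹ * energy h := by
  obtain ⟨Ω, hΩ⟩ : ∃ Ω : ℝ≥0, (Ω : ℝ≥0∞) = ∫⁻ v, ‖edgeSlope φ d v‖ₑ :=
    ⟨_, ENNReal.coe_toNNReal (hφ.integrable_edgeSlope hd).2.ne⟩
  refine ⟨Ω ^ 2 * 10002, fun h ℓ₀ r hh hr hr3 => ?_⟩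
  refine ⟨fun x => (Ω : ℝ≥0∞) ^ 2 * (2 * (avgMaj r h x + ‖aS h ℓ₀ x‖ₑ ^ 2)), ?_, ?_, ?_⟩
  · have h1 := measurable_avgMaj r hh.int
    have h2 : Measurable (aS h ℓ₀) := (continuous_synth (nice_aS hh ℓ₀).int).measurable
    fun_prop
  · intro x F hF u hu hu0 k
    have hS : ∀ w : ℕ → ℤ, Antitone w → ∀ k,
        lrNorm r k (incr (fun ℓ => if ℓ₀ ≤ ℓ then aS h ℓ x else 0) w) ≤
          (2 * (avgMaj r h x + ‖aS h ℓ₀ x‖ₑ ^ 2)) ^ (1 / 2 : ℝ) := fun w hw k =>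
      ennreal_le_rpow_half (sq_lrNorm_truncate_le hr
        (fun w hw k => lrNorm_aS_le hr hr3 hh.int hw k x) ℓ₀ hw k)
    have := hφ.lrNorm_low_le hd (B := ∫ ξ, ‖h ξ‖) (fun ℓ => ?_) (by linarith) hS hF hu hu0 k
    · refine (pow_le_pow_left₀ zero_le this 2).trans (le_of_eq ?_)
      rw [mul_pow, ennreal_rpow_half_sq, hΩ]
    · split_ifs
      · exact norm_aS_le hh.int ℓ x
      · rw [norm_zero]
        exact integral_nonneg fun _ => norm_nonneg _
  · have h1 := measurable_avgMaj r hh.int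
    have hr1 : (1 : ℝ≥0∞) ≤ ENNReal.ofReal (r - 2)⁻¹ := by
      rw [ENNReal.one_le_ofReal]
      exact (one_le_inv₀ (by linarith)).2 (by linarith)
    have h2 : Measurable fun x => ‖aS h ℓ₀ x‖ₑ ^ 2 :=
      ((continuous_synth (nice_aS hh ℓ₀).int).measurable.enorm.pow_const 2)
    rw [lintegral_const_mul _ (by fun_prop), lintegral_const_mul _ (by fun_prop),
      lintegral_add_left h1]
    have h3 := add_le_add (lintegral_avgMaj_le hr hr3 hh) ((lintegral_aS_le hh ℓ₀).trans
      (le_mul_of_one_le_left zero_le hr1))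
    refine (mul_le_mul' le_rfl (mul_le_mul' le_rfl h3)).trans (le_of_eq ?_)
    push_cast
    ring

/-- A bounded continuous multiplier decaying linearly at zero and at infinity. -/
structure LacunaryMult (μ : ℝ → ℂ) (C : ℝ) : Prop where
  cont : Continuous μ
  pos : 0 < C
  bdd : ∀ ξ, ‖μ ξ‖ ≤ C
  small : ∀ ξ, ‖μ ξ‖ ≤ C * |ξ|
  large : ∀ ξ, ‖μ ξ‖ * |ξ| ≤ C

/-- The partial sums of the dilates of `μ` starting at scale `ℓ₀`. -/
def dilateSum (μ : ℝ → ℂ) (ℓ₀ : ℤ) (n : ℕ) (ξ : ℝ) : ℂ :=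
  ∑ i ∈ Finset.range n, μ ((2 : ℝ) ^ (ℓ₀ + (i : ℤ)) * ξ)

/-- The full sum of the dilates of `μ` starting at scale `ℓ₀`. -/
def dilateTsum (μ : ℝ → ℂ) (ℓ₀ : ℤ) (ξ : ℝ) : ℂ :=
  ∑' i : ℕ, μ ((2 : ℝ) ^ (ℓ₀ + (i : ℤ)) * ξ)

/-- The error in comparing a partial sum with a smooth high-pass cutoff of the full sum. -/
def dilateErr (μ : ℝ → ℂ) (ℓ₀ : ℤ) (n : ℕ) (ξ : ℝ) : ℂ :=
  dilateSum μ ℓ₀ n ξ - (1 - Lh ((2 : ℝ) ^ (ℓ₀ + (n : ℤ)) * ξ)) * dilateTsum μ ℓ₀ ξ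

lemma tsum_wt_nat_le (ℓ₀ : ℤ) (ξ : ℝ) : ∑' n : ℕ, wt ((2 : ℝ) ^ (ℓ₀ + (n : ℤ)) * ξ) ≤ 16 :=
  (ENNReal.tsum_comp_le_tsum_of_injective (f := fun n : ℕ => ℓ₀ + (n : ℤ))
    (fun a b h => by simpa using h) fun j : ℤ => wt ((2 : ℝ) ^ j * ξ)).trans (tsum_wt_le ξ)

namespace LacunaryMult

variable {μ : ℝ → ℂ} {C : ℝ}

lemma tsum_enorm_le (hμ : LacunaryMult μ C) (ℓ₀ : ℤ) (ξ : ℝ) :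
    ∑' n : ℕ, ‖μ ((2 : ℝ) ^ (ℓ₀ + (n : ℤ)) * ξ)‖ₑ ≤ ENNReal.ofReal (C * 16) := by
  rw [ENNReal.ofReal_mul hμ.pos.le, ENNReal.ofReal_ofNat]
  refine le_trans (ENNReal.tsum_le_tsum fun n => ?_)
    (ENNReal.tsum_mul_left.le.trans (mul_le_mul' le_rfl (tsum_wt_nat_le ℓ₀ ξ)))
  rw [← ofReal_norm]
  set ζ := (2 : ℝ) ^ (ℓ₀ + (n : ℤ)) * ξ with hζ
  have h1 := hμ.bdd ζ
  have h2 := hμ.small ζ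
  have h3 := hμ.large ζ
  have h0 := norm_nonneg (μ ζ)
  have hC := hμ.pos
  refine ofReal_le_wt hC.le ?_ ?_
  · calc ‖μ ζ‖ ^ 2 = ‖μ ζ‖ * ‖μ ζ‖ := by ring
      _ ≤ C * (C * |ζ|) := mul_le_mul h1 h2 h0 hC.le
      _ = _ := by ring
  · calc ‖μ ζ‖ ^ 2 * |ζ| = ‖μ ζ‖ * (‖μ ζ‖ * |ζ|) := by ring
      _ ≤ C * C := mul_le_mul h1 h3 (by positivity) hC.le
      _ = _ := by ring

lemma summable (hμ : LacunaryMult μ C) (ℓ₀ : ℤ) (ξ : ℝ) :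
    Summable fun n : ℕ => μ ((2 : ℝ) ^ (ℓ₀ + (n : ℤ)) * ξ) :=
  .of_enorm (ne_top_of_le_ne_top ENNReal.ofReal_ne_top (hμ.tsum_enorm_le ℓ₀ ξ))

lemma norm_dilateTsum_le (hμ : LacunaryMult μ C) (ℓ₀ : ℤ) (ξ : ℝ) :
    ‖dilateTsum μ ℓ₀ ξ‖ ≤ C * 16 := by
  have h : ‖dilateTsum μ ℓ₀ ξ‖ₑ ≤ ENNReal.ofReal (C * 16) :=
    enorm_tsum_le_tsum_enorm.trans (hμ.tsum_enorm_le ℓ₀ ξ)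
  rwa [← ofReal_norm, ENNReal.ofReal_le_ofReal_iff (by linarith [hμ.pos])] at h

lemma continuous_dilateSum (hμ : LacunaryMult μ C) (ℓ₀ : ℤ) (n : ℕ) :
    Continuous (dilateSum μ ℓ₀ n) :=
  continuous_finsetSum _ fun _ _ => hμ.cont.comp (continuous_const.mul continuous_id)

lemma stronglyMeasurable_dilateTsum (hμ : LacunaryMult μ C) (ℓ₀ : ℤ) :
    StronglyMeasurable (dilateTsum μ ℓ₀) :=
  stronglyMeasurable_of_tendsto atTop (fun n => (hμ.continuous_dilateSum ℓ₀ n).stronglyMeasurable)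
    (tendsto_pi_nhds.2 fun ξ => (hμ.summable ℓ₀ ξ).hasSum.tendsto_sum_nat)

lemma stronglyMeasurable_dilateErr (hμ : LacunaryMult μ C) (ℓ₀ : ℤ) (n : ℕ) :
    StronglyMeasurable (dilateErr μ ℓ₀ n) := by
  have h1 : Continuous fun ξ : ℝ => 1 - Lh ((2 : ℝ) ^ (ℓ₀ + (n : ℤ)) * ξ) :=
    continuous_const.sub (continuous_Lh.comp (continuous_const.mul continuous_id))
  exact (hμ.continuous_dilateSum ℓ₀ n).stronglyMeasurable.sub
    (h1.stronglyMeasurable.mul (hμ.stronglyMeasurable_dilateTsum ℓ₀))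

lemma norm_dilateSum_le (hμ : LacunaryMult μ C) (ℓ₀ : ℤ) (n : ℕ) (ξ : ℝ) :
    ‖dilateSum μ ℓ₀ n ξ‖ ≤ C * |(2 : ℝ) ^ (ℓ₀ + (n : ℤ)) * ξ| := by
  have hC := hμ.pos
  unfold dilateSum
  induction n with
  | zero => simpa using by positivity
  | succ n ih =>
    rw [Finset.sum_range_succ]
    refine (norm_add_le _ _).trans ((add_le_add ih (hμ.small _)).trans (le_of_eq ?_))
    rw [abs_mul, abs_mul, abs_of_pos (by positivity : (0 : ℝ) < 2 ^ (ℓ₀ + (n : ℤ))),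
      abs_of_pos (by positivity : (0 : ℝ) < 2 ^ (ℓ₀ + ((n + 1 : ℕ) : ℤ)))]
    push_cast
    rw [← add_assoc, zpow_add_one₀ (by norm_num)]
    ring

lemma norm_dilateTsum_sub_mul_le (hμ : LacunaryMult μ C) (ℓ₀ : ℤ) (n : ℕ) (ξ : ℝ) :
    ‖dilateTsum μ ℓ₀ ξ - dilateSum μ ℓ₀ n ξ‖ * |(2 : ℝ) ^ (ℓ₀ + (n : ℤ)) * ξ| ≤ 2 * C := by
  set a := |(2 : ℝ) ^ (ℓ₀ + (n : ℤ)) * ξ| with ha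
  have hC := hμ.pos
  rcases eq_or_ne ξ 0 with rfl | hξ
  · simp only [ha, mul_zero, abs_zero]
    positivity
  have ha0 : 0 < a := abs_pos.2 (mul_ne_zero (by positivity) hξ)
  have h1 := (hμ.summable ℓ₀ ξ).sum_add_tsum_nat_add n
  have h2 : dilateTsum μ ℓ₀ ξ - dilateSum μ ℓ₀ n ξ =
      ∑' i : ℕ, μ ((2 : ℝ) ^ (ℓ₀ + ((i + n : ℕ) : ℤ)) * ξ) := by
    rw [dilateTsum, dilateSum, ← h1, add_sub_cancel_left]
  rw [h2, ← le_div_iff₀ ha0]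
  have h3 : HasSum (fun i : ℕ => C / a * (1 / 2 : ℝ) ^ i) (C / a * 2) := hasSum_geometric_two.mul_left _
  refine (tsum_of_norm_bounded h3 fun i => ?_).trans (le_of_eq (by ring))
  have h4 := hμ.large ((2 : ℝ) ^ (ℓ₀ + ((i + n : ℕ) : ℤ)) * ξ)
  have h5 : |(2 : ℝ) ^ (ℓ₀ + ((i + n : ℕ) : ℤ)) * ξ| = a * 2 ^ i := by
    rw [ha, abs_mul, abs_mul, abs_of_pos (by positivity : (0 : ℝ) < 2 ^ (ℓ₀ + (n : ℤ))),
      abs_of_pos (by positivity : (0 : ℝ) < 2 ^ (ℓ₀ + ((i + n : ℕ) : ℤ)))]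
    push_cast
    rw [show ℓ₀ + ((i : ℤ) + n) = ℓ₀ + n + i by ring, zpow_add₀ (by norm_num) (ℓ₀ + n) i,
      zpow_natCast]
    ring
  rw [h5, ← le_div_iff₀ (by positivity)] at h4
  refine h4.trans (le_of_eq ?_)
  rw [div_pow, one_pow]
  field_simp

lemma enorm_dilateErr_sq_le (hμ : LacunaryMult μ C) (ℓ₀ : ℤ) (n : ℕ) (ξ : ℝ) :
    ‖dilateErr μ ℓ₀ n ξ‖ ≤ 250 * C ∧
    ‖dilateErr μ ℓ₀ n ξ‖ₑ ^ 2 ≤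
      ENNReal.ofReal ((250 * C) ^ 2) * wt ((2 : ℝ) ^ (ℓ₀ + (n : ℤ)) * ξ) := by
  have hC := hμ.pos
  have hK := hμ.norm_dilateTsum_le ℓ₀ ξ
  have hS := hμ.norm_dilateSum_le ℓ₀ n ξ
  have hT := hμ.norm_dilateTsum_sub_mul_le ℓ₀ n ξ
  set ζ := (2 : ℝ) ^ (ℓ₀ + (n : ℤ)) * ξ with hζ
  have hL := norm_Lh_sub_one_le ζ
  have hL1 := Bump.norm_Lh_mul_abs_le ζ
  have hL2 := norm_Lh_le_one ζ
  have hπ := Real.pi_lt_d2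
  have ha := abs_nonneg ζ
  have e1 : dilateErr μ ℓ₀ n ξ = dilateSum μ ℓ₀ n ξ + (Lh ζ - 1) * dilateTsum μ ℓ₀ ξ := by
    rw [dilateErr, ← hζ]; ring
  have e2 : dilateErr μ ℓ₀ n ξ =
      Lh ζ * dilateTsum μ ℓ₀ ξ - (dilateTsum μ ℓ₀ ξ - dilateSum μ ℓ₀ n ξ) := by
    rw [dilateErr, ← hζ]; ring
  have b1 : ‖dilateErr μ ℓ₀ n ξ‖ ≤ (250 * C) * |ζ| := by
    rw [e1]
    refine (norm_add_le _ _).trans ?_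
    rw [norm_mul]
    have : ‖Lh ζ - 1‖ * ‖dilateTsum μ ℓ₀ ξ‖ ≤ (4 * Real.pi * |ζ|) * (C * 16) :=
      mul_le_mul hL hK (norm_nonneg _) (by positivity)
    have h2 : Real.pi * (|ζ| * C) ≤ 3.15 * (|ζ| * C) := by gcongr
    nlinarith [mul_nonneg ha hC.le]
  have b2 : ‖dilateErr μ ℓ₀ n ξ‖ * |ζ| ≤ 250 * C := by
    have h1 : ‖dilateErr μ ℓ₀ n ξ‖ ≤
        ‖Lh ζ‖ * ‖dilateTsum μ ℓ₀ ξ‖ + ‖dilateTsum μ ℓ₀ ξ - dilateSum μ ℓ₀ n ξ‖ := by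
      rw [e2, ← norm_mul]
      exact norm_sub_le _ _
    have h2 := mul_le_mul_of_nonneg_right h1 ha
    have h3 : (‖Lh ζ‖ * |ζ|) * ‖dilateTsum μ ℓ₀ ξ‖ ≤ 1 * (C * 16) :=
      mul_le_mul hL1 hK (norm_nonneg _) zero_le_one
    nlinarith
  have b3 : ‖dilateErr μ ℓ₀ n ξ‖ ≤ 250 * C := by
    rcases le_total |ζ| 1 with h | h
    · exact b1.trans (mul_le_of_le_one_right (by positivity) h)
    · exact (le_mul_of_one_le_right (norm_nonneg _) h).trans b2
  exact ⟨b3, enorm_sq_le_mul_wt (by positivity) b3 b1 b2 (by positivity)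
    (le_of_eq (by ring))⟩

end LacunaryMult

lemma sum_incr_sq_le_tsum (e : ℕ → ℂ) {v : ℕ → ℕ} (hv : Antitone v) (k : ℕ) :
    ∑ i ∈ Finset.range k, incr e v i ^ 2 ≤ 4 * ∑' n, ‖e n‖ₑ ^ 2 := by
  have key : ∀ m, ∑ i ∈ Finset.range m, incr e v i ^ 2 + 2 * ‖e (v m)‖ₑ ^ 2 ≤
      4 * ∑' n, if v m ≤ n then ‖e n‖ₑ ^ 2 else 0 := fun m => by
    induction m with
    | zero =>
      have := ENNReal.le_tsum (f := fun n => if v 0 ≤ n then ‖e n‖ₑ ^ 2 else 0) (v 0)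
      rw [if_pos le_rfl] at this
      rw [Finset.sum_range_zero, zero_add]
      exact mul_le_mul' (by norm_num) this
    | succ m ih =>
      rcases (hv (Nat.le_succ m)).eq_or_lt with h | h
      · rw [Finset.sum_range_succ, show incr e v m = 0 by simp [incr, h]]
        simpa [h] using ih
      · replace h : v (m + 1) < v m := h
        have h1 : incr e v m ^ 2 ≤ 2 * (‖e (v (m + 1))‖ₑ ^ 2 + ‖e (v m)‖ₑ ^ 2) :=
          (pow_le_pow_left₀ zero_le enorm_sub_le 2).trans (ennreal_add_sq_le _ _)
        have h2 : (∑' n, if v m ≤ n then ‖e n‖ₑ ^ 2 else 0) + ‖e (v (m + 1))‖ₑ ^ 2 ≤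
            ∑' n, if v (m + 1) ≤ n then ‖e n‖ₑ ^ 2 else 0 := by
          rw [← tsum_ite_eq (v (m + 1)) fun n => ‖e n‖ₑ ^ 2, ← ENNReal.tsum_add]
          refine ENNReal.tsum_le_tsum fun n => ?_
          by_cases h3 : n = v (m + 1)
          · rw [if_neg (by omega), if_pos h3, if_pos (by omega), zero_add]
          · rw [if_neg h3, add_zero]
            by_cases h4 : v m ≤ n
            · rw [if_pos h4, if_pos (by omega)]
            · rw [if_neg h4]
              exact zero_le
        rw [Finset.sum_range_succ]
        calc _ ≤ ∑ i ∈ Finset.range m, incr e v i ^ 2 +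
              2 * (‖e (v (m + 1))‖ₑ ^ 2 + ‖e (v m)‖ₑ ^ 2) + 2 * ‖e (v (m + 1))‖ₑ ^ 2 := by gcongr
          _ = (∑ i ∈ Finset.range m, incr e v i ^ 2 + 2 * ‖e (v m)‖ₑ ^ 2) +
              4 * ‖e (v (m + 1))‖ₑ ^ 2 := by ring
          _ ≤ 4 * ((∑' n, if v m ≤ n then ‖e n‖ₑ ^ 2 else 0) + ‖e (v (m + 1))‖ₑ ^ 2) := by
            rw [mul_add]; gcongr
          _ ≤ _ := by gcongr
  refine (le_self_add.trans (key k)).trans (mul_le_mul' le_rfl (ENNReal.tsum_le_tsum fun n => ?_))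
  split_ifs <;> simp

/-- The partial sums of the dilates of a lacunary multiplier have bounded variation. -/
lemma LacunaryMult.exists_partial_sum_bound {μ : ℝ → ℂ} {C : ℝ} (hμ : LacunaryMult μ C)
    {h : ℝ → ℂ} (hh : Nice h) (ℓ₀ : ℤ) {r : ℝ} (hr : 2 < r) (hr3 : r < 3) :
    ∃ G : ℝ → ℝ≥0∞, Measurable G ∧
      (∀ x, ∀ v : ℕ → ℕ, Antitone v → ∀ k,
        lrNorm r k (incr (fun n => synth (fun ξ => dilateSum μ ℓ₀ n ξ * h ξ) x) v) ^ 2 ≤ G x) ∧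
      ∫⁻ x, G x ≤ ENNReal.ofReal (12000000 * (C + 1) ^ 2) * ENNReal.ofReal (r - 2)⁻¹ * energy h := by
  have hC := hμ.pos
  set g : ℝ → ℂ := fun ξ => dilateTsum μ ℓ₀ ξ * h ξ with hg
  have hgn : Nice g := hh.mul (hμ.stronglyMeasurable_dilateTsum ℓ₀) (hμ.norm_dilateTsum_le ℓ₀)
  have hge : energy g ≤ ENNReal.ofReal ((C * 16) ^ 2) * energy h :=
    Nice.energy_mul_le h (hμ.norm_dilateTsum_le ℓ₀)
  have hen : ∀ n, Nice fun ξ => dilateErr μ ℓ₀ n ξ * h ξ := fun n =>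
    hh.mul (hμ.stronglyMeasurable_dilateErr ℓ₀ n) fun ξ => (hμ.enorm_dilateErr_sq_le ℓ₀ n ξ).1
  set e : ℕ → ℝ → ℂ := fun n x => synth (fun ξ => dilateErr μ ℓ₀ n ξ * h ξ) x with he
  have hem : ∀ n, Measurable fun x => ‖e n x‖ₑ ^ 2 := fun n =>
    (continuous_synth (hen n).int).measurable.enorm.pow_const 2
  have hE : ∫⁻ x, ∑' n, ‖e n x‖ₑ ^ 2 ≤ ENNReal.ofReal ((250 * C) ^ 2) * 16 * energy h := by
    rw [lintegral_tsum fun n => (hem n).aemeasurable]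
    have h1 : ∀ n, ∫⁻ x, ‖e n x‖ₑ ^ 2 ≤ ∫⁻ ξ, ENNReal.ofReal ((250 * C) ^ 2) *
        wt ((2 : ℝ) ^ (ℓ₀ + (n : ℤ)) * ξ) * ‖h ξ‖ₑ ^ 2 := fun n => by
      refine (energy_synth (hen n)).le.trans (lintegral_mono fun ξ => ?_)
      rw [enorm_mul, mul_pow]
      exact mul_le_mul' (hμ.enorm_dilateErr_sq_le ℓ₀ n ξ).2 le_rfl
    have hwm : ∀ n : ℕ, Measurable fun ξ : ℝ => ENNReal.ofReal ((250 * C) ^ 2) *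
        wt ((2 : ℝ) ^ (ℓ₀ + (n : ℤ)) * ξ) * ‖h ξ‖ₑ ^ 2 := fun n => by
      have := hh.meas.measurable
      have h2 : Measurable fun ξ : ℝ => wt ((2 : ℝ) ^ (ℓ₀ + (n : ℤ)) * ξ) :=
        measurable_wt.comp (measurable_const_mul _)
      fun_prop
    refine (ENNReal.tsum_le_tsum h1).trans ?_
    rw [← lintegral_tsum fun n => (hwm n).aemeasurable, energy,
      ← lintegral_const_mul' _ _ (by finiteness)]
    refine lintegral_mono fun ξ => ?_
    simp only [ENNReal.tsum_mul_right, ENNReal.tsum_mul_left]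
    exact mul_le_mul' (mul_le_mul' le_rfl (tsum_wt_nat_le ℓ₀ ξ)) le_rfl
  refine ⟨fun x => 2 * (avgMaj r g x + 4 * ∑' n, ‖e n x‖ₑ ^ 2), ?_, ?_, ?_⟩
  · have h1 := measurable_avgMaj r hgn.int
    have h2 : Measurable fun x => ∑' n, ‖e n x‖ₑ ^ 2 := Measurable.tsum hem
    fun_prop
  · intro x v hv k
    have hdec : ∀ n, synth (fun ξ => dilateSum μ ℓ₀ n ξ * h ξ) x =
        (synth g x - aS g (ℓ₀ + (n : ℤ)) x) + e n x := fun n => by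
      rw [aS, ← synth_sub hgn.int (nice_aS hgn _).int, he]
      simp only
      rw [← synth_add (g := fun ξ => g ξ - Lh ((2 : ℝ) ^ (ℓ₀ + (n : ℤ)) * ξ) * g ξ)
        (hgn.int.sub (nice_aS hgn _).int) (hen n).int]
      congr 1
      ext ξ
      simp only [hg, dilateErr]
      ring
    have hA : lrNorm r k (incr (fun n : ℕ => synth g x - aS g (ℓ₀ + (n : ℤ)) x) v) ^ 2 ≤
        avgMaj r g x := by
      refine le_of_eq_of_le ?_ (lrNorm_aS_le hr hr3 hgn.int
        (v := fun i => ℓ₀ + ((v i : ℕ) : ℤ)) (fun i j hij => ?_) k x)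
      · congr 2
        ext i
        rw [incr, incr, sub_sub_sub_cancel_left, enorm_sub_rev]
      · have := hv hij
        simp only
        omega
    refine sq_lrNorm_incr_add_le (by linarith) k (c := fun n => e n x) (fun i => hdec (v i)) hA ?_
    refine (pow_le_pow_left₀ zero_le (lrNorm_le_two hr k _) 2).trans ?_
    rw [lrNorm_two_sq]
    exact sum_incr_sq_le_tsum (fun n => e n x) hv k
  · have h1 := measurable_avgMaj r hgn.int
    have hr1 : (1 : ℝ≥0∞) ≤ ENNReal.ofReal (r - 2)⁻¹ := by
      rw [ENNReal.one_le_ofReal]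
      exact (one_le_inv₀ (by linarith)).2 (by linarith)
    have h2 : Measurable fun x => ∑' n, ‖e n x‖ₑ ^ 2 := Measurable.tsum hem
    rw [lintegral_const_mul _ (by fun_prop), lintegral_add_left h1, lintegral_const_mul _ h2]
    have h3 : (∫⁻ x, avgMaj r g x) ≤ ENNReal.ofReal (5000 * (C * 16) ^ 2) *
        ENNReal.ofReal (r - 2)⁻¹ * energy h := by
      refine (lintegral_avgMaj_le hr hr3 hgn).trans ((mul_le_mul' le_rfl hge).trans (le_of_eq ?_))
      rw [ENNReal.ofReal_mul (by norm_num) (p := 5000), ENNReal.ofReal_ofNat]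
      ring
    have h4 : 4 * (∫⁻ x, ∑' n, ‖e n x‖ₑ ^ 2) ≤ ENNReal.ofReal (64 * (250 * C) ^ 2) *
        ENNReal.ofReal (r - 2)⁻¹ * energy h := by
      refine (mul_le_mul' le_rfl hE).trans ?_
      rw [ENNReal.ofReal_mul (by norm_num) (p := 64), ENNReal.ofReal_ofNat]
      calc _ = (64 * ENNReal.ofReal ((250 * C) ^ 2)) * 1 * energy h := by ring
        _ ≤ _ := by gcongr
    refine (mul_le_mul' le_rfl (add_le_add h3 h4)).trans ?_
    rw [← add_mul, ← add_mul, ← ENNReal.ofReal_add (by positivity) (by positivity), ← mul_assoc,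
      ← mul_assoc, ← ENNReal.ofReal_ofNat 2, ← ENNReal.ofReal_mul (by norm_num)]
    refine mul_le_mul' (mul_le_mul' (ENNReal.ofReal_le_ofReal ?_) le_rfl) le_rfl
    nlinarith

open scoped FourierTransform

lemma hasSum_scale_window (b : ℤ → ℂ) (ℓ₀ j : ℤ) :
    HasSum (fun ℓ : ℤ => if ℓ₀ ≤ ℓ ∧ ℓ < j then b ℓ else 0)
      (∑ i ∈ Finset.range (j - ℓ₀).toNat, b (ℓ₀ + (i : ℤ))) := by
  have hinj : Function.Injective fun i : ℕ => ℓ₀ + (i : ℤ) := fun a b h => by simpa using h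
  refine (hinj.hasSum_iff fun ℓ hℓ => if_neg fun h => hℓ ?_).1 ?_
  · exact ⟨(ℓ - ℓ₀).toNat, by have := h.1; simp only; omega⟩
  · have h1 : ∑ i ∈ Finset.range (j - ℓ₀).toNat, b (ℓ₀ + (i : ℤ)) =
        ∑ i ∈ Finset.range (j - ℓ₀).toNat,
          ((fun ℓ : ℤ => if ℓ₀ ≤ ℓ ∧ ℓ < j then b ℓ else 0) ∘ fun i : ℕ => ℓ₀ + (i : ℤ)) i := by
      refine Finset.sum_congr rfl fun i hi => ?_
      have := Finset.mem_range.1 hi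
      simp only [Function.comp]
      rw [if_pos (by omega)]
    rw [h1]
    refine hasSum_sum_of_ne_finset_zero fun i hi => ?_
    have := mt Finset.mem_range.2 hi
    simp only [Function.comp]
    rw [if_neg (by omega)]

lemma synth_finset_sum {ι : Type*} (s : Finset ι) {m : ι → ℝ → ℂ} (hm : ∀ i, Integrable (m i))
    (x : ℝ) : synth (fun ξ => ∑ i ∈ s, m i ξ) x = ∑ i ∈ s, synth (m i) x := by
  simp only [synth, Finset.mul_sum]
  exact integral_finsetSum _ fun i _ => integrable_ex_mul (hm i) x

lemma Bump.exists_lacunaryMult {ψ : ℝ → ℂ} (hψ : Bump ψ) {d : ℕ} (hd : 1 ≤ d)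
    (h0 : osc ψ d 0 0 = 0) : ∃ C, LacunaryMult (osc ψ d 0) C := by
  obtain ⟨C, hC, h1, h2, h3, -⟩ := hψ.exists_osc_bound hd
  have hc : Continuous fun ξ : ℝ => osc ψ d 0 ξ :=
    (hψ.continuous_osc d).comp (g := Function.uncurry (osc ψ d)) (f := fun ξ : ℝ => ((0 : ℝ), ξ))
      (by fun_prop)
  refine ⟨C, ⟨hc, hC, h1 0, fun ξ => ?_, fun ξ => h3 0 ξ (by simp)⟩⟩
  have := h2 0 ξ
  rwa [h0, sub_zero] at this

namespace Cutoff

variable {φ : ℝ → ℝ} {d : ℕ}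

lemma integral_piece_eq (φ : ℝ → ℝ) (d : ℕ) (ℓ : ℤ) (u x : ℝ) (f : ℝ → ℂ) :
    ∫ t : ℝ, f (x - t) * ((φ ((2 : ℝ) ^ (-ℓ) * t) : ℝ) : ℂ) *
      Complex.exp (Complex.I * (u : ℂ) * (t : ℂ) ^ d) / (t : ℂ) =
    ∫ t : ℝ, (φ t : ℂ) / (t : ℂ) *
      (cis ((u * ((2 : ℝ) ^ d) ^ ℓ) * t ^ d) * f (x - (2 : ℝ) ^ ℓ * t)) := by
  have h2 : (0 : ℝ) < 2 ^ ℓ := by positivity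
  have h := Measure.integral_comp_mul_left (fun t : ℝ => f (x - t) *
    ((φ ((2 : ℝ) ^ (-ℓ) * t) : ℝ) : ℂ) *
      Complex.exp (Complex.I * (u : ℂ) * (t : ℂ) ^ d) / (t : ℂ)) ((2 : ℝ) ^ ℓ)
  rw [abs_of_pos (inv_pos.2 h2), eq_inv_smul_iff₀ h2.ne', ← integral_smul] at h
  rw [← h]
  refine integral_congr_ae (Eventually.of_forall fun t => ?_)
  have h3 : (2 : ℝ) ^ (-ℓ) * ((2 : ℝ) ^ ℓ * t) = t := by
    rw [← mul_assoc, ← zpow_add₀ (by norm_num), neg_add_cancel, zpow_zero, one_mul]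
  have h4 : ((2 : ℝ) ^ d) ^ ℓ = ((2 : ℝ) ^ ℓ) ^ d := by
    rw [← zpow_natCast, ← zpow_natCast, ← zpow_mul, ← zpow_mul, mul_comm]
  have h5 : Complex.exp (Complex.I * (u : ℂ) * (((2 : ℝ) ^ ℓ * t : ℝ) : ℂ) ^ d) =
      cis ((u * ((2 : ℝ) ^ d) ^ ℓ) * t ^ d) := by
    rw [cis, h4]
    congr 1
    push_cast
    ring
  have h6 : (((2 : ℝ) ^ ℓ : ℝ) : ℂ) ≠ 0 := by exact_mod_cast h2.ne'
  simp only [h3, h5, Complex.real_smul]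
  rw [Complex.ofReal_mul, mul_comm (((2 : ℝ) ^ ℓ : ℝ) : ℂ) (t : ℂ), ← div_div]
  field_simp

lemma norm_synth_osc_le {ψ : ℝ → ℂ} (hψ : Bump ψ) {A : ℝ} (hA : ∀ t, ‖ψ t‖ ≤ A) (d : ℕ) (lam : ℝ)
    {c : ℝ} (hc : 0 < c) {h : ℝ → ℂ} (hh : Integrable h) (hf : Integrable (synth h)) (x : ℝ) :
    ‖synth (fun ξ => osc ψ d lam (c * ξ) * h ξ) x‖ ≤ A * (c⁻¹ * ∫ t, ‖synth h t‖) := by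
  rw [synth_osc hψ d lam c hh x]
  have h1 : Integrable fun t => ‖synth h (x - c * t)‖ :=
    ((hf.comp_sub_left x).comp_mul_left' hc.ne').norm
  have h2 : ∫ t, ‖synth h (x - c * t)‖ = c⁻¹ * ∫ t, ‖synth h t‖ := by
    rw [Measure.integral_comp_mul_left (fun t => ‖synth h (x - t)‖) c,
      integral_sub_left_eq_self (fun t => ‖synth h t‖), abs_of_pos (inv_pos.2 hc), smul_eq_mul]
  rw [← h2, ← integral_const_mul]
  refine norm_integral_le_of_norm_le (h1.const_mul A) (Eventually.of_forall fun t => ?_)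
  rw [norm_mul, norm_mul, norm_cis, one_mul]
  exact mul_le_mul_of_nonneg_right (hA t) (norm_nonneg _)

lemma summable_pieces {ψ : ℝ → ℂ} (hψ : Bump ψ) (d : ℕ) (ℓ₀ : ℤ) (u : ℝ) {h : ℝ → ℂ}
    (hh : Integrable h) (hf : Integrable (synth h)) (x : ℝ) :
    Summable fun ℓ : ℤ => if ℓ₀ ≤ ℓ then
      synth (fun ξ => osc ψ d (u * ((2 : ℝ) ^ d) ^ ℓ) ((2 : ℝ) ^ ℓ * ξ) * h ξ) x else 0 := by
  obtain ⟨A, -, hA, -⟩ := hψ.exists_bound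
  have hinj : Function.Injective fun i : ℕ => ℓ₀ + (i : ℤ) := fun a b h => by simpa using h
  refine (hinj.summable_iff fun ℓ hℓ => if_neg fun h => hℓ ?_).1 ?_
  · exact ⟨(ℓ - ℓ₀).toNat, by simp only; omega⟩
  · refine Summable.of_norm_bounded
      (g := fun n : ℕ => A * (((2 : ℝ) ^ ℓ₀)⁻¹ * ∫ t, ‖synth h t‖) * (1 / 2 : ℝ) ^ n)
      (summable_geometric_two.mul_left _) fun n => ?_
    simp only [Function.comp]
    rw [if_pos (by omega)]
    refine (norm_synth_osc_le hψ hA d _ (by positivity) hh hf x).trans (le_of_eq ?_)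
    rw [zpow_add₀ (by norm_num), mul_inv, zpow_natCast, div_pow, one_pow]
    ring

/-- Decomposition of each piece into a low frequency part, a part independent of the modulation
parameter, and a part with cancellation. -/
lemma piece_decomposition (hφ : Cutoff φ) (d : ℕ) (ℓ₀ : ℤ) (u : ℝ) {h : ℝ → ℂ} (hh : Nice h)
    (x : ℝ) (M : ℤ) :
    shiftPiece (highMult (fun t => (φ t : ℂ) / (t : ℂ)) d M) ℓ₀ d M h u x =
      (fun ℓ : ℤ => (if ℓ₀ ≤ ℓ then
          synth (fun ξ => osc (fun t => (φ t : ℂ) / (t : ℂ)) d (u * ((2 : ℝ) ^ d) ^ ℓ)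
            ((2 : ℝ) ^ ℓ * ξ) * h ξ) x else 0) -
        (osc (fun t => (φ t : ℂ) / (t : ℂ)) d (u * ((2 : ℝ) ^ d) ^ ℓ) 0 *
            (if ℓ₀ ≤ ℓ then aS h ℓ x else 0) +
          if ℓ₀ ≤ ℓ ∧ ℓ < scaleIdx d u then
            synth (fun ξ => osc (fun t => (φ t : ℂ) / (t : ℂ)) d 0 ((2 : ℝ) ^ ℓ * ξ) * h ξ) x
          else 0)) (M + scaleIdx d u) := by
  simp only
  set ψ : ℝ → ℂ := fun t => (φ t : ℂ) / (t : ℂ) with hψd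
  have hψ : Bump ψ := hφ.bump_div
  rw [shiftPiece, add_comm (scaleIdx d u) M]
  set ℓ := M + scaleIdx d u with hℓ
  by_cases h1 : ℓ₀ ≤ ℓ
  swap
  · simp [h1]
  have hf := hψ.multFam_osc d
  have i1 := (hf.nice_dilate hh (u * ((2 : ℝ) ^ d) ^ ℓ) ((2 : ℝ) ^ ℓ)).int
  have i2 := (hf.nice_dilate hh 0 ((2 : ℝ) ^ ℓ)).int
  have i3 := ((nice_aS hh ℓ).int).const_mul (osc ψ d (u * ((2 : ℝ) ^ d) ^ ℓ) 0)
  have h00 : osc ψ d 0 0 = 0 := hφ.osc_div_zero d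
  rw [if_pos h1, if_pos h1, if_pos h1, aS, ← synth_const_mul]
  by_cases h2 : M < 0
  · rw [if_pos ⟨h1, by omega⟩, ← synth_add i3 i2, ← synth_sub
      (h := fun ξ => osc ψ d (u * ((2 : ℝ) ^ d) ^ ℓ) 0 * (Lh ((2 : ℝ) ^ ℓ * ξ) * h ξ) +
        osc ψ d 0 ((2 : ℝ) ^ ℓ * ξ) * h ξ) i1 (i3.add i2)]
    congr 1
    ext ξ
    simp only [highMult, oscHigh, h2, if_true, h00]
    ring
  · rw [if_neg (by omega), add_zero, ← synth_sub i1 i3]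
    congr 1
    ext ξ
    simp only [highMult, oscHigh, h2, if_false]
    ring

end Cutoff

lemma synth_dilateSum {μ : ℝ → ℂ} {C : ℝ} (hμ : LacunaryMult μ C) {h : ℝ → ℂ} (hh : Nice h)
    (ℓ₀ : ℤ) (n : ℕ) (x : ℝ) :
    synth (fun ξ => dilateSum μ ℓ₀ n ξ * h ξ) x =
      ∑ i ∈ Finset.range n, synth (fun ξ => μ ((2 : ℝ) ^ (ℓ₀ + (i : ℤ)) * ξ) * h ξ) x := by
  simp only [dilateSum, Finset.sum_mul]
  refine synth_finset_sum _ (m := fun (i : ℕ) ξ => μ ((2 : ℝ) ^ (ℓ₀ + (i : ℤ)) * ξ) * h ξ)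
    (fun i => ?_) x
  exact (hh.mul (m := fun ξ => μ ((2 : ℝ) ^ (ℓ₀ + (i : ℤ)) * ξ))
    (hμ.cont.comp (continuous_const.mul continuous_id)).stronglyMeasurable fun ξ => hμ.bdd _).int

/-- The square of the variation is dominated by a measurable function with small integral. -/
lemma Cutoff.exists_variation_bound {φ : ℝ → ℝ} (hφ : Cutoff φ) {d : ℕ} (hd : 2 ≤ d) :
    ∃ C : ℝ≥0, ∀ (h : ℝ → ℂ) (ℓ₀ : ℤ) (r : ℝ), Nice h → Integrable (synth h) → 2 < r → r < 3 →
      ∃ G : ℝ → ℝ≥0∞, Measurable G ∧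
        (∀ x, ∀ u : ℕ → ℝ, Monotone u → (∀ i, u i ∈ Ioi (0 : ℝ)) → ∀ k,
          lrNorm r k (incr (fun v => ∑' ℓ : ℤ, if ℓ₀ ≤ ℓ then
            synth (fun ξ => osc (fun t => (φ t : ℂ) / (t : ℂ)) d (v * ((2 : ℝ) ^ d) ^ ℓ)
              ((2 : ℝ) ^ ℓ * ξ) * h ξ) x else 0) u) ^ 2 ≤ G x) ∧
        ∫⁻ x, G x ≤ C * ENNReal.ofReal (r - 2)⁻¹ ^ 2 * energy h := by
  have hd1 : 1 ≤ d := by omega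
  have hψ := hφ.bump_div
  obtain ⟨CA, hA⟩ := hφ.exists_low_bound hd1
  obtain ⟨CB, hμ⟩ := hψ.exists_lacunaryMult hd1 (hφ.osc_div_zero d)
  obtain ⟨CC, hC⟩ := hψ.exists_high_bound hd
  refine ⟨4 * CA + 4 * (12000000 * (CB + 1) ^ 2).toNNReal + 2 * CC,
    fun h ℓ₀ r hh hf hr hr3 => ?_⟩
  obtain ⟨GA, hGA, hAv, hAi⟩ := hA h ℓ₀ r hh hr hr3
  obtain ⟨GB, hGB, hBv, hBi⟩ := hμ.exists_partial_sum_bound hh ℓ₀ hr hr3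
  obtain ⟨GC, hGC, hCv, hCi⟩ := hC h ℓ₀ r hh hr hr3
  refine ⟨fun x => 2 * (2 * (GA x + GB x) + GC x), by fun_prop, ?_, ?_⟩
  · intro x u hu hu0 k
    set ψ : ℝ → ℂ := fun t => (φ t : ℂ) / (t : ℂ) with hψd
    set T : ℝ → ℂ := fun v => ∑' ℓ : ℤ, if ℓ₀ ≤ ℓ then
      synth (fun ξ => osc ψ d (v * ((2 : ℝ) ^ d) ^ ℓ) ((2 : ℝ) ^ ℓ * ξ) * h ξ) x else 0 with hT
    set c : ℤ → ℂ := fun ℓ => if ℓ₀ ≤ ℓ then aS h ℓ x else 0 with hc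
    have hcb : ∀ ℓ, ‖c ℓ‖ ≤ ∫ ξ, ‖h ξ‖ := fun ℓ => by
      simp only [hc]
      split_ifs
      · exact norm_aS_le hh.int ℓ x
      · rw [norm_zero]
        exact integral_nonneg fun _ => norm_nonneg _
    set FA : ℝ → ℂ := fun v =>
      -(1 / (d : ℂ)) * ∫ s in Ioi 0, edgeSlope φ d s * c (1 - scaleIdx d (s / v)) with hFA
    set b : ℤ → ℂ := fun ℓ => synth (fun ξ => osc ψ d 0 ((2 : ℝ) ^ ℓ * ξ) * h ξ) x with hb
    set FB : ℕ → ℂ := fun n => synth (fun ξ => dilateSum (osc ψ d 0) ℓ₀ n ξ * h ξ) x with hFB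
    have sT : ∀ v, HasSum (fun ℓ : ℤ => if ℓ₀ ≤ ℓ then
        synth (fun ξ => osc ψ d (v * ((2 : ℝ) ^ d) ^ ℓ) ((2 : ℝ) ^ ℓ * ξ) * h ξ) x else 0) (T v) :=
      fun v => (Cutoff.summable_pieces hψ d ℓ₀ v hh.int hf x).hasSum
    have sA : ∀ v, 0 < v → HasSum (fun ℓ : ℤ => osc ψ d (v * ((2 : ℝ) ^ d) ^ ℓ) 0 * c ℓ) (FA v) :=
      fun v hv => hφ.hasSum_low hd1 hcb hv
    have sB : ∀ v, HasSum (fun ℓ : ℤ => if ℓ₀ ≤ ℓ ∧ ℓ < scaleIdx d v then b ℓ else 0)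
        (FB (scaleIdx d v - ℓ₀).toNat) := fun v => by
      simp only [hFB]
      rw [synth_dilateSum hμ hh]
      exact hasSum_scale_window b ℓ₀ (scaleIdx d v)
    set FC : ℝ → ℂ := fun v => T v - (FA v + FB (scaleIdx d v - ℓ₀).toNat) with hFC
    have sC : ∀ v, 0 < v → HasSum (fun M => shiftPiece (highMult ψ d M) ℓ₀ d M h v x) (FC v) :=
      fun v hv => by
        have := ((Equiv.addRight (scaleIdx d v)).hasSum_iff).2 ((sT v).sub ((sA v hv).add (sB v)))
        refine Eq.mpr (congrArg (HasSum · _) (funext fun M => ?_)) this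
        exact hφ.piece_decomposition d ℓ₀ v hh x M
    have vA := hAv x FA sA u hu hu0 k
    have vB := hBv x (fun i => (scaleIdx d (u i) - ℓ₀).toNat) (fun i j hij =>
      Int.toNat_le_toNat (sub_le_sub_right (scaleIdx_anti (hu0 i) (hu hij)) _)) k
    have vC := hCv x FC sC u hu hu0 k
    refine sq_lrNorm_incr_add_le (by linarith) k
      (b := fun v => FA v + FB (scaleIdx d v - ℓ₀).toNat) (c := FC) (fun i => ?_)
      (sq_lrNorm_incr_add_le (by linarith) k (b := FA)
        (c := fun v => FB (scaleIdx d v - ℓ₀).toNat) (fun i => rfl) vA vB) vC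
    simp only [hFC]
    ring
  · have hr1 : (1 : ℝ≥0∞) ≤ ENNReal.ofReal (r - 2)⁻¹ := by
      rw [ENNReal.one_le_ofReal]
      exact (one_le_inv₀ (by linarith)).2 (by linarith)
    set R := ENNReal.ofReal (r - 2)⁻¹ with hR
    have hRR : R ≤ R ^ 2 := le_self_pow₀ hr1 two_ne_zero
    rw [lintegral_const_mul _ (by fun_prop), lintegral_add_right _ hGC,
      lintegral_const_mul _ (by fun_prop), lintegral_add_right _ hGB]
    have hAi' := hAi.trans (mul_le_mul' (mul_le_mul' le_rfl hRR) le_rfl)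
    have hBi' := hBi.trans (mul_le_mul' (mul_le_mul' le_rfl hRR) le_rfl)
    refine (mul_le_mul' le_rfl (add_le_add (mul_le_mul' le_rfl (add_le_add hAi' hBi')) hCi)).trans
      (le_of_eq ?_)
    rw [ENNReal.ofReal]
    push_cast
    ring

theorem statement19 (φ₀ : ℝ → ℝ) (hsm : ContDiff ℝ (⊤ : ℕ∞) φ₀) (heven : ∀ t, φ₀ (-t) = φ₀ t)
    (hsupp : ∀ t : ℝ, ¬(1 / 2 ≤ |t| ∧ |t| ≤ 2) → φ₀ t = 0)
    (hpart : ∀ t : ℝ, t ≠ 0 → HasSum (fun ℓ : ℤ => φ₀ ((2 : ℝ) ^ (-ℓ) * t)) 1)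
    (d : ℕ) (hd : 2 ≤ d) :
    ∃ C : ℝ≥0, ∀ ℓ₀ : ℤ, ∀ r : ℝ, 2 < r → r < 3 → ∀ f : SchwartzMap ℝ ℂ,
      (∫⁻ x : ℝ,
          (vNorm r (Set.Ioi (0 : ℝ)) fun u => Tmod φ₀ ℓ₀ d u (fun y => f y) x) ^ (2 : ℝ)) ^
          ((1 : ℝ) / 2) ≤
        C * ENNReal.ofReal ((r - 2)⁻¹) * eLpNorm (fun x => f x) 2 volume := by
  have hφ : Cutoff φ₀ := ⟨hsm, heven, hsupp, hpart⟩
  obtain ⟨C, hC⟩ := hφ.exists_variation_bound hd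
  refine ⟨NNReal.sqrt C, fun ℓ₀ r hr hr3 f => ?_⟩
  have hn := nice_fourier f
  have hs := synth_fourier f
  obtain ⟨G, hGm, hG, hGi⟩ := hC _ ℓ₀ r hn (by rw [hs]; exact f.integrable) hr hr3
  have hT : ∀ x u, Tmod φ₀ ℓ₀ d u (fun y => f y) x = ∑' ℓ : ℤ, if ℓ₀ ≤ ℓ then
      synth (fun ξ => osc (fun t => (φ₀ t : ℂ) / (t : ℂ)) d (u * ((2 : ℝ) ^ d) ^ ℓ)
        ((2 : ℝ) ^ ℓ * ξ) * 𝓕 (f : ℝ → ℂ) ξ) x else 0 := fun x u => by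
    unfold Tmod
    congr 1
    ext ℓ
    rw [Cutoff.integral_piece_eq, synth_osc hφ.bump_div d _ _ hn.int, hs]
  have hv : ∀ x, vNorm r (Ioi (0 : ℝ)) (fun u => Tmod φ₀ ℓ₀ d u (fun y => f y) x) ≤
      G x ^ (1 / 2 : ℝ) := fun x =>
    vNorm_le fun k u hu hu0 => ennreal_le_rpow_half (by
      simp only [hT]
      exact hG x u hu hu0 k)
  have he : energy (𝓕 (f : ℝ → ℂ)) = eLpNorm (fun x => f x) 2 volume ^ 2 := by
    rw [← energy_synth hn, hs, energy_eq]
  have h1 : ∫⁻ x, (vNorm r (Ioi (0 : ℝ)) fun u => Tmod φ₀ ℓ₀ d u (fun y => f y) x) ^ (2 : ℝ) ≤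
      (((NNReal.sqrt C : ℝ≥0) : ℝ≥0∞) * ENNReal.ofReal (r - 2)⁻¹ *
        eLpNorm (fun x => f x) 2 volume) ^ (2 : ℝ) := by
    refine (lintegral_mono fun x => ?_).trans (hGi.trans (le_of_eq ?_))
    · have := ENNReal.rpow_le_rpow (hv x) (z := 2) (by norm_num)
      rwa [ENNReal.rpow_two (G x ^ (1 / 2 : ℝ)), ennreal_rpow_half_sq] at this
    · rw [he, ENNReal.rpow_two, mul_pow, mul_pow, ← ENNReal.coe_pow, NNReal.sq_sqrt]
  refine (ENNReal.rpow_le_rpow h1 (by norm_num)).trans (le_of_eq ?_)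
  rw [← ENNReal.rpow_mul]
  norm_num

end
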